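/- Let j ≥ −1, k ∈ {−1,0,1}, m ≥ 0, and let l be an integer with 0 ≤ l ≤ m/2. Suppose p ≤ q, 1/p + 1/q ≤ 1, and 1/p + 3/q ≥ 1. Then for every ε > 0 there is a constant C (independent of j, l, m, g) such that ‖ φ_{k,l}(r,t) 𝒰_t 𝒫_{j,m} g ‖_{L^q(ℝ²×[1,2], dr dx₃ dt)} ≤ C · 2^{−j/2} 2^{l/q} 2^{(m/2 − l)(1/p + 3/q − 1) + (3j/2)(1/p − 1/q) + εj} ‖g‖_{L^p}. -/

import Mathlib

open MeasureTheory Real Set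
open scoped ENNReal

noncomputable section

/-- Euclidean norm on `ℝ²` (the product norm on `ℝ × ℝ` is the sup norm, so we
spell out the Euclidean one). -/
def enorm2 (ξ : ℝ × ℝ) : ℝ := Real.sqrt (ξ.1 ^ 2 + ξ.2 ^ 2)

/-- Fourier transform on `ℝ²` (nonunitary convention). -/
def ft2 (g : ℝ × ℝ → ℂ) (ξ : ℝ × ℝ) : ℂ :=
  ∫ y : ℝ × ℝ, Complex.exp (-(Complex.I) * ((y.1 * ξ.1 + y.2 * ξ.2 : ℝ) : ℂ)) * g y

/-- Fourier transform of the arclength measure `dσ` on the unit circle in `ℝ²`. -/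
def sigmaHat (ξ : ℝ × ℝ) : ℂ :=
  ∫ θ in Set.Ioc (0:ℝ) (2 * π),
    Complex.exp (-(Complex.I) * ((ξ.1 * Real.cos θ + ξ.2 * Real.sin θ : ℝ) : ℂ))

/-- The operator `𝒜_t g(r,x₃) = (2π)⁻² ∫ e^{i(((r²+t²)/2)ξ₁+x₃ξ₂)} \widehat{dσ}(trξ) ĝ(ξ) dξ`. -/
def Aop (g : ℝ × ℝ → ℂ) (t r x₃ : ℝ) : ℂ :=
  (((2 * π) ^ (-2 : ℤ) : ℝ) : ℂ) *
    ∫ ξ : ℝ × ℝ,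
      Complex.exp (Complex.I * ((((r ^ 2 + t ^ 2) / 2) * ξ.1 + x₃ * ξ.2 : ℝ) : ℂ)) *
        sigmaHat (t * r * ξ.1, t * r * ξ.2) * ft2 g ξ

/-- A Littlewood–Paley bump: nonnegative, smooth, supported in `[1−10⁻³, 2+10⁻³]`,
with `∑_{j∈ℤ} φ(2^{−j}s) = 1` for all `s > 0`. -/
def IsLPBump (φ : ℝ → ℝ) : Prop :=
  ContDiff ℝ (⊤ : ℕ∞) φ ∧ (∀ s, 0 ≤ φ s) ∧
    Function.support φ ⊆ Set.Icc (1 - 1/1000) (2 + 1/1000) ∧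
    ∀ s : ℝ, 0 < s → HasSum (fun j : ℤ => φ ((2:ℝ) ^ (-j) * s)) 1

/-- The Littlewood–Paley projection `𝒫_j`, defined via its multiplier `φ(2^{−j}|ξ|)`. -/
def proj (φ : ℝ → ℝ) (j : ℤ) (g : ℝ × ℝ → ℂ) (x : ℝ × ℝ) : ℂ :=
  (((2 * π) ^ (-2 : ℤ) : ℝ) : ℂ) *
    ∫ ξ : ℝ × ℝ,
      Complex.exp (Complex.I * ((x.1 * ξ.1 + x.2 * ξ.2 : ℝ) : ℂ)) *
        ((φ ((2:ℝ) ^ (-j) * enorm2 ξ) : ℝ) : ℂ) * ft2 g ξ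

/-- `φ_{<ℓ}(s) = ∑_{j<ℓ} φ(2^{−j} s)`. -/
def philt (φ : ℝ → ℝ) (l : ℤ) (s : ℝ) : ℝ :=
  ∑' j : ℤ, if j < l then φ ((2:ℝ) ^ (-j) * s) else 0

/-- The projection `𝒫_{<ℓ}`, with multiplier `φ_{<ℓ}(|ξ|)`. -/
def projLt (φ : ℝ → ℝ) (l : ℤ) (g : ℝ × ℝ → ℂ) (x : ℝ × ℝ) : ℂ :=
  (((2 * π) ^ (-2 : ℤ) : ℝ) : ℂ) *
    ∫ ξ : ℝ × ℝ,
      Complex.exp (Complex.I * ((x.1 * ξ.1 + x.2 * ξ.2 : ℝ) : ℂ)) *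
        ((philt φ l (enorm2 ξ) : ℝ) : ℂ) * ft2 g ξ

/-- The operator `𝒰_t g(r,x₃) = ∫ e^{i(((r²+t²)/2)ξ₁+x₃ξ₂+tr|ξ|)} |rξ|^{−1/2} ĝ(ξ) dξ`. -/
def Uop (g : ℝ × ℝ → ℂ) (t r x₃ : ℝ) : ℂ :=
  ∫ ξ : ℝ × ℝ,
    Complex.exp (Complex.I *
        ((((r ^ 2 + t ^ 2) / 2) * ξ.1 + x₃ * ξ.2 + t * r * enorm2 ξ : ℝ) : ℂ)) *
      (((|r| * enorm2 ξ) ^ (-(1:ℝ)/2) : ℝ) : ℂ) * ft2 g ξ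

/-- The angular cutoff `ψ_m(ξ) = φ(2^m |ξ₁/|ξ| + 1|)`. -/
def psiA (φ : ℝ → ℝ) (m : ℤ) (ξ : ℝ × ℝ) : ℝ :=
  φ ((2:ℝ) ^ m * |ξ.1 / enorm2 ξ + 1|)

/-- The projection `𝒫_{j,m}` with multiplier `φ_j(|ξ|) ψ_m(ξ)`. -/
def projJM (φ : ℝ → ℝ) (j m : ℤ) (g : ℝ × ℝ → ℂ) (x : ℝ × ℝ) : ℂ :=
  (((2 * π) ^ (-2 : ℤ) : ℝ) : ℂ) *
    ∫ ξ : ℝ × ℝ,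
      Complex.exp (Complex.I * ((x.1 * ξ.1 + x.2 * ξ.2 : ℝ) : ℂ)) *
        ((φ ((2:ℝ) ^ (-j) * enorm2 ξ) * psiA φ m ξ : ℝ) : ℂ) * ft2 g ξ

/-- `φ_{k,l}(r,t) = φ_k(r) φ(2^l |r−t|)`. -/
def phikl (φ : ℝ → ℝ) (k l : ℤ) (r t : ℝ) : ℝ :=
  φ ((2:ℝ) ^ (-k) * r) * φ ((2:ℝ) ^ l * |r - t|)

namespace LocalSmoothing

open scoped FourierTransform InnerProductSpace ComplexConjugate

theorem plancherel {V : Type*} [NormedAddCommGroup V] [InnerProductSpace ℝ V]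
    [FiniteDimensional ℝ V] [MeasurableSpace V] [BorelSpace V] {f : V → ℂ}
    (h1 : Integrable f) (h2 : MemLp f 2) : eLpNorm (𝓕 f) 2 volume = eLpNorm f 2 volume := by
  have h_int : ∀ g : SchwartzMap V ℂ, ∫ x, g x • 𝓕 f x = ∫ x, g x • (𝓕 h2.toLp : Lp ℂ 2 (volume : Measure V)) x := by
    intro g
    have := congrArg (fun T => T g) (Lp.fourier_toTemperedDistribution_eq h2.toLp)
    simp only [Lp.toTemperedDistribution_apply, TemperedDistribution.fourier_apply] at this
    rw [← this]
    have e1 := VectorFourier.integral_fourierIntegral_smul_eq_flip (μ := (volume : Measure V)) (ν := volume)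
      (f := g) (g := f) (L := innerₗ V) Real.continuous_fourierChar (by simpa using continuous_inner) g.integrable h1
    rw [flip_innerₗ] at e1
    refine Eq.trans e1.symm ?_
    refine integral_congr_ae ?_
    filter_upwards [h2.coeFn_toLp] with x hx
    rw [hx]; rfl
  have hae : 𝓕 f =ᵐ[volume] (𝓕 h2.toLp : Lp ℂ 2 (volume : Measure V)) := by
    apply ae_eq_of_integral_contDiff_smul_eq
    · exact (VectorFourier.fourierIntegral_continuous Real.continuous_fourierChar
        (by exact continuous_inner) h1).locallyIntegrable
    · exact (Lp.memLp _).locallyIntegrable (by norm_num)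
    · intro g hg hgs
      have := h_int ((hgs.comp_left (g := fun x : ℝ => (x : ℂ)) (by simp)).toSchwartzMap (by
        exact Complex.ofRealCLM.contDiff.comp hg))
      exact this
  rw [eLpNorm_congr_ae hae]
  have := Lp.norm_fourier_eq h2.toLp
  rw [Lp.norm_def, Lp.norm_def, ENNReal.toReal_eq_toReal_iff' (Lp.eLpNorm_ne_top _) (Lp.eLpNorm_ne_top _)] at this
  rw [this]
  exact eLpNorm_congr_ae h2.coeFn_toLp

theorem plancherel_lintegral {V : Type*} [NormedAddCommGroup V] [InnerProductSpace ℝ V]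
    [FiniteDimensional ℝ V] [MeasurableSpace V] [BorelSpace V] {f : V → ℂ}
    (h1 : Integrable f) (h2 : MemLp f 2) : ∫⁻ x, ‖𝓕 f x‖ₑ ^ 2 = ∫⁻ x, ‖f x‖ₑ ^ 2 := by
  have := plancherel h1 h2
  rw [eLpNorm_eq_lintegral_rpow_enorm_toReal (by norm_num) (by norm_num),
    eLpNorm_eq_lintegral_rpow_enorm_toReal (by norm_num) (by norm_num)] at this
  have h3 := (ENNReal.rpow_left_injective (x := 1 / (2 : ℝ≥0∞).toReal) (by norm_num)) this
  simpa using h3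

theorem lintegral_comp_smul' {V : Type*} [NormedAddCommGroup V] [NormedSpace ℝ V]
    [FiniteDimensional ℝ V] [MeasurableSpace V] [BorelSpace V] (μ : Measure V) [μ.IsAddHaarMeasure]
    (f : V → ℝ≥0∞) {c : ℝ} (hc : c ≠ 0) :
    ∫⁻ x, f (c • x) ∂μ = ENNReal.ofReal |(c ^ Module.finrank ℝ V)⁻¹| * ∫⁻ x, f x ∂μ := by
  rw [← smul_eq_mul, ← lintegral_smul_measure, ← Measure.map_addHaar_smul μ hc]
  exact (lintegral_map_equiv f (Homeomorph.smul (Units.mk0 c hc)).toMeasurableEquiv).symm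

theorem plancherel_transfer {V E : Type*} [NormedAddCommGroup V] [InnerProductSpace ℝ V]
    [FiniteDimensional ℝ V] [MeasurableSpace V] [BorelSpace V] [MeasureSpace E]
    (e : V ≃ᵐ E) (he : MeasurePreserving e) (B : E → E → ℝ)
    (hB : ∀ x y, B (e x) (e y) = inner ℝ x y) {f : E → ℂ}
    (h1 : Integrable f) (h2 : MemLp f 2) :
    ∫⁻ z, ‖∫ ξ, Complex.exp (Complex.I * (B z ξ : ℝ)) * f ξ‖ₑ ^ 2 =
      ENNReal.ofReal ((2 * π) ^ Module.finrank ℝ V) * ∫⁻ x, ‖f x‖ₑ ^ 2 := by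
  have h1' : Integrable (f ∘ e) := he.integrable_comp_of_integrable h1
  have h2' : MemLp (f ∘ e) 2 := h2.comp_measurePreserving he
  have hpt : ∀ w : V, ∫ ξ, Complex.exp (Complex.I * (B (e w) ξ : ℝ)) * f ξ =
      𝓕 (f ∘ e) ((-(2 * π)⁻¹ : ℝ) • w) := by
    intro w
    rw [Real.fourier_eq', ← he.integral_comp' (g := fun ξ => Complex.exp (Complex.I * (B (e w) ξ : ℝ)) * f ξ)]
    refine integral_congr_ae (ae_of_all _ fun v => ?_)
    simp only [hB, Function.comp, smul_eq_mul]
    rw [inner_smul_right, real_inner_comm]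
    congr 2
    push_cast
    have : (π : ℂ) ≠ 0 := by exact_mod_cast Real.pi_ne_zero
    field_simp
  rw [← he.lintegral_comp_emb e.measurableEmbedding]
  simp_rw [hpt]
  rw [lintegral_comp_smul' volume (fun w => ‖𝓕 (f ∘ e) w‖ₑ ^ 2) (c := -(2 * π)⁻¹) (by simp [Real.pi_ne_zero]),
    plancherel_lintegral h1' h2']
  congr 1
  · congr 1
    rw [abs_inv, abs_pow, abs_neg, abs_inv, abs_of_pos (by positivity : 0 < 2 * π), inv_pow, inv_inv]
  · exact he.lintegral_comp_emb e.measurableEmbedding (fun x => ‖f x‖ₑ ^ 2)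

/-- Space-time `ℝ² × ℝ`. -/
abbrev E3 := (ℝ × ℝ) × ℝ

/-- Fourier integral on the plane, with the positive sign and no normalization. -/
def F2 (f : ℝ × ℝ → ℂ) (z : ℝ × ℝ) : ℂ :=
  ∫ ξ : ℝ × ℝ, Complex.exp (Complex.I * ((z.1 * ξ.1 + z.2 * ξ.2 : ℝ) : ℂ)) * f ξ

/-- Fourier integral on space-time, with the positive sign and no normalization. -/
def F3 (f : E3 → ℂ) (z : E3) : ℂ :=
  ∫ ξ : E3, Complex.exp (Complex.I * ((z.1.1 * ξ.1.1 + z.1.2 * ξ.1.2 + z.2 * ξ.2 : ℝ) : ℂ)) * f ξ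

theorem plancherel_F2 {f : ℝ × ℝ → ℂ} (h1 : Integrable f) (h2 : MemLp f 2) :
    ∫⁻ z, ‖F2 f z‖ₑ ^ 2 = ENNReal.ofReal ((2 * π) ^ 2) * ∫⁻ x, ‖f x‖ₑ ^ 2 := by
  have := plancherel_transfer (V := WithLp 2 (ℝ × ℝ)) (MeasurableEquiv.toLp 2 (ℝ × ℝ)).symm
    (WithLp.volume_preserving_symm_measurableEquiv_toLp_prod ℝ ℝ)
    (fun z ξ => z.1 * ξ.1 + z.2 * ξ.2) (by
      intro x y; simp [WithLp.prod_inner_apply, mul_comm]) h1 h2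
  have hd : Module.finrank ℝ (WithLp 2 (ℝ × ℝ)) = 2 := by
    rw [(WithLp.linearEquiv 2 ℝ (ℝ × ℝ)).finrank_eq]; simp
  rwa [hd] at this

theorem plancherel_F3 {f : E3 → ℂ} (h1 : Integrable f) (h2 : MemLp f 2) :
    ∫⁻ z, ‖F3 f z‖ₑ ^ 2 = ENNReal.ofReal ((2 * π) ^ 3) * ∫⁻ x, ‖f x‖ₑ ^ 2 := by
  let e := ((MeasurableEquiv.toLp 2 (WithLp 2 (ℝ × ℝ) × ℝ)).symm.trans
    ((MeasurableEquiv.toLp 2 (ℝ × ℝ)).symm.prodCongr (MeasurableEquiv.refl ℝ)))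
  have he : MeasurePreserving e :=
    (WithLp.volume_preserving_symm_measurableEquiv_toLp_prod _ ℝ).trans
    ((WithLp.volume_preserving_symm_measurableEquiv_toLp_prod ℝ ℝ).prod (MeasurePreserving.id _))
  have := plancherel_transfer (V := WithLp 2 (WithLp 2 (ℝ × ℝ) × ℝ)) e he
    (fun z ξ => z.1.1 * ξ.1.1 + z.1.2 * ξ.1.2 + z.2 * ξ.2) (by
      intro x y; simp [WithLp.prod_inner_apply, mul_comm, e]; rfl) h1 h2
  have hd : Module.finrank ℝ (WithLp 2 (WithLp 2 (ℝ × ℝ) × ℝ)) = 3 := by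
    rw [(WithLp.linearEquiv 2 ℝ _).finrank_eq, Module.finrank_prod, (WithLp.linearEquiv 2 ℝ _).finrank_eq]; simp
  rwa [hd] at this

instance : (volume : Measure E3).IsAddHaarMeasure :=
  inferInstanceAs (Measure.prod (volume : Measure (ℝ × ℝ)) (volume : Measure ℝ)).IsAddHaarMeasure

/-- The character of `E3` with frequency `x`. -/
def ch (x ξ : E3) : ℂ :=
  Complex.exp (Complex.I * ((x.1.1 * ξ.1.1 + x.1.2 * ξ.1.2 + x.2 * ξ.2 : ℝ) : ℂ))

theorem ch_add (x ξ η : E3) : ch x (ξ + η) = ch x ξ * ch x η := by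
  rw [ch, ch, ch, ← Complex.exp_add]; congr 1; simp; ring

theorem ch_neg (x ξ : E3) : ch x (-ξ) = conj (ch x ξ) := by
  rw [ch, ch, ← Complex.exp_conj]; congr 1; simp; ring

theorem norm_ch (x ξ : E3) : ‖ch x ξ‖ = 1 := by
  rw [ch, mul_comm, Complex.norm_exp_ofReal_mul_I]

@[fun_prop]
theorem continuous_ch (x : E3) : Continuous (ch x) := by unfold ch; fun_prop

theorem continuous_ch₂ : Continuous (fun p : E3 × E3 => ch p.1 p.2) := by unfold ch; fun_prop

theorem F3_eq (f : E3 → ℂ) (x : E3) : F3 f x = ∫ ξ, ch x ξ * f ξ := rfl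

/-- Continuous functions with compact support. -/
structure CC {α : Type*} [TopologicalSpace α] (f : α → ℂ) : Prop where
  cont : Continuous f
  supp : HasCompactSupport f

namespace CC
variable {α : Type*} [TopologicalSpace α] {f g : α → ℂ}

theorem integrable [MeasureSpace α] [OpensMeasurableSpace α]
    [IsFiniteMeasureOnCompacts (volume : Measure α)] (hf : CC f) : Integrable f :=
  hf.cont.integrable_of_hasCompactSupport hf.supp

theorem memLp [MeasureSpace α] [OpensMeasurableSpace α]
    [IsFiniteMeasureOnCompacts (volume : Measure α)] (hf : CC f) (p : ℝ≥0∞) : MemLp f p :=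
  hf.cont.memLp_of_hasCompactSupport hf.supp

theorem add (hf : CC f) (hg : CC g) : CC (fun x => f x + g x) :=
  ⟨hf.cont.add hg.cont, hf.supp.add hg.supp⟩

theorem zero : CC (fun _ : α => (0 : ℂ)) := ⟨continuous_const, HasCompactSupport.zero⟩

theorem sum {ι : Type*} {s : Finset ι} {a : ι → α → ℂ} (h : ∀ i ∈ s, CC (a i)) :
    CC (fun x => ∑ i ∈ s, a i x) := by
  classical
  induction s using Finset.induction_on with
  | empty => simpa using zero
  | insert i s hi ih =>
    simp only [Finset.sum_insert hi]
    exact (h i (by simp)).add (ih fun k hk => h k (by simp [hk]))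

theorem mul_left (hf : CC f) (hg : Continuous g) : CC (fun x => g x * f x) :=
  ⟨hg.mul hf.cont, hf.supp.mul_left⟩

end CC

theorem F3_sum {ι : Type*} {s : Finset ι} {a : ι → E3 → ℂ} (h : ∀ i ∈ s, CC (a i)) (x : E3) :
    F3 (fun ξ => ∑ i ∈ s, a i ξ) x = ∑ i ∈ s, F3 (a i) x := by
  simp only [F3_eq, Finset.mul_sum]
  exact integral_finsetSum _ fun i hi => ((h i hi).mul_left (continuous_ch x)).integrable

/-- Squared `L²` norm. -/
def N2 (f : E3 → ℂ) : ℝ≥0∞ := ∫⁻ x, ‖f x‖ₑ ^ 2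

theorem N2_F3 {f : E3 → ℂ} (hf : CC f) : N2 (F3 f) = ENNReal.ofReal ((2 * π) ^ 3) * N2 f :=
  plancherel_F3 hf.integrable (hf.memLp 2)

theorem N2_le_of_F3 {f g : E3 → ℂ} (hf : CC f) (hg : CC g) {C : ℝ≥0∞}
    (h : N2 (F3 f) ≤ C * N2 (F3 g)) : N2 f ≤ C * N2 g := by
  rw [N2_F3 hf, N2_F3 hg, mul_left_comm] at h
  exact (ENNReal.mul_le_mul_iff_right (by simp; positivity) (by simp)).1 h

/-- Convolution. -/
def conv (a b : E3 → ℂ) (x : E3) : ℂ := ∫ t, a t * b (x - t)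

/-- Correlation. -/
def corr (a b : E3 → ℂ) (ω : E3) : ℂ := ∫ ξ, a (ξ + ω) * conj (b ξ)

theorem conv_eq (a b : E3 → ℂ) :
    conv a b = MeasureTheory.convolution a b (ContinuousLinearMap.mul ℝ ℂ) volume := by
  ext x; rfl

theorem CC.conv {a b : E3 → ℂ} (ha : CC a) (hb : CC b) : CC (conv a b) := by
  rw [conv_eq]
  exact ⟨hb.supp.continuous_convolution_right _ ha.cont.locallyIntegrable hb.cont,
    HasCompactSupport.convolution _ ha.supp hb.supp⟩

theorem F3_conv {a b : E3 → ℂ} (ha : CC a) (hb : CC b) (x : E3) :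
    F3 (conv a b) x = F3 a x * F3 b x := by
  have := integral_convolution (𝕜 := ℝ) (ContinuousLinearMap.mul ℝ ℂ) (μ := (volume : Measure E3))
    (ν := volume) (ha.mul_left (continuous_ch x)).integrable (hb.mul_left (continuous_ch x)).integrable
  simp only [ContinuousLinearMap.mul_apply', ← F3_eq] at this
  rw [← this, F3_eq]
  refine integral_congr_ae (ae_of_all _ fun ω => ?_)
  simp only [LocalSmoothing.conv, MeasureTheory.convolution, ContinuousLinearMap.mul_apply']
  rw [← integral_const_mul]
  refine integral_congr_ae (ae_of_all _ fun t => ?_)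
  simp only
  have : ch x ω = ch x t * ch x (ω - t) := by rw [← ch_add]; simp
  rw [this]; ring

/-- The reflected conjugate. -/
def sharp (b : E3 → ℂ) (x : E3) : ℂ := conj (b (-x))

theorem CC.sharp {b : E3 → ℂ} (hb : CC b) : CC (sharp b) := by
  refine ⟨Complex.continuous_conj.comp (hb.cont.comp continuous_neg), ?_⟩
  exact (hb.supp.comp_homeomorph (Homeomorph.neg E3)).comp_left (g := conj) (by simp)

theorem F3_sharp (b : E3 → ℂ) (x : E3) : F3 (sharp b) x = conj (F3 b x) := by
  rw [F3_eq, F3_eq, ← integral_conj, ← integral_neg_eq_self]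
  refine integral_congr_ae (ae_of_all _ fun t => ?_)
  simp [sharp, ch_neg]

theorem corr_eq (a b : E3 → ℂ) : corr a b = conv a (sharp b) := by
  ext ω
  rw [corr, conv, ← integral_add_right_eq_self (fun t => a t * sharp b (ω - t)) ω]
  simp [sharp]

theorem CC.corr {a b : E3 → ℂ} (ha : CC a) (hb : CC b) : CC (corr a b) := by
  rw [corr_eq]; exact ha.conv hb.sharp

theorem F3_corr_self {a : E3 → ℂ} (ha : CC a) (x : E3) :
    F3 (corr a a) x = ((‖F3 a x‖ ^ 2 : ℝ) : ℂ) := by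
  rw [corr_eq, F3_conv ha ha.sharp, F3_sharp, Complex.mul_conj, Complex.normSq_eq_norm_sq]

theorem sq_enorm_sum_ofReal {ι : Type*} (s : Finset ι) (r : ι → ℝ) (hr : ∀ i, 0 ≤ r i) :
    ‖((∑ i ∈ s, r i : ℝ) : ℂ)‖ₑ = ∑ i ∈ s, ENNReal.ofReal (r i) := by
  rw [← ENNReal.ofReal_sum_of_nonneg (fun i _ => hr i), ← ofReal_norm, Complex.norm_real,
    Real.norm_of_nonneg (Finset.sum_nonneg fun i _ => hr i)]

theorem ofReal_norm_sq (z : ℂ) : ENNReal.ofReal (‖z‖ ^ 2) = ‖z‖ₑ ^ 2 := by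
  rw [ENNReal.ofReal_pow (norm_nonneg _), ofReal_norm]

/-- Fourth moments of square functions, on the frequency side. -/
theorem N2_sum_corr {ι : Type*} (s : Finset ι) {a : ι → E3 → ℂ} (h : ∀ i ∈ s, CC (a i)) :
    N2 (fun ω => ∑ i ∈ s, corr (a i) (a i) ω) =
      ∑ i ∈ s, ∑ j ∈ s, N2 (conv (a i) (a j)) := by
  have hc : ENNReal.ofReal ((2 * π) ^ 3) ≠ 0 := by simp; positivity
  rw [← ENNReal.mul_right_inj hc (by simp), ← N2_F3 (CC.sum fun i hi => (h i hi).corr (h i hi)),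
    Finset.mul_sum]
  have hcont : ∀ i ∈ s, Measurable (F3 (a i)) := by
    intro i hi
    have : StronglyMeasurable (F3 (a i)) := by
      apply StronglyMeasurable.integral_prod_right (f := fun x ξ => ch x ξ * a i ξ)
      exact (continuous_ch₂.mul ((h i hi).cont.comp continuous_snd)).stronglyMeasurable
    exact this.measurable
  have e1 : ∀ i ∈ s, ENNReal.ofReal ((2 * π) ^ 3) * ∑ j ∈ s, N2 (conv (a i) (a j)) =
      ∑ j ∈ s, ∫⁻ x, ‖F3 (a i) x‖ₑ ^ 2 * ‖F3 (a j) x‖ₑ ^ 2 := by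
    intro i hi
    rw [Finset.mul_sum]
    refine Finset.sum_congr rfl fun j hj => ?_
    rw [← N2_F3 ((h i hi).conv (h j hj)), N2]
    refine lintegral_congr fun x => ?_
    rw [F3_conv (h i hi) (h j hj), enorm_mul, mul_pow]
  rw [Finset.sum_congr rfl e1]
  have m2 : ∀ i ∈ s, ∀ j ∈ s, Measurable fun x => ‖F3 (a i) x‖ₑ ^ 2 * ‖F3 (a j) x‖ₑ ^ 2 :=
    fun i hi j hj => ((hcont i hi).enorm.pow_const 2).mul ((hcont j hj).enorm.pow_const 2)
  have e2 : ∀ i ∈ s, ∑ j ∈ s, ∫⁻ x, ‖F3 (a i) x‖ₑ ^ 2 * ‖F3 (a j) x‖ₑ ^ 2 =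
      ∫⁻ x, ∑ j ∈ s, ‖F3 (a i) x‖ₑ ^ 2 * ‖F3 (a j) x‖ₑ ^ 2 := fun i hi =>
    (lintegral_finsetSum' _ fun j hj => (m2 i hi j hj).aemeasurable).symm
  rw [Finset.sum_congr rfl e2, ← lintegral_finsetSum' _ fun i hi =>
    (Finset.measurable_fun_sum _ fun j hj => m2 i hi j hj).aemeasurable]
  refine lintegral_congr fun x => ?_
  rw [F3_sum fun i hi => (h i hi).corr (h i hi)]
  rw [Finset.sum_congr rfl fun i hi => F3_corr_self (h i hi) x, ← Complex.ofReal_sum,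
    sq_enorm_sum_ofReal _ _ fun i => by positivity]
  simp_rw [ofReal_norm_sq]
  rw [sq, Finset.sum_mul_sum]

theorem lintegral_F3_four {a : E3 → ℂ} (ha : CC a) :
    ∫⁻ x, ‖F3 a x‖ₑ ^ 4 = ENNReal.ofReal ((2 * π) ^ 3) * N2 (corr a a) := by
  rw [← N2_F3 (ha.corr ha), N2]
  refine lintegral_congr fun x => ?_
  have := sq_enorm_sum_ofReal {()} (fun _ => ‖F3 a x‖ ^ 2) fun _ => by positivity
  rw [Finset.sum_singleton, Finset.sum_singleton, ofReal_norm_sq] at this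
  rw [F3_corr_self ha, this, ← pow_mul]

/-- Autocorrelation of a window. -/
def kap (ψ : E3 → ℝ) (ω : E3) : ℝ := ∫ ζ, ψ (ω + ζ) * ψ ζ

/-- Windowed Fourier integral. -/
def Gw (ψ : E3 → ℝ) (a : E3 → ℂ) (x ζ : E3) : ℂ := F3 (fun η => (ψ (η - ζ) : ℂ) * a η) x

/-- Real continuous compactly supported windows. -/
structure CR (ψ : E3 → ℝ) : Prop where
  cont : Continuous ψ
  supp : HasCompactSupport ψ

theorem CR.window {ψ : E3 → ℝ} (hψ : CR ψ) {a : E3 → ℂ} (ha : CC a) (ζ : E3) :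
    CC (fun η => (ψ (η - ζ) : ℂ) * a η) := by
  have := hψ.cont
  exact ha.mul_left (by fun_prop)

theorem continuous_kap {ψ : E3 → ℝ} (hψ : CR ψ) : Continuous (kap ψ) := by
  have h : kap ψ = MeasureTheory.convolution ψ (fun x => ψ (-x)) (ContinuousLinearMap.mul ℝ ℝ) volume := by
    ext ω
    rw [kap, MeasureTheory.convolution,
      ← integral_add_right_eq_self (fun t => ((ContinuousLinearMap.mul ℝ ℝ) (ψ t)) (ψ (-(ω - t)))) ω]
    refine integral_congr_ae (ae_of_all _ fun t => ?_)
    simp [add_comm]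
  rw [h]
  exact (hψ.supp.comp_homeomorph (Homeomorph.neg E3)).continuous_convolution_right _
    hψ.cont.locallyIntegrable (hψ.cont.comp continuous_neg)

theorem cc_kap_corr {ψ : E3 → ℝ} (hψ : CR ψ) {a : E3 → ℂ} (ha : CC a) :
    CC (fun ω => (kap ψ ω : ℂ) * corr a a ω) :=
  (ha.corr ha).mul_left (Complex.continuous_ofReal.comp (continuous_kap hψ))

theorem window_triple {ψ : E3 → ℝ} (hψ : CR ψ) {a : E3 → ℂ} (ha : CC a) (x : E3) :
    CC (fun p : E3 × (E3 × E3) => ch x p.2.1 *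
      ((ψ (p.2.2 + p.2.1 - p.1) : ℂ) * a (p.2.2 + p.2.1) * conj ((ψ (p.2.2 - p.1) : ℂ) * a p.2.2))) := by
  have h1 := hψ.cont
  have h2 := ha.cont
  constructor
  · have := continuous_ch x
    fun_prop
  · refine HasCompactSupport.intro (K := (fun q : E3 × (E3 × E3) => (q.2.1 - q.2.2, (q.1 - q.2.1, q.2.1))) ''
      (tsupport a ×ˢ (tsupport a ×ˢ tsupport ψ))) ?_ ?_
    · exact (ha.supp.isCompact.prod (ha.supp.isCompact.prod hψ.supp.isCompact)).image (by fun_prop)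
    · rintro ⟨ζ, ω, ξ⟩ hp
      by_contra hne
      simp only [map_mul, map_eq_zero, mul_eq_zero, not_or] at hne
      apply hp
      refine ⟨(ξ + ω, (ξ, ξ - ζ)), ⟨subset_tsupport _ hne.2.1.2, subset_tsupport _ hne.2.2.2,
        subset_tsupport _ ?_⟩, ?_⟩
      · simpa using hne.2.2.1
      · ext <;> simp

theorem gw_sq_eq {ψ : E3 → ℝ} (hψ : CR ψ) {a : E3 → ℂ} (ha : CC a) (x ζ : E3) :
    ((‖Gw ψ a x ζ‖ ^ 2 : ℝ) : ℂ) = ∫ p : E3 × E3, ch x p.1 *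
      ((ψ (p.2 + p.1 - ζ) : ℂ) * a (p.2 + p.1) * conj ((ψ (p.2 - ζ) : ℂ) * a p.2)) := by
  have hcc : CC (fun p : E3 × E3 => ch x p.1 *
      ((ψ (p.2 + p.1 - ζ) : ℂ) * a (p.2 + p.1) * conj ((ψ (p.2 - ζ) : ℂ) * a p.2))) := by
    have h := window_triple hψ ha x
    have h1 := hψ.cont
    have h2 := ha.cont
    have h3 := continuous_ch x
    refine ⟨by fun_prop, ?_⟩
    refine HasCompactSupport.intro (h.supp.isCompact.image continuous_snd) fun p hp => ?_
    by_contra hne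
    exact hp ⟨(ζ, p), subset_tsupport _ hne, rfl⟩
  rw [Gw, ← F3_corr_self (hψ.window ha ζ), F3_eq, Measure.volume_eq_prod E3 E3, integral_prod _ hcc.integrable]
  refine integral_congr_ae (ae_of_all _ fun ω => ?_)
  simp only [corr]
  rw [← integral_const_mul]

theorem integrable_gw_sq {ψ : E3 → ℝ} (hψ : CR ψ) {a : E3 → ℂ} (ha : CC a) (x : E3) :
    Integrable (fun ζ => ‖Gw ψ a x ζ‖ ^ 2) := by
  have := (window_triple hψ ha x).integrable.integral_prod_left
  simp only [← gw_sq_eq hψ ha] at this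
  refine this.re.congr (ae_of_all _ fun ζ => ?_)
  exact Complex.ofReal_re _

theorem F3_kap_corr {ψ : E3 → ℝ} (hψ : CR ψ) {a : E3 → ℂ} (ha : CC a) (x : E3) :
    F3 (fun ω => (kap ψ ω : ℂ) * corr a a ω) x = ((∫ ζ, ‖Gw ψ a x ζ‖ ^ 2 : ℝ) : ℂ) := by
  have hi := (window_triple hψ ha x).integrable
  rw [← integral_complex_ofReal]
  simp only [gw_sq_eq hψ ha]
  rw [integral_integral_swap (f := fun (ζ : E3) (p : E3 × E3) => ch x p.1 *
      ((ψ (p.2 + p.1 - ζ) : ℂ) * a (p.2 + p.1) * conj ((ψ (p.2 - ζ) : ℂ) * a p.2))) hi,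
    Measure.volume_eq_prod E3 E3, integral_prod _ (by exact hi.integral_prod_right), F3_eq]
  refine integral_congr_ae (ae_of_all _ fun ω => ?_)
  simp only [corr]
  rw [← integral_const_mul, ← integral_const_mul]
  refine integral_congr_ae (ae_of_all _ fun ξ => ?_)
  simp only
  have : kap ψ ω = ∫ ζ, ψ (ξ + ω - ζ) * ψ (ξ - ζ) := by
    rw [kap, ← integral_sub_left_eq_self _ _ ξ]
    refine integral_congr_ae (ae_of_all _ fun ζ => ?_)
    simp only
    congr 2; abel
  rw [this, ← integral_complex_ofReal, ← integral_mul_const, ← integral_const_mul]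
  refine integral_congr_ae (ae_of_all _ fun ζ => ?_)
  simp only [map_mul, Complex.conj_ofReal, Complex.ofReal_mul]
  ring

theorem Gw_sum {ι : Type*} {ψ : E3 → ℝ} (hψ : CR ψ) {s : Finset ι} {a : ι → E3 → ℂ}
    (h : ∀ i ∈ s, CC (a i)) (x ζ : E3) :
    Gw ψ (fun ξ => ∑ i ∈ s, a i ξ) x ζ = ∑ i ∈ s, Gw ψ (a i) x ζ := by
  simp only [Gw, Finset.mul_sum]
  exact F3_sum (fun i hi => hψ.window (h i hi) ζ) x

theorem cc_kap_sum {ι : Type*} {ψ : E3 → ℝ} (hψ : CR ψ) {s : Finset ι} {a : ι → E3 → ℂ}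
    (h : ∀ i ∈ s, CC (a i)) : CC (fun ω => (kap ψ ω : ℂ) * ∑ i ∈ s, corr (a i) (a i) ω) := by
  simp only [Finset.mul_sum]
  exact CC.sum fun i hi => cc_kap_corr hψ (h i hi)

theorem F3_kap_sum {ι : Type*} {ψ : E3 → ℝ} (hψ : CR ψ) {s : Finset ι} {a : ι → E3 → ℂ}
    (h : ∀ i ∈ s, CC (a i)) (x : E3) :
    F3 (fun ω => (kap ψ ω : ℂ) * ∑ i ∈ s, corr (a i) (a i) ω) x =
      ((∑ i ∈ s, ∫ ζ, ‖Gw ψ (a i) x ζ‖ ^ 2 : ℝ) : ℂ) := by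
  simp only [Finset.mul_sum]
  rw [F3_sum fun i hi => cc_kap_corr hψ (h i hi), Complex.ofReal_sum]
  exact Finset.sum_congr rfl fun i hi => F3_kap_corr hψ (h i hi) x

theorem norm_sum_sq_le {ι : Type*} (s : Finset ι) (f : ι → ℂ) :
    ‖∑ i ∈ s, f i‖ ^ 2 ≤ (s.card : ℝ) * ∑ i ∈ s, ‖f i‖ ^ 2 :=
  (pow_le_pow_left₀ (norm_nonneg _) (norm_sum_le _ _) 2).trans sq_sum_le_card_mul_sum_sq

/-- Local orthogonality in windows meeting boundedly many pieces. -/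
theorem window_orthogonality {ι κ : Type*} [DecidableEq κ] {ψ : E3 → ℝ} (hψ : CR ψ) (s : Finset ι)
    {a : ι → E3 → ℂ} (h : ∀ i ∈ s, CC (a i)) (pr : ι → κ) (M : ℕ)
    (hM : ∀ ζ : E3, ∀ t ⊆ s, (∀ i ∈ t, ∃ η, ψ (η - ζ) ≠ 0 ∧ a i η ≠ 0) → t.card ≤ M) :
    N2 (fun ω => (kap ψ ω : ℂ) * ∑ σ ∈ s.image pr,
        corr (fun ξ => ∑ i ∈ s with pr i = σ, a i ξ) (fun ξ => ∑ i ∈ s with pr i = σ, a i ξ) ω) ≤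
      ENNReal.ofReal ((M : ℝ) ^ 2) * N2 (fun ω => (kap ψ ω : ℂ) * ∑ i ∈ s, corr (a i) (a i) ω) := by
  classical
  have hA : ∀ σ ∈ s.image pr, CC (fun ξ => ∑ i ∈ s with pr i = σ, a i ξ) := fun σ _ =>
    CC.sum fun i hi => h i (Finset.mem_filter.1 hi).1
  refine N2_le_of_F3 (cc_kap_sum hψ hA) (cc_kap_sum hψ h) ?_
  rw [N2, N2, ← lintegral_const_mul' _ _ (by simp)]
  refine lintegral_mono fun x => ?_
  simp only
  rw [F3_kap_sum hψ hA, F3_kap_sum hψ h, ← ofReal_norm_sq, ← ofReal_norm_sq,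
    ← ENNReal.ofReal_mul (by positivity), ← mul_pow]
  refine ENNReal.ofReal_le_ofReal (pow_le_pow_left₀ (norm_nonneg _) ?_ 2)
  have pos : ∀ (b : E3 → ℂ), 0 ≤ ∫ ζ, ‖Gw ψ b x ζ‖ ^ 2 := fun b =>
    integral_nonneg fun ζ => by positivity
  rw [Complex.norm_real, Complex.norm_real, Real.norm_of_nonneg (Finset.sum_nonneg fun i _ => pos _),
    Real.norm_of_nonneg (Finset.sum_nonneg fun i _ => pos _),
    ← integral_finsetSum _ fun i hi => integrable_gw_sq hψ (hA i hi) x,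
    ← integral_finsetSum _ fun i hi => integrable_gw_sq hψ (h i hi) x, ← integral_const_mul]
  refine integral_mono (integrable_finsetSum _ fun i hi => integrable_gw_sq hψ (hA i hi) x)
    ((integrable_finsetSum _ fun i hi => integrable_gw_sq hψ (h i hi) x).const_mul _) fun ζ => ?_
  simp only
  have key : ∀ σ ∈ s.image pr, ‖Gw ψ (fun ξ => ∑ i ∈ s with pr i = σ, a i ξ) x ζ‖ ^ 2 ≤
      M * ∑ i ∈ s with pr i = σ, ‖Gw ψ (a i) x ζ‖ ^ 2 := by
    intro σ _
    rw [Gw_sum hψ fun i hi => h i (Finset.mem_filter.1 hi).1]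
    rw [← Finset.sum_filter_ne_zero]
    refine (norm_sum_sq_le _ _).trans ?_
    refine mul_le_mul ?_ (Finset.sum_le_sum_of_subset_of_nonneg (Finset.filter_subset _ _)
      fun _ _ _ => by positivity) (Finset.sum_nonneg fun _ _ => by positivity) (by positivity)
    refine Nat.cast_le.2 (hM ζ _ ?_ ?_)
    · exact (Finset.filter_subset _ _).trans (Finset.filter_subset _ _)
    · intro i hi
      have hne := (Finset.mem_filter.1 hi).2
      by_contra hcon
      push Not at hcon
      apply hne
      rw [Gw, F3_eq]
      have : ∀ η, ch x η * ((ψ (η - ζ) : ℂ) * a i η) = 0 := by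
        intro η
        by_cases h0 : ψ (η - ζ) = 0
        · simp [h0]
        · simp [hcon η h0]
      simp [this]
  refine (Finset.sum_le_sum key).trans ?_
  rw [← Finset.mul_sum, Finset.sum_fiberwise_of_maps_to fun i hi => Finset.mem_image_of_mem pr hi]

/-! ### Light-cone coordinates -/

/-- The light-cone coordinate transversal to the planks. -/
def hA (ξ : E3) : ℝ := ξ.2 - ξ.1.1

/-- The intermediate light-cone coordinate at angle `u`. -/
def hB (u : ℝ) (ξ : E3) : ℝ := ξ.1.2 - u * hA ξ

/-- The light-cone coordinate normal to the cone at angle `u`. -/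
def hC (u : ℝ) (ξ : E3) : ℝ := ξ.2 + ξ.1.1 - 2 * u * ξ.1.2 + u ^ 2 * hA ξ

theorem hA_add (ξ η : E3) : hA (ξ + η) = hA ξ + hA η := by simp [hA]; ring
theorem hB_add (u : ℝ) (ξ η : E3) : hB u (ξ + η) = hB u ξ + hB u η := by simp [hB, hA]; ring
theorem hC_add (u : ℝ) (ξ η : E3) : hC u (ξ + η) = hC u ξ + hC u η := by simp [hC, hA]; ring
theorem hA_sub (ξ η : E3) : hA (ξ - η) = hA ξ - hA η := by simp [hA]; ring
theorem hB_sub (u : ℝ) (ξ η : E3) : hB u (ξ - η) = hB u ξ - hB u η := by simp [hB, hA]; ring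

theorem hB_shift (u v : ℝ) (ξ : E3) : hB v ξ = hB u ξ - (v - u) * hA ξ := by simp [hB]; ring
theorem hC_shift (u v : ℝ) (ξ : E3) :
    hC v ξ = hC u ξ - 2 * (v - u) * hB u ξ + (v - u) ^ 2 * hA ξ := by simp [hC, hB]; ring

/-! ### Windows adapted to planks -/

/-- The smooth profile of the windows. -/
def beta : ContDiffBump (0 : ℝ) := ⟨7680, 15360, by norm_num, by norm_num⟩

/-- Light-cone coordinates at angle `u`, rescaled to a plank of width `s`. -/
def lam (ρ s u : ℝ) : E3 →ₗ[ℝ] E3 where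
  toFun ξ := ((ρ * hA ξ, ρ / s * hB u ξ), ρ / s ^ 2 * hC u ξ)
  map_add' ξ η := by ext <;> simp [hA_add, hB_add, hC_add] <;> ring
  map_smul' c ξ := by ext <;> simp [hA, hB, hC] <;> ring

/-- The inverse of `lam`. -/
def lamInv (ρ s u : ℝ) : E3 →ₗ[ℝ] E3 where
  toFun x :=
    (((x.2 * s ^ 2 / ρ + 2 * u * (x.1.2 * s / ρ + u * (x.1.1 / ρ)) - u ^ 2 * (x.1.1 / ρ) - x.1.1 / ρ) / 2,
      x.1.2 * s / ρ + u * (x.1.1 / ρ)),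
      (x.2 * s ^ 2 / ρ + 2 * u * (x.1.2 * s / ρ + u * (x.1.1 / ρ)) - u ^ 2 * (x.1.1 / ρ) + x.1.1 / ρ) / 2)
  map_add' ξ η := by ext <;> simp <;> ring
  map_smul' c ξ := by ext <;> simp <;> ring

theorem lam_det_ne {ρ s : ℝ} (hρ : 0 < ρ) (hs : 0 < s) (u : ℝ) : LinearMap.det (lam ρ s u) ≠ 0 := by
  have : lamInv ρ s u ∘ₗ lam ρ s u = LinearMap.id := by
    apply LinearMap.ext
    intro x
    ext <;> simp [lam, lamInv, hA, hB, hC] <;> field_simp <;> ring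
  intro h
  have h2 := congrArg LinearMap.det this
  rw [LinearMap.det_comp, h, mul_zero, LinearMap.det_id] at h2
  exact zero_ne_one h2

theorem integral_comp_lam {ρ s : ℝ} (hρ : 0 < ρ) (hs : 0 < s) (u : ℝ) (F : E3 → ℝ) :
    |LinearMap.det (lam ρ s u)| * ∫ ζ, F (lam ρ s u ζ) = ∫ x, F x := by
  have hd := lam_det_ne hρ hs u
  have h1 := Measure.map_linearMap_addHaar_eq_smul_addHaar (volume : Measure E3) hd
  let e := (LinearEquiv.ofIsUnitDet (f := lam ρ s u) (v := Module.finBasis ℝ E3) (v' := Module.finBasis ℝ E3)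
    (by rw [LinearMap.det_toMatrix]; exact hd.isUnit)).toContinuousLinearEquiv.toHomeomorph
  have h2 : ∫ ζ, F (lam ρ s u ζ) = ∫ x, F x ∂(Measure.map (lam ρ s u) volume) :=
    (integral_map_equiv e.toMeasurableEquiv F).symm
  rw [h2, h1, integral_smul_measure, ENNReal.toReal_ofReal (abs_nonneg _), abs_inv, smul_eq_mul,
    mul_inv_cancel_left₀ (abs_ne_zero.2 hd)]

/-- The product profile of the windows. -/
def prof (x : E3) : ℝ := beta x.1.1 * beta x.1.2 * beta x.2

/-- The window adapted to a plank. -/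
def win (ρ s u : ℝ) (ξ : E3) : ℝ := √|LinearMap.det (lam ρ s u)| * prof (lam ρ s u ξ)

/-- Autocorrelation of `beta`. -/
def bb (w : ℝ) : ℝ := ∫ t, beta (w + t) * beta t

theorem kap_win {ρ s : ℝ} (hρ : 0 < ρ) (hs : 0 < s) (u : ℝ) (ω : E3) :
    kap (win ρ s u) ω = bb (ρ * hA ω) * bb (ρ / s * hB u ω) * bb (ρ / s ^ 2 * hC u ω) := by
  have h1 : kap (win ρ s u) ω = |LinearMap.det (lam ρ s u)| *
      ∫ ζ, (fun x => prof (lam ρ s u ω + x) * prof x) (lam ρ s u ζ) := by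
    rw [kap, ← integral_const_mul]
    refine integral_congr_ae (ae_of_all _ fun ζ => ?_)
    simp only [win, map_add]
    nth_rewrite 3 [← Real.mul_self_sqrt (abs_nonneg (LinearMap.det (lam ρ s u)))]
    ring
  rw [h1, integral_comp_lam hρ hs u (fun x => prof (lam ρ s u ω + x) * prof x), bb, bb, bb,
    ← integral_prod_mul, ← integral_prod_mul]
  refine integral_congr_ae (ae_of_all _ fun x => ?_)
  simp only [prof, lam, LinearMap.coe_mk, AddHom.coe_mk, Prod.fst_add, Prod.snd_add]
  ring

theorem beta_integrand_integrable (w : ℝ) : Integrable (fun t : ℝ => beta (w + t) * beta t) := by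
  have h : Continuous (fun t : ℝ => beta (w + t) * beta t) :=
    (beta.continuous.comp (by fun_prop)).mul beta.continuous
  exact h.integrable_of_hasCompactSupport beta.hasCompactSupport.mul_left

theorem beta_zero {t : ℝ} (h : 15360 < |t|) : beta t = 0 := by
  apply beta.zero_of_le_dist
  rw [Real.dist_eq, sub_zero]
  exact h.le

theorem bb_nonneg (w : ℝ) : 0 ≤ bb w :=
  integral_nonneg fun _ => mul_nonneg beta.nonneg beta.nonneg

theorem bb_le (w : ℝ) : bb w ≤ 30720 := by
  have h1 : bb w ≤ ∫ _ in Icc (-15360 : ℝ) 15360, (1 : ℝ) := by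
    rw [← integral_indicator measurableSet_Icc]
    refine integral_mono (beta_integrand_integrable w)
      ((integrable_indicator_iff measurableSet_Icc).2 (by simp)) fun t => ?_
    by_cases ht : t ∈ Icc (-15360 : ℝ) 15360
    · simp only [ht, indicator_of_mem]
      exact mul_le_one₀ beta.le_one beta.nonneg beta.le_one
    · simp only [ht, not_false_eq_true, indicator_of_notMem]
      rw [beta_zero (t := t) (by rw [← not_le, abs_le]; exact ht), mul_zero]
  refine h1.trans ?_
  simp; norm_num

theorem one_le_bb {w : ℝ} (hw : |w| ≤ 7680) : 1 ≤ bb w := by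
  have key : ∀ c : ℝ, (∀ t ∈ Icc c (c + 1), |t| ≤ 7680 ∧ |w + t| ≤ 7680) → 1 ≤ bb w := by
    intro c hc
    have h1 : ∫ _ in Icc c (c + 1), (1 : ℝ) ≤ bb w := by
      rw [← integral_indicator measurableSet_Icc]
      refine integral_mono ((integrable_indicator_iff measurableSet_Icc).2 (by simp))
        (beta_integrand_integrable w) fun t => ?_
      by_cases ht : t ∈ Icc c (c + 1)
      · simp only [ht, indicator_of_mem]
        have := hc t ht
        rw [beta.one_of_mem_closedBall (x := t) (by simpa [beta] using this.1),
          beta.one_of_mem_closedBall (x := w + t) (by simpa [beta] using this.2)]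
        simp
      · simp only [ht, not_false_eq_true, indicator_of_notMem]
        exact mul_nonneg beta.nonneg beta.nonneg
    simpa using h1
  rw [abs_le] at hw
  rcases le_total 0 w with h | h
  · apply key (-7680)
    intro t ht
    rw [abs_le, abs_le]; constructor <;> constructor <;> linarith [ht.1, ht.2]
  · apply key (7679)
    intro t ht
    rw [abs_le, abs_le]; constructor <;> constructor <;> linarith [ht.1, ht.2]

theorem bb_ne_zero {w : ℝ} (h : bb w ≠ 0) : |w| ≤ 30720 := by
  by_contra hc
  push Not at hc
  apply h
  rw [bb, integral_eq_zero_of_ae]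
  refine ae_of_all _ fun t => ?_
  simp only [Pi.zero_apply]
  by_cases ht : |t| ≤ 15360
  · rw [beta_zero (t := w + t), zero_mul]
    have := abs_sub_abs_le_abs_sub w (-t)
    rw [abs_neg, sub_neg_eq_add] at this
    linarith
  · rw [beta_zero (t := t) (not_le.1 ht), mul_zero]

theorem CR_win {ρ s : ℝ} (hρ : 0 < ρ) (hs : 0 < s) (u : ℝ) : CR (win ρ s u) := by
  have hl : Continuous (lam ρ s u) := (lam ρ s u).continuous_of_finiteDimensional
  constructor
  · have hb := beta.continuous
    have hp : Continuous prof := by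
      unfold prof
      exact ((hb.comp (by fun_prop)).mul (hb.comp (by fun_prop))).mul (hb.comp (by fun_prop))
    exact continuous_const.mul (hp.comp hl)
  · refine HasCompactSupport.intro (K := lamInv ρ s u ''
      ((Icc (-15360 : ℝ) 15360 ×ˢ Icc (-15360 : ℝ) 15360) ×ˢ Icc (-15360 : ℝ) 15360)) ?_ ?_
    · exact ((isCompact_Icc.prod isCompact_Icc).prod isCompact_Icc).image
        (lamInv ρ s u).continuous_of_finiteDimensional
    · intro x hx
      by_contra hne
      apply hx
      simp only [win, prof, mul_eq_zero, not_or] at hne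
      refine ⟨lam ρ s u x, ⟨⟨?_, ?_⟩, ?_⟩, ?_⟩
      · rw [mem_Icc, ← abs_le]; by_contra h; exact hne.2.1.1 (beta_zero (not_le.1 h))
      · rw [mem_Icc, ← abs_le]; by_contra h; exact hne.2.1.2 (beta_zero (not_le.1 h))
      · rw [mem_Icc, ← abs_le]; by_contra h; exact hne.2.2 (beta_zero (not_le.1 h))
      · ext <;> simp [lam, lamInv, hA, hB, hC] <;> field_simp <;> ring

theorem win_ne_zero {ρ s u : ℝ} {ξ : E3} (h : win ρ s u ξ ≠ 0) :
    |ρ * hA ξ| ≤ 15360 ∧ |ρ / s * hB u ξ| ≤ 15360 ∧ |ρ / s ^ 2 * hC u ξ| ≤ 15360 := by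
  simp only [win, prof, ne_eq, mul_eq_zero, not_or] at h
  refine ⟨?_, ?_, ?_⟩
  · by_contra hc; exact h.2.1.1 (beta_zero (not_le.1 hc))
  · by_contra hc; exact h.2.1.2 (beta_zero (not_le.1 hc))
  · by_contra hc; exact h.2.2 (beta_zero (not_le.1 hc))

theorem kap_win_nonneg {ρ s : ℝ} (hρ : 0 < ρ) (hs : 0 < s) (u : ℝ) (ω : E3) :
    0 ≤ kap (win ρ s u) ω := by
  rw [kap_win hρ hs]
  exact mul_nonneg (mul_nonneg (bb_nonneg _) (bb_nonneg _)) (bb_nonneg _)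

theorem kap_win_le {ρ s : ℝ} (hρ : 0 < ρ) (hs : 0 < s) (u : ℝ) (ω : E3) :
    kap (win ρ s u) ω ≤ 30720 ^ 3 := by
  rw [kap_win hρ hs, show (30720 : ℝ) ^ 3 = 30720 * 30720 * 30720 by norm_num]
  exact mul_le_mul (mul_le_mul (bb_le _) (bb_le _) (bb_nonneg _) (by norm_num)) (bb_le _)
    (bb_nonneg _) (by norm_num)

theorem one_le_kap_win {ρ s : ℝ} (hρ : 0 < ρ) (hs : 0 < s) {u : ℝ} {ω : E3}
    (h1 : |ρ * hA ω| ≤ 7680) (h2 : |ρ / s * hB u ω| ≤ 7680) (h3 : |ρ / s ^ 2 * hC u ω| ≤ 7680) :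
    1 ≤ kap (win ρ s u) ω := by
  rw [kap_win hρ hs]
  exact one_le_mul_of_one_le_of_one_le
    (one_le_mul_of_one_le_of_one_le (one_le_bb h1) (one_le_bb h2)) (one_le_bb h3)

theorem kap_win_ne_zero {ρ s : ℝ} (hρ : 0 < ρ) (hs : 0 < s) {u : ℝ} {ω : E3}
    (h : kap (win ρ s u) ω ≠ 0) : |ρ * hA ω| ≤ 30720 ∧ |ρ / s * hB u ω| ≤ 30720 := by
  rw [kap_win hρ hs] at h
  exact ⟨bb_ne_zero (left_ne_zero_of_mul (left_ne_zero_of_mul h)),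
    bb_ne_zero (right_ne_zero_of_mul (left_ne_zero_of_mul h))⟩

/-! ### Dyadic scales and planks -/

/-- Dyadic scale. -/
def sc (j : ℕ) : ℝ := (1 / 2) ^ j

theorem sc_pos (j : ℕ) : 0 < sc j := by unfold sc; positivity

theorem sc_add (j d : ℕ) : sc (j + d) * 2 ^ d = sc j := by
  unfold sc
  rw [pow_add, mul_assoc, ← mul_pow]; norm_num

theorem sc_le {i j : ℕ} (h : i ≤ j) : sc j ≤ sc i :=
  pow_le_pow_of_le_one (by norm_num) (by norm_num) h

theorem sc_eq {j N : ℕ} (h : j ≤ N) : sc j = 2 ^ (N - j) * sc N := by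
  rw [mul_comm, ← sc_add j (N - j), Nat.add_sub_cancel' h]


/-- The dyadic ancestor `k` generations above. -/
def anc (d : ℕ) (ν : ℤ) : ℤ := ν / 2 ^ d

theorem anc_anc (d e : ℕ) (ν : ℤ) : anc e (anc d ν) = anc (d + e) ν := by
  rw [anc, anc, anc, Int.ediv_ediv_of_nonneg (by positivity), pow_add]

theorem anc_zero (ν : ℤ) : anc 0 ν = ν := by simp [anc]

theorem anc_bounds {j N : ℕ} (h : j ≤ N) (ν : ℤ) :
    (anc (N - j) ν : ℝ) * sc j ≤ ν * sc N ∧ ν * sc N ≤ (anc (N - j) ν : ℝ) * sc j + sc j := by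
  have h1 : anc (N - j) ν * 2 ^ (N - j) ≤ ν := Int.ediv_mul_le _ (by positivity)
  have h2 : ν < (anc (N - j) ν + 1) * 2 ^ (N - j) := Int.lt_ediv_add_one_mul_self _ (by positivity)
  have h1' : (anc (N - j) ν : ℝ) * 2 ^ (N - j) ≤ ν := by exact_mod_cast h1
  have h2' : (ν : ℝ) ≤ (anc (N - j) ν + 1) * 2 ^ (N - j) := by exact_mod_cast h2.le
  rw [sc_eq h]
  have := sc_pos N
  constructor <;> nlinarith

theorem card_le_of_diam {t : Finset ℤ} {D : ℕ} (h : ∀ x ∈ t, ∀ y ∈ t, |x - y| ≤ D) :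
    t.card ≤ D + 1 := by
  rcases t.eq_empty_or_nonempty with rfl | hne
  · simp
  have hsub : t ⊆ Finset.Icc (t.min' hne) (t.min' hne + D) := by
    intro x hx
    have h1 := t.min'_le x hx
    have h2 := h x hx _ (t.min'_mem hne)
    rw [Finset.mem_Icc]
    rw [abs_le] at h2
    omega
  refine (Finset.card_le_card hsub).trans ?_
  rw [Int.card_Icc]
  omega

theorem int_le_of_scaled {x y : ℤ} {S : ℝ} (hS : 0 < S) {D : ℕ} (h : |x * S - y * S| ≤ D * S) :
    |x - y| ≤ D := by
  rw [← sub_mul, abs_mul, abs_of_pos hS] at h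
  have := le_of_mul_le_mul_right h hS
  exact_mod_cast this

/-- The frequency cutoff of the plank `i` of scale `j` seen from scale `N`. -/
def kp (N j : ℕ) (i : ℤ) (ω : E3) : ℝ := kap (win ((sc j / sc N) ^ 2) (sc j) (i * sc j)) ω

theorem kp_nonneg (N j : ℕ) (i : ℤ) (ω : E3) : 0 ≤ kp N j i ω :=
  kap_win_nonneg (pow_pos (div_pos (sc_pos _) (sc_pos _)) 2) (sc_pos _) _ _

theorem kp_le (N j : ℕ) (i : ℤ) (ω : E3) : kp N j i ω ≤ 30720 ^ 3 :=
  kap_win_le (pow_pos (div_pos (sc_pos _) (sc_pos _)) 2) (sc_pos _) _ _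

theorem one_le_kp {N j : ℕ} {i : ℤ} {ω : E3} (h1 : |hA ω| * sc j ^ 2 ≤ 7680 * sc N ^ 2)
    (h2 : |hB (i * sc j) ω| * sc j ≤ 7680 * sc N ^ 2)
    (h3 : |hC (i * sc j) ω| ≤ 7680 * sc N ^ 2) : 1 ≤ kp N j i ω := by
  have hs := sc_pos j
  have hS := sc_pos N
  refine one_le_kap_win (pow_pos (div_pos (sc_pos _) (sc_pos _)) 2) (sc_pos _) ?_ ?_ ?_
  · rw [abs_mul, abs_of_pos (by positivity), div_pow, div_mul_eq_mul_div, div_le_iff₀ (by positivity)]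
    linarith
  · rw [abs_mul, abs_of_pos (by positivity), show (sc j / sc N) ^ 2 / sc j = sc j / sc N ^ 2 by
      field_simp, div_mul_eq_mul_div, div_le_iff₀ (by positivity)]
    linarith
  · rw [abs_mul, abs_of_pos (by positivity), show (sc j / sc N) ^ 2 / sc j ^ 2 = 1 / sc N ^ 2 by
      field_simp, div_mul_eq_mul_div, div_le_iff₀ (by positivity)]
    linarith

theorem kp_ne_zero {N j : ℕ} {i : ℤ} {ω : E3} (h : kp N j i ω ≠ 0) :
    |hA ω| * sc j ^ 2 ≤ 30720 * sc N ^ 2 ∧ |hB (i * sc j) ω| * sc j ≤ 30720 * sc N ^ 2 := by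
  have hs := sc_pos j
  have hS := sc_pos N
  obtain ⟨h1, h2⟩ := kap_win_ne_zero (pow_pos (div_pos (sc_pos _) (sc_pos _)) 2) (sc_pos _) h
  constructor
  · rwa [abs_mul, abs_of_pos (by positivity), div_pow, div_mul_eq_mul_div, div_le_iff₀ (by positivity),
      mul_comm] at h1
  · rwa [abs_mul, abs_of_pos (by positivity), show (sc j / sc N) ^ 2 / sc j = sc j / sc N ^ 2 by
      field_simp, div_mul_eq_mul_div, div_le_iff₀ (by positivity), mul_comm] at h2

/-- A family of functions adapted to the planks of scale `N`. -/
structure Fam (N : ℕ) (J : Finset ℤ) (b : ℤ → E3 → ℂ) (h0 δ : ℝ) : Prop where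
  cc : ∀ ν ∈ J, CC (b ν)
  supp : ∀ ν ∈ J, ∀ ξ, b ν ξ ≠ 0 → 1 / 2 ≤ hA ξ ∧ hA ξ ≤ 6 ∧ |hA ξ - h0| ≤ δ ∧
    |hB (ν * sc N) ξ| ≤ 60 * sc N ∧ |hC (ν * sc N) ξ| ≤ 60 * sc N ^ 2

theorem disc_eq (u v : ℝ) (ξ : E3) :
    hA ξ * hC v ξ - hB v ξ ^ 2 = hA ξ * hC u ξ - hB u ξ ^ 2 := by
  simp only [hB, hC]; ring

theorem corr_ne_zero {a : E3 → ℂ} {ω : E3} (h : corr a a ω ≠ 0) :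
    ∃ ξ, a (ξ + ω) ≠ 0 ∧ a ξ ≠ 0 := by
  by_contra hc
  push Not at hc
  apply h
  rw [corr, integral_eq_zero_of_ae]
  refine ae_of_all _ fun ξ => ?_
  by_cases h1 : a (ξ + ω) = 0
  · simp [h1]
  · simp [hc ξ h1]

theorem conv_ne_zero {a b : E3 → ℂ} {x : E3} (h : conv a b x ≠ 0) :
    ∃ ξ η, a ξ ≠ 0 ∧ b η ≠ 0 ∧ ξ + η = x := by
  by_contra hc
  push Not at hc
  apply h
  rw [conv, integral_eq_zero_of_ae]
  refine ae_of_all _ fun ξ => ?_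
  by_cases h1 : a ξ = 0
  · simp [h1]
  · by_cases h2 : b (x - ξ) = 0
    · simp [h2]
    · exact absurd (add_sub_cancel ξ x) (hc ξ (x - ξ) h1 h2)

section
variable {N : ℕ} {J : Finset ℤ} {b : ℤ → E3 → ℂ} {h0 δ : ℝ}

theorem Fam.corr_supp (hF : Fam N J b h0 δ) {ν : ℤ} (hν : ν ∈ J) {ω : E3}
    (h : corr (b ν) (b ν) ω ≠ 0) :
    |hA ω| ≤ 6 ∧ |hB (ν * sc N) ω| ≤ 120 * sc N ∧ |hC (ν * sc N) ω| ≤ 120 * sc N ^ 2 := by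
  obtain ⟨ξ, h1, h2⟩ := corr_ne_zero h
  obtain ⟨a1, a2, -, a3, a4⟩ := hF.supp ν hν _ h1
  obtain ⟨b1, b2, -, b3, b4⟩ := hF.supp ν hν _ h2
  rw [hA_add] at a1 a2
  rw [hB_add] at a3
  rw [hC_add] at a4
  rw [abs_le] at *
  refine ⟨⟨?_, ?_⟩, ?_, ?_⟩
  · linarith
  · linarith
  · rw [abs_le]; constructor <;> linarith [a3.1, a3.2, b3.1, b3.2]
  · rw [abs_le]; constructor <;> linarith [a4.1, a4.2, b4.1, b4.2]

/-- Finitely many pieces meet a given window. -/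
theorem Fam.window_count (hF : Fam N J b h0 δ) {j N₁ : ℕ} (hj : j ≤ N₁) (hN : N₁ ≤ N)
    (hc : N - N₁ ≤ N₁ - j) {i : ℤ} {S : Finset ℤ} (hS : S ⊆ J) (hSi : ∀ ν ∈ S, anc (N - j) ν = i)
    {ζ : E3} {t : Finset ℤ} (ht : t ⊆ S)
    (h : ∀ ν ∈ t, ∃ η, win ((sc j / sc N₁) ^ 2) (sc j) (i * sc j) (η - ζ) ≠ 0 ∧ b ν η ≠ 0) :
    t.card ≤ 123121 := by
  refine card_le_of_diam (D := 123120) fun ν hν ν' hν' => ?_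
  obtain ⟨η, w1, e1⟩ := h ν hν
  obtain ⟨η', w2, e2⟩ := h ν' hν'
  have hs := sc_pos j
  have hS1 := sc_pos N₁
  have hSp := sc_pos N
  have hkey : sc N₁ ^ 2 ≤ sc j * sc N := by
    unfold sc
    rw [← pow_mul, ← pow_add]
    exact pow_le_pow_of_le_one (by norm_num) (by norm_num) (by omega)
  obtain ⟨p1, p2, -⟩ := win_ne_zero w1
  obtain ⟨q1, q2, -⟩ := win_ne_zero w2
  have conv1 : ∀ x : ℝ, |(sc j / sc N₁) ^ 2 * x| ≤ 15360 → |x| * sc j ≤ 15360 * sc N := by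
    intro x hx
    rw [abs_mul, abs_of_pos (by positivity), div_pow, div_mul_eq_mul_div, div_le_iff₀ (by positivity)] at hx
    have : sc j * (|x| * sc j) ≤ sc j * (15360 * sc N) := by nlinarith
    exact le_of_mul_le_mul_left this hs
  have conv2 : ∀ x : ℝ, |(sc j / sc N₁) ^ 2 / sc j * x| ≤ 15360 → |x| ≤ 15360 * sc N := by
    intro x hx
    rw [abs_mul, abs_of_pos (by positivity), show (sc j / sc N₁) ^ 2 / sc j = sc j / sc N₁ ^ 2 by
      field_simp, div_mul_eq_mul_div, div_le_iff₀ (by positivity)] at hx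
    have : sc j * (|x|) ≤ sc j * (15360 * sc N) := by nlinarith
    exact le_of_mul_le_mul_left this hs
  replace p1 := conv1 _ p1
  replace p2 := conv2 _ p2
  replace q1 := conv1 _ q1
  replace q2 := conv2 _ q2
  obtain ⟨a1, a2, -, a3, -⟩ := hF.supp ν (hS (ht hν)) _ e1
  obtain ⟨b1, b2, -, b3, -⟩ := hF.supp ν' (hS (ht hν')) _ e2
  have g1 := anc_bounds (hj.trans hN) ν'
  rw [hSi ν' (ht hν')] at g1
  apply int_le_of_scaled hSp
  rw [hB_shift (i * sc j)] at a3 b3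
  set u := (i : ℝ) * sc j
  set v := (ν : ℝ) * sc N
  set v' := (ν' : ℝ) * sc N
  set A := hA η
  set A' := hA η'
  rw [hA_sub] at p1 q1
  rw [hB_sub] at p2 q2
  set Z := hA ζ
  set Y := hB u ζ
  set B := hB u η
  set B' := hB u η'
  have hAA : |(v' - u) * (A - A')| ≤ 30720 * sc N := by
    rw [abs_mul, abs_of_nonneg (by linarith [g1.1])]
    have : |A - A'| ≤ |A - Z| + |A' - Z| := by
      have := abs_sub (A - Z) (A' - Z)
      rwa [sub_sub_sub_cancel_right] at this
    calc (v' - u) * |A - A'| ≤ sc j * (|A - Z| + |A' - Z|) := by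
          apply mul_le_mul _ this (abs_nonneg _) hs.le
          linarith [g1.2]
      _ ≤ _ := by linarith
  have hid : (v - v') * A = -(B - (v - u) * A) + (B' - (v' - u) * A') + (B - Y) - (B' - Y)
      - (v' - u) * (A - A') := by ring
  have hb : |(v - v') * A| ≤ 61560 * sc N := by
    rw [hid]
    rw [abs_le] at *
    constructor <;> linarith [a3.1, a3.2, b3.1, b3.2, p2.1, p2.2, q2.1, q2.2, hAA.1, hAA.2]
  rw [abs_mul, abs_of_pos (by linarith : (0:ℝ) < A)] at hb
  have := abs_nonneg (v - v')
  push_cast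
  nlinarith

end

theorem near_of_sq_sub {P Q e : ℝ} (he : 0 ≤ e) (h : |P ^ 2 - Q ^ 2| ≤ e ^ 2) :
    |P - Q| ≤ e ∨ |P + Q| ≤ e := by
  by_contra hc
  push Not at hc
  have : e * e < |P - Q| * |P + Q| := mul_lt_mul'' hc.1 hc.2 he he
  rw [← abs_mul] at this
  have h2 : (P - Q) * (P + Q) = P ^ 2 - Q ^ 2 := by ring
  rw [h2] at this
  nlinarith

section
variable {N : ℕ} {J : Finset ℤ} {b : ℤ → E3 → ℂ} {h0 δ : ℝ}

/-- Coordinates of a point of a plank, relative to an ancestor. -/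
theorem Fam.plank_coords (hF : Fam N J b h0 δ) {j : ℕ} (hj : j ≤ N) {i : ℤ}
    (hδ : δ * sc j ^ 2 ≤ sc N ^ 2) {ν : ℤ} (hν : ν ∈ J) (hi : anc (N - j) ν = i) {ξ : E3}
    (h : b ν ξ ≠ 0) :
    |hB (i * sc j) ξ - (ν * sc N - i * sc j) * h0| ≤ 61 * sc N ∧
    |h0 * hC (i * sc j) ξ - hB (i * sc j) ξ ^ 2| ≤ 20592 * sc N ^ 2 := by
  obtain ⟨a1, a2, a3, a4, a5⟩ := hF.supp ν hν _ h
  have hs := sc_pos j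
  have hS := sc_pos N
  have hSs := sc_le hj
  have hd := disc_eq (i * sc j) (ν * sc N) ξ
  have hw := anc_bounds hj ν
  rw [hi] at hw
  rw [hB_shift (i * sc j)] at a4 hd
  set u := (i : ℝ) * sc j
  set v := (ν : ℝ) * sc N
  set A := hA ξ
  set B := hB u ξ
  set C := hC u ξ
  set w := v - u with hwd
  set E := B - w * A with hE
  set s := sc j
  set S := sc N
  have hw0 : 0 ≤ w := by linarith
  have hw1 : w ≤ s := by linarith
  have hδ0 : 0 ≤ δ := (abs_nonneg _).trans a3
  have hsd : δ * s ≤ S := by nlinarith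
  have hEb := abs_le.1 a4
  have hB1 : |B| ≤ 66 * s := by
    rw [abs_le]; constructor <;> nlinarith
  have hdisc : |A * C - B ^ 2| ≤ 3960 * S ^ 2 := by
    rw [← hd]
    have h1 : |A * hC v ξ| ≤ 6 * (60 * S ^ 2) := by
      rw [abs_mul, abs_of_pos (by linarith : (0:ℝ) < A)]
      exact mul_le_mul a2 a5 (abs_nonneg _) (by norm_num)
    have h2 : |E ^ 2| ≤ 3600 * S ^ 2 := by
      rw [abs_pow]
      calc |E| ^ 2 ≤ (60 * S) ^ 2 := pow_le_pow_left₀ (abs_nonneg _) a4 2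
        _ = _ := by ring
    calc _ ≤ |A * hC v ξ| + |E ^ 2| := abs_sub _ _
      _ ≤ _ := by linarith
  have hC1 : |C| ≤ 16632 * s ^ 2 := by
    have h1 : |A * C| ≤ 8316 * s ^ 2 := by
      have hB2 : |B ^ 2| ≤ 4356 * s ^ 2 := by
        rw [abs_pow]
        calc |B| ^ 2 ≤ (66 * s) ^ 2 := pow_le_pow_left₀ (abs_nonneg _) hB1 2
          _ = _ := by ring
      have h3 : |A * C| ≤ |A * C - B ^ 2| + |B ^ 2| := by
        have := abs_add_le (A * C - B ^ 2) (B ^ 2)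
        rwa [sub_add_cancel] at this
      nlinarith
    rw [abs_mul, abs_of_pos (by linarith : (0:ℝ) < A)] at h1
    have := abs_nonneg C
    nlinarith
  constructor
  · have : B - w * h0 = E + w * (A - h0) := by rw [hE]; ring
    rw [this]
    have h2 : |w * (A - h0)| ≤ S := by
      rw [abs_mul, abs_of_nonneg hw0]
      calc w * |A - h0| ≤ s * δ := mul_le_mul hw1 a3 (abs_nonneg _) hs.le
        _ ≤ S := by linarith
    calc _ ≤ |E| + |w * (A - h0)| := abs_add_le _ _
      _ ≤ _ := by linarith
  · have : h0 * C - B ^ 2 = (A * C - B ^ 2) - (A - h0) * C := by ring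
    rw [this]
    have h2 : |(A - h0) * C| ≤ 16632 * S ^ 2 := by
      rw [abs_mul]
      calc |A - h0| * |C| ≤ δ * (16632 * s ^ 2) := mul_le_mul a3 hC1 (abs_nonneg _) hδ0
        _ ≤ _ := by linarith
    calc _ ≤ |A * C - B ^ 2| + |(A - h0) * C| := abs_sub _ _
      _ ≤ _ := by linarith

theorem pair_near {s1 s2 t1 t2 : ℝ} {e : ℝ} (he : 0 ≤ e) (h1 : s1 + s2 = t1 + t2)
    (h2 : |(s1 ^ 2 + s2 ^ 2) - (t1 ^ 2 + t2 ^ 2)| ≤ 2 * e ^ 2) :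
    (|t1 - s1| ≤ e ∧ |t2 - s2| ≤ e) ∨ (|t1 - s2| ≤ e ∧ |t2 - s1| ≤ e) := by
  have h3 : |(s1 - s2) ^ 2 - (t1 - t2) ^ 2| ≤ (2 * e) ^ 2 := by
    have : (s1 - s2) ^ 2 - (t1 - t2) ^ 2 = 2 * ((s1 ^ 2 + s2 ^ 2) - (t1 ^ 2 + t2 ^ 2)) := by
      have : (s1 + s2) ^ 2 = (t1 + t2) ^ 2 := by rw [h1]
      linarith
    rw [this, abs_mul, abs_two]
    linarith
  rcases near_of_sq_sub (by positivity) h3 with h | h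
  · left
    rw [abs_le] at h
    constructor <;> rw [abs_le] <;> constructor <;> linarith [h.1, h.2]
  · right
    rw [abs_le] at h
    constructor <;> rw [abs_le] <;> constructor <;> linarith [h.1, h.2]

/-- Sums of pairs of planks have bounded overlap. -/
theorem Fam.pair_count (hF : Fam N J b h0 δ) {j : ℕ} (hj : j ≤ N) {i : ℤ} (hh : 1 / 2 ≤ h0)
    (hδ : δ * sc j ^ 2 ≤ sc N ^ 2) {x : E3} {t : Finset (ℤ × ℤ)}
    (ht : ∀ p ∈ t, p.1 ∈ J ∧ p.2 ∈ J ∧ anc (N - j) p.1 = i ∧ anc (N - j) p.2 = i ∧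
      conv (b p.1) (b p.2) x ≠ 0) : t.card ≤ 2602 ^ 2 := by
  rcases t.eq_empty_or_nonempty with rfl | ⟨p, hp⟩
  · simp
  have hS := sc_pos N
  let G : Finset ℤ := Finset.Icc (p.1 - 650) (p.1 + 650) ∪ Finset.Icc (p.2 - 650) (p.2 + 650)
  have hG : G.card ≤ 2602 := by
    refine (Finset.card_union_le _ _).trans ?_
    rw [Int.card_Icc, Int.card_Icc]
    omega
  have hsub : t ⊆ G ×ˢ G := by
    intro r hr
    obtain ⟨p1, p2, p3, p4, p5⟩ := ht p hp
    obtain ⟨r1, r2, r3, r4, r5⟩ := ht r hr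
    obtain ⟨ξ1, ξ2, x1, x2, x3⟩ := conv_ne_zero p5
    obtain ⟨η1, η2, y1, y2, y3⟩ := conv_ne_zero r5
    obtain ⟨c1, d1⟩ := hF.plank_coords hj hδ p1 p3 x1
    obtain ⟨c2, d2⟩ := hF.plank_coords hj hδ p2 p4 x2
    obtain ⟨c3, d3⟩ := hF.plank_coords hj hδ r1 r3 y1
    obtain ⟨c4, d4⟩ := hF.plank_coords hj hδ r2 r4 y2
    rw [← y3] at x3
    have e1 := congrArg (hB (i * sc j)) x3
    have e2 := congrArg (hC (i * sc j)) x3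
    rw [hB_add, hB_add] at e1
    rw [hC_add, hC_add] at e2
    have hn := pair_near (s1 := hB (i * sc j) ξ1) (s2 := hB (i * sc j) ξ2)
      (t1 := hB (i * sc j) η1) (t2 := hB (i * sc j) η2) (e := 203 * sc N) (by positivity) e1 (by
        rw [abs_le] at *
        have e3 : h0 * hC (i * sc j) ξ1 + h0 * hC (i * sc j) ξ2 =
          h0 * hC (i * sc j) η1 + h0 * hC (i * sc j) η2 := by rw [← mul_add, ← mul_add, e2]
        constructor <;> nlinarith [d1.1, d1.2, d2.1, d2.2, d3.1, d3.2, d4.1, d4.2])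
    have fin : ∀ {μ μ' : ℤ} {ξ η : E3},
        |hB (i * sc j) ξ - (μ * sc N - i * sc j) * h0| ≤ 61 * sc N →
        |hB (i * sc j) η - (μ' * sc N - i * sc j) * h0| ≤ 61 * sc N →
        |hB (i * sc j) η - hB (i * sc j) ξ| ≤ 203 * sc N → μ' ∈ Finset.Icc (μ - 650) (μ + 650) := by
      intro μ μ' ξ η z1 z2 z3
      have : |μ' * sc N - μ * sc N| * h0 ≤ 325 * sc N := by
        have ha : |μ' * sc N - μ * sc N| * h0 = |(μ' * sc N - μ * sc N) * h0| := by
          rw [abs_mul, abs_of_pos (a := h0) (by linarith)]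
        rw [ha]
        rw [abs_le] at *
        constructor <;> linarith [z1.1, z1.2, z2.1, z2.2, z3.1, z3.2]
      have h4 : |μ' * sc N - μ * sc N| ≤ (650 : ℕ) * sc N := by
        have := abs_nonneg (μ' * sc N - μ * sc N)
        push_cast
        nlinarith
      have := int_le_of_scaled hS h4
      rw [abs_le] at this
      rw [Finset.mem_Icc]
      push_cast at this
      constructor <;> linarith [this.1, this.2]
    rw [Finset.mem_product, Finset.mem_union, Finset.mem_union]
    rcases hn with ⟨h1, h2⟩ | ⟨h1, h2⟩
    · exact ⟨Or.inl (fin c1 c3 h1), Or.inr (fin c2 c4 h2)⟩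
    · exact ⟨Or.inr (fin c2 c3 h1), Or.inl (fin c1 c4 h2)⟩
  refine (Finset.card_le_card hsub).trans ?_
  rw [Finset.card_product, sq]
  exact Nat.mul_le_mul hG hG

theorem conv_sum_left {ι : Type*} {s : Finset ι} {a : ι → E3 → ℂ} (h : ∀ i ∈ s, CC (a i))
    {c : E3 → ℂ} (hc : CC c) (x : E3) :
    conv (fun ξ => ∑ i ∈ s, a i ξ) c x = ∑ i ∈ s, conv (a i) c x := by
  simp only [conv, Finset.sum_mul]
  refine integral_finsetSum _ fun i hi => ?_
  refine CC.integrable ⟨(h i hi).cont.mul (hc.cont.comp (by fun_prop)), (h i hi).supp.mul_right⟩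

theorem conv_sum_right {ι : Type*} {s : Finset ι} {a : ι → E3 → ℂ} (h : ∀ i ∈ s, CC (a i))
    {c : E3 → ℂ} (hc : CC c) (x : E3) :
    conv c (fun ξ => ∑ i ∈ s, a i ξ) x = ∑ i ∈ s, conv c (a i) x := by
  simp only [conv, Finset.mul_sum]
  refine integral_finsetSum _ fun i hi => ?_
  refine CC.integrable ⟨hc.cont.mul ((h i hi).cont.comp (by fun_prop)), hc.supp.mul_right⟩

theorem enorm_sum_sq_le {ι : Type*} [DecidableEq ι] (s : Finset ι) (f : ι → ℂ) (P : ℕ)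
    (h : ∀ t ⊆ s, (∀ i ∈ t, f i ≠ 0) → t.card ≤ P) :
    ‖∑ i ∈ s, f i‖ₑ ^ 2 ≤ P * ∑ i ∈ s, ‖f i‖ₑ ^ 2 := by
  classical
  have h1 : ∑ i ∈ s, f i = ∑ i ∈ s with f i ≠ 0, f i := (Finset.sum_filter_ne_zero s).symm
  have h2 : ∑ i ∈ s with f i ≠ 0, ‖f i‖ₑ ^ 2 ≤ ∑ i ∈ s, ‖f i‖ₑ ^ 2 :=
    Finset.sum_le_sum_of_subset (Finset.filter_subset _ _)
  refine le_trans ?_ (mul_le_mul_right h2 _)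
  rw [h1]
  have hP := h (s.filter fun i => f i ≠ 0) (Finset.filter_subset _ _) (by simp)
  have h3 := norm_sum_sq_le (s.filter fun i => f i ≠ 0) f
  simp only [← ofReal_norm_sq]
  rw [← ENNReal.ofReal_sum_of_nonneg (fun _ _ => by positivity), ← ENNReal.ofReal_natCast,
    ← ENNReal.ofReal_mul (by positivity)]
  refine ENNReal.ofReal_le_ofReal (h3.trans ?_)
  exact mul_le_mul_of_nonneg_right (by exact_mod_cast hP) (Finset.sum_nonneg fun _ _ => by positivity)

theorem lintegral_N2_sum {ι : Type*} (s : Finset ι) {f : ι → E3 → ℂ} (h : ∀ i ∈ s, CC (f i)) :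
    ∫⁻ x, ∑ i ∈ s, ‖f i x‖ₑ ^ 2 = ∑ i ∈ s, N2 (f i) := by
  rw [lintegral_finsetSum']
  · rfl
  · exact fun i hi => ((h i hi).cont.enorm.measurable.pow_const 2).aemeasurable

theorem Fam.sum_overlap (hF : Fam N J b h0 δ) {j : ℕ} (hj : j ≤ N) {i : ℤ} (hh : 1 / 2 ≤ h0)
    (hδ : δ * sc j ^ 2 ≤ sc N ^ 2) {S : Finset ℤ} (hS : S ⊆ J) (hSi : ∀ ν ∈ S, anc (N - j) ν = i)
    (pr : ℤ → ℤ) :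
    N2 (fun ω => ∑ σ ∈ S.image pr,
        corr (fun ξ => ∑ ν ∈ S with pr ν = σ, b ν ξ) (fun ξ => ∑ ν ∈ S with pr ν = σ, b ν ξ) ω) ≤
      (2602 ^ 2 : ℕ) * N2 (fun ω => ∑ ν ∈ S, corr (b ν) (b ν) ω) := by
  classical
  have hcc : ∀ ν ∈ S, CC (b ν) := fun ν hν => hF.cc ν (hS hν)
  have hf : ∀ σ, ∀ ν ∈ S.filter (fun ν => pr ν = σ), CC (b ν) := fun σ ν hν =>
    hcc ν (Finset.mem_filter.1 hν).1
  have hsig : ∀ σ, CC (fun ξ => ∑ ν ∈ S with pr ν = σ, b ν ξ) := fun σ => CC.sum (hf σ)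
  rw [N2_sum_corr _ (fun σ _ => hsig σ), N2_sum_corr _ hcc]
  have hpair : ∀ σ σ', N2 (conv (fun ξ => ∑ ν ∈ S with pr ν = σ, b ν ξ)
      (fun ξ => ∑ ν ∈ S with pr ν = σ', b ν ξ)) ≤ (2602 ^ 2 : ℕ) *
      ∑ ν ∈ S with pr ν = σ, ∑ ν' ∈ S with pr ν' = σ', N2 (conv (b ν) (b ν')) := by
    intro σ σ'
    set s1 := S.filter (fun ν => pr ν = σ)
    set s2 := S.filter (fun ν => pr ν = σ')
    have hprod : ∀ p ∈ s1 ×ˢ s2, CC (conv (b p.1) (b p.2)) := fun p hp =>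
      (hf σ _ (Finset.mem_product.1 hp).1).conv (hf σ' _ (Finset.mem_product.1 hp).2)
    rw [← Finset.sum_product', ← lintegral_N2_sum _ hprod, ← lintegral_const_mul' _ _ (by simp)]
    refine lintegral_mono fun x => ?_
    have : conv (fun ξ => ∑ ν ∈ s1, b ν ξ) (fun ξ => ∑ ν ∈ s2, b ν ξ) x =
        ∑ p ∈ s1 ×ˢ s2, conv (b p.1) (b p.2) x := by
      rw [conv_sum_left (hf σ) (hsig σ'), Finset.sum_product]
      exact Finset.sum_congr rfl fun ν hν => conv_sum_right (hf σ') (hf σ ν hν) x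
    dsimp only
    rw [this]
    refine enorm_sum_sq_le _ _ _ fun t ht hne => hF.pair_count hj hh hδ (x := x) (i := i) fun p hp => ?_
    have h1 := Finset.mem_product.1 (ht hp)
    have h2 := (Finset.mem_filter.1 h1.1).1
    have h3 := (Finset.mem_filter.1 h1.2).1
    exact ⟨hS h2, hS h3, hSi _ h2, hSi _ h3, hne p hp⟩
  calc _ ≤ ∑ σ ∈ S.image pr, ∑ σ' ∈ S.image pr, (2602 ^ 2 : ℕ) *
      ∑ ν ∈ S with pr ν = σ, ∑ ν' ∈ S with pr ν' = σ', N2 (conv (b ν) (b ν')) :=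
        Finset.sum_le_sum fun σ _ => Finset.sum_le_sum fun σ' _ => hpair σ σ'
    _ = _ := by
      simp only [← Finset.mul_sum]
      congr 1
      rw [← Finset.sum_fiberwise_of_maps_to (g := pr) (t := S.image pr)
        (fun x hx => Finset.mem_image_of_mem _ hx)]
      refine Finset.sum_congr rfl fun σ _ => ?_
      rw [Finset.sum_comm]
      refine Finset.sum_congr rfl fun ν _ => ?_
      rw [← Finset.sum_fiberwise_of_maps_to (s := S) (g := pr) (t := S.image pr)
        (fun x hx => Finset.mem_image_of_mem _ hx)]

end

theorem CR_kp (N j : ℕ) (i : ℤ) : CR (win ((sc j / sc N) ^ 2) (sc j) (i * sc j)) :=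
  CR_win (pow_pos (div_pos (sc_pos _) (sc_pos _)) 2) (sc_pos _) _

section
variable {N : ℕ} {J : Finset ℤ} {b : ℤ → E3 → ℂ} {h0 δ : ℝ}

theorem kp_of_bounds {j' N : ℕ} (hj : j' ≤ N) {ω : E3} {β : ℝ} {ν : ℤ}
    (hα : |hA ω| * sc j' ^ 2 ≤ 1280 * sc N ^ 2) (hβ : |β| * sc j' ≤ 1280 * sc N ^ 2)
    (hB2 : hB (ν * sc N) ω ^ 2 ≤ β ^ 2 + 240 * sc N ^ 2 * |hA ω|)
    (hC2 : |hC (ν * sc N) ω| ≤ 120 * sc N ^ 2) : 1 ≤ kp N j' (anc (N - j') ν) ω := by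
  have hs := sc_pos j'
  have hS := sc_pos N
  have hw := anc_bounds hj ν
  set u := (anc (N - j') ν : ℝ) * sc j'
  set v := (ν : ℝ) * sc N
  set s := sc j'
  set S := sc N
  have hBv : |hB v ω| * s ≤ 2560 * S ^ 2 := by
    have h1 : (|hB v ω| * s) ^ 2 ≤ (2560 * S ^ 2) ^ 2 := by
      have h2 : (|β| * s) ^ 2 ≤ (1280 * S ^ 2) ^ 2 := pow_le_pow_left₀ (by positivity) hβ 2
      rw [mul_pow, sq_abs] at h2 ⊢
      nlinarith [mul_le_mul_of_nonneg_right hB2 (sq_nonneg s), mul_le_mul_of_nonneg_left hα (sq_nonneg S),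
        pow_nonneg hS.le 4]
    exact (pow_le_pow_iff_left₀ (by positivity) (by positivity) two_ne_zero).1 h1
  have hd : |u - v| ≤ s := by rw [abs_le]; constructor <;> linarith [hw.1, hw.2]
  refine one_le_kp (by linarith [sq_nonneg S]) ?_ ?_
  · rw [hB_shift v]
    calc |hB v ω - (u - v) * hA ω| * s ≤ (|hB v ω| + |(u - v) * hA ω|) * s :=
          mul_le_mul_of_nonneg_right (abs_sub _ _) hs.le
      _ ≤ (|hB v ω| + s * |hA ω|) * s := by
          rw [abs_mul]; gcongr
      _ ≤ 7680 * S ^ 2 := by nlinarith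
  · rw [hC_shift v]
    have h1 : |2 * (u - v) * hB v ω| ≤ 5120 * S ^ 2 := by
      rw [abs_mul, abs_mul, abs_two]
      nlinarith [abs_nonneg (hB v ω), abs_nonneg (u - v)]
    have h2 : |(u - v) ^ 2 * hA ω| ≤ 1280 * S ^ 2 := by
      rw [abs_mul, abs_pow]
      calc |u - v| ^ 2 * |hA ω| ≤ s ^ 2 * |hA ω| := by gcongr
        _ ≤ _ := by linarith
    calc _ ≤ |hC v ω| + |2 * (u - v) * hB v ω| + |(u - v) ^ 2 * hA ω| :=
          (abs_add_le _ _).trans (add_le_add_left (abs_sub _ _) _)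
      _ ≤ _ := by linarith [sq_nonneg S]

theorem anc_diff {j N : ℕ} (h : j ≤ N) {x y : ℤ} (hxy : |x * sc N - y * sc N| ≤ sc j) :
    |anc (N - j) x - anc (N - j) y| ≤ (1 : ℕ) := by
  rw [sc_eq h] at hxy
  have h1 := int_le_of_scaled (D := 2 ^ (N - j)) (sc_pos N) (by push_cast; exact hxy)
  have h2 : (0 : ℤ) < 2 ^ (N - j) := by positivity
  push_cast at h1 ⊢
  rw [abs_le] at h1 ⊢
  unfold anc
  constructor
  · have : y / 2 ^ (N - j) ≤ (x + 1 * 2 ^ (N - j)) / 2 ^ (N - j) := Int.ediv_le_ediv h2 (by linarith)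
    rw [Int.add_mul_ediv_right _ _ h2.ne'] at this
    linarith
  · have : x / 2 ^ (N - j) ≤ (y + 1 * 2 ^ (N - j)) / 2 ^ (N - j) := Int.ediv_le_ediv h2 (by linarith)
    rw [Int.add_mul_ediv_right _ _ h2.ne'] at this
    linarith

/-- Two roots on the same side are close when the point is not in a thinner plank. -/
theorem root_close {s S α β B B' C C' w : ℝ} (hs : 0 < s) (hS : 0 < S)
    (hα : |α| * s ^ 2 ≤ 1280 * S ^ 2)
    (hlarge : 320 * S ^ 2 < |α| * s ^ 2 ∨ 640 * S ^ 2 < |β| * s)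
    (hB : B' = B - w * α) (hC : C' = C - 2 * w * B + w ^ 2 * α)
    (hb : β ^ 2 - 240 * S ^ 2 * |α| ≤ B ^ 2)
    (hc : |C| ≤ 120 * S ^ 2) (hc' : |C'| ≤ 120 * S ^ 2) (hBB : 0 ≤ B * B') : |w| ≤ s := by
  have h1 : |w| * |B + B'| ≤ 240 * S ^ 2 := by
    have : w * (B + B') = C - C' := by rw [hC, hB]; ring
    rw [← abs_mul, this]
    exact (abs_sub _ _).trans (by linarith)
  have h2 : |B - B'| ≤ |B + B'| := by
    apply sq_le_sq.1
    nlinarith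
  have h3 : |B| ≤ |B + B'| := by
    apply sq_le_sq.1
    nlinarith [sq_nonneg B']
  rcases hlarge with h | h
  · have h4 : |w| * |α| ≤ |B + B'| := by
      have : w * α = B - B' := by rw [hB]; ring
      rw [← abs_mul, this]; exact h2
    have h5 : |w| ^ 2 * |α| ≤ 240 * S ^ 2 := by nlinarith [abs_nonneg w]
    have hα0 : 0 < |α| := by
      by_contra hc
      nlinarith [sq_nonneg S, sq_nonneg s]
    have h6 : |w| ^ 2 ≤ s ^ 2 := by
      have : |w| ^ 2 * |α| ≤ s ^ 2 * |α| := by nlinarith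
      exact le_of_mul_le_mul_right this hα0
    exact (pow_le_pow_iff_left₀ (abs_nonneg _) hs.le two_ne_zero).1 h6
  · have h4 : (320 * S ^ 2) ^ 2 ≤ (|B| * s) ^ 2 := by
      have h5 : (640 * S ^ 2) ^ 2 ≤ (|β| * s) ^ 2 := pow_le_pow_left₀ (by positivity) h.le 2
      rw [mul_pow |β|, sq_abs] at h5
      rw [mul_pow |B|, sq_abs]
      nlinarith [mul_le_mul_of_nonneg_right hb (sq_nonneg s), mul_le_mul_of_nonneg_left hα (sq_nonneg S)]
    have h5 : 320 * S ^ 2 ≤ |B| * s :=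
      (pow_le_pow_iff_left₀ (by positivity) (by positivity) two_ne_zero).1 h4
    have h6 : |w| * (320 * S ^ 2) ≤ s * (240 * S ^ 2) := by
      have : |w| * (320 * S ^ 2) ≤ |w| * (|B| * s) := mul_le_mul_of_nonneg_left h5 (abs_nonneg _)
      have h7 : |w| * |B| ≤ 240 * S ^ 2 := (mul_le_mul_of_nonneg_left h3 (abs_nonneg _)).trans h1
      nlinarith
    have hS2 : 0 < S ^ 2 := by positivity
    nlinarith [abs_nonneg w]

theorem Fam.kakeya (hF : Fam N J b h0 δ) {j J₁ : ℕ} (hjJ : j ≤ J₁) (hJN : J₁ ≤ N) {i : ℤ}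
    {S : Finset ℤ} (hS : S ⊆ J) (hSi : ∀ ν ∈ S, anc (N - j) ν = i) (ω : E3)
    (hQ : ∀ ν ∈ S, corr (b ν) (b ν) ω ≠ 0 → |hA ω| * sc J₁ ^ 2 ≤ 1280 * sc N ^ 2 ∧
      |hB (ν * sc N) ω| * sc J₁ ≤ 1280 * sc N ^ 2) :
    ‖∑ ν ∈ S, corr (b ν) (b ν) ω‖ₑ ^ 2 ≤ 4 * ∑ j' ∈ Finset.Icc j J₁,
      ∑ i' ∈ S.image (anc (N - j')),
        ‖(kp N j' i' ω : ℂ) * ∑ ν ∈ S with anc (N - j') ν = i', corr (b ν) (b ν) ω‖ₑ ^ 2 := by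
  classical
  by_cases hne : ∃ ν ∈ S, corr (b ν) (b ν) ω ≠ 0
  swap
  · push Not at hne
    rw [Finset.sum_eq_zero hne]
    simp
  obtain ⟨ν0, hν0, hq0⟩ := hne
  have hSN := sc_pos N
  have hex : ∃ j', j ≤ j' ∧ |hA ω| * sc j' ^ 2 ≤ 1280 * sc N ^ 2 ∧
      |hB (ν0 * sc N) ω| * sc j' ≤ 1280 * sc N ^ 2 := ⟨J₁, hjJ, hQ ν0 hν0 hq0⟩
  let j' := Nat.find hex
  have hj1 : j' ≤ J₁ := Nat.find_min' hex ⟨hjJ, hQ ν0 hν0 hq0⟩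
  obtain ⟨hj0, hα, hβ⟩ : j ≤ j' ∧ |hA ω| * sc j' ^ 2 ≤ 1280 * sc N ^ 2 ∧
      |hB (ν0 * sc N) ω| * sc j' ≤ 1280 * sc N ^ 2 := Nat.find_spec hex
  have hjN : j' ≤ N := hj1.trans hJN
  set β := hB (ν0 * sc N) ω
  obtain ⟨-, -, c3⟩ := hF.corr_supp (hS hν0) hq0
  have hB2 : ∀ ν ∈ S, corr (b ν) (b ν) ω ≠ 0 →
      |hB (ν * sc N) ω ^ 2 - β ^ 2| ≤ 240 * sc N ^ 2 * |hA ω| := by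
    intro ν hν hq
    obtain ⟨-, -, d3⟩ := hF.corr_supp (hS hν) hq
    have : hB (ν * sc N) ω ^ 2 - β ^ 2 = (hC (ν * sc N) ω - hC (ν0 * sc N) ω) * hA ω := by
      have := disc_eq (ν0 * sc N) (ν * sc N) ω
      simp only [β]
      linarith
    rw [this, abs_mul]
    gcongr
    exact (abs_sub _ _).trans (by linarith)
  have hkp : ∀ ν ∈ S, corr (b ν) (b ν) ω ≠ 0 → 1 ≤ kp N j' (anc (N - j') ν) ω := by
    intro ν hν hq
    obtain ⟨-, -, d3⟩ := hF.corr_supp (hS hν) hq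
    exact kp_of_bounds hjN hα hβ (by linarith [(abs_le.1 (hB2 ν hν hq)).2]) d3
  have hcount : ∀ t ⊆ S.image (anc (N - j')),
      (∀ i' ∈ t, ∑ ν ∈ S with anc (N - j') ν = i', corr (b ν) (b ν) ω ≠ 0) → t.card ≤ 4 := by
    intro t ht hne
    have hrep : ∀ i' ∈ t, ∃ ν ∈ S, anc (N - j') ν = i' ∧ corr (b ν) (b ν) ω ≠ 0 := by
      intro i' hi'
      obtain ⟨ν, h1, h2⟩ := Finset.exists_ne_zero_of_sum_ne_zero (hne i' hi')
      exact ⟨ν, (Finset.mem_filter.1 h1).1, (Finset.mem_filter.1 h1).2, h2⟩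
    rcases hj0.eq_or_lt with heq | hlt
    · have : t ⊆ {i} := by
        intro i' hi'
        obtain ⟨ν, h1, h2, -⟩ := hrep i' hi'
        rw [Finset.mem_singleton, ← h2, ← heq, hSi ν h1]
      exact (Finset.card_le_card this).trans (by simp)
    · have hnot := Nat.find_min hex (m := j' - 1) (by change j' - 1 < j'; omega)
      have hsc : sc (j' - 1) = 2 * sc j' := by
        have := sc_add (j' - 1) 1
        rw [Nat.sub_add_cancel (by omega)] at this
        rw [← this]; ring
      have hlarge : 320 * sc N ^ 2 < |hA ω| * sc j' ^ 2 ∨ 640 * sc N ^ 2 < |β| * sc j' := by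
        by_contra hc
        push Not at hc
        apply hnot
        rw [hsc]
        exact ⟨by omega, by nlinarith [hc.1], by nlinarith [hc.2]⟩
      choose! f hf using hrep
      have hdiam : ∀ x ∈ t, ∀ y ∈ t, 0 ≤ hB (f x * sc N) ω * hB (f y * sc N) ω → |x - y| ≤ (1 : ℕ) := by
        intro x hx y hy hxy
        obtain ⟨x1, x2, x3⟩ := hf x hx
        obtain ⟨y1, y2, y3⟩ := hf y hy
        have hcl := root_close (sc_pos j') hSN hα hlarge (hB_shift (f x * sc N) (f y * sc N) ω)
          (hC_shift (f x * sc N) (f y * sc N) ω) (by linarith [(abs_le.1 (hB2 _ x1 x3)).1])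
          (hF.corr_supp (hS x1) x3).2.2 (hF.corr_supp (hS y1) y3).2.2 hxy
        rw [abs_le] at hcl
        have h4 := anc_diff hjN (x := f x) (y := f y) (by rw [abs_le]; constructor <;> linarith [hcl.1, hcl.2])
        rwa [x2, y2] at h4
      have hsplit : t ⊆ t.filter (fun x => 0 ≤ hB (f x * sc N) ω) ∪ t.filter (fun x => hB (f x * sc N) ω ≤ 0) := by
        intro x hx
        rw [Finset.mem_union, Finset.mem_filter, Finset.mem_filter]
        rcases le_total 0 (hB (f x * sc N) ω) with h | h
        · exact Or.inl ⟨hx, h⟩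
        · exact Or.inr ⟨hx, h⟩
      refine (Finset.card_le_card hsplit).trans ((Finset.card_union_le _ _).trans ?_)
      have e1 : (t.filter (fun x => 0 ≤ hB (f x * sc N) ω)).card ≤ 1 + 1 :=
        card_le_of_diam fun x hx y hy => hdiam x (Finset.mem_filter.1 hx).1 y (Finset.mem_filter.1 hy).1
          (mul_nonneg (Finset.mem_filter.1 hx).2 (Finset.mem_filter.1 hy).2)
      have e2 : (t.filter (fun x => hB (f x * sc N) ω ≤ 0)).card ≤ 1 + 1 :=
        card_le_of_diam fun x hx y hy => hdiam x (Finset.mem_filter.1 hx).1 y (Finset.mem_filter.1 hy).1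
          (mul_nonneg_of_nonpos_of_nonpos (Finset.mem_filter.1 hx).2 (Finset.mem_filter.1 hy).2)
      omega
  rw [← Finset.sum_fiberwise_of_maps_to (s := S) (g := anc (N - j')) (t := S.image (anc (N - j')))
    (fun x hx => Finset.mem_image_of_mem _ hx)]
  refine (enorm_sum_sq_le _ _ 4 hcount).trans ?_
  rw [Nat.cast_ofNat]
  refine mul_le_mul_right (le_trans ?_ (Finset.single_le_sum (f := fun j' => ∑ i' ∈ S.image (anc (N - j')),
        ‖(kp N j' i' ω : ℂ) * ∑ ν ∈ S with anc (N - j') ν = i', corr (b ν) (b ν) ω‖ₑ ^ 2)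
        (fun _ _ => by positivity) (Finset.mem_Icc.2 ⟨hj0, hj1⟩))) _
  refine Finset.sum_le_sum fun i' _ => ?_
  by_cases hz : ∑ ν ∈ S with anc (N - j') ν = i', corr (b ν) (b ν) ω = 0
  · rw [hz]; simp
  · obtain ⟨ν, h1, h2⟩ := Finset.exists_ne_zero_of_sum_ne_zero hz
    have hk := hkp ν (Finset.mem_filter.1 h1).1 h2
    rw [(Finset.mem_filter.1 h1).2] at hk
    rw [enorm_mul]
    gcongr
    refine le_mul_of_one_le_left (by positivity) ?_
    rw [← ofReal_norm, Complex.norm_real, Real.norm_of_nonneg (kp_nonneg _ _ _ _)]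
    exact ENNReal.one_le_ofReal.2 hk

/-- The constant of the multiscale step. -/
def cst : ℕ := 4 * (30720 ^ 6 * 123121 ^ 2)

theorem Fam.kakeya_lintegral (hF : Fam N J b h0 δ) {j J₁ : ℕ} (hjJ : j ≤ J₁) (hJN : J₁ ≤ N) {i : ℤ}
    {S : Finset ℤ} (hS : S ⊆ J) (hSi : ∀ ν ∈ S, anc (N - j) ν = i) (f : E3 → ℂ) {A : ℕ}
    (hf : ∀ ω, ‖f ω‖ₑ ^ 2 ≤ A * ‖∑ ν ∈ S, corr (b ν) (b ν) ω‖ₑ ^ 2)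
    (hQ : ∀ ω, f ω ≠ 0 → ∀ ν ∈ S, corr (b ν) (b ν) ω ≠ 0 → |hA ω| * sc J₁ ^ 2 ≤ 1280 * sc N ^ 2 ∧
      |hB (ν * sc N) ω| * sc J₁ ≤ 1280 * sc N ^ 2) :
    N2 f ≤ A * (4 * ∑ j' ∈ Finset.Icc j J₁, ∑ i' ∈ S.image (anc (N - j')),
      N2 (fun ω => (kp N j' i' ω : ℂ) * ∑ ν ∈ S with anc (N - j') ν = i', corr (b ν) (b ν) ω)) := by
  have hcc : ∀ j' i', CC (fun ω => (kp N j' i' ω : ℂ) *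
      ∑ ν ∈ S with anc (N - j') ν = i', corr (b ν) (b ν) ω) := fun j' i' =>
    cc_kap_sum (CR_kp N j' i') fun ν hν => hF.cc ν (hS (Finset.mem_filter.1 hν).1)
  have h1 : ∫⁻ ω, ∑ j' ∈ Finset.Icc j J₁, ∑ i' ∈ S.image (anc (N - j')),
        ‖(kp N j' i' ω : ℂ) * ∑ ν ∈ S with anc (N - j') ν = i', corr (b ν) (b ν) ω‖ₑ ^ 2 =
      ∑ j' ∈ Finset.Icc j J₁, ∑ i' ∈ S.image (anc (N - j')), N2 (fun ω => (kp N j' i' ω : ℂ) *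
        ∑ ν ∈ S with anc (N - j') ν = i', corr (b ν) (b ν) ω) := by
    rw [lintegral_finsetSum']
    · exact Finset.sum_congr rfl fun j' _ => lintegral_N2_sum _ fun i' _ => hcc j' i'
    · exact fun j' _ => Finset.aemeasurable_fun_sum _ fun i' _ =>
        ((hcc j' i').cont.enorm.measurable.pow_const 2).aemeasurable
  rw [← h1, N2, ← lintegral_const_mul' _ _ (by simp), ← lintegral_const_mul' _ _ (by simp)]
  refine lintegral_mono fun ω => ?_
  dsimp only
  by_cases hz : f ω = 0
  · rw [hz]; simp
  · exact (hf ω).trans (mul_le_mul_right (hF.kakeya hjJ hJN hS hSi ω (hQ ω hz)) _)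

theorem Fam.step (hF : Fam N J b h0 δ) (hh : 1 / 2 ≤ h0) {K : ℕ} (hδ : δ ≤ sc (4 * K)) {j N₁ : ℕ}
    (hj : j ≤ N₁) (hN : N₁ ≤ N) (hK : N - N₁ ≤ K) {i : ℤ}
    {S : Finset ℤ} (hS : S ⊆ J) (hSi : ∀ ν ∈ S, anc (N - j) ν = i) :
    N2 (fun ω => (kp N₁ j i ω : ℂ) * ∑ σ ∈ S.image (anc (N - N₁)),
        corr (fun ξ => ∑ ν ∈ S with anc (N - N₁) ν = σ, b ν ξ)
          (fun ξ => ∑ ν ∈ S with anc (N - N₁) ν = σ, b ν ξ) ω) ≤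
      cst * ∑ j' ∈ Finset.Icc j (min N (j + 2 * K + 6)), ∑ i' ∈ S.image (anc (N - j')),
        N2 (fun ω => (kp N j' i' ω : ℂ) * ∑ ν ∈ S with anc (N - j') ν = i', corr (b ν) (b ν) ω) := by
  have hjN := hj.trans hN
  have hs := sc_pos j
  have hSp := sc_pos N
  set J₁ := min N (j + 2 * K + 6) with hJ₁
  have hjJ : j ≤ J₁ := le_min hjN (by omega)
  have hJN : J₁ ≤ N := min_le_left _ _
  have hkpn : ∀ ω, ‖(kp N₁ j i ω : ℂ)‖ₑ ^ 2 ≤ (30720 ^ 6 : ℕ) := by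
    intro ω
    rw [← ofReal_norm, Complex.norm_real, Real.norm_of_nonneg (kp_nonneg _ _ _ _),
      ← ENNReal.ofReal_pow (kp_nonneg _ _ _ _), ← ENNReal.ofReal_natCast]
    refine ENNReal.ofReal_le_ofReal ((pow_le_pow_left₀ (kp_nonneg _ _ _ _) (kp_le _ _ _ _) 2).trans ?_)
    norm_num
  set R := ∑ j' ∈ Finset.Icc j J₁, ∑ i' ∈ S.image (anc (N - j')),
        N2 (fun ω => (kp N j' i' ω : ℂ) * ∑ ν ∈ S with anc (N - j') ν = i', corr (b ν) (b ν) ω) with hR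
  by_cases hc : N - N₁ ≤ N₁ - j
  · have h1 := window_orthogonality (CR_kp N₁ j i) S (fun ν hν => hF.cc ν (hS hν)) (anc (N - N₁)) 123121
      (fun ζ t ht h => hF.window_count hj hN hc hS hSi ht h)
    have h2 := hF.kakeya_lintegral hjJ hJN hS hSi
      (fun ω => (kp N₁ j i ω : ℂ) * ∑ ν ∈ S, corr (b ν) (b ν) ω) (A := 30720 ^ 6) (fun ω => by
        rw [enorm_mul, mul_pow]
        exact mul_le_mul_left (hkpn ω) _) (fun ω hω ν hν hq => by
        obtain ⟨c1, c2, -⟩ := hF.corr_supp (hS hν) hq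
        rcases le_total N (j + 2 * K + 6) with h | h
        · rw [hJ₁, min_eq_left h]
          constructor <;> nlinarith
        · have hk : kp N₁ j i ω ≠ 0 := fun h0 => hω (by simp [h0])
          obtain ⟨k1, k2⟩ := kp_ne_zero hk
          have hJe : J₁ = j + (2 * K + 6) := by rw [hJ₁, min_eq_right h]; ring
          have hsJ : sc j = 64 * (2 ^ K) ^ 2 * sc J₁ := by
            rw [hJe, ← sc_add j (2 * K + 6), pow_add, mul_comm 2 K, pow_mul]; ring
          have hSN1 : sc N₁ ≤ 2 ^ K * sc N := by
            rw [sc_eq hN]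
            exact mul_le_mul_of_nonneg_right (pow_le_pow_right₀ (by norm_num) hK) hSp.le
          have hSq : sc N₁ ^ 2 ≤ (2 ^ K) ^ 2 * sc N ^ 2 := by
            rw [← mul_pow]; exact pow_le_pow_left₀ (sc_pos _).le hSN1 2
          have hJp := sc_pos J₁
          set X : ℝ := (2 ^ K) ^ 2 with hX
          have hX1 : 1 ≤ X := one_le_pow₀ (one_le_pow₀ (by norm_num))
          have hX0 : 0 < X := by linarith
          have hw := anc_bounds hjN ν
          rw [hSi ν hν] at hw
          have hBv : |hB (ν * sc N) ω| ≤ |hB (i * sc j) ω| + sc j * |hA ω| := by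
            rw [hB_shift (i * sc j)]
            refine (abs_sub _ _).trans (add_le_add_right ?_ _)
            rw [abs_mul, abs_of_nonneg (by linarith [hw.1])]
            exact mul_le_mul_of_nonneg_right (by linarith [hw.2]) (abs_nonneg _)
          constructor
          · have e1 : |hA ω| * sc j ^ 2 = X * (4096 * X * (|hA ω| * sc J₁ ^ 2)) := by rw [hsJ]; ring
            have e2 : X * (4096 * X * (|hA ω| * sc J₁ ^ 2)) ≤ X * (30720 * sc N ^ 2) := by
              rw [← e1]; linarith
            have e3 := le_of_mul_le_mul_left e2 hX0
            have e4 : 0 ≤ |hA ω| * sc J₁ ^ 2 := by positivity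
            nlinarith [sq_nonneg (sc N)]
          · have e1 : |hB (ν * sc N) ω| * sc j ≤ X * (61440 * sc N ^ 2) := by
              calc _ ≤ (|hB (i * sc j) ω| + sc j * |hA ω|) * sc j := mul_le_mul_of_nonneg_right hBv hs.le
                _ ≤ _ := by linarith
            have e2 : X * (64 * (|hB (ν * sc N) ω| * sc J₁)) ≤ X * (61440 * sc N ^ 2) := by
              have : |hB (ν * sc N) ω| * sc j = X * (64 * (|hB (ν * sc N) ω| * sc J₁)) := by
                rw [hsJ]; ring
              rwa [this] at e1
            have e3 := le_of_mul_le_mul_left e2 hX0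
            nlinarith [sq_nonneg (sc N)])
    refine h1.trans ((mul_le_mul_right h2 _).trans ?_)
    rw [← hR, cst, show ((123121 : ℕ) : ℝ) ^ 2 = ((123121 ^ 2 : ℕ) : ℝ) by norm_num, ENNReal.ofReal_natCast]
    apply le_of_eq
    push_cast
    ring
  · have hδ0 : δ * sc j ^ 2 ≤ sc N ^ 2 := by
      calc δ * sc j ^ 2 ≤ sc (4 * K) * sc j ^ 2 := mul_le_mul_of_nonneg_right hδ (sq_nonneg _)
        _ ≤ sc N ^ 2 := by
          unfold sc
          rw [← pow_mul, ← pow_mul, ← pow_add]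
          exact pow_le_pow_of_le_one (by norm_num) (by norm_num) (by omega)
    have h1 := hF.sum_overlap hjN hh hδ0 hS hSi (anc (N - N₁))
    have h2 := hF.kakeya_lintegral hjJ hJN hS hSi
      (fun ω => ∑ ν ∈ S, corr (b ν) (b ν) ω) (A := 1) (fun ω => by simp) (fun ω _ ν hν hq => by
        obtain ⟨c1, c2, -⟩ := hF.corr_supp (hS hν) hq
        rw [hJ₁, min_eq_left (by omega)]
        constructor <;> nlinarith)
    have h3 : N2 (fun ω => (kp N₁ j i ω : ℂ) * ∑ σ ∈ S.image (anc (N - N₁)),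
        corr (fun ξ => ∑ ν ∈ S with anc (N - N₁) ν = σ, b ν ξ)
          (fun ξ => ∑ ν ∈ S with anc (N - N₁) ν = σ, b ν ξ) ω) ≤ (30720 ^ 6 : ℕ) *
        N2 (fun ω => ∑ σ ∈ S.image (anc (N - N₁)),
        corr (fun ξ => ∑ ν ∈ S with anc (N - N₁) ν = σ, b ν ξ)
          (fun ξ => ∑ ν ∈ S with anc (N - N₁) ν = σ, b ν ξ) ω) := by
      rw [N2, N2, ← lintegral_const_mul' _ _ (by simp)]
      refine lintegral_mono fun ω => ?_
      rw [enorm_mul, mul_pow]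
      exact mul_le_mul_left (hkpn ω) _
    refine h3.trans ((mul_le_mul_right (h1.trans (mul_le_mul_right h2 _)) _).trans ?_)
    rw [← hR, Nat.cast_one, one_mul, cst, ← mul_assoc, ← mul_assoc]
    refine mul_le_mul_left ?_ _
    exact_mod_cast (by norm_num : 30720 ^ 6 * 2602 ^ 2 * 4 ≤ 4 * (30720 ^ 6 * 123121 ^ 2))

end

theorem continuous_F3 {a : E3 → ℂ} (ha : CC a) : Continuous (F3 a) := by
  simp only [funext (F3_eq a)]
  refine continuous_of_dominated (bound := fun ξ => ‖a ξ‖) (fun x => ?_) (fun x => ?_)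
    ha.integrable.norm (ae_of_all _ fun ξ => ?_)
  · exact ((continuous_ch x).mul ha.cont).aestronglyMeasurable
  · exact ae_of_all _ fun ξ => by rw [norm_mul, norm_ch, one_mul]
  · exact (continuous_ch₂.comp (by fun_prop : Continuous fun x : E3 => (x, ξ))).mul
      continuous_const

/-- A family of functions adapted to the finest planks. -/
structure Fine (n : ℕ) (I : Finset ℤ) (a : ℤ → E3 → ℂ) (h0 δ : ℝ) : Prop where
  cc : ∀ k ∈ I, CC (a k)
  supp : ∀ k ∈ I, ∀ ξ, a k ξ ≠ 0 → 1 / 2 ≤ hA ξ ∧ hA ξ ≤ 6 ∧ |hA ξ - h0| ≤ δ ∧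
    |hB (k * sc n) ξ| ≤ 16 * sc n ∧ |hC (k * sc n) ξ| ≤ 16 * sc n ^ 2

/-- The pieces of scale `N`. -/
def agg (n : ℕ) (I : Finset ℤ) (a : ℤ → E3 → ℂ) (N : ℕ) (ν : ℤ) (ξ : E3) : ℂ :=
  ∑ k ∈ I with anc (n - N) k = ν, a k ξ

section
variable {n : ℕ} {I : Finset ℤ} {a : ℤ → E3 → ℂ} {h0 δ : ℝ}

theorem Fine.cc_agg (hF : Fine n I a h0 δ) (N : ℕ) (ν : ℤ) : CC (agg n I a N ν) :=
  CC.sum fun k hk => hF.cc k (Finset.mem_filter.1 hk).1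

theorem Fine.fam (hF : Fine n I a h0 δ) {N : ℕ} (hN : N ≤ n) :
    Fam N (I.image (anc (n - N))) (agg n I a N) h0 δ := by
  refine ⟨fun ν _ => hF.cc_agg N ν, fun ν _ ξ h => ?_⟩
  obtain ⟨k, h1, h2⟩ := Finset.exists_ne_zero_of_sum_ne_zero h
  obtain ⟨h3, h4⟩ := Finset.mem_filter.1 h1
  obtain ⟨a1, a2, a3, a4, a5⟩ := hF.supp k h3 ξ h2
  refine ⟨a1, a2, a3, ?_⟩
  have hw := anc_bounds hN k
  rw [h4] at hw
  have hs := sc_pos n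
  have hS := sc_pos N
  have hle := sc_le hN
  set u := (ν : ℝ) * sc N
  set v := (k : ℝ) * sc n
  have hd : |u - v| ≤ sc N := by rw [abs_le]; constructor <;> linarith [hw.1, hw.2]
  have hAa : |hA ξ| ≤ 6 := by rw [abs_le]; constructor <;> linarith
  have hB1 : |hB v ξ| ≤ 16 * sc N := a4.trans (by linarith)
  have hC1 : |hC v ξ| ≤ 16 * sc N ^ 2 := a5.trans (by nlinarith)
  constructor
  · rw [hB_shift v]
    have : |(u - v) * hA ξ| ≤ sc N * 6 := by
      rw [abs_mul]; exact mul_le_mul hd hAa (abs_nonneg _) hS.le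
    exact (abs_sub _ _).trans (by linarith)
  · rw [hC_shift v]
    have e1 : |2 * (u - v) * hB v ξ| ≤ 2 * sc N * (16 * sc N) := by
      rw [abs_mul, abs_mul, abs_two]
      exact mul_le_mul (by linarith) hB1 (abs_nonneg _) (by positivity)
    have e2 : |(u - v) ^ 2 * hA ξ| ≤ sc N ^ 2 * 6 := by
      rw [abs_mul, abs_pow]
      exact mul_le_mul (pow_le_pow_left₀ (abs_nonneg _) hd 2) hAa (abs_nonneg _) (by positivity)
    calc _ ≤ |hC v ξ| + |2 * (u - v) * hB v ξ| + |(u - v) ^ 2 * hA ξ| :=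
          (abs_add_le _ _).trans (add_le_add_left (abs_sub _ _) _)
      _ ≤ _ := by nlinarith [sq_nonneg (sc N)]

/-- The localized square function at plank `(j, i)` built from the pieces of scale `N`. -/
def loc (n : ℕ) (I : Finset ℤ) (a : ℤ → E3 → ℂ) (j : ℕ) (i : ℤ) (N : ℕ) : ℝ≥0∞ :=
  N2 (fun ω => (kp N j i ω : ℂ) * ∑ ν ∈ (I.image (anc (n - N))).filter (fun ν => anc (N - j) ν = i),
    corr (agg n I a N ν) (agg n I a N ν) ω)

/-- The sum over all descendants of `(j, i)` of the finest localized square functions. -/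
def locSum (n : ℕ) (I : Finset ℤ) (a : ℤ → E3 → ℂ) (j : ℕ) (i : ℤ) : ℝ≥0∞ :=
  ∑ j' ∈ Finset.Icc j n, ∑ i' ∈ (I.filter (fun k => anc (n - j) k = i)).image (anc (n - j')),
    loc n I a j' i' n

theorem anc_of_anc {j N n : ℕ} (hj : j ≤ N) (hN : N ≤ n) (k : ℤ) :
    anc (N - j) (anc (n - N) k) = anc (n - j) k := by
  rw [anc_anc]; congr 1; omega

theorem Fine.loc_step (hF : Fine n I a h0 δ) (hh : 1 / 2 ≤ h0) {K : ℕ} (hδ : δ ≤ sc (4 * K))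
    {j N N' : ℕ} (hj : j ≤ N) (hN : N ≤ N') (hN' : N' ≤ n) (hK : N' - N ≤ K) (i : ℤ) :
    loc n I a j i N ≤ cst * ∑ j' ∈ Finset.Icc j (min N' (j + 2 * K + 6)),
      ∑ i' ∈ (I.filter (fun k => anc (n - j) k = i)).image (anc (n - j')), loc n I a j' i' N' := by
  set S := (I.image (anc (n - N'))).filter (fun ν => anc (N' - j) ν = i) with hSdef
  have h1 := (hF.fam hN').step hh hδ hj hN hK (Finset.filter_subset _ _ : S ⊆ _)
    (fun ν hν => (Finset.mem_filter.1 hν).2)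
  have himg : ∀ j', j ≤ j' → j' ≤ N' → S.image (anc (N' - j')) =
      (I.filter (fun k => anc (n - j) k = i)).image (anc (n - j')) := by
    intro j' hj1 hj2
    ext σ
    simp only [hSdef, Finset.mem_image, Finset.mem_filter]
    constructor
    · rintro ⟨ν, ⟨⟨k, hk, rfl⟩, h3⟩, h4⟩
      rw [anc_of_anc (hj.trans hN) hN'] at h3
      rw [anc_of_anc hj2 hN'] at h4
      exact ⟨k, ⟨hk, h3⟩, h4⟩
    · rintro ⟨k, ⟨hk, h3⟩, h4⟩
      exact ⟨anc (n - N') k, ⟨⟨k, hk, rfl⟩, by rwa [anc_of_anc (hj.trans hN) hN']⟩,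
        by rwa [anc_of_anc hj2 hN']⟩
  have hfil : ∀ j', j ≤ j' → j' ≤ N' → ∀ i' ∈ S.image (anc (N' - j')),
      S.filter (fun ν => anc (N' - j') ν = i') =
        (I.image (anc (n - N'))).filter (fun ν => anc (N' - j') ν = i') := by
    intro j' hj1 hj2 i' hi'
    obtain ⟨ν', hν', rfl⟩ := Finset.mem_image.1 hi'
    have hν2 := (Finset.mem_filter.1 hν').2
    ext ν
    simp only [hSdef, Finset.mem_filter]
    constructor
    · rintro ⟨⟨h3, -⟩, h4⟩; exact ⟨h3, h4⟩
    · rintro ⟨h3, h4⟩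
      refine ⟨⟨h3, ?_⟩, h4⟩
      rw [← anc_of_anc hj1 hj2, h4, anc_of_anc hj1 hj2, hν2]
  have hLHS : loc n I a j i N = N2 (fun ω => (kp N j i ω : ℂ) * ∑ σ ∈ S.image (anc (N' - N)),
        corr (fun ξ => ∑ ν ∈ S with anc (N' - N) ν = σ, agg n I a N' ν ξ)
          (fun ξ => ∑ ν ∈ S with anc (N' - N) ν = σ, agg n I a N' ν ξ) ω) := by
    have hset : (I.image (anc (n - N))).filter (fun ν => anc (N - j) ν = i) = S.image (anc (N' - N)) := by
      rw [himg N hj hN]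
      ext σ
      simp only [Finset.mem_image, Finset.mem_filter]
      constructor
      · rintro ⟨⟨k, hk, rfl⟩, h3⟩
        rw [anc_of_anc hj (hN.trans hN')] at h3
        exact ⟨k, ⟨hk, h3⟩, rfl⟩
      · rintro ⟨k, ⟨hk, h3⟩, rfl⟩
        exact ⟨⟨k, hk, rfl⟩, by rwa [anc_of_anc hj (hN.trans hN')]⟩
    rw [loc, hset]
    congr 1
    ext ω
    congr 1
    refine Finset.sum_congr rfl fun σ hσ => ?_
    have : agg n I a N σ = fun ξ => ∑ ν ∈ S with anc (N' - N) ν = σ, agg n I a N' ν ξ := by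
      ext ξ
      rw [hfil N hj hN σ hσ]
      simp only [agg]
      rw [← Finset.sum_fiberwise_of_maps_to (s := I.filter (fun k => anc (n - N) k = σ)) (g := anc (n - N'))
        (t := (I.image (anc (n - N'))).filter (fun ν => anc (N' - N) ν = σ))]
      · refine Finset.sum_congr rfl fun ν hν => ?_
        rw [Finset.filter_filter]
        refine Finset.sum_congr (Finset.filter_congr fun k _ => ?_) fun _ _ => rfl
        constructor
        · exact fun h => h.2
        · intro h
          refine ⟨?_, h⟩
          rw [← anc_of_anc hN hN', h]; exact (Finset.mem_filter.1 hν).2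
      · intro k hk
        obtain ⟨h3, h4⟩ := Finset.mem_filter.1 hk
        exact Finset.mem_filter.2 ⟨Finset.mem_image_of_mem _ h3, by rwa [anc_of_anc hN hN']⟩
    rw [this]
  rw [hLHS]
  refine h1.trans (mul_le_mul_right (le_of_eq ?_) _)
  refine Finset.sum_congr rfl fun j' hj' => ?_
  obtain ⟨b1, b2⟩ := Finset.mem_Icc.1 hj'
  have b3 := b2.trans (min_le_left _ _)
  rw [← himg j' b1 b3]
  refine Finset.sum_congr rfl fun i' hi' => ?_
  rw [loc, hfil j' b1 b3 i' hi']

theorem locSum_desc {j j' : ℕ} (hj : j ≤ j') (i : ℤ) :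
    ∑ i' ∈ (I.filter (fun k => anc (n - j) k = i)).image (anc (n - j')), locSum n I a j' i' ≤
      locSum n I a j i := by
  by_cases hjn : j' ≤ n
  swap
  · have : Finset.Icc j' n = ∅ := Finset.Icc_eq_empty hjn
    simp [locSum, this]
  unfold locSum
  rw [Finset.sum_comm]
  refine le_trans ?_ (Finset.sum_le_sum_of_subset (Finset.Icc_subset_Icc_left hj))
  refine Finset.sum_le_sum fun j'' hj'' => ?_
  obtain ⟨b1, b2⟩ := Finset.mem_Icc.1 hj''
  rw [← Finset.sum_biUnion]
  · refine Finset.sum_le_sum_of_subset fun σ hσ => ?_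
    obtain ⟨i', h1, h2⟩ := Finset.mem_biUnion.1 hσ
    obtain ⟨k, hk, rfl⟩ := Finset.mem_image.1 h1
    obtain ⟨k', hk', rfl⟩ := Finset.mem_image.1 h2
    obtain ⟨c1, c2⟩ := Finset.mem_filter.1 hk
    obtain ⟨c3, c4⟩ := Finset.mem_filter.1 hk'
    refine Finset.mem_image_of_mem _ (Finset.mem_filter.2 ⟨c3, ?_⟩)
    rw [← anc_of_anc hj hjn, c4, anc_of_anc hj hjn, c2]
  · intro x _ y _ hxy
    rw [Function.onFun, Finset.disjoint_left]
    intro σ hx hy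
    obtain ⟨k, hk, rfl⟩ := Finset.mem_image.1 hx
    obtain ⟨k', hk', hkk⟩ := Finset.mem_image.1 hy
    apply hxy
    rw [← (Finset.mem_filter.1 hk).2, ← (Finset.mem_filter.1 hk').2, ← anc_of_anc b1 b2, ← hkk,
      anc_of_anc b1 b2]

theorem Fine.loc_le (hF : Fine n I a h0 δ) (hh : 1 / 2 ≤ h0) {K : ℕ} (hδ : δ ≤ sc (4 * K)) (t : ℕ) :
    ∀ {j N : ℕ}, j ≤ N → N ≤ n → n ≤ N + t * K → ∀ i : ℤ,
      loc n I a j i N ≤ ((cst * (2 * K + 7) : ℕ) : ℝ≥0∞) ^ t * locSum n I a j i := by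
  induction t with
  | zero =>
    intro j N hj hN hn i
    obtain rfl : n = N := by omega
    rw [pow_zero, one_mul]
    by_cases hi : i ∈ (I.filter (fun k => anc (n - j) k = i)).image (anc (n - j))
    · refine le_trans ?_ (Finset.single_le_sum (f := fun j' =>
        ∑ i' ∈ (I.filter (fun k => anc (n - j) k = i)).image (anc (n - j')), loc n I a j' i' n)
        (fun _ _ => by positivity) (Finset.mem_Icc.2 ⟨le_rfl, hj⟩))
      exact Finset.single_le_sum (f := fun i' => loc n I a j i' n) (fun _ _ => by positivity) hi
    · have : (I.image (anc (n - n))).filter (fun ν => anc (n - j) ν = i) = ∅ := by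
        rw [Finset.filter_eq_empty_iff]
        intro ν hν hc
        obtain ⟨k, hk, rfl⟩ := Finset.mem_image.1 hν
        apply hi
        rw [Nat.sub_self, anc_zero] at hc
        exact Finset.mem_image.2 ⟨k, Finset.mem_filter.2 ⟨hk, hc⟩, hc⟩
      rw [loc, this]
      simp [N2]
  | succ t ih =>
    intro j N hj hN hn i
    have hN1 : N ≤ min (N + K) n := le_min (by omega) hN
    refine (hF.loc_step hh hδ hj hN1 (min_le_right _ _) (by omega) i).trans ?_
    set B : ℝ≥0∞ := ((cst * (2 * K + 7) : ℕ) : ℝ≥0∞)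
    have h1 : ∀ j' ∈ Finset.Icc j (min (min (N + K) n) (j + 2 * K + 6)),
        ∑ i' ∈ (I.filter (fun k => anc (n - j) k = i)).image (anc (n - j')),
          loc n I a j' i' (min (N + K) n) ≤ B ^ t * locSum n I a j i := by
      intro j' hj'
      obtain ⟨b1, b2⟩ := Finset.mem_Icc.1 hj'
      have b3 := b2.trans (min_le_left _ _)
      calc _ ≤ ∑ i' ∈ (I.filter (fun k => anc (n - j) k = i)).image (anc (n - j')),
            B ^ t * locSum n I a j' i' := Finset.sum_le_sum fun i' _ =>
              ih b3 (min_le_right _ _) (by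
                have : (t + 1) * K = t * K + K := by ring
                omega) i'
        _ ≤ _ := by
          rw [← Finset.mul_sum]
          exact mul_le_mul_right (locSum_desc b1 i) _
    calc _ ≤ (cst : ℝ≥0∞) * ∑ j' ∈ Finset.Icc j (min (min (N + K) n) (j + 2 * K + 6)),
          B ^ t * locSum n I a j i := mul_le_mul_right (Finset.sum_le_sum h1) _
      _ ≤ (cst : ℝ≥0∞) * ((2 * K + 7 : ℕ) * (B ^ t * locSum n I a j i)) := by
          rw [Finset.sum_const, nsmul_eq_mul]
          refine mul_le_mul_right (mul_le_mul_left ?_ _) _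
          rw [Nat.card_Icc]
          exact_mod_cast (by omega)
      _ = _ := by
          rw [pow_succ, ← mul_assoc, ← mul_assoc, mul_comm (B ^ t)]
          congr 2
          simp only [B]
          push_cast
          ring

theorem enorm_sum_four_le {ι : Type*} (s : Finset ι) (f : ι → ℂ) :
    ‖∑ i ∈ s, f i‖ₑ ^ 4 ≤ (s.card : ℝ≥0∞) ^ 3 * ∑ i ∈ s, ‖f i‖ₑ ^ 4 := by
  have h1 : ‖∑ i ∈ s, f i‖ ^ 4 ≤ (s.card : ℝ) ^ 3 * ∑ i ∈ s, ‖f i‖ ^ 4 := by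
    have h2 := norm_sum_sq_le s f
    have h3 : (∑ i ∈ s, ‖f i‖ ^ 2) ^ 2 ≤ (s.card : ℝ) * ∑ i ∈ s, (‖f i‖ ^ 2) ^ 2 :=
      sq_sum_le_card_mul_sum_sq
    have h4 := pow_le_pow_left₀ (by positivity) h2 2
    calc ‖∑ i ∈ s, f i‖ ^ 4 = (‖∑ i ∈ s, f i‖ ^ 2) ^ 2 := by ring
      _ ≤ ((s.card : ℝ) * ∑ i ∈ s, ‖f i‖ ^ 2) ^ 2 := h4
      _ = (s.card : ℝ) ^ 2 * (∑ i ∈ s, ‖f i‖ ^ 2) ^ 2 := by ring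
      _ ≤ (s.card : ℝ) ^ 2 * ((s.card : ℝ) * ∑ i ∈ s, (‖f i‖ ^ 2) ^ 2) := by gcongr
      _ = _ := by simp only [← pow_mul]; ring
  have e : ∀ z : ℂ, ‖z‖ₑ ^ 4 = ENNReal.ofReal (‖z‖ ^ 4) := fun z => by
    rw [ENNReal.ofReal_pow (norm_nonneg _), ofReal_norm]
  simp only [e]
  rw [← ENNReal.ofReal_sum_of_nonneg (fun _ _ => by positivity), ← ENNReal.ofReal_natCast,
    ← ENNReal.ofReal_pow (by positivity), ← ENNReal.ofReal_mul (by positivity)]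
  exact ENNReal.ofReal_le_ofReal h1

/-- The multiscale square function estimate. -/
theorem Fine.multiscale (hF : Fine n I a h0 δ) (hh : 1 / 2 ≤ h0) {K : ℕ} (hδ : δ ≤ sc (4 * K))
    {t : ℕ} (ht : n ≤ t * K) {R : ℕ} (hR : (I.image (anc n)).card ≤ R) :
    ∫⁻ x, ‖F3 (fun ξ => ∑ k ∈ I, a k ξ) x‖ₑ ^ 4 ≤
      (R : ℝ≥0∞) ^ 3 * ENNReal.ofReal ((2 * π) ^ 3) * ((cst * (2 * K + 7) : ℕ) : ℝ≥0∞) ^ t *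
        ∑ j ∈ Finset.Icc 0 n, ∑ i ∈ I.image (anc (n - j)),
          N2 (fun ω => (kp n j i ω : ℂ) * ∑ k ∈ I with anc (n - j) k = i, corr (a k) (a k) ω) := by
  set B : ℝ≥0∞ := ((cst * (2 * K + 7) : ℕ) : ℝ≥0∞)
  have hsplit : ∀ ξ, ∑ k ∈ I, a k ξ = ∑ τ ∈ I.image (anc n), agg n I a 0 τ ξ := fun ξ =>
    (Finset.sum_fiberwise_of_maps_to (fun x hx => Finset.mem_image_of_mem _ hx) _).symm
  have hroot : ∀ τ ∈ I.image (anc n), ∫⁻ x, ‖F3 (agg n I a 0 τ) x‖ₑ ^ 4 ≤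
      ENNReal.ofReal ((2 * π) ^ 3) * (B ^ t * locSum n I a 0 τ) := by
    intro τ hτ
    rw [lintegral_F3_four (hF.cc_agg 0 τ)]
    refine mul_le_mul_right (le_trans ?_ (hF.loc_le hh hδ t le_rfl (Nat.zero_le n) (by omega) τ)) _
    rw [loc]
    have : (I.image (anc (n - 0))).filter (fun ν => anc (0 - 0) ν = τ) = {τ} := by
      ext ν
      simp only [Finset.mem_filter, Nat.sub_zero, anc_zero, Finset.mem_singleton]
      constructor
      · exact fun h => h.2
      · rintro rfl; exact ⟨hτ, rfl⟩
    rw [this]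
    refine lintegral_mono fun ω => ?_
    dsimp only
    rw [Finset.sum_singleton]
    by_cases hz : corr (agg n I a 0 τ) (agg n I a 0 τ) ω = 0
    · rw [hz]; simp
    · obtain ⟨c1, c2, c3⟩ := (hF.fam (Nat.zero_le n)).corr_supp (ν := τ) (by simpa using hτ) hz
      have hk : 1 ≤ kp 0 0 τ ω := one_le_kp (by simp [sc]; linarith)
        (by simp [sc] at c2 ⊢; linarith) (by simp [sc] at c3 ⊢; linarith)
      rw [enorm_mul]
      gcongr
      refine le_mul_of_one_le_left (by positivity) ?_
      rw [← ofReal_norm, Complex.norm_real, Real.norm_of_nonneg (kp_nonneg _ _ _ _)]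
      exact ENNReal.one_le_ofReal.2 hk
  have hcc : ∀ τ ∈ I.image (anc n), CC (agg n I a 0 τ) := fun τ _ => hF.cc_agg 0 τ
  have hloc : ∀ j i, loc n I a j i n =
      N2 (fun ω => (kp n j i ω : ℂ) * ∑ k ∈ I with anc (n - j) k = i, corr (a k) (a k) ω) := by
    intro j i
    have e1 : I.image (anc (n - n)) = I := by
      rw [Nat.sub_self, show anc 0 = id from funext anc_zero, Finset.image_id]
    have e2 : ∀ k ∈ I, agg n I a n k = a k := by
      intro k hk
      ext ξ
      simp [agg, anc_zero, Finset.filter_eq', hk]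
    rw [loc, e1]
    congr 1
    ext ω
    congr 1
    exact Finset.sum_congr rfl fun k hk => by rw [e2 k (Finset.mem_filter.1 hk).1]
  simp only [hsplit]
  calc ∫⁻ x, ‖F3 (fun ξ => ∑ τ ∈ I.image (anc n), agg n I a 0 τ ξ) x‖ₑ ^ 4
      ≤ ∫⁻ x, (R : ℝ≥0∞) ^ 3 * ∑ τ ∈ I.image (anc n), ‖F3 (agg n I a 0 τ) x‖ₑ ^ 4 := by
        refine lintegral_mono fun x => ?_
        dsimp only
        rw [F3_sum hcc]
        refine (enorm_sum_four_le _ _).trans ?_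
        gcongr
    _ = (R : ℝ≥0∞) ^ 3 * ∑ τ ∈ I.image (anc n), ∫⁻ x, ‖F3 (agg n I a 0 τ) x‖ₑ ^ 4 := by
        rw [lintegral_const_mul' _ _ (by simp), lintegral_finsetSum']
        exact fun τ hτ => ((continuous_F3 (hcc τ hτ)).enorm.measurable.pow_const 4).aemeasurable
    _ ≤ (R : ℝ≥0∞) ^ 3 * ∑ τ ∈ I.image (anc n),
          ENNReal.ofReal ((2 * π) ^ 3) * (B ^ t * locSum n I a 0 τ) :=
        mul_le_mul_right (Finset.sum_le_sum hroot) _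
    _ = (R : ℝ≥0∞) ^ 3 * ENNReal.ofReal ((2 * π) ^ 3) * B ^ t *
          ∑ τ ∈ I.image (anc n), locSum n I a 0 τ := by
        rw [← Finset.mul_sum, ← Finset.mul_sum]; ring
    _ ≤ _ := by
        refine mul_le_mul_right ?_ _
        simp only [locSum, ← hloc]
        rw [Finset.sum_comm]
        refine Finset.sum_le_sum fun j hj => ?_
        obtain ⟨b1, b2⟩ := Finset.mem_Icc.1 hj
        rw [← Finset.sum_biUnion]
        · refine Finset.sum_le_sum_of_subset fun σ hσ => ?_
          obtain ⟨i', h1, h2⟩ := Finset.mem_biUnion.1 hσ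
          obtain ⟨k', hk', rfl⟩ := Finset.mem_image.1 h2
          exact Finset.mem_image_of_mem _ (Finset.mem_filter.1 hk').1
        · intro x _ y _ hxy
          rw [Function.onFun, Finset.disjoint_left]
          intro σ hx hy
          obtain ⟨k, hk, rfl⟩ := Finset.mem_image.1 hx
          obtain ⟨k', hk', hkk⟩ := Finset.mem_image.1 hy
          apply hxy
          rw [← (Finset.mem_filter.1 hk).2, ← (Finset.mem_filter.1 hk').2, ← anc_of_anc b1 b2, ← hkk,
            anc_of_anc b1 b2]

end

/-! ### Mixed derivatives of order two and decay of Fourier integrals -/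

/-- `f`, its derivatives along `v` and `w`, and the mixed one are bounded by `M` on `U`. -/
def Jt (U : Set E3) (v w : E3) (M : ℝ) (f : E3 → ℝ) : Prop :=
  ∃ f1 f2 f12 : E3 → ℝ, Measurable f1 ∧ Measurable f2 ∧ Measurable f12 ∧ ∀ x ∈ U,
    HasLineDerivAt ℝ f (f1 x) x v ∧ HasLineDerivAt ℝ f (f2 x) x w ∧
    HasLineDerivAt ℝ f1 (f12 x) x w ∧ |f x| ≤ M ∧ |f1 x| ≤ M ∧ |f2 x| ≤ M ∧ |f12 x| ≤ M

theorem HasLineDerivAt.mul' {f g : E3 → ℝ} {a b : ℝ} {x v : E3} (hf : HasLineDerivAt ℝ f a x v)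
    (hg : HasLineDerivAt ℝ g b x v) :
    HasLineDerivAt ℝ (fun x => f x * g x) (a * g x + f x * b) x v := by
  have := HasDerivAt.mul hf hg
  simp only [zero_smul, add_zero] at this
  exact this

theorem HasLineDerivAt.add' {f g : E3 → ℝ} {a b : ℝ} {x v : E3} (hf : HasLineDerivAt ℝ f a x v)
    (hg : HasLineDerivAt ℝ g b x v) : HasLineDerivAt ℝ (fun x => f x + g x) (a + b) x v :=
  HasDerivAt.add hf hg

theorem HasLineDerivAt.comp' {f : E3 → ℝ} {Φ : ℝ → ℝ} {a b : ℝ} {x v : E3}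
    (hf : HasLineDerivAt ℝ f a x v) (hΦ : HasDerivAt Φ b (f x)) :
    HasLineDerivAt ℝ (fun x => Φ (f x)) (b * a) x v := by
  have h : HasDerivAt (fun t : ℝ => f (x + t • v)) a 0 := hf
  exact HasDerivAt.comp (h₂ := Φ) (h := fun t : ℝ => f (x + t • v)) 0 (by simpa using hΦ) h

section
variable {U : Set E3} {v w : E3}

theorem abs_mul_le {a b M M' : ℝ} (ha : |a| ≤ M) (hb : |b| ≤ M') : |a * b| ≤ M * M' := by
  rw [abs_mul]
  exact mul_le_mul ha hb (abs_nonneg _) ((abs_nonneg _).trans ha)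

theorem Jt.mul {f g : E3 → ℝ} {M M' : ℝ} (hf : Jt U v w M f) (hg : Jt U v w M' g)
    (hfm : Measurable f) (hgm : Measurable g) :
    Jt U v w (4 * (M * M')) (fun x => f x * g x) := by
  obtain ⟨f1, f2, f12, m1, m2, m3, hf⟩ := hf
  obtain ⟨g1, g2, g12, n1, n2, n3, hg⟩ := hg
  refine ⟨fun x => f1 x * g x + f x * g1 x, fun x => f2 x * g x + f x * g2 x,
    fun x => (f12 x * g x + f1 x * g2 x) + (f2 x * g1 x + f x * g12 x), by fun_prop, by fun_prop,
    by fun_prop, fun x hx => ?_⟩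
  obtain ⟨a1, a2, a3, a4, a5, a6, a7⟩ := hf x hx
  obtain ⟨b1, b2, b3, b4, b5, b6, b7⟩ := hg x hx
  have hp : 0 ≤ M * M' := mul_nonneg ((abs_nonneg _).trans a4) ((abs_nonneg _).trans b4)
  refine ⟨HasLineDerivAt.mul' a1 b1, HasLineDerivAt.mul' a2 b2, HasLineDerivAt.add' (HasLineDerivAt.mul' a3 b2) (HasLineDerivAt.mul' a2 b3),
    ?_, ?_, ?_, ?_⟩
  · linarith [abs_mul_le a4 b4]
  · linarith [abs_add_le (f1 x * g x) (f x * g1 x), abs_mul_le a5 b4, abs_mul_le a4 b5]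
  · linarith [abs_add_le (f2 x * g x) (f x * g2 x), abs_mul_le a6 b4, abs_mul_le a4 b6]
  · linarith [abs_add_le (f12 x * g x + f1 x * g2 x) (f2 x * g1 x + f x * g12 x),
      abs_add_le (f12 x * g x) (f1 x * g2 x), abs_add_le (f2 x * g1 x) (f x * g12 x),
      abs_mul_le a7 b4, abs_mul_le a5 b6, abs_mul_le a6 b5, abs_mul_le a4 b7]

theorem Jt.const_mul {f : E3 → ℝ} {M : ℝ} (hf : Jt U v w M f) (c : ℝ) :
    Jt U v w (|c| * M) (fun x => c * f x) := by
  obtain ⟨f1, f2, f12, m1, m2, m3, hf⟩ := hf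
  refine ⟨fun x => c * f1 x, fun x => c * f2 x, fun x => c * f12 x, by fun_prop, by fun_prop,
    by fun_prop, fun x hx => ?_⟩
  obtain ⟨a1, a2, a3, a4, a5, a6, a7⟩ := hf x hx
  refine ⟨HasDerivAt.const_mul c a1, HasDerivAt.const_mul c a2, HasDerivAt.const_mul c a3,
    ?_, ?_, ?_, ?_⟩ <;> exact abs_mul_le le_rfl ‹_›

/-- Bound for a function of one variable and its two first derivatives. -/
def C2B (Φ : ℝ → ℝ) (B : ℝ) : Prop :=
  ∃ Φ1 Φ2 : ℝ → ℝ, Measurable Φ1 ∧ Measurable Φ2 ∧ ∀ y, HasDerivAt Φ (Φ1 y) y ∧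
    HasDerivAt Φ1 (Φ2 y) y ∧ |Φ y| ≤ B ∧ |Φ1 y| ≤ B ∧ |Φ2 y| ≤ B

theorem exists_C2B {Φ : ℝ → ℝ} (h : ContDiff ℝ 2 Φ) (hs : HasCompactSupport Φ) :
    ∃ B, 1 ≤ B ∧ C2B Φ B := by
  have h1 : ContDiff ℝ 1 (deriv Φ) := by
    have : ContDiff ℝ (1 + 1) Φ := by norm_num; exact h
    exact (contDiff_succ_iff_deriv.1 this).2.2
  have h2 : Continuous (deriv (deriv Φ)) := h1.continuous_deriv le_rfl
  obtain ⟨B0, hB0⟩ := h.continuous.bounded_above_of_compact_support hs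
  obtain ⟨B1, hB1⟩ := h1.continuous.bounded_above_of_compact_support hs.deriv
  obtain ⟨B2, hB2⟩ := h2.bounded_above_of_compact_support hs.deriv.deriv
  refine ⟨max 1 (max B0 (max B1 B2)), le_max_left _ _, deriv Φ, deriv (deriv Φ), measurable_deriv _,
    measurable_deriv _, fun y => ⟨((h.differentiable (by norm_num)) y).hasDerivAt,
      ((h1.differentiable (by norm_num)) y).hasDerivAt, ?_, ?_, ?_⟩⟩
  · exact (hB0 y).trans (by simp)
  · exact (hB1 y).trans (by simp)
  · exact (hB2 y).trans (by simp)

theorem Jt.comp {f f1 f2 f12 : E3 → ℝ} {Φ : ℝ → ℝ} {B L : ℝ} (hΦ : C2B Φ B) (hB : 0 ≤ B)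
    (hL : 1 ≤ L) (m0 : Measurable f)
    (m1 : Measurable f1) (m2 : Measurable f2) (m3 : Measurable f12)
    (h : ∀ x ∈ U, HasLineDerivAt ℝ f (f1 x) x v ∧ HasLineDerivAt ℝ f (f2 x) x w ∧
      HasLineDerivAt ℝ f1 (f12 x) x w ∧ |f1 x| ≤ L ∧ |f2 x| ≤ L ∧ |f12 x| ≤ L) :
    Jt U v w (2 * (B * L ^ 2)) (fun x => Φ (f x)) := by
  obtain ⟨Φ1, Φ2, n1, n2, hΦ⟩ := hΦ
  refine ⟨fun x => Φ1 (f x) * f1 x, fun x => Φ1 (f x) * f2 x,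
    fun x => Φ2 (f x) * f2 x * f1 x + Φ1 (f x) * f12 x, by fun_prop, by fun_prop, by fun_prop,
    fun x hx => ?_⟩
  obtain ⟨a1, a2, a3, a4, a5, a6⟩ := h x hx
  obtain ⟨b1, b2, b3, b4, b5⟩ := hΦ (f x)
  have hBL : B * L ≤ B * L ^ 2 := mul_le_mul_of_nonneg_left (by nlinarith) hB
  have hBL' : B ≤ B * L := le_mul_of_one_le_right hB hL
  refine ⟨HasLineDerivAt.comp' a1 b1, HasLineDerivAt.comp' a2 b1,
    HasLineDerivAt.mul' (HasLineDerivAt.comp' a2 b2) a3, ?_, ?_, ?_, ?_⟩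
  · linarith
  · linarith [abs_mul_le b4 a4]
  · linarith [abs_mul_le b4 a5]
  · linarith [abs_add_le (Φ2 (f x) * f2 x * f1 x) (Φ1 (f x) * f12 x),
      abs_mul_le (abs_mul_le b5 a5) a4, abs_mul_le b4 a6]

/-- The pairing `⟨z, v⟩`. -/
def pr (z v : E3) : ℝ := z.1.1 * v.1.1 + z.1.2 * v.1.2 + z.2 * v.2

theorem hasLineDerivAt_ch (z x v : E3) :
    HasLineDerivAt ℝ (ch z) (Complex.I * (pr z v : ℂ) * ch z x) x v := by
  have h : ∀ t : ℝ, ch z (x + t • v) = ch z x * Complex.exp (Complex.I * (pr z v : ℂ) * t) := by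
    intro t
    rw [ch, ch, ← Complex.exp_add]
    congr 1
    simp [pr]; ring
  unfold HasLineDerivAt
  simp only [h]
  have h1 : HasDerivAt (fun t : ℝ => Complex.I * (pr z v : ℂ) * (t : ℂ))
      (Complex.I * (pr z v : ℂ)) 0 := by
    simpa using (Complex.ofRealCLM.hasDerivAt (x := 0)).const_mul (Complex.I * (pr z v : ℂ))
  have := (h1.cexp).const_mul (ch z x)
  simp only [Complex.ofReal_zero, mul_zero, Complex.exp_zero, one_mul] at this
  rwa [mul_comm (ch z x) (_ * _)] at this

/-- Bounded measurable with bounded support. -/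
structure BM (f : E3 → ℝ) (K : Set E3) (M : ℝ) : Prop where
  meas : Measurable f
  bd : ∀ x, |f x| ≤ M
  zero : ∀ x ∉ K, f x = 0

theorem BM.sub {f g : E3 → ℝ} {K : Set E3} {M M' : ℝ} (hf : BM f K M) (hg : BM g K M') :
    BM (fun x => f x - g x) K (M + M') :=
  ⟨hf.meas.sub hg.meas, fun x => (abs_sub _ _).trans (add_le_add (hf.bd x) (hg.bd x)), fun x hx => by
    rw [hf.zero x hx, hg.zero x hx, sub_zero]⟩

theorem BM.integrable {f : E3 → ℝ} {K : Set E3} {M : ℝ} (hf : BM f K M) (hK : IsCompact K) :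
    Integrable (fun x => (f x : ℂ)) := by
  have h : IntegrableOn (fun x => (f x : ℂ)) K :=
    Measure.integrableOn_of_bounded (M := M) hK.measure_ne_top
      (Complex.measurable_ofReal.comp hf.meas).aestronglyMeasurable (ae_of_all _ fun x => by
        simpa using hf.bd x)
  refine (integrableOn_iff_integrable_of_support_subset fun x hx => ?_).1 h
  by_contra hc
  exact hx (by simp [hf.zero x hc])

theorem ch_mul_integrable {a : E3 → ℂ} (ha : Integrable a) (z : E3) :
    Integrable (fun x => ch z x * a x) :=
  ha.bdd_mul (continuous_ch z).aestronglyMeasurable (c := 1) (ae_of_all _ fun x => by rw [norm_ch])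

theorem F3_lineDeriv {f f1 : E3 → ℝ} {K : Set E3} {M M' : ℝ} (hK : IsCompact K) (hf : BM f K M)
    (hf1 : BM f1 K M') (hd : ∀ x, HasLineDerivAt ℝ f (f1 x) x v) (z : E3) :
    (1 + Complex.I * (pr z v : ℂ)) * F3 (fun x => (f x : ℂ)) z =
      F3 (fun x => ((f x - f1 x : ℝ) : ℂ)) z := by
  have i0 := ch_mul_integrable (hf.integrable hK) z
  have i1 := ch_mul_integrable (hf1.integrable hK) z
  have key := integral_bilinear_hasLineDerivAt_right_eq_neg_left_of_integrable (μ := volume)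
    (B := ContinuousLinearMap.mul ℝ ℂ) (f := ch z) (g := fun x => (f x : ℂ))
    (f' := fun x => Complex.I * (pr z v : ℂ) * ch z x) (g' := fun x => (f1 x : ℂ)) (v := v)
    (by simpa [mul_assoc] using i0.const_mul (Complex.I * (pr z v : ℂ))) (by simpa using i1)
    (by simpa using i0) (fun x _ => hasLineDerivAt_ch z x v)
    (fun x _ => by
      have := HasDerivAt.ofReal_comp (hd x)
      exact this)
  simp only [ContinuousLinearMap.mul_apply', mul_assoc] at key
  rw [integral_const_mul, integral_const_mul] at key
  simp only [F3_eq, Complex.ofReal_sub, mul_sub]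
  rw [integral_sub i0 i1, key]
  ring

theorem Jt.F3_decay {F : E3 → ℝ} {M : ℝ} (hM : 0 ≤ M) (hU : IsOpen U) (hF : Continuous F)
    (hs : HasCompactSupport F) (hsU : tsupport F ⊆ U) (hJ : Jt U v w M F) :
    ∃ G : E3 → ℝ, BM G (tsupport F) (4 * M) ∧ ∀ z,
      (1 + Complex.I * (pr z w : ℂ)) * ((1 + Complex.I * (pr z v : ℂ)) *
        F3 (fun x => (F x : ℂ)) z) = F3 (fun x => (G x : ℂ)) z := by
  obtain ⟨f1, f2, f12, m1, m2, m3, h⟩ := hJ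
  have hK : IsCompact (tsupport F) := hs
  have hKo : IsOpen (tsupport F)ᶜ := (isClosed_tsupport F).isOpen_compl
  have hz0 : ∀ x ∉ tsupport F, F x = 0 := fun x hx => image_eq_zero_of_notMem_tsupport hx
  have key : ∀ {g g1 : E3 → ℝ} {e : E3} (_ : ∀ x ∉ tsupport F, g x = 0)
      (_ : ∀ x ∈ U, HasLineDerivAt ℝ g (g1 x) x e),
      (∀ x ∉ tsupport F, U.indicator g1 x = 0) ∧
        ∀ x, HasLineDerivAt ℝ (U.indicator g) (U.indicator g1 x) x e := by
    intro g g1 e hg hd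
    have hloc : ∀ x ∉ tsupport F, g =ᶠ[nhds x] fun _ => 0 := fun x hx => by
      filter_upwards [hKo.mem_nhds hx] with y hy using hg y hy
    have h0 : ∀ x, HasLineDerivAt ℝ (fun _ : E3 => (0 : ℝ)) 0 x e := fun x =>
      hasDerivAt_const _ _
    have hA : ∀ x ∉ tsupport F, U.indicator g1 x = 0 := by
      intro x hx
      by_cases hxU : x ∈ U
      · rw [indicator_of_mem hxU, ← (hd x hxU).lineDeriv,
          ((h0 x).congr_of_eventuallyEq (hloc x hx)).lineDeriv]
      · rw [indicator_of_notMem hxU]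
    refine ⟨hA, fun x => ?_⟩
    by_cases hxU : x ∈ U
    · rw [indicator_of_mem hxU]
      refine (hd x hxU).congr_of_eventuallyEq ?_
      filter_upwards [hU.mem_nhds hxU] with y hy using indicator_of_mem hy _
    · rw [indicator_of_notMem hxU]
      refine (h0 x).congr_of_eventuallyEq ?_
      filter_upwards [hKo.mem_nhds (fun hc => hxU (hsU hc))] with y hy
      by_cases hyU : y ∈ U
      · rw [indicator_of_mem hyU, hg y hy]
      · rw [indicator_of_notMem hyU]
  have hFi : U.indicator F = F := by
    ext x
    by_cases hxU : x ∈ U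
    · rw [indicator_of_mem hxU]
    · rw [indicator_of_notMem hxU, hz0 x fun hc => hxU (hsU hc)]
  obtain ⟨z1, d1⟩ := key hz0 fun x hx => (h x hx).1
  obtain ⟨z2, d2⟩ := key hz0 fun x hx => (h x hx).2.1
  have hz1 : ∀ x ∈ U, HasLineDerivAt ℝ (U.indicator f1) (f12 x) x w := fun x hx =>
    (h x hx).2.2.1.congr_of_eventuallyEq (by
      filter_upwards [hU.mem_nhds hx] with y hy using indicator_of_mem hy _)
  obtain ⟨z12, d12⟩ := key z1 hz1
  rw [indicator_indicator, inter_self] at d12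
  rw [hFi] at d1 d2
  have bd : ∀ g : E3 → ℝ, (∀ x ∈ U, |g x| ≤ M) → ∀ x, |U.indicator g x| ≤ M := by
    intro g hg x
    by_cases hxU : x ∈ U
    · rw [indicator_of_mem hxU]; exact hg x hxU
    · rw [indicator_of_notMem hxU]; simpa
  have b0 : BM F (tsupport F) M := ⟨hF.measurable, by
    have := bd F fun x hx => (h x hx).2.2.2.1
    rwa [hFi] at this, hz0⟩
  have b1 : BM (U.indicator f1) (tsupport F) M :=
    ⟨m1.indicator hU.measurableSet, bd f1 fun x hx => (h x hx).2.2.2.2.1, z1⟩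
  have b2 : BM (U.indicator f2) (tsupport F) M :=
    ⟨m2.indicator hU.measurableSet, bd f2 fun x hx => (h x hx).2.2.2.2.2.1, z2⟩
  have b12 : BM (U.indicator f12) (tsupport F) M :=
    ⟨m3.indicator hU.measurableSet, bd f12 fun x hx => (h x hx).2.2.2.2.2.2, z12⟩
  have b := (b0.sub b1).sub (b2.sub b12)
  refine ⟨_, ⟨b.meas, fun x => (b.bd x).trans (by linarith), b.zero⟩, fun z => ?_⟩
  rw [F3_lineDeriv hK b0 b1 d1, F3_lineDeriv hK (b0.sub b1) (b2.sub b12)]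
  intro x
  exact HasDerivAt.sub (d2 x) (d12 x)

end

/-! ### Amplitudes localised to fine planks -/

/-- A smooth function on `[-1, 1]` whose integer translates sum to `1`. -/
def chi (x : ℝ) : ℝ := Real.smoothTransition (x + 1) - Real.smoothTransition x

theorem contDiff_chi {n : ℕ∞} : ContDiff ℝ n chi := by
  unfold chi
  exact (Real.smoothTransition.contDiff.comp (by fun_prop)).sub Real.smoothTransition.contDiff

theorem chi_zero {x : ℝ} (h : 1 ≤ |x|) : chi x = 0 := by
  rcases le_abs.1 h with h | h
  · rw [chi, Real.smoothTransition.one_of_one_le h, Real.smoothTransition.one_of_one_le (by linarith),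
      sub_self]
  · rw [chi, Real.smoothTransition.zero_of_nonpos (by linarith),
      Real.smoothTransition.zero_of_nonpos (by linarith), sub_self]

theorem chi_nonneg (x : ℝ) : 0 ≤ chi x := by
  unfold chi
  rcases le_total x 0 with h | h
  · rw [Real.smoothTransition.zero_of_nonpos h, sub_zero]
    exact Real.smoothTransition.nonneg _
  · rw [Real.smoothTransition.one_of_one_le (x := x + 1) (by linarith)]
    linarith [Real.smoothTransition.le_one x]

theorem chi_le_one (x : ℝ) : chi x ≤ 1 := by
  unfold chi
  linarith [Real.smoothTransition.le_one (x + 1), Real.smoothTransition.nonneg x]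

theorem chi_ne_zero {x : ℝ} (h : chi x ≠ 0) : |x| < 1 := by
  by_contra hc
  exact h (chi_zero (not_lt.1 hc))

theorem hasCompactSupport_chi : HasCompactSupport chi :=
  HasCompactSupport.of_support_subset_isCompact (isCompact_Icc (a := -1) (b := 1)) fun _ hx =>
    abs_le.1 (chi_ne_zero hx).le

@[fun_prop]
theorem continuous_chi : Continuous chi := (contDiff_chi (n := 0)).continuous

theorem sum_chi (M : ℕ) (x : ℝ) : ∑ i ∈ Finset.Icc (-M : ℤ) M, chi (x - i) =
    Real.smoothTransition (x + M + 1) - Real.smoothTransition (x - M) := by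
  induction M with
  | zero => simp [chi]
  | succ M ih =>
    have e : Finset.Icc (-((M + 1 : ℕ) : ℤ)) ((M + 1 : ℕ) : ℤ) =
        insert (-((M + 1 : ℕ) : ℤ)) (insert ((M + 1 : ℕ) : ℤ) (Finset.Icc (-M : ℤ) M)) := by
      ext i; simp only [Finset.mem_Icc, Finset.mem_insert]; omega
    rw [e, Finset.sum_insert, Finset.sum_insert, ih]
    · simp only [chi]; push_cast; ring_nf
    · simp
    · simp only [Finset.mem_insert, Finset.mem_Icc]; omega

theorem sum_chi_eq_one {M : ℕ} {x : ℝ} (hx : |x| ≤ M) :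
    ∑ i ∈ Finset.Icc (-M : ℤ) M, chi (x - i) = 1 := by
  have := abs_le.1 hx
  rw [sum_chi, Real.smoothTransition.one_of_one_le (by linarith),
    Real.smoothTransition.zero_of_nonpos (by linarith), sub_zero]

/-- Euclidean norm. -/
def en (ξ : ℝ × ℝ) : ℝ := √(ξ.1 ^ 2 + ξ.2 ^ 2)

@[fun_prop]
theorem continuous_en : Continuous en := by unfold en; fun_prop

@[fun_prop]
theorem continuous_hA : Continuous hA := by unfold hA; fun_prop

/-- Amplitude of the `k`-th piece at frequency scale `N = 2 ^ n`. -/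
def amp (δ : ℝ) (i₀ : ℤ) (N : ℝ) (k : ℤ) (ξ : E3) : ℝ :=
  N ^ 2 * (chi (hA ξ / δ - i₀) * (chi (N * (ξ.1.2 / hA ξ) - k) * chi (10 * N ^ 2 * (ξ.2 - en ξ.1))))

/-- The long direction of a plank. -/
def pv (ρ u : ℝ) : E3 := (((u ^ 2 - 1) / 2 / ρ, u / ρ), (1 + u ^ 2) / 2 / ρ)
/-- The intermediate direction of a plank. -/
def pw (ρ s u : ℝ) : E3 := ((s / ρ * u, s / ρ), s / ρ * u)

/-- An open region around the plank at angle `u`. -/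
def Ureg (N s u : ℝ) : Set E3 :=
  {ξ | 1 / 3 < hA ξ ∧ hA ξ < 7 ∧ |ξ.1.2 - u * hA ξ| < 3 * s * hA ξ ∧ |ξ.2 - en ξ.1| < 1 / (9 * N ^ 2)}

theorem isOpen_Ureg (N s u : ℝ) : IsOpen (Ureg N s u) := by
  have h1 : Continuous fun ξ : E3 => ξ.2 - en ξ.1 := by fun_prop
  have h2 : Continuous fun ξ : E3 => |ξ.1.2 - u * hA ξ| := by fun_prop
  have h3 : Continuous fun ξ : E3 => 3 * s * hA ξ := by fun_prop
  exact (isOpen_lt continuous_const continuous_hA).inter ((isOpen_lt continuous_hA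
    continuous_const).inter ((isOpen_lt h2 h3).inter (isOpen_lt h1.abs continuous_const)))

theorem hA_pv {ρ : ℝ} (u : ℝ) : hA (pv ρ u) = 1 / ρ := by simp [hA, pv]; ring
theorem hA_pw (ρ s u : ℝ) : hA (pw ρ s u) = 0 := by simp [hA, pw]
theorem lam_pv {ρ : ℝ} (hρ : 0 < ρ) (s u : ℝ) : lam ρ s u (pv ρ u) = ((1, 0), 0) := by
  ext <;> simp [lam, pv, hA, hB, hC] <;> field_simp <;> ring_nf <;> simp
theorem lam_pw {ρ s : ℝ} (hρ : 0 < ρ) (hs : 0 < s) (u : ℝ) : lam ρ s u (pw ρ s u) = ((0, 1), 0) := by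
  ext <;> simp [lam, pw, hA, hB, hC] <;> field_simp
  ring_nf
  simp
theorem hA_smul (t : ℝ) (v : E3) : hA (t • v) = t * hA v := by simp [hA]; ring

theorem hasLineDerivAt_linear (ℓ : E3 →ₗ[ℝ] ℝ) (c : ℝ) (x v : E3) :
    HasLineDerivAt ℝ (fun x => ℓ x + c) (ℓ v) x v := by
  unfold HasLineDerivAt
  simp only [map_add, map_smul, smul_eq_mul]
  simpa using (((hasDerivAt_id (0 : ℝ)).mul_const (ℓ v)).const_add (ℓ x)).add_const c

section
variable {ρ s u N : ℝ}

theorem Jt.linear {U : Set E3} {v w : E3} {Φ : ℝ → ℝ} {B L : ℝ} (hΦ : C2B Φ B) (hB0 : 0 ≤ B)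
    (hL : 1 ≤ L) (ℓ : E3 →ₗ[ℝ] ℝ) (c : ℝ) (h1 : |ℓ v| ≤ L) (h2 : |ℓ w| ≤ L) :
    Jt U v w (2 * (B * L ^ 2)) (fun x => Φ (ℓ x + c)) :=
  Jt.comp (f1 := fun _ => ℓ v) (f2 := fun _ => ℓ w) (f12 := fun _ => 0) hΦ hB0 hL
    (ℓ.continuous_of_finiteDimensional.measurable.add_const c) measurable_const measurable_const
    measurable_const fun x _ => ⟨hasLineDerivAt_linear ℓ c x v, hasLineDerivAt_linear ℓ c x w,
      hasDerivAt_const _ _, h1, h2, by simp; linarith⟩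

/-- `hA` as a linear map. -/
def hAl : E3 →ₗ[ℝ] ℝ where
  toFun := hA
  map_add' := hA_add
  map_smul' := hA_smul

theorem jt_window {B : ℝ} (hΦ : C2B beta B) (hB0 : 0 ≤ B) (hρ : 0 < ρ) (hs : 0 < s) (U : Set E3)
    (ζ : E3) : Jt U (pv ρ u) (pw ρ s u) (√|LinearMap.det (lam ρ s u)| * (128 * B ^ 3))
      (fun ξ => win ρ s u (ξ - ζ)) := by
  have h1 : Jt U (pv ρ u) (pw ρ s u) (2 * (B * 1 ^ 2)) _ := Jt.linear hΦ hB0 le_rfl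
    (LinearMap.fst ℝ ℝ ℝ ∘ₗ LinearMap.fst ℝ (ℝ × ℝ) ℝ ∘ₗ lam ρ s u) (-(lam ρ s u ζ).1.1)
    (by simp [lam_pv hρ]) (by simp [lam_pw hρ hs])
  have h2 : Jt U (pv ρ u) (pw ρ s u) (2 * (B * 1 ^ 2)) _ := Jt.linear hΦ hB0 le_rfl
    (LinearMap.snd ℝ ℝ ℝ ∘ₗ LinearMap.fst ℝ (ℝ × ℝ) ℝ ∘ₗ lam ρ s u) (-(lam ρ s u ζ).1.2)
    (by simp [lam_pv hρ]) (by simp [lam_pw hρ hs])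
  have h3 : Jt U (pv ρ u) (pw ρ s u) (2 * (B * 1 ^ 2)) _ := Jt.linear hΦ hB0 le_rfl
    (LinearMap.snd ℝ (ℝ × ℝ) ℝ ∘ₗ lam ρ s u) (-(lam ρ s u ζ).2)
    (by simp [lam_pv hρ]) (by simp [lam_pw hρ hs])
  have hb := beta.continuous
  have m : ∀ (ℓ : E3 →ₗ[ℝ] ℝ) (c : ℝ), Measurable fun x => beta (ℓ x + c) := fun ℓ c =>
    (hb.comp (ℓ.continuous_of_finiteDimensional.add continuous_const)).measurable
  have h12 := (h1.mul h2 (m _ _) (m _ _)).mul h3 ((m _ _).mul (m _ _)) (m _ _)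
  have := h12.const_mul √|LinearMap.det (lam ρ s u)|
  rw [abs_of_nonneg (sqrt_nonneg _)] at this
  convert this using 1
  · ring
  · ext ξ
    simp [win, prof, sub_eq_add_neg]

theorem jt_quot {B : ℝ} (hΦ : C2B chi B) (hB0 : 0 ≤ B) (hρ : 1 ≤ ρ) (hs : 0 < s) (hN : 0 < N)
    (hNs : N * s ≤ ρ) (k : ℤ) : Jt (Ureg N s u) (pv ρ u) (pw ρ s u) (2 * (B * 9 ^ 2))
      (fun ξ => chi (N * (ξ.1.2 / hA ξ) - k)) := by
  have hρ0 : 0 < ρ := by linarith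
  refine Jt.comp (f1 := fun ξ => N * ((u / ρ * hA ξ - ξ.1.2 * (1 / ρ)) / hA ξ ^ 2))
    (f2 := fun ξ => N * (s / ρ / hA ξ)) (f12 := fun ξ => N * (-(s / ρ * (1 / ρ)) / hA ξ ^ 2)) hΦ hB0
    (by norm_num) ?_ ?_ ?_ ?_ ?_
  · have := continuous_hA.measurable; fun_prop
  · have := continuous_hA.measurable; fun_prop
  · have := continuous_hA.measurable; fun_prop
  · have := continuous_hA.measurable; fun_prop
  rintro ξ ⟨a1, a2, a3, a4⟩
  have hA0 : 0 < hA ξ := by linarith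
  have hNρ : N * s / ρ ≤ 1 := (div_le_one hρ0).2 hNs
  have hinv : 1 / hA ξ ≤ 3 := by rw [div_le_iff₀ hA0]; linarith
  have q1 : N * (s / ρ / hA ξ) = (N * s / ρ) * (1 / hA ξ) := by ring
  have p1 : 0 ≤ N * s / ρ := by positivity
  have p2 : 0 ≤ 1 / hA ξ := by positivity
  refine ⟨?_, ?_, ?_, ?_, ?_, ?_⟩
  · unfold HasLineDerivAt
    have h1 : HasDerivAt (fun t : ℝ => ξ.1.2 + t * (u / ρ)) (u / ρ) 0 := by
      simpa using ((hasDerivAt_id (0 : ℝ)).mul_const (u / ρ)).const_add ξ.1.2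
    have h2 : HasDerivAt (fun t : ℝ => hA ξ + t * (1 / ρ)) (1 / ρ) 0 := by
      simpa using ((hasDerivAt_id (0 : ℝ)).mul_const (1 / ρ)).const_add (hA ξ)
    have := ((h1.div h2 (by simpa using hA0.ne')).const_mul N).sub_const (k : ℝ)
    have e : (pv ρ u).1.2 = u / ρ := rfl
    simpa [hA_add, hA_smul, hA_pv, e] using this
  · unfold HasLineDerivAt
    have h1 : HasDerivAt (fun t : ℝ => ξ.1.2 + t * (s / ρ)) (s / ρ) 0 := by
      simpa using ((hasDerivAt_id (0 : ℝ)).mul_const (s / ρ)).const_add ξ.1.2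
    have := ((h1.div_const (hA ξ)).const_mul N).sub_const (k : ℝ)
    have e : (pw ρ s u).1.2 = s / ρ := rfl
    simpa [hA_add, hA_smul, hA_pw, e] using this
  · unfold HasLineDerivAt
    have h1 : HasDerivAt (fun t : ℝ => u / ρ * hA ξ - (ξ.1.2 + t * (s / ρ)) * (1 / ρ))
        (-(s / ρ * (1 / ρ))) 0 := by
      simpa using ((((hasDerivAt_id (0 : ℝ)).mul_const (s / ρ)).const_add ξ.1.2).mul_const
        (1 / ρ)).const_sub (u / ρ * hA ξ)
    have := (h1.div_const (hA ξ ^ 2)).const_mul N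
    have e : (pw ρ s u).1.2 = s / ρ := rfl
    simpa [hA_add, hA_smul, hA_pw, e] using this
  · have : N * ((u / ρ * hA ξ - ξ.1.2 * (1 / ρ)) / hA ξ ^ 2) =
        (N / ρ) * (-(ξ.1.2 - u * hA ξ)) * (1 / hA ξ * (1 / hA ξ)) := by field_simp; ring
    rw [this, abs_mul, abs_mul, abs_neg, abs_of_nonneg (a := N / ρ) (by positivity),
      abs_of_nonneg (a := 1 / hA ξ * (1 / hA ξ)) (by positivity)]
    calc N / ρ * |ξ.1.2 - u * hA ξ| * (1 / hA ξ * (1 / hA ξ))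
        ≤ N / ρ * (3 * s * hA ξ) * (1 / hA ξ * (1 / hA ξ)) := by gcongr
      _ = 3 * (N * s / ρ) * (1 / hA ξ) := by field_simp
      _ ≤ 3 * 1 * 3 := by gcongr
      _ = 9 := by norm_num
  · rw [q1, abs_of_nonneg (by positivity)]
    nlinarith
  · have q2 : N * (-(s / ρ * (1 / ρ)) / hA ξ ^ 2) =
        -((N * s / ρ) * (1 / ρ) * (1 / hA ξ * (1 / hA ξ))) := by field_simp
    rw [q2, abs_neg, abs_of_nonneg (by positivity)]
    have : 1 / ρ ≤ 1 := by rw [div_le_one hρ0]; exact hρ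
    calc (N * s / ρ) * (1 / ρ) * (1 / hA ξ * (1 / hA ξ)) ≤ 1 * 1 * (3 * 3) := by gcongr
      _ = 9 := by norm_num

end

theorem hasLineDerivAt_dist (c : ℝ) {ξ : E3} (v : E3) (h : 0 < en ξ.1) :
    HasLineDerivAt ℝ (fun ξ => c * (ξ.2 - en ξ.1))
      (c * (v.2 - (ξ.1.1 * v.1.1 + ξ.1.2 * v.1.2) / en ξ.1)) ξ v := by
  unfold HasLineDerivAt
  have h1 : HasDerivAt (fun t : ℝ => (ξ.1.1 + t * v.1.1) ^ 2 + (ξ.1.2 + t * v.1.2) ^ 2)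
      (2 * (ξ.1.1 * v.1.1 + ξ.1.2 * v.1.2)) 0 := by
    have e1 := (((hasDerivAt_id (0 : ℝ)).mul_const v.1.1).const_add ξ.1.1).pow 2
    have e2 := (((hasDerivAt_id (0 : ℝ)).mul_const v.1.2).const_add ξ.1.2).pow 2
    refine (e1.add e2).congr_deriv ?_
    simp; ring
  have h0 : (ξ.1.1 + 0 * v.1.1) ^ 2 + (ξ.1.2 + 0 * v.1.2) ^ 2 ≠ 0 := by
    simpa using (Real.sqrt_pos.1 h).ne'
  have h3 : HasDerivAt (fun t : ℝ => ξ.2 + t * v.2) v.2 0 := by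
    simpa using ((hasDerivAt_id (0 : ℝ)).mul_const v.2).const_add ξ.2
  refine ((h3.sub (h1.sqrt h0)).const_mul c).congr_deriv ?_
  simp only [en, zero_mul, add_zero]
  rw [mul_div_mul_left _ _ two_ne_zero]

theorem hasLineDerivAt_dist₂ (c : ℝ) {ξ : E3} (v w : E3) (h : 0 < en ξ.1) :
    HasLineDerivAt ℝ (fun ξ => c * (v.2 - (ξ.1.1 * v.1.1 + ξ.1.2 * v.1.2) / en ξ.1))
      (-(c * ((ξ.1.1 * v.1.2 - ξ.1.2 * v.1.1) * (ξ.1.1 * w.1.2 - ξ.1.2 * w.1.1)) / en ξ.1 ^ 3)) ξ w := by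
  have h1 := hasLineDerivAt_dist (-1) w h
  unfold HasLineDerivAt at h1 ⊢
  have h3 : HasDerivAt (fun t : ℝ => ξ.2 + t * w.2) w.2 0 := by
    simpa using ((hasDerivAt_id (0 : ℝ)).mul_const w.2).const_add ξ.2
  have h2 : HasDerivAt (fun t : ℝ => en (ξ + t • w).1)
      ((ξ.1.1 * w.1.1 + ξ.1.2 * w.1.2) / en ξ.1) 0 := by
    have := h1.add h3
    refine (this.congr_deriv ?_).congr_of_eventuallyEq (Filter.Eventually.of_forall fun t => ?_)
    · ring
    · simp
  have h4 : HasDerivAt (fun t : ℝ => (ξ.1.1 + t * w.1.1) * v.1.1 + (ξ.1.2 + t * w.1.2) * v.1.2)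
      (w.1.1 * v.1.1 + w.1.2 * v.1.2) 0 := by
    have e1 := (((hasDerivAt_id (0 : ℝ)).mul_const w.1.1).const_add ξ.1.1).mul_const v.1.1
    have e2 := (((hasDerivAt_id (0 : ℝ)).mul_const w.1.2).const_add ξ.1.2).mul_const v.1.2
    refine (e1.add e2).congr_deriv ?_
    simp
  have h5 : en (ξ + (0 : ℝ) • w).1 ≠ 0 := by simpa using h.ne'
  refine (((h4.div h2 h5).const_sub v.2).const_mul c).congr_deriv ?_
  have hr : en ξ.1 ^ 2 = ξ.1.1 ^ 2 + ξ.1.2 ^ 2 := Real.sq_sqrt (by positivity)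
  simp only [zero_smul, add_zero, zero_mul]
  have hne := h.ne'
  field_simp
  rw [hr]
  ring

section
variable {ρ s u N : ℝ}

theorem Ureg_bounds (hs : 0 < s) (hs1 : s ≤ 1) (hN : 0 < N) (hNs : 1 ≤ N ^ 2 * s ^ 2) (hu : |u| ≤ 3)
    {ξ : E3} (hξ : ξ ∈ Ureg N s u) :
    2 / 9 ≤ en ξ.1 - ξ.1.1 ∧ 1 / 9 ≤ en ξ.1 ∧ |ξ.1.2 - u * (en ξ.1 - ξ.1.1)| ≤ 22 * s ∧
      |ξ.1.1| ≤ en ξ.1 ∧ |ξ.1.2| ≤ en ξ.1 := by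
  obtain ⟨a1, a2, a3, a4⟩ := hξ
  have hs2 : 1 / (9 * N ^ 2) ≤ s ^ 2 / 9 := by
    rw [div_le_div_iff₀ (by positivity) (by norm_num)]; linarith
  have hss : s ^ 2 ≤ s := by nlinarith
  have e1 : |ξ.1.1| ≤ en ξ.1 := Real.abs_le_sqrt (by nlinarith [sq_nonneg ξ.1.2])
  have e2 : |ξ.1.2| ≤ en ξ.1 := Real.abs_le_sqrt (by nlinarith [sq_nonneg ξ.1.1])
  have h4 := abs_lt.1 a4
  have hd : hA ξ = ξ.2 - ξ.1.1 := rfl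
  have h9 : 2 / 9 ≤ en ξ.1 - ξ.1.1 := by linarith
  refine ⟨h9, by linarith [abs_le.1 e1], ?_, e1, e2⟩
  have : ξ.1.2 - u * (en ξ.1 - ξ.1.1) = (ξ.1.2 - u * hA ξ) + u * (ξ.2 - en ξ.1) := by rw [hd]; ring
  rw [this]
  have h5 := abs_mul_le hu (a4.le.trans hs2)
  have h6 : 3 * s * hA ξ ≤ 21 * s := by nlinarith
  linarith [abs_add_le (ξ.1.2 - u * hA ξ) (u * (ξ.2 - en ξ.1))]

theorem jt_dist {B : ℝ} (hΦ : C2B chi B) (hB0 : 0 ≤ B) (hρ : 1 ≤ ρ) (hs : 0 < s) (hs1 : s ≤ 1)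
    (hN : 0 < N) (hNs : N ^ 2 * s ^ 2 = ρ) (hu : |u| ≤ 3) :
    Jt (Ureg N s u) (pv ρ u) (pw ρ s u) (2 * (B * (2 * 10 ^ 7) ^ 2))
      (fun ξ => chi (10 * N ^ 2 * (ξ.2 - en ξ.1))) := by
  have hρ0 : 0 < ρ := by linarith
  refine Jt.comp (f1 := fun ξ => 10 * N ^ 2 * ((pv ρ u).2 - (ξ.1.1 * (pv ρ u).1.1 +
      ξ.1.2 * (pv ρ u).1.2) / en ξ.1)) (f2 := fun ξ => 10 * N ^ 2 * ((pw ρ s u).2 -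
      (ξ.1.1 * (pw ρ s u).1.1 + ξ.1.2 * (pw ρ s u).1.2) / en ξ.1)) (f12 := fun ξ =>
      -(10 * N ^ 2 * ((ξ.1.1 * (pv ρ u).1.2 - ξ.1.2 * (pv ρ u).1.1) *
        (ξ.1.1 * (pw ρ s u).1.2 - ξ.1.2 * (pw ρ s u).1.1)) / en ξ.1 ^ 3)) hΦ hB0
    (by norm_num) ?_ ?_ ?_ ?_ ?_
  · have := continuous_en.measurable; fun_prop
  · have := continuous_en.measurable; fun_prop
  · have := continuous_en.measurable; fun_prop
  · have := continuous_en.measurable; fun_prop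
  intro ξ hξ
  obtain ⟨b1, b2, b3, b4, b5⟩ := Ureg_bounds hs hs1 hN (by rw [hNs]; exact hρ) hu hξ
  have hr : 0 < en ξ.1 := by linarith
  refine ⟨hasLineDerivAt_dist _ _ hr, hasLineDerivAt_dist _ _ hr, hasLineDerivAt_dist₂ _ _ _ hr,
    ?_, ?_, ?_⟩
  all_goals
    have hr2 : en ξ.1 ^ 2 = ξ.1.1 ^ 2 + ξ.1.2 ^ 2 := Real.sq_sqrt (by positivity)
    simp only [pv, pw]
    generalize en ξ.1 = r at *
    generalize ξ.1.1 = x at *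
    generalize ξ.1.2 = b at *
    obtain ⟨h, rfl⟩ : ∃ h, r = x + h := ⟨r - x, by ring⟩
    rw [add_sub_cancel_left] at b1 b3
    have hh : 0 < h := by linarith
    have hb2 : b ^ 2 = h * (h + 2 * x) := by nlinarith
    subst hNs
  · have : 10 * N ^ 2 * ((1 + u ^ 2) / 2 / (N ^ 2 * s ^ 2) - (x * ((u ^ 2 - 1) / 2 / (N ^ 2 * s ^ 2)) +
        b * (u / (N ^ 2 * s ^ 2))) / (x + h)) = 5 * ((b - u * h) / s) ^ 2 / (h * (x + h)) := by
      field_simp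
      linear_combination (-10) * hb2
    rw [this, abs_of_nonneg (by positivity), div_le_iff₀ (by positivity)]
    have h1 : ((b - u * h) / s) ^ 2 ≤ 22 ^ 2 := by
      rw [sq_le_sq, abs_div, abs_of_pos hs, abs_of_pos (by norm_num : (0 : ℝ) < 22), div_le_iff₀ hs]
      exact b3
    nlinarith [mul_le_mul b1 b2 (by norm_num) hh.le]
  · have : 10 * N ^ 2 * (s / (N ^ 2 * s ^ 2) * u - (x * (s / (N ^ 2 * s ^ 2) * u) +
        b * (s / (N ^ 2 * s ^ 2))) / (x + h)) = -(10 * ((b - u * h) / s) / (x + h)) := by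
      field_simp
      ring
    rw [this, abs_neg, abs_div, abs_of_pos hr, div_le_iff₀ hr, abs_mul, abs_div, abs_of_pos hs]
    have h1 : |b - u * h| / s ≤ 22 := by rwa [div_le_iff₀ hs]
    rw [abs_of_pos (by norm_num : (0 : ℝ) < 10)]
    nlinarith
  · have : 10 * N ^ 2 * ((x * (u / (N ^ 2 * s ^ 2)) - b * ((u ^ 2 - 1) / 2 / (N ^ 2 * s ^ 2))) *
        (x * (s / (N ^ 2 * s ^ 2)) - b * (s / (N ^ 2 * s ^ 2) * u))) / (x + h) ^ 3 =
        5 * (1 / (N ^ 2 * s ^ 2)) * ((b - u * h) / s) * (1 + u * (b / h)) * ((x - b * u) / (x + h)) *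
          (1 / (x + h) ^ 2) := by
      field_simp
      linear_combination (-10 * u) * (x - b * u) * hb2
    rw [this, abs_neg]
    have h1 : |(b - u * h) / s| ≤ 22 := by rwa [abs_div, abs_of_pos hs, div_le_iff₀ hs]
    have h2 : |b / h| ≤ 102 := by
      rw [abs_div, abs_of_pos hh, div_le_iff₀ hh]
      have := abs_mul_le hu (le_refl |h|)
      rw [abs_of_pos hh] at this
      have h3 := abs_add_le (b - u * h) (u * h)
      rw [sub_add_cancel] at h3
      linarith
    have h3 : |1 + u * (b / h)| ≤ 307 := by
      have := abs_add_le 1 (u * (b / h))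
      have h4 := abs_mul_le hu h2
      rw [abs_one] at this
      linarith
    have h4 : |(x - b * u) / (x + h)| ≤ 4 := by
      rw [abs_div, abs_of_pos hr, div_le_iff₀ hr]
      have := abs_mul_le b5 hu
      linarith [abs_sub x (b * u)]
    have h5 : |1 / (x + h) ^ 2| ≤ 81 := by
      rw [abs_of_pos (by positivity), div_le_iff₀ (by positivity)]
      nlinarith
    have h6 : |5 * (1 / (N ^ 2 * s ^ 2))| ≤ 5 := by
      rw [abs_of_pos (by positivity)]
      have : 1 / (N ^ 2 * s ^ 2) ≤ 1 := by rw [div_le_one (by positivity)]; exact hρ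
      linarith
    refine (abs_mul_le (abs_mul_le (abs_mul_le (abs_mul_le h6 h1) h3) h4) h5).trans (by norm_num)

/-- Second order bounds for the windowed amplitudes. -/
theorem exists_jt_amp {δ : ℝ} (hδ : 0 < δ) (hδ1 : δ ≤ 1) : ∃ C, 0 ≤ C ∧ ∀ (ρ s u N : ℝ) (i₀ k : ℤ)
    (ζ : E3), 1 ≤ ρ → 0 < s → s ≤ 1 → 0 < N → N ^ 2 * s ^ 2 = ρ → |u| ≤ 3 →
    Jt (Ureg N s u) (pv ρ u) (pw ρ s u) (C * (N ^ 2 * √|LinearMap.det (lam ρ s u)|))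
      (fun ξ => win ρ s u (ξ - ζ) * amp δ i₀ N k ξ) := by
  obtain ⟨B, hB1, hB⟩ := exists_C2B (contDiff_chi (n := 2)) hasCompactSupport_chi
  obtain ⟨D, hD1, hD⟩ := exists_C2B (Φ := beta) beta.contDiff beta.hasCompactSupport
  refine ⟨4 * ((128 * D ^ 3) * (4 * ((2 * (B * (1 / δ) ^ 2)) * (4 * ((2 * (B * 9 ^ 2)) *
    (2 * (B * (2 * 10 ^ 7) ^ 2))))))), by positivity, ?_⟩
  intro ρ s u N i₀ k ζ hρ hs hs1 hN hNs hu
  have hB0 : 0 ≤ B := by linarith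
  have hρ0 : 0 < ρ := by linarith
  have hδi : 1 ≤ 1 / δ := by rw [le_div_iff₀ hδ]; linarith
  have hNs1 : N * s ≤ ρ := by nlinarith [mul_pos hN hs]
  have j1 : Jt (Ureg N s u) (pv ρ u) (pw ρ s u) _ _ := Jt.linear hB hB0 hδi (δ⁻¹ • hAl) (-i₀)
    (by
      have : hAl (pv ρ u) = 1 / ρ := hA_pv u
      have h2 : 1 / ρ ≤ 1 := by rw [div_le_one hρ0]; exact hρ
      rw [LinearMap.smul_apply, this, smul_eq_mul, abs_of_pos (by positivity), one_div δ]
      exact mul_le_of_le_one_right (by positivity) h2)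
    (by
      have : hAl (pw ρ s u) = 0 := hA_pw ρ s u
      rw [LinearMap.smul_apply, this, smul_zero, abs_zero]; positivity)
  have j2 := jt_quot (u := u) hB hB0 hρ hs hN hNs1 k
  have j3 := jt_dist hB hB0 hρ hs hs1 hN hNs hu
  have hch := continuous_chi.measurable
  have hAm := continuous_hA.measurable
  have hen := continuous_en.measurable
  have m1 : Measurable fun x => chi ((δ⁻¹ • hAl) x + (-i₀ : ℝ)) :=
    hch.comp ((δ⁻¹ • hAl).continuous_of_finiteDimensional.measurable.add_const _)
  have m2 : Measurable fun ξ : E3 => chi (N * (ξ.1.2 / hA ξ) - k) := by fun_prop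
  have m3 : Measurable fun ξ : E3 => chi (10 * N ^ 2 * (ξ.2 - en ξ.1)) := by fun_prop
  have mw : Measurable fun ξ => win ρ s u (ξ - ζ) :=
    ((CR_win hρ0 hs u).cont.comp (by fun_prop)).measurable
  have := (jt_window (u := u) hD (by linarith) hρ0 hs (Ureg N s u) ζ).mul
    ((j1.mul (j2.mul j3 m2 m3) m1 (m2.mul m3)).const_mul (N ^ 2)) mw
    ((m1.mul (m2.mul m3)).const_mul _)
  rw [abs_of_nonneg (by positivity : 0 ≤ N ^ 2)] at this
  convert this using 1
  · ring
  · ext ξ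
    have : (δ⁻¹ • hAl) ξ + (-i₀ : ℝ) = hA ξ / δ - i₀ := by
      rw [LinearMap.smul_apply, smul_eq_mul, inv_mul_eq_div, ← sub_eq_add_neg]; rfl
    rw [amp, this]

end

/-- The closed region carrying the `k`-th amplitude. -/
def Kset (δ : ℝ) (i₀ : ℤ) (N : ℝ) (k : ℤ) : Set E3 :=
  {ξ | |hA ξ - i₀ * δ| ≤ δ ∧ |N * ξ.1.2 - k * hA ξ| ≤ hA ξ ∧ |10 * N ^ 2 * (ξ.2 - en ξ.1)| ≤ 1}

theorem isClosed_Kset (δ : ℝ) (i₀ : ℤ) (N : ℝ) (k : ℤ) : IsClosed (Kset δ i₀ N k) := by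
  have h1 : Continuous fun ξ : E3 => |hA ξ - i₀ * δ| := by fun_prop
  have h2 : Continuous fun ξ : E3 => |N * ξ.1.2 - k * hA ξ| := by fun_prop
  have h3 : Continuous fun ξ : E3 => |10 * N ^ 2 * (ξ.2 - en ξ.1)| := by fun_prop
  exact (isClosed_le h1 continuous_const).inter ((isClosed_le h2 continuous_hA).inter
    (isClosed_le h3 continuous_const))

/-- Admissible parameters for amplitudes. -/
structure Adm (δ : ℝ) (i₀ : ℤ) (N : ℝ) (k : ℤ) : Prop where
  δ0 : 0 < δ
  δ1 : δ ≤ 1 / 10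
  lo : 6 / 10 ≤ i₀ * δ
  hi : i₀ * δ ≤ 59 / 10
  N1 : 1 ≤ N
  k1 : |(k : ℝ)| ≤ 2 * N

section
variable {δ N : ℝ} {i₀ k : ℤ}

theorem Adm.bounds (h : Adm δ i₀ N k) {ξ : E3} (hξ : ξ ∈ Kset δ i₀ N k) : 1 / 2 ≤ hA ξ ∧ hA ξ ≤ 6 ∧
    |ξ.2 - en ξ.1| ≤ 1 / (10 * N ^ 2) ∧ |ξ.1.2 - k / N * hA ξ| ≤ hA ξ / N ∧ |ξ.1.2| ≤ 3 * hA ξ ∧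
    en ξ.1 ≤ 63 / 10 * hA ξ := by
  obtain ⟨a1, a2, a3⟩ := hξ
  have hN := h.N1
  have b1 := abs_le.1 a1
  have lo : 1 / 2 ≤ hA ξ := by linarith [h.δ1, h.lo]
  have c3 : |ξ.2 - en ξ.1| ≤ 1 / (10 * N ^ 2) := by
    rw [abs_mul, abs_of_pos (by positivity)] at a3
    rw [le_div_iff₀ (by positivity), mul_comm]; exact a3
  have c4 : |ξ.1.2 - k / N * hA ξ| ≤ hA ξ / N := by
    rw [le_div_iff₀ (by positivity)]
    have : |N * ξ.1.2 - k * hA ξ| = |ξ.1.2 - k / N * hA ξ| * N := by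
      rw [← abs_of_pos (by positivity : 0 < N), ← abs_mul, abs_of_pos (by positivity : 0 < N)]
      congr 1; field_simp
    rwa [← this]
  have c5 : |ξ.1.2| ≤ 3 * hA ξ := by
    have e1 : |(k : ℝ) / N| ≤ 2 := by
      rw [abs_div, abs_of_pos (by positivity : 0 < N), div_le_iff₀ (by positivity)]; exact h.k1
    have e2 := abs_mul_le e1 (le_refl |hA ξ|)
    rw [abs_of_pos (by linarith : 0 < hA ξ)] at e2
    have e3 := abs_add_le (ξ.1.2 - k / N * hA ξ) (k / N * hA ξ)
    rw [sub_add_cancel] at e3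
    have e4 : hA ξ / N ≤ hA ξ := div_le_self (by linarith) hN
    linarith
  refine ⟨lo, by linarith [h.δ1, h.hi], c3, c4, c5, ?_⟩
  have c6 : 1 / (10 * N ^ 2) ≤ 1 / 10 := by
    rw [div_le_div_iff₀ (by positivity) (by norm_num)]; nlinarith
  have c7 := abs_le.1 (c3.trans c6)
  have hr2 : en ξ.1 ^ 2 = ξ.1.1 ^ 2 + ξ.1.2 ^ 2 := Real.sq_sqrt (by positivity)
  have hAd : hA ξ = ξ.2 - ξ.1.1 := rfl
  obtain ⟨c, hc⟩ : ∃ c, en ξ.1 = ξ.1.1 + c := ⟨en ξ.1 - ξ.1.1, by ring⟩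
  have g1 : 8 / 10 * hA ξ ≤ c := by linarith
  have g2 : c ≤ 12 / 10 * hA ξ := by linarith
  have g3 : ξ.1.2 ^ 2 ≤ 9 * hA ξ ^ 2 := by
    have := sq_le_sq' (by linarith [neg_abs_le ξ.1.2]) ((le_abs_self ξ.1.2).trans c5)
    linarith
  have g4 : 2 * en ξ.1 * c = c ^ 2 + ξ.1.2 ^ 2 := by
    have : ξ.1.1 = en ξ.1 - c := by linarith
    rw [this] at hr2; nlinarith
  by_contra hcon
  push Not at hcon
  nlinarith [mul_le_mul hcon.le g1 (by linarith) (by linarith)]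

theorem Adm.amp_zero (h : Adm δ i₀ N k) {ξ : E3} (hξ : ξ ∉ Kset δ i₀ N k) : amp δ i₀ N k ξ = 0 := by
  by_contra hne
  apply hξ
  have h1 : chi (hA ξ / δ - i₀) ≠ 0 := fun hc => hne (by rw [amp, hc]; ring)
  have h2 : chi (N * (ξ.1.2 / hA ξ) - k) ≠ 0 := fun hc => hne (by rw [amp, hc]; ring)
  have h3 : chi (10 * N ^ 2 * (ξ.2 - en ξ.1)) ≠ 0 := fun hc => hne (by rw [amp, hc]; ring)
  have δ0 := h.δ0
  have a1 : |hA ξ - i₀ * δ| ≤ δ := by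
    have := chi_ne_zero h1
    have e : hA ξ - i₀ * δ = (hA ξ / δ - i₀) * δ := by field_simp
    rw [e, abs_mul, abs_of_pos δ0]
    nlinarith
  have lo : 0 < hA ξ := by linarith [h.δ1, h.lo, (abs_le.1 a1).1]
  refine ⟨a1, ?_, (chi_ne_zero h3).le⟩
  have := chi_ne_zero h2
  have e : N * ξ.1.2 - k * hA ξ = (N * (ξ.1.2 / hA ξ) - k) * hA ξ := by field_simp
  rw [e, abs_mul, abs_of_pos lo]
  nlinarith

theorem Adm.isCompact_Kset (h : Adm δ i₀ N k) : IsCompact (Kset δ i₀ N k) := by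
  refine (isCompact_Icc (a := (((-100, -100), -100) : E3)) (b := ((100, 100), 100))).of_isClosed_subset
    (isClosed_Kset _ _ _ _) fun ξ hξ => ?_
  obtain ⟨a1, a2, a3, a4, a5, a6⟩ := h.bounds hξ
  have c6 : 1 / (10 * N ^ 2) ≤ 1 / 10 := by
    have := h.N1
    rw [div_le_div_iff₀ (by positivity) (by norm_num)]; nlinarith
  have c7 := abs_le.1 (a3.trans c6)
  have b5 := abs_le.1 a5
  have hAd : hA ξ = ξ.2 - ξ.1.1 := rfl
  have e1 : |ξ.1.1| ≤ en ξ.1 := Real.abs_le_sqrt (by nlinarith [sq_nonneg ξ.1.2])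
  have b1 := abs_le.1 e1
  simp only [Set.mem_Icc, Prod.le_def]
  refine ⟨⟨⟨?_, ?_⟩, ?_⟩, ⟨?_, ?_⟩, ?_⟩ <;> linarith

theorem Adm.tsupport_amp (h : Adm δ i₀ N k) : tsupport (amp δ i₀ N k) ⊆ Kset δ i₀ N k :=
  closure_minimal (fun ξ hξ => by by_contra hc; exact hξ (h.amp_zero hc)) (isClosed_Kset _ _ _ _)

theorem Adm.continuous_amp (h : Adm δ i₀ N k) : Continuous (amp δ i₀ N k) := by
  refine continuous_of_tsupport fun ξ hξ => ?_
  have h0 : hA ξ ≠ 0 := by linarith [(h.bounds (h.tsupport_amp hξ)).1]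
  have hq : ContinuousAt (fun ξ : E3 => ξ.1.2 / hA ξ) ξ :=
    ContinuousAt.div (by fun_prop) continuous_hA.continuousAt h0
  have h1 : ContinuousAt (fun ξ : E3 => chi (N * (ξ.1.2 / hA ξ) - k)) ξ :=
    continuous_chi.continuousAt.comp ((hq.const_mul N).sub continuousAt_const)
  have h2 : Continuous fun ξ : E3 => chi (hA ξ / δ - i₀) := by fun_prop
  have h3 : Continuous fun ξ : E3 => chi (10 * N ^ 2 * (ξ.2 - en ξ.1)) := by fun_prop
  exact continuousAt_const.mul (h2.continuousAt.mul (h1.mul h3.continuousAt))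

theorem Adm.hasCompactSupport_amp (h : Adm δ i₀ N k) : HasCompactSupport (amp δ i₀ N k) :=
  h.isCompact_Kset.of_isClosed_subset (isClosed_tsupport _) h.tsupport_amp

theorem Adm.subset_Ureg (h : Adm δ i₀ N k) {s u : ℝ} (hs : 0 < s) (hNs : 1 ≤ N * s) (hu : |k / N - u| ≤ s) :
    Kset δ i₀ N k ⊆ Ureg N s u := by
  intro ξ hξ
  obtain ⟨a1, a2, a3, a4, a5, a6⟩ := h.bounds hξ
  have hN := h.N1
  refine ⟨by linarith, by linarith, ?_, a3.trans_lt ?_⟩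
  · have e1 := abs_mul_le hu (le_refl |hA ξ|)
    rw [abs_of_pos (by linarith : 0 < hA ξ)] at e1
    have e3 := abs_add_le (ξ.1.2 - k / N * hA ξ) ((k / N - u) * hA ξ)
    have e4 : ξ.1.2 - k / N * hA ξ + (k / N - u) * hA ξ = ξ.1.2 - u * hA ξ := by ring
    rw [e4] at e3
    have e5 : hA ξ / N ≤ s * hA ξ := by
      rw [div_le_iff₀ (by linarith)]; nlinarith
    nlinarith
  · exact one_div_lt_one_div_of_lt (by positivity) (by nlinarith)

theorem abs_amp_le (h : Adm δ i₀ N k) (ξ : E3) : |amp δ i₀ N k ξ| ≤ N ^ 2 * (Kset δ i₀ N k).indicator 1 ξ := by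
  by_cases hξ : ξ ∈ Kset δ i₀ N k
  · rw [indicator_of_mem hξ, amp, abs_mul, abs_of_nonneg (by positivity)]
    refine mul_le_mul_of_nonneg_left ?_ (by positivity)
    have hc : ∀ x, |chi x| ≤ 1 := fun x => by
      rw [abs_of_nonneg (chi_nonneg x)]; exact chi_le_one x
    refine (abs_mul_le (hc _) (abs_mul_le (hc _) (hc _))).trans (by simp)
  · rw [indicator_of_notMem hξ, h.amp_zero hξ]; simp

end

theorem card_Kset_le {δ N : ℝ} {i₀ : ℤ} (I : Finset ℤ) (h : ∀ k ∈ I, Adm δ i₀ N k) (ξ : E3) :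
    ∑ k ∈ I, (Kset δ i₀ N k).indicator (1 : E3 → ℝ≥0∞) ξ ≤
      3 * {ξ : E3 | |10 * N ^ 2 * (ξ.2 - en ξ.1)| ≤ 1}.indicator 1 ξ := by
  classical
  have e : ∑ k ∈ I, (Kset δ i₀ N k).indicator (1 : E3 → ℝ≥0∞) ξ =
      ((I.filter fun k => ξ ∈ Kset δ i₀ N k).card : ℝ≥0∞) := by
    rw [Finset.card_filter]
    push_cast
    exact Finset.sum_congr rfl fun k _ => by simp [indicator]
  rw [e]
  rcases (I.filter fun k => ξ ∈ Kset δ i₀ N k).eq_empty_or_nonempty with h0 | ⟨k0, hk0⟩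
  · rw [h0]; simp
  have hk1 := Finset.mem_filter.1 hk0
  rw [indicator_of_mem (show ξ ∈ {ξ : E3 | |10 * N ^ 2 * (ξ.2 - en ξ.1)| ≤ 1} from hk1.2.2.2)]
  have hA0 : 0 < hA ξ := by linarith [((h k0 hk1.1).bounds hk1.2).1]
  have hcard : (I.filter fun k => ξ ∈ Kset δ i₀ N k).card ≤ 3 := by
    set c := N * ξ.1.2 / hA ξ
    have : (I.filter fun k => ξ ∈ Kset δ i₀ N k) ⊆ Finset.Icc ⌈c - 1⌉ ⌊c + 1⌋ := by
      intro k hk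
      have h2 := (Finset.mem_filter.1 hk).2.2.1
      have h3 : |c - k| ≤ 1 := by
        have : c - k = (N * ξ.1.2 - k * hA ξ) / hA ξ := by simp only [c]; field_simp
        rw [this, abs_div, abs_of_pos hA0, div_le_one hA0]; exact h2
      have h4 := abs_le.1 h3
      exact Finset.mem_Icc.2 ⟨Int.ceil_le.2 (by linarith), Int.le_floor.2 (by linarith)⟩
    refine (Finset.card_le_card this).trans ?_
    rw [Int.card_Icc]
    have h5 := Int.floor_le (c + 1)
    have h6 := Int.le_ceil (c - 1)
    have h7 : (⌊c + 1⌋ : ℝ) ≤ ⌈c - 1⌉ + 2 := by linarith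
    have h8 : ⌊c + 1⌋ ≤ ⌈c - 1⌉ + 2 := by exact_mod_cast h7
    omega
  have : ((I.filter fun k => ξ ∈ Kset δ i₀ N k).card : ℝ≥0∞) ≤ (3 : ℕ) := by exact_mod_cast hcard
  simpa using this

theorem lintegral_slab {N : ℝ} (hN : 0 < N) {f : ℝ × ℝ → ℝ≥0∞} (hf : Measurable f) :
    ∫⁻ ξ : E3, {ξ : E3 | |10 * N ^ 2 * (ξ.2 - en ξ.1)| ≤ 1}.indicator 1 ξ * f ξ.1 =
      ENNReal.ofReal (1 / (5 * N ^ 2)) * ∫⁻ ξ, f ξ := by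
  have hm : MeasurableSet {ξ : E3 | |10 * N ^ 2 * (ξ.2 - en ξ.1)| ≤ 1} := by
    have h3 : Continuous fun ξ : E3 => |10 * N ^ 2 * (ξ.2 - en ξ.1)| := by fun_prop
    exact (isClosed_le h3 continuous_const).measurableSet
  have hm2 : Measurable fun ξ : E3 =>
      {ξ : E3 | |10 * N ^ 2 * (ξ.2 - en ξ.1)| ≤ 1}.indicator (1 : E3 → ℝ≥0∞) ξ * f ξ.1 :=
    (measurable_one.indicator hm).mul (hf.comp measurable_fst)
  rw [Measure.volume_eq_prod, lintegral_prod _ hm2.aemeasurable, ← lintegral_const_mul _ hf]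
  refine lintegral_congr fun ξ => ?_
  dsimp only
  have hm3 : Measurable fun ω : ℝ =>
      {ξ : E3 | |10 * N ^ 2 * (ξ.2 - en ξ.1)| ≤ 1}.indicator (1 : E3 → ℝ≥0∞) (ξ, ω) :=
    (measurable_one.indicator hm).comp measurable_prodMk_left
  rw [lintegral_mul_const _ hm3]
  congr 1
  have : (fun ω : ℝ => {ξ : E3 | |10 * N ^ 2 * (ξ.2 - en ξ.1)| ≤ 1}.indicator (1 : E3 → ℝ≥0∞) (ξ, ω)) =
      (Icc (en ξ - 1 / (10 * N ^ 2)) (en ξ + 1 / (10 * N ^ 2))).indicator 1 := by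
    ext ω
    have : (ξ, ω) ∈ {ξ : E3 | |10 * N ^ 2 * (ξ.2 - en ξ.1)| ≤ 1} ↔
        ω ∈ Icc (en ξ - 1 / (10 * N ^ 2)) (en ξ + 1 / (10 * N ^ 2)) := by
      rw [mem_ofPred_eq, abs_mul, abs_of_pos (by positivity), mul_comm, ← le_div_iff₀ (by positivity),
        abs_le, mem_Icc]
      constructor <;> rintro ⟨h1, h2⟩ <;> constructor <;> linarith
    by_cases hc : (ξ, ω) ∈ {ξ : E3 | |10 * N ^ 2 * (ξ.2 - en ξ.1)| ≤ 1}
    · rw [indicator_of_mem hc, indicator_of_mem (this.1 hc)]; rfl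
    · rw [indicator_of_notMem hc, indicator_of_notMem (fun h => hc (this.2 h))]
  rw [this, lintegral_indicator_one measurableSet_Icc, Real.volume_Icc]
  congr 1
  field_simp
  ring

/-- Coordinates on `E3`. -/
def eqv3 : E3 ≃ₗ[ℝ] (Fin 3 → ℝ) where
  toFun x := ![x.1.1, x.1.2, x.2]
  invFun v := ((v 0, v 1), v 2)
  map_add' x y := by ext i; fin_cases i <;> simp
  map_smul' c x := by ext i; fin_cases i <;> simp
  left_inv x := by simp
  right_inv v := by ext i; fin_cases i <;> simp

theorem det_lam (ρ s u : ℝ) : LinearMap.det (lam ρ s u) = -(2 * (ρ * (ρ / s) * (ρ / s ^ 2))) := by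
  rw [← LinearMap.det_toMatrix (Module.Basis.ofEquivFun eqv3), Matrix.det_fin_three]
  simp [LinearMap.toMatrix_apply, lam, eqv3, hA, hB, hC]
  ring

theorem abs_det_lam {ρ s : ℝ} (hρ : 0 < ρ) (hs : 0 < s) (u : ℝ) :
    |LinearMap.det (lam ρ s u)| = 2 * ρ ^ 3 / s ^ 3 := by
  rw [det_lam, abs_neg, abs_of_pos (by positivity)]
  field_simp

/-- The box supporting a window. -/
def wbox (ρ s u : ℝ) : Set E3 :=
  {ξ | |ρ * hA ξ| ≤ 15360 ∧ |ρ / s * hB u ξ| ≤ 15360 ∧ |ρ / s ^ 2 * hC u ξ| ≤ 15360}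

theorem isClosed_wbox (ρ s u : ℝ) : IsClosed (wbox ρ s u) := by
  have h1 : Continuous fun ξ : E3 => |ρ * hA ξ| := by fun_prop
  have h2 : Continuous fun ξ : E3 => |ρ / s * hB u ξ| := by unfold hB; fun_prop
  have h3 : Continuous fun ξ : E3 => |ρ / s ^ 2 * hC u ξ| := by unfold hC; fun_prop
  exact (isClosed_le h1 continuous_const).inter ((isClosed_le h2 continuous_const).inter
    (isClosed_le h3 continuous_const))

theorem volume_wbox {ρ s : ℝ} (hρ : 0 < ρ) (hs : 0 < s) (u : ℝ) :
    volume (wbox ρ s u) = ENNReal.ofReal (30720 ^ 3 / (2 * ρ ^ 3 / s ^ 3)) := by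
  have h : wbox ρ s u = (lam ρ s u) ⁻¹' ((Icc (-15360) 15360 ×ˢ Icc (-15360) 15360) ×ˢ Icc (-15360) 15360) := by
    ext ξ
    simp only [wbox, lam, abs_le, mem_ofPred_eq, mem_preimage, mem_prod, mem_Icc, LinearMap.coe_mk,
      AddHom.coe_mk]
    tauto
  rw [h, Measure.addHaar_preimage_linearMap _ (lam_det_ne hρ hs u), Measure.volume_eq_prod,
    Measure.prod_prod, Measure.volume_eq_prod, Measure.prod_prod, Real.volume_Icc, abs_inv,
    abs_det_lam hρ hs, ← ENNReal.ofReal_mul (by norm_num), ← ENNReal.ofReal_mul (by norm_num),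
    ← ENNReal.ofReal_mul (by positivity)]
  congr 1
  field_simp
  norm_num

theorem integrable_pair {G : E3 → ℂ} (hG : Integrable G) {g : ℝ × ℝ → ℂ} (hg : Integrable g) (z : E3) :
    Integrable (fun q : E3 × (ℝ × ℝ) => ch (z - (q.2, 0)) q.1 * (G q.1 * g q.2)) := by
  have hc : Continuous fun q : E3 × (ℝ × ℝ) => ch (z - (q.2, 0)) q.1 := by
    have := continuous_ch₂
    exact this.comp (by fun_prop : Continuous fun q : E3 × (ℝ × ℝ) => (z - (q.2, (0:ℝ)), q.1))
  exact (hG.mul_prod hg).bdd_mul hc.aestronglyMeasurable (c := 1) (ae_of_all _ fun x => by rw [norm_ch])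

theorem F3_mul_hat {G : E3 → ℂ} (hG : Integrable G) {g : ℝ × ℝ → ℂ} (hg : Integrable g) (z : E3) :
    F3 (fun ξ => G ξ * F2 g (-ξ.1)) z = ∫ y, g y * F3 G (z - (y, 0)) := by
  have e1 : F3 (fun ξ => G ξ * F2 g (-ξ.1)) z = ∫ ξ, ∫ y, ch (z - (y, 0)) ξ * (G ξ * g y) := by
    rw [F3_eq]
    refine integral_congr_ae (ae_of_all _ fun ξ => ?_)
    simp only [F2]
    rw [← integral_const_mul, ← integral_const_mul]
    refine integral_congr_ae (ae_of_all _ fun y => ?_)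
    simp only [ch]
    rw [← mul_assoc, ← mul_assoc, ← mul_assoc, mul_right_comm _ (G ξ), ← Complex.exp_add,
      mul_assoc, mul_assoc]
    congr 2
    simp; ring
  rw [e1, integral_integral_swap (integrable_pair hG hg z)]
  refine integral_congr_ae (ae_of_all _ fun y => ?_)
  simp only [F3_eq]
  rw [← integral_const_mul]
  refine integral_congr_ae (ae_of_all _ fun ξ => ?_)
  ring

/-- The denominator produced by integrating by parts. -/
def den (v w z : E3) : ℂ := (1 + Complex.I * (pr z w : ℂ)) * (1 + Complex.I * (pr z v : ℂ))

theorem normSq_one_add (x : ℝ) : ‖(1 + Complex.I * (x : ℂ))‖ ^ 2 = 1 + x ^ 2 := by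
  rw [← Complex.normSq_eq_norm_sq, Complex.normSq_apply]; simp; ring

theorem norm_den_sq (v w z : E3) : ‖den v w z‖ ^ 2 = (1 + pr z w ^ 2) * (1 + pr z v ^ 2) := by
  rw [den, norm_mul, mul_pow, normSq_one_add, normSq_one_add]

theorem one_le_norm_den (v w z : E3) : 1 ≤ ‖den v w z‖ := by
  have := norm_den_sq v w z
  nlinarith [norm_nonneg (den v w z), sq_nonneg (pr z w), sq_nonneg (pr z v),
    mul_nonneg (sq_nonneg (pr z w)) (sq_nonneg (pr z v))]

theorem continuous_den (v w : E3) : Continuous (den v w) := by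
  unfold den pr; fun_prop

theorem F3_shift_hat {F G : E3 → ℝ} {v w : E3} (hF : Integrable (fun ξ => (F ξ : ℂ)))
    (hG : Integrable (fun ξ => (G ξ : ℂ)))
    (h : ∀ z, (1 + Complex.I * (pr z w : ℂ)) * ((1 + Complex.I * (pr z v : ℂ)) *
        F3 (fun x => (F x : ℂ)) z) = F3 (fun x => (G x : ℂ)) z)
    {g : ℝ × ℝ → ℂ} (hg : Integrable g) (z : E3) :
    Integrable (fun y => (den v w (z - (y, 0)))⁻¹ * g y) ∧
    F3 (fun ξ => (F ξ : ℂ) * F2 g (-ξ.1)) z =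
      F3 (fun ξ => (G ξ : ℂ) * F2 (fun y => (den v w (z - (y, 0)))⁻¹ * g y) (-ξ.1)) z := by
  have hne : ∀ z, den v w z ≠ 0 := fun z hz => by
    have := one_le_norm_den v w z; rw [hz, norm_zero] at this; linarith
  have hi : Integrable (fun y => (den v w (z - (y, 0)))⁻¹ * g y) := by
    have hc : Continuous fun y : ℝ × ℝ => (den v w (z - (y, 0)))⁻¹ :=
      ((continuous_den v w).comp (by fun_prop)).inv₀ fun y => hne _
    refine hg.bdd_mul hc.aestronglyMeasurable (c := 1) (ae_of_all _ fun y => ?_)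
    rw [norm_inv]; exact inv_le_one_of_one_le₀ (one_le_norm_den _ _ _)
  refine ⟨hi, ?_⟩
  rw [F3_mul_hat hF hg, F3_mul_hat hG hi]
  refine integral_congr_ae (ae_of_all _ fun y => ?_)
  simp only []
  rw [← h, ← mul_assoc (1 + _)]
  change _ = (den v w _)⁻¹ * g y * (den v w _ * _)
  have := hne (z - (y, 0))
  field_simp

theorem lintegral_inv_one_add_sq {a : ℝ} (ha : a ≠ 0) (c : ℝ) :
    ∫⁻ x : ℝ, ENNReal.ofReal (1 + (c + a * x) ^ 2)⁻¹ = ENNReal.ofReal (π / |a|) := by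
  have h0 : Integrable fun x : ℝ => (1 + (c + a * x) ^ 2)⁻¹ := by
    have := (integrable_inv_one_add_sq.comp_add_left c).comp_mul_left' ha
    simpa using this
  rw [← ofReal_integral_eq_lintegral_ofReal h0 (ae_of_all _ fun x => by positivity)]
  congr 1
  have := Measure.integral_comp_mul_left (fun x : ℝ => (1 + (c + x) ^ 2)⁻¹) a
  rw [this, integral_add_left_eq_self (fun x : ℝ => (1 + x ^ 2)⁻¹), integral_univ_inv_one_add_sq,
    abs_inv]
  simp; ring

theorem lintegral_den {v1 v2 w1 w2 c d : ℝ} (hw : w2 ≠ 0) (hd : v1 * w2 - v2 * w1 ≠ 0) :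
    ∫⁻ y : ℝ × ℝ, ENNReal.ofReal (((1 + (c + (w1 * y.1 + w2 * y.2)) ^ 2) *
      (1 + (d + (v1 * y.1 + v2 * y.2)) ^ 2))⁻¹) = ENNReal.ofReal (π ^ 2 / |v1 * w2 - v2 * w1|) := by
  have hf : ∀ a b a' b' : ℝ, Measurable fun y : ℝ × ℝ => ENNReal.ofReal
      (((1 + (c + (a * y.1 + b * y.2)) ^ 2) * (1 + (d + (a' * y.1 + b' * y.2)) ^ 2))⁻¹) := by
    intros; fun_prop
  set e := v1 - v2 * w1 / w2 with he
  have he0 : e ≠ 0 := by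
    intro h0; apply hd
    have : v1 * w2 - v2 * w1 = e * w2 := by rw [he]; field_simp
    rw [this, h0, zero_mul]
  have e1 : ∀ x : ℝ, ∫⁻ y : ℝ, ENNReal.ofReal (((1 + (c + (w1 * x + w2 * y)) ^ 2) *
      (1 + (d + (v1 * x + v2 * y)) ^ 2))⁻¹) = ∫⁻ y : ℝ, ENNReal.ofReal
        (((1 + (c + (0 * x + w2 * y)) ^ 2) * (1 + (d + (e * x + v2 * y)) ^ 2))⁻¹) := by
    intro x
    rw [← lintegral_add_right_eq_self _ (-(w1 / w2 * x))]
    refine lintegral_congr fun y => ?_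
    congr 5
    · field_simp; ring
    · rw [he]; field_simp; ring
  rw [Measure.volume_eq_prod, lintegral_prod _ (hf _ _ _ _).aemeasurable]
  simp only [e1]
  rw [lintegral_lintegral_swap (hf 0 w2 e v2).aemeasurable]
  have e2 : ∀ y : ℝ, ∫⁻ x : ℝ, ENNReal.ofReal
        (((1 + (c + (0 * x + w2 * y)) ^ 2) * (1 + (d + (e * x + v2 * y)) ^ 2))⁻¹) =
      ENNReal.ofReal ((1 + (c + w2 * y) ^ 2)⁻¹) * ENNReal.ofReal (π / |e|) := by
    intro y
    rw [← lintegral_inv_one_add_sq he0 (d + v2 * y), ← lintegral_const_mul _ (by fun_prop)]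
    refine lintegral_congr fun x => ?_
    rw [mul_inv, ENNReal.ofReal_mul (by positivity)]
    congr 5 <;> ring
  simp only [e2]
  rw [lintegral_mul_const _ (by fun_prop), lintegral_inv_one_add_sq hw,
    ← ENNReal.ofReal_mul (by positivity)]
  congr 1
  have : v1 * w2 - v2 * w1 = e * w2 := by rw [he]; field_simp
  rw [this, abs_mul]
  have := abs_pos.2 he0
  have := abs_pos.2 hw
  field_simp

theorem continuous_F2 {g : ℝ × ℝ → ℂ} (hg : Integrable g) : Continuous (F2 g) := by
  unfold F2
  refine continuous_of_dominated (bound := fun ξ => ‖g ξ‖) (fun x => ?_) (fun x => ?_)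
    hg.norm (ae_of_all _ fun ξ => ?_)
  · exact (Continuous.aestronglyMeasurable (by fun_prop)).mul hg.aestronglyMeasurable
  · exact ae_of_all _ fun ξ => by rw [norm_mul, mul_comm Complex.I, Complex.norm_exp_ofReal_mul_I, one_mul]
  · fun_prop

/-- The `k`-th piece of the extension of `g` to a neighbourhood of the cone. -/
def pc (δ : ℝ) (i₀ : ℤ) (N : ℝ) (g : ℝ × ℝ → ℂ) (k : ℤ) (ξ : E3) : ℂ :=
  (amp δ i₀ N k ξ : ℂ) * F2 g (-ξ.1)

theorem cc_pc {δ N : ℝ} {i₀ k : ℤ} (h : Adm δ i₀ N k) {g : ℝ × ℝ → ℂ} (hg : Integrable g) :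
    CC (pc δ i₀ N g k) := by
  have h1 := h.continuous_amp
  have h2 := continuous_F2 hg
  refine ⟨by unfold pc; fun_prop, ?_⟩
  have h3 := h.hasCompactSupport_amp.comp_left (g := fun x : ℝ => (x : ℂ)) (by simp)
  exact h3.mul_right

theorem lintegral_mul_sq_le {α : Type*} [MeasurableSpace α] {μ : Measure α} {f g : α → ℝ≥0∞}
    (hf : AEMeasurable f μ) (hg : AEMeasurable g μ) :
    (∫⁻ x, f x * g x ∂μ) ^ 2 ≤ (∫⁻ x, f x ^ 2 ∂μ) * ∫⁻ x, g x ^ 2 ∂μ := by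
  have := ENNReal.lintegral_mul_le_Lp_mul_Lq μ Real.HolderConjugate.two_two hf hg
  have h2 := pow_le_pow_left₀ zero_le this 2
  simp only [Pi.mul_apply, ENNReal.rpow_ofNat] at h2
  refine h2.trans (le_of_eq ?_)
  rw [mul_pow, ← ENNReal.rpow_natCast, ← ENNReal.rpow_natCast, ← ENNReal.rpow_mul, ← ENNReal.rpow_mul]
  norm_num

theorem indicator_one_sq {α : Type*} (s : Set α) (x : α) :
    (s.indicator (1 : α → ℝ≥0∞) x) ^ 2 = s.indicator 1 x := by
  by_cases h : x ∈ s <;> simp [h]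

theorem enorm_F3_sq_le {G : E3 → ℝ} {K W : Set E3} {M : ℝ} (hG : BM G (K ∩ W) M) (hM : 0 ≤ M)
    (hK : MeasurableSet K) (hW : MeasurableSet W) {f : E3 → ℂ} (hf : Measurable f) (z : E3) :
    ‖F3 (fun ξ => (G ξ : ℂ) * f ξ) z‖ₑ ^ 2 ≤ ENNReal.ofReal (M ^ 2) * (volume W *
      ∫⁻ ξ, K.indicator 1 ξ * W.indicator 1 ξ * ‖f ξ‖ₑ ^ 2) := by
  have hi : ∀ {s : Set E3}, MeasurableSet s → Measurable (s.indicator (1 : E3 → ℝ≥0∞)) :=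
    fun h => measurable_one.indicator h
  have hiW := hi hW
  have hiK := hi hK
  have hfe := hf.enorm
  have hm : Measurable fun ξ => K.indicator (1 : E3 → ℝ≥0∞) ξ * W.indicator 1 ξ * ‖f ξ‖ₑ := by
    fun_prop
  have h1 : ‖F3 (fun ξ => (G ξ : ℂ) * f ξ) z‖ₑ ≤
      ∫⁻ ξ, ENNReal.ofReal M * (W.indicator 1 ξ * (K.indicator 1 ξ * W.indicator 1 ξ * ‖f ξ‖ₑ)) := by
    rw [F3_eq]
    refine (enorm_integral_le_lintegral_enorm _).trans (lintegral_mono fun ξ => ?_)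
    rw [enorm_mul, enorm_mul, ← ofReal_norm, norm_ch, ENNReal.ofReal_one, one_mul]
    by_cases h : ξ ∈ K ∩ W
    · rw [indicator_of_mem h.1, indicator_of_mem h.2]
      simp only [Pi.one_apply, one_mul]
      refine mul_le_mul_left ?_ _
      rw [← ofReal_norm, Complex.norm_real]
      exact ENNReal.ofReal_le_ofReal (hG.bd ξ)
    · rw [hG.zero ξ h]; simp
  refine (pow_le_pow_left₀ zero_le h1 2).trans ?_
  rw [lintegral_const_mul _ (by fun_prop), mul_pow,
    ENNReal.ofReal_pow hM]
  refine mul_le_mul_right ?_ _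
  refine (lintegral_mul_sq_le hiW.aemeasurable hm.aemeasurable).trans (le_of_eq ?_)
  simp only [mul_pow, indicator_one_sq]
  rw [lintegral_indicator_one hW]

theorem enorm_gw_sq_le {δ : ℝ} (hδ : 0 < δ) (hδ1 : δ ≤ 1) : ∃ C, 0 ≤ C ∧
    ∀ (s u N : ℝ) (i₀ k : ℤ), Adm δ i₀ N k → 0 < s → s ≤ 1 → 1 ≤ N * s → |k / N - u| ≤ s → |u| ≤ 3 →
    ∀ (g : ℝ × ℝ → ℂ), Integrable g → ∀ z ζ,
    Integrable (fun y => (den (pv (N ^ 2 * s ^ 2) u) (pw (N ^ 2 * s ^ 2) s u) (z - (y, 0)))⁻¹ * g y) ∧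
    ‖Gw (win (N ^ 2 * s ^ 2) s u) (pc δ i₀ N g k) z ζ‖ₑ ^ 2 ≤
      ENNReal.ofReal (C * (N ^ 4 * (N ^ 2 * s) ^ 3)) *
        (volume (wbox (N ^ 2 * s ^ 2) s u) * ∫⁻ ξ, (Kset δ i₀ N k).indicator 1 ξ *
          (wbox (N ^ 2 * s ^ 2) s u).indicator 1 (ξ - ζ) *
          ‖F2 (fun y => (den (pv (N ^ 2 * s ^ 2) u) (pw (N ^ 2 * s ^ 2) s u) (z - (y, 0)))⁻¹ * g y)
            (-ξ.1)‖ₑ ^ 2) := by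
  obtain ⟨C, hC0, hC⟩ := exists_jt_amp hδ hδ1
  refine ⟨(4 * C) ^ 2 * 2, by positivity, ?_⟩
  intro s u N i₀ k hadm hs hs1 hNs hku hu g hg z ζ
  set ρ := N ^ 2 * s ^ 2 with hρd
  have hN := hadm.N1
  have hρ : 1 ≤ ρ := by rw [hρd, ← mul_pow]; exact one_le_pow₀ hNs
  have hρ0 : 0 < ρ := by linarith
  set F : E3 → ℝ := fun ξ => win ρ s u (ξ - ζ) * amp δ i₀ N k ξ with hF
  set W : Set E3 := (fun ξ => ξ - ζ) ⁻¹' wbox ρ s u with hW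
  have hWc : IsClosed W := (isClosed_wbox ρ s u).preimage (by fun_prop)
  have hsup : tsupport F ⊆ Kset δ i₀ N k ∩ W := by
    refine closure_minimal (fun ξ hξ => ?_) ((isClosed_Kset _ _ _ _).inter hWc)
    refine ⟨?_, ?_⟩
    · by_contra hc
      exact hξ (by simp only [hF, hadm.amp_zero hc, mul_zero])
    · exact win_ne_zero (left_ne_zero_of_mul hξ)
  have hcw := (CR_win hρ0 hs u).cont
  have hca := hadm.continuous_amp
  have hFc : Continuous F := by simp only [hF]; fun_prop
  have hFs : HasCompactSupport F := hadm.hasCompactSupport_amp.mul_left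
  have hM : 0 ≤ C * (N ^ 2 * √|LinearMap.det (lam ρ s u)|) := by positivity
  obtain ⟨G, hG, hd⟩ := (hC ρ s u N i₀ k ζ hρ hs hs1 (by linarith) hρd.symm hu).F3_decay hM
    (isOpen_Ureg N s u) hFc hFs (hsup.trans (inter_subset_left.trans (hadm.subset_Ureg hs hNs hku)))
  have hGi := hG.integrable hFs
  have hFi : Integrable fun ξ => (F ξ : ℂ) :=
    (CC.mk (Complex.continuous_ofReal.comp hFc) (hFs.comp_left (g := fun x : ℝ => (x : ℂ)) (by simp))).integrable
  obtain ⟨h1, h2⟩ := F3_shift_hat hFi hGi hd hg z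
  refine ⟨h1, ?_⟩
  have e : Gw (win ρ s u) (pc δ i₀ N g k) z ζ = F3 (fun ξ => (F ξ : ℂ) * F2 g (-ξ.1)) z := by
    simp only [Gw, pc, hF]
    congr 1; ext ξ; push_cast; ring
  rw [e, h2]
  have hG' : BM G (Kset δ i₀ N k ∩ W) (4 * (C * (N ^ 2 * √|LinearMap.det (lam ρ s u)|))) :=
    ⟨hG.meas, hG.bd, fun ξ hξ => hG.zero ξ fun h => hξ (hsup h)⟩
  refine (enorm_F3_sq_le hG' (by positivity) (isClosed_Kset _ _ _ _).measurableSet hWc.measurableSet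
    ((continuous_F2 h1).comp (by fun_prop)).measurable z).trans (le_of_eq ?_)
  congr 2
  · have : √|LinearMap.det (lam ρ s u)| ^ 2 = 2 * (N ^ 2 * s) ^ 3 := by
      rw [Real.sq_sqrt (abs_nonneg _), abs_det_lam hρ0 hs, hρd]; field_simp
    linear_combination (4 * C * N ^ 2) ^ 2 * this
  · simp only [hW, sub_eq_add_neg]
    exact measure_preimage_add_right _ _ _

theorem lintegral_window {W : Set E3} (hW : MeasurableSet W) {f : E3 → ℝ≥0∞} (hf : Measurable f) :
    ∫⁻ ζ, ∫⁻ ξ, f ξ * W.indicator 1 (ξ - ζ) = volume W * ∫⁻ ξ, f ξ := by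
  have hi : Measurable (W.indicator (1 : E3 → ℝ≥0∞)) := measurable_one.indicator hW
  rw [lintegral_lintegral_swap
    ((hf.comp measurable_snd).mul (hi.comp (measurable_snd.sub measurable_fst))).aemeasurable,
    ← lintegral_const_mul _ hf]
  refine lintegral_congr fun ξ => ?_
  have hi2 : Measurable fun ζ => W.indicator (1 : E3 → ℝ≥0∞) (ξ - ζ) :=
    hi.comp (measurable_const.sub measurable_id)
  rw [lintegral_const_mul _ hi2,
    lintegral_sub_left_eq_self (fun ζ => W.indicator (1 : E3 → ℝ≥0∞) ζ) ξ, lintegral_indicator_one hW,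
    mul_comm]

/-- Total mass of hat functions against a family of pieces. -/
theorem sum_lintegral_Kset_le {δ N : ℝ} {i₀ : ℤ} {I : Finset ℤ} (hN : 0 < N)
    (h : ∀ k ∈ I, Adm δ i₀ N k) {f : ℝ × ℝ → ℂ} (h1 : Integrable f) (h2 : MemLp f 2) :
    ∑ k ∈ I, ∫⁻ ξ, (Kset δ i₀ N k).indicator 1 ξ * ‖F2 f (-ξ.1)‖ₑ ^ 2 ≤
      ENNReal.ofReal (3 / (5 * N ^ 2) * (2 * π) ^ 2) * ∫⁻ y, ‖f y‖ₑ ^ 2 := by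
  have hc := continuous_F2 h1
  have hm : Measurable fun ξ : ℝ × ℝ => ‖F2 f (-ξ)‖ₑ ^ 2 := by
    have : Continuous fun ξ : ℝ × ℝ => F2 f (-ξ) := by fun_prop
    exact this.measurable.enorm.pow_const 2
  have hm' : Measurable fun ξ : E3 => ‖F2 f (-ξ.1)‖ₑ ^ 2 := hm.comp measurable_fst
  have hK : ∀ k, Measurable ((Kset δ i₀ N k).indicator (1 : E3 → ℝ≥0∞)) := fun k =>
    measurable_one.indicator (isClosed_Kset _ _ _ _).measurableSet
  have hmk : ∀ k ∈ I, Measurable fun ξ : E3 =>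
      (Kset δ i₀ N k).indicator (1 : E3 → ℝ≥0∞) ξ * ‖F2 f (-ξ.1)‖ₑ ^ 2 := fun k _ => (hK k).mul hm'
  rw [← lintegral_finsetSum _ hmk]
  have : ∀ ξ : E3, ∑ k ∈ I, (Kset δ i₀ N k).indicator 1 ξ * ‖F2 f (-ξ.1)‖ₑ ^ 2 ≤
      3 * ({ξ : E3 | |10 * N ^ 2 * (ξ.2 - en ξ.1)| ≤ 1}.indicator 1 ξ * ‖F2 f (-ξ.1)‖ₑ ^ 2) := by
    intro ξ
    rw [← Finset.sum_mul, ← mul_assoc]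
    exact mul_le_mul_left (card_Kset_le I h ξ) _
  refine (lintegral_mono this).trans (le_of_eq ?_)
  rw [lintegral_const_mul' _ _ (by norm_num), lintegral_slab hN (f := fun ξ => ‖F2 f (-ξ)‖ₑ ^ 2) hm,
    lintegral_neg_eq_self (fun ξ : ℝ × ℝ => ‖F2 f ξ‖ₑ ^ 2), plancherel_F2 h1 h2, ← mul_assoc, ← mul_assoc]
  congr 1
  rw [show (3 : ℝ≥0∞) = ENNReal.ofReal 3 by norm_num, ← ENNReal.ofReal_mul (by norm_num),
    ← ENNReal.ofReal_mul (by positivity)]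
  congr 1; field_simp

theorem lintegral_den_le {ρ s : ℝ} (hρ : 0 < ρ) (hs : 0 < s) (u : ℝ) (z : E3) {g : ℝ × ℝ → ℂ}
    {B : ℝ≥0∞} (hg : ∀ᵐ y, ‖g y‖ₑ ≤ B) :
    ∫⁻ y, ‖(den (pv ρ u) (pw ρ s u) (z - (y, 0)))⁻¹ * g y‖ₑ ^ 2 ≤
      ENNReal.ofReal (2 * π ^ 2 * ρ ^ 2 / s) * B ^ 2 := by
  have hdet : -(pv ρ u).1.1 * -(pw ρ s u).1.2 - -(pv ρ u).1.2 * -(pw ρ s u).1.1 =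
      -((1 + u ^ 2) / 2 * s / ρ ^ 2) := by
    simp only [pv, pw]; field_simp; ring
  have hpos : 0 < (1 + u ^ 2) / 2 * s / ρ ^ 2 := by positivity
  have key := lintegral_den (c := pr z (pw ρ s u)) (d := pr z (pv ρ u)) (v1 := -(pv ρ u).1.1)
    (v2 := -(pv ρ u).1.2) (w1 := -(pw ρ s u).1.1) (w2 := -(pw ρ s u).1.2)
    (by simp only [pw]; have := div_pos hs hρ; linarith) (by rw [hdet]; linarith)
  have : ∀ᵐ y, ‖(den (pv ρ u) (pw ρ s u) (z - (y, 0)))⁻¹ * g y‖ₑ ^ 2 ≤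
      ENNReal.ofReal (((1 + (pr z (pw ρ s u) + (-(pw ρ s u).1.1 * y.1 + -(pw ρ s u).1.2 * y.2)) ^ 2) *
      (1 + (pr z (pv ρ u) + (-(pv ρ u).1.1 * y.1 + -(pv ρ u).1.2 * y.2)) ^ 2))⁻¹) * B ^ 2 := by
    filter_upwards [hg] with y hy
    rw [enorm_mul, mul_pow]
    refine mul_le_mul' (le_of_eq ?_) (pow_le_pow_left₀ zero_le hy 2)
    rw [← ofReal_norm_sq, norm_inv, inv_pow, norm_den_sq]
    congr 5 <;> simp [pr] <;> ring
  refine (lintegral_mono_ae this).trans ?_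
  rw [lintegral_mul_const _ (by fun_prop), key, hdet, abs_neg, abs_of_pos hpos]
  refine mul_le_mul_left (ENNReal.ofReal_le_ofReal ?_) _
  rw [div_le_div_iff₀ hpos hs]
  have : 2 * π ^ 2 * ρ ^ 2 * ((1 + u ^ 2) / 2 * s / ρ ^ 2) = π ^ 2 * s * (1 + u ^ 2) := by
    field_simp
  rw [this]
  nlinarith [mul_nonneg (mul_nonneg (sq_nonneg π) hs.le) (sq_nonneg u)]

theorem sum_gw_sup {δ : ℝ} (hδ : 0 < δ) (hδ1 : δ ≤ 1) : ∃ C, 0 ≤ C ∧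
    ∀ (s u N : ℝ) (i₀ : ℤ) (I : Finset ℤ), 0 < s → s ≤ 1 → 1 ≤ N * s → |u| ≤ 3 → 0 < N →
    (∀ k ∈ I, Adm δ i₀ N k ∧ |k / N - u| ≤ s) →
    ∀ (g : ℝ × ℝ → ℂ), Integrable g → ∀ B : ℝ≥0∞, B ≠ ⊤ → (∀ᵐ y, ‖g y‖ₑ ≤ B) → ∀ z,
      ∑ k ∈ I, ∫⁻ ζ, ‖Gw (win (N ^ 2 * s ^ 2) s u) (pc δ i₀ N g k) z ζ‖ₑ ^ 2 ≤ ENNReal.ofReal C * B ^ 2 := by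
  obtain ⟨C, hC0, hC⟩ := enorm_gw_sq_le hδ hδ1
  refine ⟨C * 30720 ^ 6 * π ^ 4 * (6 / 5), by positivity, ?_⟩
  intro s u N i₀ I hs hs1 hNs hu hN hI g hg B hB hgB z
  rcases I.eq_empty_or_nonempty with rfl | ⟨k0, hk0⟩
  · simp
  set ρ := N ^ 2 * s ^ 2 with hρd
  have hρ0 : 0 < ρ := by positivity
  set f : ℝ × ℝ → ℂ := fun y => (den (pv ρ u) (pw ρ s u) (z - (y, 0)))⁻¹ * g y with hf
  have hf1 : Integrable f := (hC s u N i₀ k0 (hI k0 hk0).1 hs hs1 hNs (hI k0 hk0).2 hu g hg z 0).1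
  have hfb : ∫⁻ y, ‖f y‖ₑ ^ 2 ≤ ENNReal.ofReal (2 * π ^ 2 * ρ ^ 2 / s) * B ^ 2 :=
    lintegral_den_le hρ0 hs u z hgB
  have hf2 : MemLp f 2 := by
    refine ⟨hf1.aestronglyMeasurable, ?_⟩
    rw [eLpNorm_lt_top_iff_lintegral_rpow_enorm_lt_top (by norm_num) (by norm_num)]
    simp only [ENNReal.toReal_ofNat, ENNReal.rpow_ofNat]
    exact hfb.trans_lt (ENNReal.mul_lt_top ENNReal.ofReal_lt_top (ENNReal.pow_lt_top hB.lt_top))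
  have hm' : Measurable fun ξ : E3 => ‖F2 f (-ξ.1)‖ₑ ^ 2 :=
    ((continuous_F2 hf1).comp (by fun_prop : Continuous fun ξ : E3 => -ξ.1)).measurable.enorm.pow_const 2
  have hK : ∀ k, Measurable ((Kset δ i₀ N k).indicator (1 : E3 → ℝ≥0∞)) := fun k =>
    measurable_one.indicator (isClosed_Kset _ _ _ _).measurableSet
  have hW := (isClosed_wbox ρ s u).measurableSet
  have hvol := volume_wbox hρ0 hs u
  have h1 : ∀ k ∈ I, ∫⁻ ζ, ‖Gw (win ρ s u) (pc δ i₀ N g k) z ζ‖ₑ ^ 2 ≤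
      ENNReal.ofReal (C * (N ^ 4 * (N ^ 2 * s) ^ 3)) * (volume (wbox ρ s u) *
        (volume (wbox ρ s u) * ∫⁻ ξ, (Kset δ i₀ N k).indicator 1 ξ * ‖F2 f (-ξ.1)‖ₑ ^ 2)) := by
    intro k hk
    have hmk : Measurable fun ξ : E3 =>
        (Kset δ i₀ N k).indicator (1 : E3 → ℝ≥0∞) ξ * ‖F2 f (-ξ.1)‖ₑ ^ 2 := (hK k).mul hm'
    refine (lintegral_mono fun ζ =>
      (hC s u N i₀ k (hI k hk).1 hs hs1 hNs (hI k hk).2 hu g hg z ζ).2).trans (le_of_eq ?_)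
    rw [lintegral_const_mul' _ _ (by simp), ← hρd, lintegral_const_mul' _ _ (by rw [hvol]; simp),
      ← lintegral_window hW hmk]
    congr 2
    refine lintegral_congr fun ζ => lintegral_congr fun ξ => ?_
    exact mul_right_comm _ _ _
  refine (Finset.sum_le_sum h1).trans ?_
  rw [← Finset.mul_sum, ← Finset.mul_sum, ← Finset.mul_sum]
  have h2 := (sum_lintegral_Kset_le hN (fun k hk => (hI k hk).1) hf1 hf2).trans
    (mul_le_mul_right hfb _)
  refine (mul_le_mul_right (mul_le_mul_right (mul_le_mul_right h2 _) _) _).trans (le_of_eq ?_)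
  rw [hvol, ← mul_assoc, ← mul_assoc, ← mul_assoc, ← mul_assoc, ← ENNReal.ofReal_mul (by positivity), ← ENNReal.ofReal_mul (by positivity),
    ← ENNReal.ofReal_mul (by positivity), ← ENNReal.ofReal_mul (by positivity)]
  congr 2
  rw [hρd]
  field_simp
  ring

/-- Square mean of a windowed family. -/
theorem continuous_gw {ψ : E3 → ℝ} (hw : CR ψ) {a : E3 → ℂ} (ha : CC a) :
    Continuous fun p : E3 × E3 => Gw ψ a p.1 p.2 := by
  have hwc := hw.cont
  have hac := ha.cont
  have hch := continuous_ch₂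
  obtain ⟨B, hB⟩ := hwc.bounded_above_of_compact_support hw.supp
  simp only [Gw, F3_eq]
  refine continuous_of_dominated (bound := fun ξ => B * ‖a ξ‖) (fun x => ?_) (fun x => ?_)
    (ha.integrable.norm.const_mul B) (ae_of_all _ fun ξ => ?_)
  · exact Continuous.aestronglyMeasurable (by fun_prop)
  · refine ae_of_all _ fun ξ => ?_
    rw [norm_mul, norm_ch, one_mul, norm_mul, Complex.norm_real]
    exact mul_le_mul_of_nonneg_right (hB _) (norm_nonneg _)
  · exact (hch.comp (by fun_prop : Continuous fun x : E3 × E3 => (x.1, ξ))).mul (by fun_prop)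

theorem lintegral_gw_sq_le {ρ s : ℝ} (hρ : 0 < ρ) (hs : 0 < s) (u : ℝ) {a : E3 → ℂ} (ha : CC a) :
    ∫⁻ z, ∫⁻ ζ, ‖Gw (win ρ s u) a z ζ‖ₑ ^ 2 ≤ ENNReal.ofReal ((2 * π) ^ 3 * 30720 ^ 3) * N2 a := by
  have hw := CR_win hρ hs u
  have hwc := hw.cont
  have hcont := continuous_gw hw ha
  rw [lintegral_lintegral_swap (f := fun z ζ => ‖Gw (win ρ s u) a z ζ‖ₑ ^ 2)
    (hcont.measurable.enorm.pow_const 2).aemeasurable]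
  have h1 : ∀ ζ, ∫⁻ z, ‖Gw (win ρ s u) a z ζ‖ₑ ^ 2 = ENNReal.ofReal ((2 * π) ^ 3) *
      ∫⁻ η, ENNReal.ofReal (win ρ s u (η - ζ) ^ 2) * ‖a η‖ₑ ^ 2 := by
    intro ζ
    refine (N2_F3 (hw.window ha ζ)).trans ?_
    congr 1
    refine lintegral_congr fun η => ?_
    rw [enorm_mul, mul_pow, ← ofReal_norm_sq, Complex.norm_real, Real.norm_eq_abs, sq_abs]
  simp only [h1]
  rw [lintegral_const_mul' _ _ (by simp), lintegral_lintegral_swap, ENNReal.ofReal_mul (by positivity),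
    mul_assoc]
  · refine mul_le_mul_right ?_ _
    rw [N2, ← lintegral_const_mul' _ _ (by simp)]
    refine lintegral_mono fun η => ?_
    dsimp only
    rw [lintegral_mul_const' _ _ (by simp [ENNReal.pow_eq_top_iff])]
    refine mul_le_mul_left ?_ _
    rw [lintegral_sub_left_eq_self (fun ζ => ENNReal.ofReal (win ρ s u ζ ^ 2)),
      ← ofReal_integral_eq_lintegral_ofReal _ (ae_of_all _ fun _ => by positivity)]
    · refine ENNReal.ofReal_le_ofReal ((le_of_eq ?_).trans (kap_win_le hρ hs u 0))
      rw [kap]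
      refine integral_congr_ae (ae_of_all _ fun ζ => ?_)
      simp [sq]
    · simp only [sq]
      exact (hwc.mul hwc).integrable_of_hasCompactSupport hw.supp.mul_left
  · refine Measurable.aemeasurable ?_
    have h2 := ha.cont
    have h3 : Measurable fun p : E3 × E3 => win ρ s u (p.2 - p.1) ^ 2 := Continuous.measurable (by fun_prop)
    have h4 : Measurable fun p : E3 × E3 => ‖a p.2‖ₑ ^ 2 :=
      (h2.comp continuous_snd).measurable.enorm.pow_const 2
    exact h3.ennreal_ofReal.mul h4

theorem N2_pc_le {δ N : ℝ} {i₀ : ℤ} {I : Finset ℤ} (hN : 0 < N)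
    (h : ∀ k ∈ I, Adm δ i₀ N k) {g : ℝ × ℝ → ℂ} (h1 : Integrable g) (h2 : MemLp g 2) :
    ∑ k ∈ I, N2 (pc δ i₀ N g k) ≤
      ENNReal.ofReal (3 / 5 * N ^ 2 * (2 * π) ^ 2) * ∫⁻ y, ‖g y‖ₑ ^ 2 := by
  have h3 : ∀ k ∈ I, N2 (pc δ i₀ N g k) ≤ ENNReal.ofReal (N ^ 4) *
      ∫⁻ ξ, (Kset δ i₀ N k).indicator 1 ξ * ‖F2 g (-ξ.1)‖ₑ ^ 2 := by
    intro k hk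
    rw [N2, ← lintegral_const_mul' _ _ (by simp)]
    refine lintegral_mono fun ξ => ?_
    dsimp only
    rw [pc, enorm_mul, mul_pow, ← mul_assoc]
    refine mul_le_mul_left ?_ _
    rw [← ofReal_norm_sq, Complex.norm_real]
    have h4 := abs_amp_le (h k hk) ξ
    by_cases hξ : ξ ∈ Kset δ i₀ N k
    · rw [indicator_of_mem hξ] at h4 ⊢
      simp only [Pi.one_apply, mul_one] at h4 ⊢
      refine ENNReal.ofReal_le_ofReal ((pow_le_pow_left₀ (norm_nonneg _) h4 2).trans (le_of_eq ?_))
      ring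
    · rw [(h k hk).amp_zero hξ]; simp
  refine (Finset.sum_le_sum h3).trans ?_
  rw [← Finset.mul_sum]
  refine (mul_le_mul_right (sum_lintegral_Kset_le hN h h1 h2) _).trans (le_of_eq ?_)
  rw [← mul_assoc, ← ENNReal.ofReal_mul (by positivity)]
  congr 2
  field_simp

theorem lintegral_Ioi_rpow_indicator {a : ℝ} (ha : 0 < a) {T : ℝ} (hT : 0 ≤ T) :
    ∫⁻ t in Ioi (0 : ℝ), (Iio T).indicator (fun t => ENNReal.ofReal (t ^ (a - 1))) t =
      ENNReal.ofReal (T ^ a / a) := by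
  rw [lintegral_indicator measurableSet_Iio, Measure.restrict_restrict measurableSet_Iio,
    Iio_inter_Ioi, ← ofReal_integral_eq_lintegral_ofReal]
  · rw [← integral_Ioc_eq_integral_Ioo, ← intervalIntegral.integral_of_le hT,
      integral_rpow (Or.inl (by linarith)), sub_add_cancel, zero_rpow ha.ne', sub_zero]
  · have := (intervalIntegral.intervalIntegrable_rpow' (a := 0) (b := T) (r := a - 1) (by linarith))
    exact ((intervalIntegrable_iff_integrableOn_Ioc_of_le hT).1 this).mono_set Ioo_subset_Ioc_self
  · exact (ae_restrict_iff' measurableSet_Ioo).2 (ae_of_all _ fun t ht => rpow_nonneg ht.1.le _)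

theorem rpow_le_lintegral_layer {p q : ℝ} (hp : 0 < p) (hpq : p < q) {F : ℝ≥0∞} (hF : F ≠ ⊤) :
    F ^ q ≤ ENNReal.ofReal (2 ^ q * (q - p)) * ∫⁻ t in Ioi (0 : ℝ),
      ENNReal.ofReal (t ^ (q - p - 1)) * (F - ENNReal.ofReal t) ^ p := by
  obtain ⟨f, hf, rfl⟩ : ∃ f : ℝ, 0 ≤ f ∧ F = ENNReal.ofReal f :=
    ⟨F.toReal, ENNReal.toReal_nonneg, (ENNReal.ofReal_toReal hF).symm⟩
  have hf2 : 0 ≤ f / 2 := by linarith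
  have h1 : ENNReal.ofReal ((f / 2) ^ (q - p) / (q - p)) * ENNReal.ofReal ((f / 2) ^ p) ≤
      ∫⁻ t in Ioi (0 : ℝ), ENNReal.ofReal (t ^ (q - p - 1)) * (ENNReal.ofReal f - ENNReal.ofReal t) ^ p := by
    rw [← lintegral_Ioi_rpow_indicator (by linarith) hf2, ← lintegral_mul_const' _ _ (by simp)]
    refine setLIntegral_mono' measurableSet_Ioi fun t (ht : 0 < t) => ?_
    by_cases h : t ∈ Iio (f / 2)
    · rw [indicator_of_mem h]
      have h' : t < f / 2 := h
      refine mul_le_mul_right ?_ _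
      rw [← ENNReal.ofReal_sub _ ht.le, ENNReal.ofReal_rpow_of_nonneg (by linarith) hp.le]
      exact ENNReal.ofReal_le_ofReal (rpow_le_rpow hf2 (by linarith) hp.le)
    · rw [indicator_of_notMem h, zero_mul]; exact zero_le
  refine le_trans (le_of_eq ?_) (mul_le_mul_right h1 _)
  have hqp : 0 < q - p := by linarith
  rw [ENNReal.ofReal_rpow_of_nonneg hf (by linarith), ← ENNReal.ofReal_mul (by positivity),
    ← ENNReal.ofReal_mul (by positivity)]
  congr 1
  have : (f / 2) ^ q = (f / 2) ^ (q - p) * (f / 2) ^ p := by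
    rw [← rpow_add_of_nonneg hf2 hqp.le hp.le, sub_add_cancel]
  calc f ^ q = 2 ^ q * (f / 2) ^ q := by rw [← mul_rpow (by norm_num) hf2]; congr 1; ring
    _ = _ := by rw [this]; field_simp

/-- A Marcinkiewicz-type lemma: control of the truncated moments of `F` at all heights
gives control of a higher moment. -/
theorem lintegral_rpow_le_of_layer {X Y : Type*} [MeasurableSpace X] [MeasurableSpace Y]
    {μ : Measure X} {ν : Measure Y} [SFinite μ] [SFinite ν] {p q : ℝ} (hp : 0 < p) (hpq : p < q)
    {F : X → ℝ≥0∞} (hFm : Measurable F) (hF : ∀ x, F x ≠ ⊤) {h : Y → ℝ≥0∞} (hh : Measurable h)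
    {τ : Y → ℝ} (hτ : Measurable τ) (hτ0 : ∀ y, 0 ≤ τ y) {A : ℝ≥0∞} (hA : A ≠ ⊤)
    (H : ∀ t : ℝ, 0 < t → ∫⁻ x, (F x - ENNReal.ofReal t) ^ p ∂μ ≤
      A * ∫⁻ y, {y | t < τ y}.indicator h y ∂ν) :
    ∫⁻ x, F x ^ q ∂μ ≤ ENNReal.ofReal (2 ^ q) * A * ∫⁻ y, h y * ENNReal.ofReal (τ y ^ (q - p)) ∂ν := by
  have hqp : 0 < q - p := by linarith
  have hm1 : Measurable fun z : X × ℝ => ENNReal.ofReal (z.2 ^ (q - p - 1)) *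
      (F z.1 - ENNReal.ofReal z.2) ^ p := by fun_prop
  have hm2 : Measurable fun z : Y × ℝ => (Iio (τ z.1)).indicator
      (fun t => ENNReal.ofReal (t ^ (q - p - 1))) z.2 * h z.1 := by
    have hs : MeasurableSet {z : Y × ℝ | z.2 < τ z.1} :=
      measurableSet_lt measurable_snd (hτ.comp measurable_fst)
    have hw : Measurable fun z : Y × ℝ => ENNReal.ofReal (z.2 ^ (q - p - 1)) := by fun_prop
    have := (hw.indicator hs).mul (hh.comp measurable_fst)
    exact this
  calc ∫⁻ x, F x ^ q ∂μ
      ≤ ∫⁻ x, (ENNReal.ofReal (2 ^ q * (q - p)) * ∫⁻ t in Ioi (0 : ℝ),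
        ENNReal.ofReal (t ^ (q - p - 1)) * (F x - ENNReal.ofReal t) ^ p) ∂μ :=
        lintegral_mono fun x => rpow_le_lintegral_layer hp hpq (hF x)
    _ = ENNReal.ofReal (2 ^ q * (q - p)) * ∫⁻ t in Ioi (0 : ℝ), ENNReal.ofReal (t ^ (q - p - 1)) *
          ∫⁻ x, (F x - ENNReal.ofReal t) ^ p ∂μ := by
        rw [lintegral_const_mul' _ _ (by simp), lintegral_lintegral_swap hm1.aemeasurable]
        congr 1
        refine lintegral_congr fun t => ?_
        rw [lintegral_const_mul' _ _ (by simp)]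
    _ ≤ ENNReal.ofReal (2 ^ q * (q - p)) * ∫⁻ t in Ioi (0 : ℝ), A * 
          ∫⁻ y, (Iio (τ y)).indicator (fun t => ENNReal.ofReal (t ^ (q - p - 1))) t * h y ∂ν := by
        refine mul_le_mul_right (setLIntegral_mono' measurableSet_Ioi fun t ht => ?_) _
        refine (mul_le_mul_right (H t ht) _).trans (le_of_eq ?_)
        rw [mul_left_comm, ← lintegral_const_mul' _ _ (by simp)]
        congr 1
        refine lintegral_congr fun y => ?_
        by_cases hy : t < τ y
        · rw [indicator_of_mem (s := {y | t < τ y}) hy, indicator_of_mem (s := Iio (τ y)) hy]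
        · rw [indicator_of_notMem (s := {y | t < τ y}) hy, indicator_of_notMem (s := Iio (τ y)) hy]
          simp
    _ = ENNReal.ofReal (2 ^ q * (q - p)) * (A * ∫⁻ y, ENNReal.ofReal (τ y ^ (q - p) / (q - p)) * h y ∂ν) := by
        rw [lintegral_const_mul' _ _ hA, ← lintegral_lintegral_swap hm2.aemeasurable]
        congr 2
        refine lintegral_congr fun y => ?_
        rw [lintegral_mul_const, lintegral_Ioi_rpow_indicator hqp (hτ0 y)]
        exact Measurable.indicator (by fun_prop) measurableSet_Iio
    _ = _ := by
        have : ∀ y, ENNReal.ofReal (τ y ^ (q - p) / (q - p)) * h y =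
            ENNReal.ofReal (q - p)⁻¹ * (h y * ENNReal.ofReal (τ y ^ (q - p))) := fun y => by
          rw [div_eq_inv_mul, ENNReal.ofReal_mul (by positivity)]; ring
        simp only [this]
        rw [lintegral_const_mul' _ _ (by simp), ENNReal.ofReal_mul (by positivity)]
        have h2 : ENNReal.ofReal (q - p) * ENNReal.ofReal (q - p)⁻¹ = 1 := by
          rw [← ENNReal.ofReal_mul hqp.le, mul_inv_cancel₀ hqp.ne', ENNReal.ofReal_one]
        calc _ = ENNReal.ofReal (2 ^ q) * A * (ENNReal.ofReal (q - p) * ENNReal.ofReal (q - p)⁻¹) *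
            ∫⁻ y, h y * ENNReal.ofReal (τ y ^ (q - p)) ∂ν := by ring
          _ = _ := by rw [h2, mul_one]

theorem lintegral_count_prod {ι X : Type*} [MeasurableSpace X] {μ : Measure X} [SFinite μ]
    (J : Finset ι) {f : ι → X → ℝ≥0∞} (hf : ∀ i ∈ J, Measurable (f i)) {φ : ℝ≥0∞ → ℝ≥0∞}
    (hφ : Measurable φ) :
    letI : MeasurableSpace J := ⊤
    ∫⁻ z : J × X, φ (f z.1 z.2) ∂(Measure.count.prod μ) = ∑ i ∈ J, ∫⁻ x, φ (f i x) ∂μ := by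
  let _ : MeasurableSpace J := ⊤
  have hm : Measurable fun z : J × X => φ (f z.1 z.2) :=
    hφ.comp (measurable_from_prod_countable_right fun i => hf i i.2)
  rw [lintegral_prod _ hm.aemeasurable, lintegral_count, tsum_fintype]
  exact Finset.sum_coe_sort J fun i => ∫⁻ x, φ (f i x) ∂μ

theorem sum_lintegral_rpow_le_of_layer {ι X Y : Type*} [MeasurableSpace X] [MeasurableSpace Y]
    {μ : Measure X} {ν : Measure Y} [SFinite μ] [SFinite ν] {p q : ℝ} (hp : 0 < p) (hpq : p < q)
    (J : Finset ι) {F : ι → X → ℝ≥0∞} (hFm : ∀ i ∈ J, Measurable (F i)) (hF : ∀ i ∈ J, ∀ x, F i x ≠ ⊤)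
    {h : Y → ℝ≥0∞} (hh : Measurable h)
    {τ : Y → ℝ} (hτ : Measurable τ) (hτ0 : ∀ y, 0 ≤ τ y) {A : ℝ≥0∞} (hA : A ≠ ⊤)
    (H : ∀ t : ℝ, 0 < t → ∑ i ∈ J, ∫⁻ x, (F i x - ENNReal.ofReal t) ^ p ∂μ ≤
      A * ∫⁻ y, {y | t < τ y}.indicator h y ∂ν) :
    ∑ i ∈ J, ∫⁻ x, F i x ^ q ∂μ ≤
      ENNReal.ofReal (2 ^ q) * A * ∫⁻ y, h y * ENNReal.ofReal (τ y ^ (q - p)) ∂ν := by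
  let _ : MeasurableSpace J := ⊤
  have key := lintegral_rpow_le_of_layer (μ := (Measure.count : Measure J).prod μ) (ν := ν) hp hpq
    (F := fun z => F z.1 z.2) (measurable_from_prod_countable_right fun i => hFm i i.2)
    (fun z => hF z.1 z.1.2 z.2) hh hτ hτ0 hA fun t ht => by
      have := lintegral_count_prod (μ := μ) J hFm (φ := fun v => (v - ENNReal.ofReal t) ^ p) (by fun_prop)
      exact this.trans_le (H t ht)
  exact (lintegral_count_prod (μ := μ) J hFm (φ := fun v => v ^ q) (by fun_prop)).symm.trans_le key

theorem F2_add {g h : ℝ × ℝ → ℂ} (hg : Integrable g) (hh : Integrable h) (z : ℝ × ℝ) :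
    F2 (g + h) z = F2 g z + F2 h z := by
  have key : ∀ {f : ℝ × ℝ → ℂ}, Integrable f →
      Integrable fun ξ : ℝ × ℝ => Complex.exp (Complex.I * ((z.1 * ξ.1 + z.2 * ξ.2 : ℝ) : ℂ)) * f ξ := by
    intro f hf
    refine hf.norm.mono' ((Continuous.aestronglyMeasurable (by fun_prop)).mul hf.aestronglyMeasurable)
      (ae_of_all _ fun ξ => ?_)
    rw [norm_mul, mul_comm Complex.I, Complex.norm_exp_ofReal_mul_I, one_mul]
  rw [F2, F2, F2, ← integral_add (key hg) (key hh)]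
  simp only [Pi.add_apply, mul_add]

theorem gw_pc_add {δ N : ℝ} {i₀ k : ℤ} (hk : Adm δ i₀ N k) {ψ : E3 → ℝ} (hψ : CR ψ)
    {g h : ℝ × ℝ → ℂ} (hg : Integrable g) (hh : Integrable h) (z ζ : E3) :
    Gw ψ (pc δ i₀ N (g + h) k) z ζ = Gw ψ (pc δ i₀ N g k) z ζ + Gw ψ (pc δ i₀ N h k) z ζ := by
  have := Gw_sum hψ (s := {true, false}) (a := fun b : Bool => pc δ i₀ N (if b then g else h) k)
    (fun b _ => by cases b <;> exact cc_pc hk (by simpa)) z ζ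
  simp only [Finset.mem_singleton, Bool.true_eq_false, not_false_eq_true, Finset.sum_insert,
    Finset.sum_singleton, if_true, Bool.false_eq_true, if_false] at this
  rw [← this]
  congr 1
  funext ξ
  rw [pc, F2_add hg hh, mul_add]
  rfl

/-- The local square function of the pieces in `I`. -/
def Qf (ψ : E3 → ℝ) (δ : ℝ) (i₀ : ℤ) (N : ℝ) (I : Finset ℤ) (g : ℝ × ℝ → ℂ) (z : E3) : ℝ≥0∞ :=
  ∑ k ∈ I, ∫⁻ ζ, ‖Gw ψ (pc δ i₀ N g k) z ζ‖ₑ ^ 2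

theorem enorm_add_sq_le (a b : ℂ) : ‖a + b‖ₑ ^ 2 ≤ 2 * ‖a‖ₑ ^ 2 + 2 * ‖b‖ₑ ^ 2 := by
  rw [← ofReal_norm_sq, ← ofReal_norm_sq, ← ofReal_norm_sq, ← ENNReal.ofReal_ofNat 2,
    ← ENNReal.ofReal_mul (by norm_num), ← ENNReal.ofReal_mul (by norm_num),
    ← ENNReal.ofReal_add (by positivity) (by positivity)]
  refine ENNReal.ofReal_le_ofReal ?_
  have := pow_le_pow_left₀ (norm_nonneg _) (norm_add_le a b) 2
  nlinarith [sq_nonneg (‖a‖ - ‖b‖)]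

section
variable {δ N : ℝ} {i₀ : ℤ} {I : Finset ℤ} {ψ : E3 → ℝ}

theorem Qf_add_le (hI : ∀ k ∈ I, Adm δ i₀ N k) (hψ : CR ψ)
    {g h : ℝ × ℝ → ℂ} (hg : Integrable g) (hh : Integrable h) (z : E3) :
    Qf ψ δ i₀ N I (g + h) z ≤ 2 * Qf ψ δ i₀ N I g z + 2 * Qf ψ δ i₀ N I h z := by
  simp only [Qf, Finset.mul_sum]
  rw [← Finset.sum_add_distrib]
  refine Finset.sum_le_sum fun k hk => ?_
  have hm : ∀ {f : ℝ × ℝ → ℂ}, Integrable f → Measurable fun ζ => ‖Gw ψ (pc δ i₀ N f k) z ζ‖ₑ ^ 2 := by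
    intro f hf
    have h1 := continuous_gw hψ (cc_pc (hI k hk) hf)
    exact (h1.comp (by fun_prop : Continuous fun ζ : E3 => (z, ζ))).measurable.enorm.pow_const 2
  rw [← lintegral_const_mul' _ _ (by simp), ← lintegral_const_mul' _ _ (by simp),
    ← lintegral_add_left ((hm hg).const_mul 2)]
  refine lintegral_mono fun ζ => ?_
  rw [gw_pc_add (hI k hk) hψ hg hh]
  exact enorm_add_sq_le _ _

theorem lintegral_gw_ne_top (hψ : CR ψ) {a : E3 → ℂ} (ha : CC a) (z : E3) :
    ∫⁻ ζ, ‖Gw ψ a z ζ‖ₑ ^ 2 = ENNReal.ofReal (∫ ζ, ‖Gw ψ a z ζ‖ ^ 2) := by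
  rw [ofReal_integral_eq_lintegral_ofReal (integrable_gw_sq hψ ha z) (ae_of_all _ fun _ => by positivity)]
  exact lintegral_congr fun ζ => (ofReal_norm_sq _).symm

theorem Qf_eq (hI : ∀ k ∈ I, Adm δ i₀ N k) (hψ : CR ψ) {g : ℝ × ℝ → ℂ} (hg : Integrable g) (z : E3) :
    Qf ψ δ i₀ N I g z = ENNReal.ofReal (∑ k ∈ I, ∫ ζ, ‖Gw ψ (pc δ i₀ N g k) z ζ‖ ^ 2) := by
  rw [Qf, ENNReal.ofReal_sum_of_nonneg fun k _ => integral_nonneg fun _ => by positivity]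
  exact Finset.sum_congr rfl fun k hk => lintegral_gw_ne_top hψ (cc_pc (hI k hk) hg) z

theorem measurable_Qf (hI : ∀ k ∈ I, Adm δ i₀ N k) (hψ : CR ψ) {g : ℝ × ℝ → ℂ} (hg : Integrable g) :
    Measurable (Qf ψ δ i₀ N I g) := by
  unfold Qf
  refine Finset.measurable_fun_sum _ fun k hk => ?_
  exact ((continuous_gw hψ (cc_pc (hI k hk) hg)).measurable.enorm.pow_const 2).lintegral_prod_right'

end

theorem sum_lintegral_Qf_sq_le {δ : ℝ} (hδ : 0 < δ) (hδ1 : δ ≤ 1) : ∃ C, 0 ≤ C ∧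
    ∀ (s N : ℝ) (i₀ : ℤ) (I : Finset ℤ) (f : ℤ → ℤ) (u : ℤ → ℝ), 0 < s → s ≤ 1 → 1 ≤ N * s → 0 < N →
    (∀ k ∈ I, Adm δ i₀ N k ∧ |k / N - u (f k)| ≤ s ∧ |u (f k)| ≤ 3) →
    ∀ (g : ℝ × ℝ → ℂ), Measurable g → Integrable g →
      ∑ i ∈ I.image f, ∫⁻ z, Qf (win (N ^ 2 * s ^ 2) s (u i)) δ i₀ N {k ∈ I | f k = i} g z ^ 2 ≤
        ENNReal.ofReal (C * N ^ 2) * ∫⁻ y, ‖g y‖ₑ ^ 4 := by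
  obtain ⟨C, hC0, hC⟩ := sum_gw_sup hδ hδ1
  refine ⟨4 * (2 * ((2 * π) ^ 3 * 30720 ^ 3 * (3 / 5 * (2 * π) ^ 2))) * (2 * (C + 1)),
    by positivity, ?_⟩
  intro s N i₀ I f u hs hs1 hNs hN hI g hgm hg
  have hρ : 0 < N ^ 2 * s ^ 2 := by positivity
  have hw : ∀ i, CR (win (N ^ 2 * s ^ 2) s (u i)) := fun i => CR_win hρ hs _
  have hI' : ∀ i, ∀ k ∈ ({k ∈ I | f k = i} : Finset ℤ), Adm δ i₀ N k := fun i k hk =>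
    (hI k (Finset.mem_filter.1 hk).1).1
  have hu : ∀ i ∈ I.image f, |u i| ≤ 3 := by
    intro i hi
    obtain ⟨k, hk, rfl⟩ := Finset.mem_image.1 hi
    exact (hI k hk).2.2
  by_cases h4 : ∫⁻ y, ‖g y‖ₑ ^ 4 = ⊤
  · rw [h4, ENNReal.mul_top]
    · exact le_top
    · exact (ENNReal.ofReal_pos.2 (by positivity)).ne'
  have key := sum_lintegral_rpow_le_of_layer (μ := (volume : Measure E3)) (ν := (volume : Measure (ℝ × ℝ)))
    one_pos one_lt_two (I.image f)
    (F := fun i => Qf (win (N ^ 2 * s ^ 2) s (u i)) δ i₀ N {k ∈ I | f k = i} g)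
    (fun i _ => measurable_Qf (hI' i) (hw i) hg)
    (fun i _ z => by rw [Qf_eq (hI' i) (hw i) hg]; exact ENNReal.ofReal_ne_top)
    (h := fun y => ‖g y‖ₑ ^ 2) (by fun_prop) (τ := fun y => 2 * (C + 1) * ‖g y‖ ^ 2) (by fun_prop)
    (fun y => by positivity)
    (A := ENNReal.ofReal (2 * ((2 * π) ^ 3 * 30720 ^ 3 * (3 / 5 * N ^ 2 * (2 * π) ^ 2)))) ENNReal.ofReal_ne_top ?_
  · have e1 : ∀ x : ℝ≥0∞, x ^ (2 : ℝ) = x ^ 2 := fun x => by simp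
    simp only [e1] at key
    refine key.trans (le_of_eq ?_)
    have e2 : ∀ y, ‖g y‖ₑ ^ 2 * ENNReal.ofReal ((2 * (C + 1) * ‖g y‖ ^ 2) ^ ((2 : ℝ) - 1)) =
        ENNReal.ofReal (2 * (C + 1)) * ‖g y‖ₑ ^ 4 := fun y => by
      rw [show (2 : ℝ) - 1 = 1 by norm_num, rpow_one, ENNReal.ofReal_mul (by positivity), ofReal_norm_sq]
      ring
    simp only [e2]
    rw [lintegral_const_mul' _ _ ENNReal.ofReal_ne_top, ← mul_assoc, ← ENNReal.ofReal_mul (by positivity),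
      ← ENNReal.ofReal_mul (by positivity)]
    congr 2
    rw [show ((2 : ℝ) ^ (2 : ℝ)) = 4 by norm_num]
    ring
  intro t ht
  set S : Set (ℝ × ℝ) := {y | t < 2 * (C + 1) * ‖g y‖ ^ 2} with hS
  have hSm : MeasurableSet S := measurableSet_lt measurable_const (by fun_prop)
  have hgS : Integrable (S.indicator g) := hg.indicator hSm
  have hgS' : Integrable (Sᶜ.indicator g) := hg.indicator hSm.compl
  have hsplit : S.indicator g + Sᶜ.indicator g = g := indicator_self_add_compl S g
  set b := t / (2 * (C + 1)) with hb
  have hb0 : 0 < b := by positivity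
  have hsmall : ∀ y, ‖Sᶜ.indicator g y‖ₑ ≤ ENNReal.ofReal (√b) := by
    intro y
    by_cases hy : y ∈ S
    · simp [hy]
    · rw [indicator_of_mem (by simpa using hy), ← ofReal_norm]
      refine ENNReal.ofReal_le_ofReal (le_sqrt_of_sq_le ?_)
      have : ¬ t < 2 * (C + 1) * ‖g y‖ ^ 2 := hy
      rw [hb, le_div_iff₀ (by positivity)]; linarith
  have hbig : ∀ y, ‖S.indicator g y‖ₑ ^ 2 = S.indicator (fun y => ‖g y‖ₑ ^ 2) y := by
    intro y
    by_cases hy : y ∈ S <;> simp [hy]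
  have hL2 : MemLp (S.indicator g) 2 := by
    refine ⟨hgS.aestronglyMeasurable, ?_⟩
    rw [eLpNorm_lt_top_iff_lintegral_rpow_enorm_lt_top (by norm_num) (by norm_num)]
    simp only [ENNReal.toReal_ofNat, ENNReal.rpow_ofNat, hbig]
    have h5 := ENNReal.mul_lt_top (ENNReal.ofReal_lt_top (r := b⁻¹)) (lt_top_iff_ne_top.2 h4)
    rw [← lintegral_const_mul' _ _ ENNReal.ofReal_ne_top] at h5
    refine lt_of_le_of_lt (lintegral_mono fun y => ?_) h5
    by_cases hy : y ∈ S
    · rw [indicator_of_mem hy]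
      have h1 : b < ‖g y‖ ^ 2 := by
        have : t < 2 * (C + 1) * ‖g y‖ ^ 2 := hy
        rw [hb, div_lt_iff₀ (by positivity)]; linarith
      have h2 : (1 : ℝ≥0∞) ≤ ENNReal.ofReal b⁻¹ * ‖g y‖ₑ ^ 2 := by
        rw [← ofReal_norm_sq, ← ENNReal.ofReal_mul (by positivity)]
        refine ENNReal.one_le_ofReal.2 ?_
        rw [inv_mul_eq_div, one_le_div hb0]; exact h1.le
      calc ‖g y‖ₑ ^ 2 = 1 * ‖g y‖ₑ ^ 2 := (one_mul _).symm
        _ ≤ ENNReal.ofReal b⁻¹ * ‖g y‖ₑ ^ 2 * ‖g y‖ₑ ^ 2 := mul_le_mul_left h2 _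
        _ = _ := by ring
    · rw [indicator_of_notMem hy]; exact zero_le
  have hQ : ∀ i ∈ I.image f, ∀ z, (Qf (win (N ^ 2 * s ^ 2) s (u i)) δ i₀ N {k ∈ I | f k = i} g z -
      ENNReal.ofReal t) ^ (1 : ℝ) ≤
      2 * Qf (win (N ^ 2 * s ^ 2) s (u i)) δ i₀ N {k ∈ I | f k = i} (S.indicator g) z := by
    intro i hi z
    rw [ENNReal.rpow_one]
    refine tsub_le_iff_right.2 ?_
    conv_lhs => rw [← hsplit]
    refine (Qf_add_le (hI' i) (hw i) hgS hgS' z).trans (add_le_add_right ?_ _)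
    refine (mul_le_mul_right (hC s (u i) N i₀ {k ∈ I | f k = i} hs hs1 hNs (hu i hi) hN (fun k hk => ?_)
      _ hgS' _ ENNReal.ofReal_ne_top (ae_of_all _ hsmall) z) 2).trans ?_
    · obtain ⟨hk', rfl⟩ := Finset.mem_filter.1 hk
      exact ⟨(hI k hk').1, (hI k hk').2.1⟩
    · rw [← ENNReal.ofReal_pow (sqrt_nonneg _), sq_sqrt hb0.le, ← ENNReal.ofReal_ofNat 2,
        ← ENNReal.ofReal_mul hC0, ← ENNReal.ofReal_mul (by norm_num)]
      refine ENNReal.ofReal_le_ofReal ?_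
      rw [hb, mul_div_assoc', mul_div_assoc', div_le_iff₀ (by positivity)]
      nlinarith
  calc _ ≤ ∑ i ∈ I.image f, ∫⁻ z,
        2 * Qf (win (N ^ 2 * s ^ 2) s (u i)) δ i₀ N {k ∈ I | f k = i} (S.indicator g) z :=
        Finset.sum_le_sum fun i hi => lintegral_mono (hQ i hi)
    _ ≤ ∑ i ∈ I.image f, ∑ k ∈ I with f k = i, ENNReal.ofReal (2 * ((2 * π) ^ 3 * 30720 ^ 3)) *
          N2 (pc δ i₀ N (S.indicator g) k) := by
        refine Finset.sum_le_sum fun i hi => ?_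
        unfold Qf
        rw [lintegral_const_mul' _ _ (by simp), lintegral_finsetSum', Finset.mul_sum]
        · refine Finset.sum_le_sum fun k hk => ?_
          rw [ENNReal.ofReal_mul (by norm_num), mul_assoc, ENNReal.ofReal_ofNat]
          exact mul_le_mul_right (lintegral_gw_sq_le hρ hs (u i) (cc_pc (hI' i k hk) hgS)) _
        · intro k hk
          exact ((continuous_gw (hw i) (cc_pc (hI' i k hk) hgS)).measurable.enorm.pow_const
            2).lintegral_prod_right'.aemeasurable
    _ = ENNReal.ofReal (2 * ((2 * π) ^ 3 * 30720 ^ 3)) * ∑ k ∈ I, N2 (pc δ i₀ N (S.indicator g) k) := by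
        rw [Finset.sum_fiberwise_of_maps_to fun k hk => Finset.mem_image_of_mem f hk, Finset.mul_sum]
    _ ≤ _ := by
        refine (mul_le_mul_right (N2_pc_le hN (fun k hk => (hI k hk).1) hgS hL2) _).trans (le_of_eq ?_)
        rw [← mul_assoc, ← ENNReal.ofReal_mul (by positivity)]
        congr 1
        · congr 1; ring
        · exact lintegral_congr hbig

theorem sc_eq_inv (n : ℕ) : sc n = ((2 : ℝ) ^ n)⁻¹ := by rw [sc, one_div, inv_pow]

theorem Adm.pc_supp {δ N : ℝ} {i₀ k : ℤ} (h : Adm δ i₀ N k) {g : ℝ × ℝ → ℂ} {ξ : E3}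
    (hne : pc δ i₀ N g k ξ ≠ 0) :
    1 / 2 ≤ hA ξ ∧ hA ξ ≤ 6 ∧ |hA ξ - i₀ * δ| ≤ δ ∧
      |hB (k * N⁻¹) ξ| ≤ 16 * N⁻¹ ∧ |hC (k * N⁻¹) ξ| ≤ 16 * N⁻¹ ^ 2 := by
  have hξ : ξ ∈ Kset δ i₀ N k := by
    by_contra hc
    exact hne (by rw [pc, h.amp_zero hc]; simp)
  obtain ⟨a1, a2, a3, a4, a5, a6⟩ := h.bounds hξ
  have hN := h.N1
  have hN0 : 0 < N := by linarith
  have hA0 : 0 < hA ξ := by linarith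
  have e1 : hB (k * N⁻¹) ξ = ξ.1.2 - k / N * hA ξ := by rw [hB]; ring
  have b1 : |hB (k * N⁻¹) ξ| ≤ hA ξ * N⁻¹ := by rw [e1]; exact a4
  have hen : en ξ.1 ^ 2 = ξ.1.1 ^ 2 + ξ.1.2 ^ 2 := sq_sqrt (by positivity)
  have e2 : hA ξ * hC (k * N⁻¹) ξ = hB (k * N⁻¹) ξ ^ 2 + (ξ.2 - en ξ.1) * (ξ.2 + en ξ.1) := by
    have : (ξ.2 - en ξ.1) * (ξ.2 + en ξ.1) = ξ.2 ^ 2 - (ξ.1.1 ^ 2 + ξ.1.2 ^ 2) := by rw [← hen]; ring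
    rw [this, hC, hB, hA]; ring
  have hi1 : 0 < N⁻¹ := by positivity
  refine ⟨a1, a2, hξ.1, b1.trans (mul_le_mul_of_nonneg_right (by linarith) hi1.le), ?_⟩
  have hen0 : 0 ≤ en ξ.1 := sqrt_nonneg _
  have c3 : |ξ.2 - en ξ.1| ≤ 1 / 10 * N⁻¹ ^ 2 := a3.trans (le_of_eq (by field_simp))
  have hNi : N⁻¹ ≤ 1 := inv_le_one_of_one_le₀ hN
  have c4 : |ξ.2 - en ξ.1| ≤ 1 / 10 := c3.trans (by nlinarith)
  have c5 : |ξ.2 + en ξ.1| ≤ 13 * hA ξ := by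
    have := abs_le.1 c4
    rw [abs_le]; constructor <;> linarith
  have b2 : hB (k * N⁻¹) ξ ^ 2 ≤ (hA ξ * N⁻¹) ^ 2 := sq_le_sq' (by linarith [(abs_le.1 b1).1]) (abs_le.1 b1).2
  have b3 : |(ξ.2 - en ξ.1) * (ξ.2 + en ξ.1)| ≤ 1 / 10 * N⁻¹ ^ 2 * (13 * hA ξ) := by
    rw [abs_mul]; exact mul_le_mul c3 c5 (abs_nonneg _) (by positivity)
  have b4 : hA ξ * |hC (k * N⁻¹) ξ| ≤ hA ξ * (16 * N⁻¹ ^ 2) := by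
    rw [← abs_of_pos hA0, ← abs_mul, abs_of_pos hA0, e2]
    refine (abs_add_le _ _).trans ?_
    rw [abs_of_nonneg (sq_nonneg _)]
    have : (hA ξ * N⁻¹) ^ 2 ≤ 6 * hA ξ * N⁻¹ ^ 2 := by
      rw [mul_pow, sq (hA ξ)]; gcongr
    have : 0 ≤ hA ξ * N⁻¹ ^ 2 := by positivity
    linarith
  exact le_of_mul_le_mul_left b4 hA0

theorem card_image_anc {n : ℕ} {I : Finset ℤ} (h : ∀ k ∈ I, |(k : ℝ)| ≤ 2 * 2 ^ n) :
    (I.image (anc n)).card ≤ 5 := by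
  have : I.image (anc n) ⊆ Finset.Icc (-2) 2 := by
    intro i hi
    obtain ⟨k, hk, rfl⟩ := Finset.mem_image.1 hi
    have h1 : |k| ≤ 2 * 2 ^ n := by exact_mod_cast h k hk
    have h2 := abs_le.1 h1
    rw [Finset.mem_Icc, anc]
    constructor
    · rw [Int.le_ediv_iff_mul_le (by positivity)]; linarith
    · refine (Int.ediv_le_ediv (by positivity) h2.2).trans ?_
      rw [Int.mul_ediv_cancel _ (by positivity)]
  exact (Finset.card_le_card this).trans (by simp)

theorem N2_kp_eq {δ : ℝ} {i₀ : ℤ} {n j : ℕ} {I : Finset ℤ} (hI : ∀ k ∈ I, Adm δ i₀ (2 ^ n) k)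
    {g : ℝ × ℝ → ℂ} (hg : Integrable g) (i : ℤ) :
    ENNReal.ofReal ((2 * π) ^ 3) *
      N2 (fun ω => (kp n j i ω : ℂ) * ∑ k ∈ I, corr (pc δ i₀ (2 ^ n) g k) (pc δ i₀ (2 ^ n) g k) ω) =
    ∫⁻ z, Qf (win (((2 : ℝ) ^ n) ^ 2 * sc j ^ 2) (sc j) (i * sc j)) δ i₀ (2 ^ n) I g z ^ 2 := by
  have e : (sc j / sc n) ^ 2 = ((2 : ℝ) ^ n) ^ 2 * sc j ^ 2 := by rw [sc_eq_inv n, div_inv_eq_mul]; ring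
  have hw := CR_kp n j i
  have hcc : ∀ k ∈ I, CC (pc δ i₀ (2 ^ n) g k) := fun k hk => cc_pc (hI k hk) hg
  unfold kp
  rw [← N2_F3 (cc_kap_sum hw hcc), ← e, N2]
  refine lintegral_congr fun z => ?_
  rw [F3_kap_sum hw hcc, Qf_eq hI hw hg, ← ofReal_norm, Complex.norm_real, Real.norm_of_nonneg]
  exact Finset.sum_nonneg fun k _ => integral_nonneg fun _ => by positivity

theorem pc_four {δ : ℝ} (hδ : 0 < δ) (hδ1 : δ ≤ 1 / 10) {K : ℕ} (hδK : δ ≤ sc (4 * K)) :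
    ∃ C, 0 ≤ C ∧ ∀ (n t : ℕ) (i₀ : ℤ) (I : Finset ℤ), n ≤ t * K →
    (∀ k ∈ I, Adm δ i₀ (2 ^ n) k) → ∀ (g : ℝ × ℝ → ℂ), Measurable g → Integrable g →
      ∫⁻ x, ‖F3 (fun ξ => ∑ k ∈ I, pc δ i₀ (2 ^ n) g k ξ) x‖ₑ ^ 4 ≤
        ENNReal.ofReal (C * ((cst * (2 * K + 7) : ℕ) : ℝ) ^ t * (n + 1) * 4 ^ n) * ∫⁻ y, ‖g y‖ₑ ^ 4 := by
  obtain ⟨C, hC0, hC⟩ := sum_lintegral_Qf_sq_le hδ (by linarith)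
  refine ⟨125 * C, by positivity, fun n t i₀ I ht hI g hgm hg => ?_⟩
  rcases I.eq_empty_or_nonempty with rfl | ⟨k0, hk0⟩
  · simp [F3_eq]
  have hF : Fine n I (fun k => pc δ i₀ (2 ^ n) g k) (i₀ * δ) δ := by
    refine ⟨fun k hk => cc_pc (hI k hk) hg, fun k hk ξ hξ => ?_⟩
    rw [sc_eq_inv]
    exact (hI k hk).pc_supp hξ
  refine (hF.multiscale (by linarith [(hI k0 hk0).lo]) hδK ht
    (card_image_anc fun k hk => (hI k hk).k1)).trans ?_
  have hj : ∀ j ∈ Finset.Icc 0 n, ENNReal.ofReal ((2 * π) ^ 3) * ∑ i ∈ I.image (anc (n - j)),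
      N2 (fun ω => (kp n j i ω : ℂ) * ∑ k ∈ I with anc (n - j) k = i,
        corr (pc δ i₀ (2 ^ n) g k) (pc δ i₀ (2 ^ n) g k) ω) ≤
      ENNReal.ofReal (C * (2 ^ n) ^ 2) * ∫⁻ y, ‖g y‖ₑ ^ 4 := by
    intro j hj
    have hjn := (Finset.mem_Icc.1 hj).2
    rw [Finset.mul_sum]
    have e : ∀ i ∈ I.image (anc (n - j)), _ = _ := fun i _ =>
      N2_kp_eq (j := j) (I := {k ∈ I | anc (n - j) k = i})
        (fun k hk => hI k (Finset.mem_filter.1 hk).1) hg i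
    rw [Finset.sum_congr rfl e]
    have hsj : sc j ≤ 1 := pow_le_one₀ (by norm_num) (by norm_num)
    have hns : 1 ≤ (2 : ℝ) ^ n * sc j := by
      rw [sc_eq_inv, ← div_eq_mul_inv, one_le_div (by positivity)]
      exact pow_le_pow_right₀ one_le_two hjn
    refine hC (sc j) (2 ^ n) i₀ I (anc (n - j)) (fun i => i * sc j) (sc_pos j) hsj hns
      (by positivity) (fun k hk => ?_) g hgm hg
    have h1 := anc_bounds hjn k
    have h2 : (k : ℝ) / 2 ^ n = k * sc n := by rw [sc_eq_inv]; rfl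
    have h3 : |(k : ℝ) / 2 ^ n| ≤ 2 := by
      rw [abs_div, abs_of_pos (by positivity : (0 : ℝ) < 2 ^ n), div_le_iff₀ (by positivity)]
      exact (hI k hk).k1
    refine ⟨hI k hk, ?_, ?_⟩
    · rw [h2, abs_le]; constructor <;> linarith
    · rw [h2] at h3
      have := abs_le.1 h3
      rw [abs_le]; constructor <;> linarith
  set B : ℝ≥0∞ := ((cst * (2 * K + 7) : ℕ) : ℝ≥0∞) with hB
  calc _ = ((5 : ℕ) : ℝ≥0∞) ^ 3 * B ^ t * ∑ j ∈ Finset.Icc 0 n, ENNReal.ofReal ((2 * π) ^ 3) *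
      ∑ i ∈ I.image (anc (n - j)), N2 (fun ω => (kp n j i ω : ℂ) * ∑ k ∈ I with anc (n - j) k = i,
        corr (pc δ i₀ (2 ^ n) g k) (pc δ i₀ (2 ^ n) g k) ω) := by
        rw [← Finset.mul_sum]; ring
    _ ≤ ((5 : ℕ) : ℝ≥0∞) ^ 3 * B ^ t * ∑ j ∈ Finset.Icc 0 n,
          ENNReal.ofReal (C * (2 ^ n) ^ 2) * ∫⁻ y, ‖g y‖ₑ ^ 4 :=
        mul_le_mul_right (Finset.sum_le_sum hj) _
    _ = _ := by
        rw [Finset.sum_const, Nat.card_Icc, nsmul_eq_mul, hB, ← ENNReal.ofReal_natCast,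
          ← ENNReal.ofReal_natCast, ← ENNReal.ofReal_natCast, ← ENNReal.ofReal_pow (by positivity),
          ← ENNReal.ofReal_pow (by positivity), ← mul_assoc, ← mul_assoc,
          ← ENNReal.ofReal_mul (by positivity), ← ENNReal.ofReal_mul (by positivity),
          ← ENNReal.ofReal_mul (by positivity)]
        congr 2
        have : ((2 : ℝ) ^ n) ^ 2 = 4 ^ n := by rw [← pow_mul, mul_comm, pow_mul]; norm_num
        rw [this]; push_cast; ring

/-- The extension operator: `Ext g (y, τ) = ∫ e^{i(y·ξ + τ|ξ|)} ĝ(ξ) dξ`. -/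
def Ext (g : ℝ × ℝ → ℂ) (x : E3) : ℂ := ∫ ξ : ℝ × ℝ, ch x (ξ, en ξ) * F2 g (-ξ)

/-- Transform of the radial cutoff. -/
def Th (σ : ℝ) : ℂ := ∫ w : ℝ, Complex.exp (Complex.I * ((σ * w : ℝ) : ℂ)) * (chi (10 * w) : ℂ)

theorem integrable_chi_ten : Integrable fun w : ℝ => chi (10 * w) :=
  Continuous.integrable_of_hasCompactSupport (by fun_prop)
    (hasCompactSupport_chi.comp_homeomorph (Homeomorph.mulLeft₀ (10 : ℝ) (by norm_num)))

theorem exists_le_norm_Th : ∃ c, 0 < c ∧ ∀ σ, |σ| ≤ 1 → c ≤ ‖Th σ‖ := by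
  have hi := integrable_chi_ten
  have hpos : 0 < ∫ w : ℝ, chi (10 * w) := by
    refine (by fun_prop : Continuous fun w : ℝ => chi (10 * w)).integral_pos_of_hasCompactSupport_nonneg_nonzero
      (hasCompactSupport_chi.comp_homeomorph (Homeomorph.mulLeft₀ (10 : ℝ) (by norm_num)))
      (fun w => chi_nonneg _) (x := 0) ?_
    simp [chi]
  refine ⟨1 / 2 * ∫ w : ℝ, chi (10 * w), by positivity, fun σ hσ => ?_⟩
  refine le_trans ?_ (Complex.re_le_norm _)
  have h_int : Integrable fun w : ℝ => Complex.exp (Complex.I * ((σ * w : ℝ) : ℂ)) * (chi (10 * w) : ℂ) := by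
    refine hi.norm.mono' (Continuous.aestronglyMeasurable (by fun_prop)) (ae_of_all _ fun w => ?_)
    rw [norm_mul, mul_comm Complex.I, Complex.norm_exp_ofReal_mul_I, one_mul, Complex.norm_real]
  rw [Th, ← RCLike.re_eq_complex_re, ← integral_re h_int, ← integral_const_mul]
  refine integral_mono (hi.const_mul _) h_int.re fun w => ?_
  have e : RCLike.re (Complex.exp (Complex.I * ((σ * w : ℝ) : ℂ)) * (chi (10 * w) : ℂ)) =
      Real.cos (σ * w) * chi (10 * w) := by
    rw [RCLike.re_eq_complex_re, mul_comm Complex.I, Complex.re_mul_ofReal, Complex.exp_ofReal_mul_I_re]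
  simp only [e]
  by_cases h : chi (10 * w) = 0
  · simp [h]
  · refine mul_le_mul_of_nonneg_right ?_ (chi_nonneg _)
    have h1 := chi_ne_zero h
    rw [abs_mul, abs_of_pos (by norm_num : (0 : ℝ) < 10)] at h1
    have h2 : |σ * w| ≤ 1 := by
      rw [abs_mul]; nlinarith [abs_nonneg σ, abs_nonneg w]
    have h3 := Real.one_sub_sq_div_two_le_cos (x := σ * w)
    have h4 : (σ * w) ^ 2 ≤ 1 := by rw [← sq_abs]; exact pow_le_one₀ (abs_nonneg _) h2
    linarith

/-- The cone sector in which the multiscale estimate applies. -/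
def Sec : Set (ℝ × ℝ) := {ξ | 9 / 10 ≤ en ξ - ξ.1 ∧ en ξ - ξ.1 ≤ 45 / 10 ∧ |ξ.2| ≤ 11 / 10 * (en ξ - ξ.1)}

/-- The radial indices meeting the sector, up to size `M`. -/
def win0 (δ : ℝ) (M : ℕ) : Finset ℤ :=
  {i ∈ Finset.Icc (-M : ℤ) M | 6 / 10 ≤ (i : ℝ) * δ ∧ (i : ℝ) * δ ≤ 59 / 10}

theorem sum_pc {δ : ℝ} (hδ : 0 < δ) (hδ1 : δ ≤ 1 / 10) {M : ℕ} (hM : 6 ≤ M * δ) {n : ℕ}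
    {g : ℝ × ℝ → ℂ} (hg : ∀ ξ, F2 g (-ξ) ≠ 0 → ξ ∈ Sec) (ξ : E3) :
    ∑ i ∈ win0 δ M, ∑ k ∈ Finset.Icc (-(2 * 2 ^ n : ℕ) : ℤ) (2 * 2 ^ n : ℕ), pc δ i (2 ^ n) g k ξ =
      ((((2 : ℝ) ^ n) ^ 2 * chi (10 * ((2 : ℝ) ^ n) ^ 2 * (ξ.2 - en ξ.1)) : ℝ) : ℂ) * F2 g (-ξ.1) := by
  by_cases h0 : F2 g (-ξ.1) = 0
  · simp [pc, h0]
  by_cases h1 : chi (10 * ((2 : ℝ) ^ n) ^ 2 * (ξ.2 - en ξ.1)) = 0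
  · simp [pc, amp, h1]
  set N : ℝ := 2 ^ n with hN
  have hN1 : 1 ≤ N := one_le_pow₀ one_le_two
  obtain ⟨s1, s2, s3⟩ := hg _ h0
  have h2 : |ξ.2 - en ξ.1| ≤ 1 / 10 := by
    have := chi_ne_zero h1
    rw [abs_mul, abs_of_pos (by positivity)] at this
    nlinarith [abs_nonneg (ξ.2 - en ξ.1)]
  have h3 := abs_le.1 h2
  have hAd : hA ξ = ξ.2 - ξ.1.1 := rfl
  have a1 : 8 / 10 ≤ hA ξ := by rw [hAd]; linarith
  have a2 : hA ξ ≤ 46 / 10 := by rw [hAd]; linarith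
  have a3 : |ξ.1.2| ≤ 2 * hA ξ := s3.trans (by rw [hAd] at *; linarith)
  have hk : ∑ k ∈ Finset.Icc (-(2 * 2 ^ n : ℕ) : ℤ) (2 * 2 ^ n : ℕ), chi (N * (ξ.1.2 / hA ξ) - k) = 1 := by
    refine sum_chi_eq_one ?_
    rw [abs_mul, abs_div, abs_of_pos (by linarith : 0 < hA ξ), abs_of_pos (by linarith : 0 < N)]
    push_cast
    rw [← hN, mul_comm]
    refine mul_le_mul_of_nonneg_right ?_ (by linarith)
    rw [div_le_iff₀ (by linarith)]; exact a3
  have hi : ∑ i ∈ win0 δ M, chi (hA ξ / δ - i) = 1 := by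
    rw [win0, ← sum_chi_eq_one (M := M) (x := hA ξ / δ)]
    · refine Finset.sum_filter_of_ne fun i _ hi => ?_
      have h5 := chi_ne_zero hi
      have h6 : |hA ξ - i * δ| < δ := by
        have e : hA ξ - i * δ = (hA ξ / δ - i) * δ := by field_simp
        rw [e, abs_mul, abs_of_pos hδ]
        nlinarith
      have h7 := abs_lt.1 h6
      constructor <;> linarith
    · rw [abs_of_pos (by positivity), div_le_iff₀ hδ]; linarith
  simp only [pc]
  simp only [← Finset.sum_mul]
  congr 1
  have e : ∑ i ∈ win0 δ M, ∑ k ∈ Finset.Icc (-(2 * 2 ^ n : ℕ) : ℤ) (2 * 2 ^ n : ℕ), amp δ i N k ξ =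
      N ^ 2 * chi (10 * N ^ 2 * (ξ.2 - en ξ.1)) := by
    simp only [amp, ← Finset.mul_sum, ← Finset.sum_mul, hk, hi, one_mul]
  rw [← e]
  push_cast
  rfl

theorem F3_ext {N : ℝ} (hN : 0 < N) {g : ℝ × ℝ → ℂ} {G : E3 → ℂ} (hG : CC G)
    (h : ∀ ξ, G ξ = ((N ^ 2 * chi (10 * N ^ 2 * (ξ.2 - en ξ.1)) : ℝ) : ℂ) * F2 g (-ξ.1)) (x : E3) :
    F3 G x = Th (x.2 / N ^ 2) * Ext g x := by
  have hi : Integrable fun ξ => ch x ξ * G ξ := (hG.mul_left (continuous_ch x)).integrable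
  rw [F3_eq]
  refine (integral_prod _ hi).trans ?_
  rw [Ext, ← integral_const_mul]
  refine integral_congr_ae (ae_of_all _ fun ξ => ?_)
  simp only [h]
  rw [← integral_add_right_eq_self (fun w => _) (en ξ)]
  have e : ∀ v : ℝ, ch x (ξ, v + en ξ) * (((N ^ 2 * chi (10 * N ^ 2 * (v + en ξ - en ξ)) : ℝ) : ℂ) * F2 g (-ξ)) =
      (N ^ 2 : ℝ) • (Complex.exp (Complex.I * ((x.2 / N ^ 2 * (N ^ 2 * v) : ℝ) : ℂ)) * (chi (10 * (N ^ 2 * v)) : ℂ)) *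
        (ch x (ξ, en ξ) * F2 g (-ξ)) := by
    intro v
    have e1 : ((ξ, v + en ξ) : E3) = (ξ, en ξ) + ((0, 0), v) := by simp [Prod.ext_iff, add_comm]
    rw [e1, ch_add, add_sub_cancel_right, mul_assoc 10]
    have e2 : x.2 / N ^ 2 * (N ^ 2 * v) = x.2 * v := by field_simp
    have e3 : ch x ((0, 0), v) = Complex.exp (Complex.I * ((x.2 * v : ℝ) : ℂ)) := by simp [ch]
    rw [e2, e3, Complex.real_smul]; push_cast; ring
  simp only [e]
  rw [integral_mul_const]
  congr 1
  rw [integral_smul, Measure.integral_comp_mul_left (fun w => Complex.exp (Complex.I * ((x.2 / N ^ 2 * w : ℝ) : ℂ)) * (chi (10 * w) : ℂ)) (N ^ 2),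
    smul_smul, abs_of_pos (by positivity), mul_inv_cancel₀ (by positivity), one_smul]
  rfl

theorem one_add_mul_log_le {ε : ℝ} (n : ℕ) : 1 + ε * Real.log 2 * n ≤ (2 : ℝ) ^ (ε * n) := by
  rw [rpow_def_of_pos two_pos]
  have := Real.add_one_le_exp (Real.log 2 * (ε * n))
  linarith

theorem exists_scale {ε : ℝ} (hε : 0 < ε) (c : ℕ) : ∃ K : ℕ, 0 < K ∧
    ((c * (2 * K + 7) : ℕ) : ℝ) ≤ (2 : ℝ) ^ (ε * K) := by
  have hl : 0 < Real.log 2 := Real.log_pos one_lt_two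
  set b := ε / 2 * Real.log 2 with hb
  have hb0 : 0 < b := by positivity
  refine ⟨⌈9 * c / b ^ 2⌉₊ + 1, by positivity, ?_⟩
  set K := ⌈9 * c / b ^ 2⌉₊ + 1 with hK
  have h1 : 9 * c / b ^ 2 ≤ K := (Nat.le_ceil _).trans (by rw [hK]; push_cast; linarith)
  have hK1 : (1 : ℝ) ≤ K := by rw [hK]; push_cast; linarith [Nat.cast_nonneg (α := ℝ) ⌈9 * c / b ^ 2⌉₊]
  rw [div_le_iff₀ (by positivity)] at h1
  have h2 := one_add_mul_log_le (ε := ε / 2) K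
  rw [← hb] at h2
  have h3 : (2 : ℝ) ^ (ε * K) = ((2 : ℝ) ^ (ε / 2 * K)) ^ 2 := by
    rw [← rpow_natCast, ← rpow_mul two_pos.le]; congr 1; push_cast; ring
  rw [h3]
  have h4 : b * K ≤ (2 : ℝ) ^ (ε / 2 * K) := by linarith
  have h5 := pow_le_pow_left₀ (by positivity) h4 2
  refine le_trans ?_ h5
  push_cast
  nlinarith [Nat.cast_nonneg (α := ℝ) c]

theorem ext_four {ε : ℝ} (hε : 0 < ε) : ∃ C, 0 ≤ C ∧ ∀ (n : ℕ) (g : ℝ × ℝ → ℂ), Measurable g →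
    Integrable g → (∀ ξ, F2 g (-ξ) ≠ 0 → ξ ∈ Sec) →
    ∫⁻ x in {x : E3 | |x.2| ≤ 4 ^ n}, ‖Ext g x‖ₑ ^ 4 ≤
      ENNReal.ofReal (C * 4 ^ n * (2 : ℝ) ^ (ε * n)) * ∫⁻ y, ‖g y‖ₑ ^ 4 := by
  obtain ⟨K, hK0, hK⟩ := exists_scale (half_pos hε) cst
  set B : ℝ := ((cst * (2 * K + 7) : ℕ) : ℝ) with hB
  set δ : ℝ := min (1 / 10) (sc (4 * K)) with hδ
  have hδ0 : 0 < δ := lt_min (by norm_num) (sc_pos _)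
  have hδ1 : δ ≤ 1 / 10 := min_le_left _ _
  obtain ⟨C, hC0, hC⟩ := pc_four hδ0 hδ1 (min_le_right _ _ : δ ≤ sc (4 * K))
  obtain ⟨c, hc0, hc⟩ := exists_le_norm_Th
  set M := ⌈6 / δ⌉₊ with hM
  have hM6 : 6 ≤ M * δ := by
    rw [← div_le_iff₀ hδ0]; exact Nat.le_ceil _
  have hl : 0 < Real.log 2 := Real.log_pos one_lt_two
  set R : ℝ := ((win0 δ M).card : ℝ) with hR
  refine ⟨(c ^ 4)⁻¹ * R ^ 4 * C * B * (1 + 1 / (ε / 2 * Real.log 2)), by positivity, ?_⟩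
  intro n g hgm hg hsec
  have hN : (0 : ℝ) < 2 ^ n := by positivity
  set I := Finset.Icc (-(2 * 2 ^ n : ℕ) : ℤ) (2 * 2 ^ n : ℕ) with hI
  have hadm : ∀ i ∈ win0 δ M, ∀ k ∈ I, Adm δ i (2 ^ n) k := by
    intro i hi k hk
    have h1 := (Finset.mem_filter.1 hi).2
    refine ⟨hδ0, hδ1, h1.1, h1.2, one_le_pow₀ one_le_two, ?_⟩
    have h2 : |k| ≤ (2 * 2 ^ n : ℕ) := abs_le.2 (Finset.mem_Icc.1 hk)
    exact_mod_cast h2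
  have hccI : ∀ i ∈ win0 δ M, CC fun ξ => ∑ k ∈ I, pc δ i (2 ^ n) g k ξ := fun i hi =>
    CC.sum fun k hk => cc_pc (hadm i hi k hk) hg
  have hG := CC.sum hccI
  have h1 : ∀ x ∈ {x : E3 | |x.2| ≤ 4 ^ n}, ‖Ext g x‖ₑ ^ 4 ≤ ENNReal.ofReal ((c ^ 4)⁻¹ * R ^ 3) *
      ∑ i ∈ win0 δ M, ‖F3 (fun ξ => ∑ k ∈ I, pc δ i (2 ^ n) g k ξ) x‖ₑ ^ 4 := by
    intro x hx
    have e := F3_ext hN hG (sum_pc hδ0 hδ1 hM6 hsec) x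
    rw [F3_sum hccI] at e
    have h2 : |x.2 / (2 ^ n) ^ 2| ≤ 1 := by
      rw [abs_div, abs_of_pos (by positivity : (0 : ℝ) < (2 ^ n) ^ 2), div_le_one (by positivity)]
      refine (show |x.2| ≤ 4 ^ n from hx).trans_eq ?_
      rw [← pow_mul, mul_comm, pow_mul]; norm_num
    have h3 := hc _ h2
    have h4 : ENNReal.ofReal (c ^ 4) * ‖Ext g x‖ₑ ^ 4 ≤ ENNReal.ofReal (R ^ 3) *
        ∑ i ∈ win0 δ M, ‖F3 (fun ξ => ∑ k ∈ I, pc δ i (2 ^ n) g k ξ) x‖ₑ ^ 4 := by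
      have h5 := enorm_sum_four_le (win0 δ M) fun i => F3 (fun ξ => ∑ k ∈ I, pc δ i (2 ^ n) g k ξ) x
      rw [e, enorm_mul, mul_pow] at h5
      rw [ENNReal.ofReal_pow (by positivity), ENNReal.ofReal_pow (by positivity), hR,
        ENNReal.ofReal_natCast]
      refine le_trans (mul_le_mul_left (pow_le_pow_left₀ zero_le ?_ 4) _) h5
      rw [← ofReal_norm]
      exact ENNReal.ofReal_le_ofReal h3
    calc ‖Ext g x‖ₑ ^ 4 = ENNReal.ofReal ((c ^ 4)⁻¹) * (ENNReal.ofReal (c ^ 4) * ‖Ext g x‖ₑ ^ 4) := by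
          rw [← mul_assoc, ← ENNReal.ofReal_mul (by positivity), inv_mul_cancel₀ (by positivity),
            ENNReal.ofReal_one, one_mul]
      _ ≤ _ := by
          rw [ENNReal.ofReal_mul (by positivity), mul_assoc]
          exact mul_le_mul_right h4 _
  have hmeas : MeasurableSet {x : E3 | |x.2| ≤ (4 : ℝ) ^ n} :=
    measurableSet_le (by fun_prop) measurable_const
  set t := n / K + 1 with ht
  have htK : n ≤ t * K := by
    rw [ht, add_mul, one_mul]
    have := Nat.div_add_mod n K
    have := Nat.mod_lt n hK0
    nlinarith
  calc _ ≤ ∫⁻ x in {x : E3 | |x.2| ≤ 4 ^ n}, ENNReal.ofReal ((c ^ 4)⁻¹ * R ^ 3) *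
      ∑ i ∈ win0 δ M, ‖F3 (fun ξ => ∑ k ∈ I, pc δ i (2 ^ n) g k ξ) x‖ₑ ^ 4 :=
        setLIntegral_mono' hmeas h1
    _ ≤ ∫⁻ x, ENNReal.ofReal ((c ^ 4)⁻¹ * R ^ 3) *
      ∑ i ∈ win0 δ M, ‖F3 (fun ξ => ∑ k ∈ I, pc δ i (2 ^ n) g k ξ) x‖ₑ ^ 4 := setLIntegral_le_lintegral _ _
    _ ≤ ENNReal.ofReal ((c ^ 4)⁻¹ * R ^ 3) * ∑ i ∈ win0 δ M,
          (ENNReal.ofReal (C * B ^ t * (n + 1) * 4 ^ n) * ∫⁻ y, ‖g y‖ₑ ^ 4) := by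
        rw [lintegral_const_mul' _ _ ENNReal.ofReal_ne_top, lintegral_finsetSum']
        · exact mul_le_mul_right (Finset.sum_le_sum fun i hi => hC n t i I htK (hadm i hi) g hgm hg) _
        · intro i hi
          exact ((continuous_F3 (hccI i hi)).measurable.enorm.pow_const 4).aemeasurable
    _ ≤ _ := by
        rw [Finset.sum_const, nsmul_eq_mul, ← ENNReal.ofReal_natCast, ← mul_assoc, ← mul_assoc,
          ← ENNReal.ofReal_mul (by positivity), ← ENNReal.ofReal_mul (by positivity)]
        refine mul_le_mul_left (ENNReal.ofReal_le_ofReal ?_) _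
        rw [← hR]
        have h2e : (2 : ℝ) ^ (ε * n) = (2 : ℝ) ^ (ε / 2 * n) * (2 : ℝ) ^ (ε / 2 * n) := by
          rw [← rpow_add two_pos]; congr 1; ring
        have b1 : B ^ t ≤ B * (2 : ℝ) ^ (ε / 2 * n) := by
          rw [ht, pow_succ']
          refine mul_le_mul_of_nonneg_left ?_ (by positivity)
          refine (pow_le_pow_left₀ (by positivity) hK _).trans ?_
          rw [← rpow_natCast, ← rpow_mul two_pos.le]
          refine rpow_le_rpow_of_exponent_le one_le_two ?_
          rw [mul_assoc]
          refine mul_le_mul_of_nonneg_left ?_ (by positivity)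
          exact_mod_cast Nat.mul_div_le n K
        have b2 : (n : ℝ) + 1 ≤ (1 + 1 / (ε / 2 * Real.log 2)) * (2 : ℝ) ^ (ε / 2 * n) := by
          refine le_trans ?_ (mul_le_mul_of_nonneg_left (one_add_mul_log_le n) (by positivity))
          have h3 : 0 < ε / 2 * Real.log 2 := by positivity
          have h4 : 1 / (ε / 2 * Real.log 2) * (ε / 2 * Real.log 2 * n) = n := by field_simp
          have h5 : 0 ≤ 1 / (ε / 2 * Real.log 2) := by positivity
          have h6 : 0 ≤ ε / 2 * Real.log 2 * n := by positivity
          nlinarith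
        calc (c ^ 4)⁻¹ * R ^ 3 * R * (C * B ^ t * (n + 1) * 4 ^ n)
            = (c ^ 4)⁻¹ * R ^ 4 * C * 4 ^ n * (B ^ t * (n + 1)) := by ring
          _ ≤ (c ^ 4)⁻¹ * R ^ 4 * C * 4 ^ n * ((B * (2 : ℝ) ^ (ε / 2 * n)) *
              ((1 + 1 / (ε / 2 * Real.log 2)) * (2 : ℝ) ^ (ε / 2 * n))) := by gcongr
          _ = _ := by rw [h2e]; ring

open scoped ContDiff NNReal SchwartzMap

theorem norm_iteratedFDeriv_slice_le {E : Type*} [NormedAddCommGroup E] [NormedSpace ℝ E]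
    {Φ : ℝ × E → ℂ} (hΦ : ContDiff ℝ ∞ Φ) (n : ℕ) (σ : ℝ) (v : E) :
    ‖iteratedFDeriv ℝ n (fun v => Φ (σ, v)) v‖ ≤ ‖iteratedFDeriv ℝ n Φ (σ, v)‖ := by
  have h1 : (fun v => Φ (σ, v)) =
      (fun z => Φ ((σ, (0 : E)) + z)) ∘ (ContinuousLinearMap.inr ℝ ℝ E) := by
    funext w; simp
  have h2 : ContDiff ℝ ∞ fun z => Φ ((σ, (0 : E)) + z) := hΦ.comp (by fun_prop)
  rw [h1, ContinuousLinearMap.iteratedFDeriv_comp_right _ h2 v (i := n) (by exact_mod_cast le_top),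
    iteratedFDeriv_comp_add_left]
  refine (ContinuousMultilinearMap.norm_compContinuousLinearMap_le _ _).trans ?_
  have h3 : ‖ContinuousLinearMap.inr ℝ ℝ E‖ ≤ 1 := ContinuousLinearMap.norm_inr_le_one ..
  have h4 : ∏ _i : Fin n, ‖ContinuousLinearMap.inr ℝ ℝ E‖ ≤ 1 :=
    Finset.prod_le_one (fun _ _ => norm_nonneg _) fun _ _ => h3
  have h5 : (σ, (0 : E)) + (ContinuousLinearMap.inr ℝ ℝ E) v = (σ, v) := by simp
  rw [h5]
  exact mul_le_of_le_one_right (norm_nonneg _) h4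

/-- Fourier transforms of a smooth one-parameter family of test functions are uniformly
integrable. -/
theorem exists_lintegral_fourier_le {E : Type*} [NormedAddCommGroup E] [InnerProductSpace ℝ E]
    [FiniteDimensional ℝ E] [MeasurableSpace E] [BorelSpace E]
    {Φ : ℝ × E → ℂ} (hΦ : ContDiff ℝ ∞ Φ) (R : ℝ) (hR : ∀ σ v, Φ (σ, v) ≠ 0 → ‖v‖ ≤ R) :
    ∃ C : ℝ, ∀ σ, |σ| ≤ 1 → ∫⁻ x, ‖𝓕 (fun v => Φ (σ, v)) x‖ₑ ≤ ENNReal.ofReal C := by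
  have hsupp : ∀ σ, Function.support (fun v => Φ (σ, v)) ⊆ Metric.closedBall 0 R := fun σ v hv => by
    simpa using hR σ v hv
  have htsupp : ∀ σ, tsupport (fun v => Φ (σ, v)) ⊆ Metric.closedBall 0 R := fun σ =>
    closure_minimal (hsupp σ) Metric.isClosed_closedBall
  have hcs : ∀ σ, HasCompactSupport (fun v => Φ (σ, v)) := fun σ =>
    (isCompact_closedBall (0 : E) R).of_isClosed_subset (isClosed_tsupport _) (htsupp σ)
  have hcd : ∀ σ, ContDiff ℝ ∞ fun v => Φ (σ, v) := fun σ => hΦ.comp (by fun_prop)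
  let S : ℝ → 𝓢(E, ℂ) := fun σ => (hcs σ).toSchwartzMap (hcd σ)
  let T : 𝓢(E, ℂ) →L[ℂ] Lp ℂ 1 (volume : Measure E) :=
    (SchwartzMap.toLpCLM ℂ ℂ 1 volume).comp (FourierTransform.fourierCLM ℂ 𝓢(E, ℂ))
  have hq : Continuous ((normSeminorm ℂ (Lp ℂ 1 (volume : Measure E))).comp T.toLinearMap) := by
    change Continuous fun x => ‖T x‖
    fun_prop
  obtain ⟨s, C, -, hC⟩ := Seminorm.bound_of_continuous (schwartz_withSeminorms ℂ E ℂ) _ hq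
  have hb : ∀ kn : ℕ × ℕ, ∃ M : ℝ, 0 ≤ M ∧ ∀ σ, |σ| ≤ 1 →
      schwartzSeminormFamily ℂ E ℂ kn (S σ) ≤ M := by
    intro kn
    have hcont : Continuous fun z : ℝ × E => ‖z.2‖ ^ kn.1 * ‖iteratedFDeriv ℝ kn.2 Φ z‖ :=
      (by fun_prop : Continuous fun z : ℝ × E => ‖z.2‖ ^ kn.1).mul
        (hΦ.of_le (mod_cast le_top)).continuous_iteratedFDeriv'.norm
    obtain ⟨M, hM⟩ := ((isCompact_Icc (a := (-1 : ℝ)) (b := 1)).prod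
      (isCompact_closedBall (0 : E) R)).bddAbove_image hcont.continuousOn
    refine ⟨max M 0, le_max_right _ _, fun σ hσ => ?_⟩
    refine SchwartzMap.seminorm_le_bound ℂ kn.1 kn.2 (S σ) (le_max_right _ _) fun x => ?_
    by_cases hx : x ∈ Metric.closedBall (0 : E) R
    · refine le_trans ?_ (le_max_left _ _)
      refine le_trans (mul_le_mul_of_nonneg_left (norm_iteratedFDeriv_slice_le hΦ kn.2 σ x)
        (by positivity)) ?_
      exact hM ⟨(σ, x), ⟨abs_le.1 hσ, hx⟩, rfl⟩
    · have : iteratedFDeriv ℝ kn.2 (fun v => Φ (σ, v)) x = 0 := by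
        by_contra h
        exact hx (htsupp σ (support_iteratedFDeriv_subset (𝕜 := ℝ) kn.2 h))
      change ‖x‖ ^ kn.1 * ‖iteratedFDeriv ℝ kn.2 (fun v => Φ (σ, v)) x‖ ≤ _
      rw [this]; simp
  choose M hM0 hM using hb
  refine ⟨C * ∑ kn ∈ s, M kn, fun σ hσ => ?_⟩
  have h1 : ‖T (S σ)‖ ≤ C * ∑ kn ∈ s, M kn := by
    refine (hC (S σ)).trans ?_
    change (C : ℝ) * (s.sup (schwartzSeminormFamily ℂ E ℂ)) (S σ) ≤ _
    refine mul_le_mul_of_nonneg_left ?_ C.2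
    refine Seminorm.finset_sup_apply_le (Finset.sum_nonneg fun i _ => hM0 i) fun i hi => ?_
    exact (hM i σ hσ).trans (Finset.single_le_sum (f := M) (fun i _ => hM0 i) hi)
  have h2 : ‖T (S σ)‖ = ∫ x, ‖(𝓕 (S σ) : 𝓢(E, ℂ)) x‖ := SchwartzMap.norm_toLp_one
  rw [← ofReal_integral_norm_eq_lintegral_enorm]
  · refine ENNReal.ofReal_le_ofReal ?_
    rw [h2, SchwartzMap.fourier_coe] at h1
    exact h1
  · have := (𝓕 (S σ) : 𝓢(E, ℂ)).integrable (μ := volume)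
    rw [SchwartzMap.fourier_coe] at this
    exact this

theorem F2_eq_fourier (f : ℝ × ℝ → ℂ) (w : WithLp 2 (ℝ × ℝ)) :
    F2 f (WithLp.ofLp w) = 𝓕 (fun v : WithLp 2 (ℝ × ℝ) => f (WithLp.ofLp v)) ((-(2 * π)⁻¹ : ℝ) • w) := by
  have he := WithLp.volume_preserving_symm_measurableEquiv_toLp_prod ℝ ℝ
  rw [Real.fourier_eq', F2, ← he.integral_comp' (g := fun ξ => Complex.exp
    (Complex.I * (((WithLp.ofLp w).1 * ξ.1 + (WithLp.ofLp w).2 * ξ.2 : ℝ) : ℂ)) * f ξ)]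
  refine integral_congr_ae (ae_of_all _ fun v => ?_)
  simp only [smul_eq_mul]
  rw [inner_smul_right, WithLp.prod_inner_apply]
  congr 2
  simp
  have : (π : ℂ) ≠ 0 := by exact_mod_cast Real.pi_ne_zero
  field_simp

theorem exists_lintegral_F2_le {Φ : ℝ × (ℝ × ℝ) → ℂ} (hΦ : ContDiff ℝ ∞ Φ) (R : ℝ)
    (hR : ∀ σ v, Φ (σ, v) ≠ 0 → ‖v‖ ≤ R) :
    ∃ C : ℝ, ∀ σ, |σ| ≤ 1 → ∫⁻ x, ‖F2 (fun v => Φ (σ, v)) x‖ₑ ≤ ENNReal.ofReal C := by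
  let L : WithLp 2 (ℝ × ℝ) →L[ℝ] ℝ × ℝ := (WithLp.prodContinuousLinearEquiv 2 ℝ ℝ ℝ).toContinuousLinearMap
  let Ψ : ℝ × WithLp 2 (ℝ × ℝ) → ℂ := fun z => Φ (z.1, L z.2)
  have hΨ : ContDiff ℝ ∞ Ψ := hΦ.comp (contDiff_fst.prodMk (L.contDiff.comp contDiff_snd))
  obtain ⟨C, hC⟩ := exists_lintegral_fourier_le hΨ (R + R) (by
    intro σ v hv
    have h1 := hR σ (L v) hv
    rw [WithLp.prod_norm_eq_of_L2]
    have h2 : ‖v.fst‖ ≤ R := (norm_fst_le (L v)).trans h1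
    have h3 : ‖v.snd‖ ≤ R := (norm_snd_le (L v)).trans h1
    rw [Real.sqrt_le_iff]
    have := norm_nonneg v.fst
    have := norm_nonneg v.snd
    constructor
    · linarith
    · nlinarith)
  refine ⟨(2 * π) ^ 2 * C, fun σ hσ => ?_⟩
  have he := (WithLp.volume_preserving_symm_measurableEquiv_toLp_prod ℝ ℝ)
  rw [← he.lintegral_comp_emb (MeasurableEquiv.measurableEmbedding _)]
  have h1 : ∀ w : WithLp 2 (ℝ × ℝ), F2 (fun v => Φ (σ, v)) ((MeasurableEquiv.toLp 2 (ℝ × ℝ)).symm w) =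
      𝓕 (fun v => Ψ (σ, v)) ((-(2 * π)⁻¹ : ℝ) • w) := fun w => F2_eq_fourier _ w
  simp_rw [h1]
  have hd : Module.finrank ℝ (WithLp 2 (ℝ × ℝ)) = 2 := by
    rw [(WithLp.linearEquiv 2 ℝ (ℝ × ℝ)).finrank_eq]; simp
  rw [lintegral_comp_smul' volume (fun w => ‖𝓕 (fun v => Ψ (σ, v)) w‖ₑ) (c := -(2 * π)⁻¹)
    (by simp [Real.pi_ne_zero]), hd, ENNReal.ofReal_mul (by positivity)]
  refine mul_le_mul' (ENNReal.ofReal_le_ofReal (le_of_eq ?_)) (hC σ hσ)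
  rw [abs_inv, abs_pow, abs_neg, abs_inv, abs_of_pos (by positivity : 0 < 2 * π), inv_pow, inv_inv]

theorem map_scale {σ : ℝ} (hσ : 0 < σ) :
    (volume : Measure (ℝ × ℝ)).map (fun x => (x.1, σ * x.2)) = ENNReal.ofReal σ⁻¹ • volume := by
  have h : (fun x : ℝ × ℝ => (x.1, σ * x.2)) = Prod.map id (fun y => σ * y) := rfl
  rw [h, Measure.volume_eq_prod, ← Measure.map_prod_map _ _ measurable_id (by fun_prop), Measure.map_id,
    Real.map_volume_mul_left hσ.ne', Measure.prod_smul_right, abs_of_pos (inv_pos.2 hσ)]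

theorem measurableEmbedding_scale {σ : ℝ} (hσ : 0 < σ) :
    MeasurableEmbedding fun x : ℝ × ℝ => (x.1, σ * x.2) := by
  have : (fun x : ℝ × ℝ => (x.1, σ * x.2)) =
      (((Homeomorph.refl ℝ).prodCongr (Homeomorph.mulLeft₀ σ hσ.ne')) : ℝ × ℝ → ℝ × ℝ) := rfl
  rw [this]
  exact Homeomorph.measurableEmbedding _

theorem lintegral_F2_scale {σ : ℝ} (hσ : 0 < σ) (f : ℝ × ℝ → ℂ) :
    ∫⁻ x, ‖F2 (fun ξ => f (ξ.1, σ⁻¹ * ξ.2)) x‖ₑ = ∫⁻ x, ‖F2 f x‖ₑ := by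
  have h1 : ∀ x, F2 (fun ξ => f (ξ.1, σ⁻¹ * ξ.2)) x = σ * F2 f (x.1, σ * x.2) := by
    intro x
    have h2 : F2 (fun ξ => f (ξ.1, σ⁻¹ * ξ.2)) x = ∫ ξ : ℝ × ℝ,
        (fun η : ℝ × ℝ => Complex.exp (Complex.I * ((x.1 * η.1 + (σ * x.2) * η.2 : ℝ) : ℂ)) * f η)
          (ξ.1, σ⁻¹ * ξ.2) := by
      refine integral_congr_ae (ae_of_all _ fun ξ => ?_)
      have : σ * x.2 * (σ⁻¹ * ξ.2) = x.2 * ξ.2 := by field_simp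
      simp only [this]
    rw [h2]
    refine ((measurableEmbedding_scale (inv_pos.2 hσ)).integral_map (μ := volume) (fun η : ℝ × ℝ =>
      Complex.exp (Complex.I * ((x.1 * η.1 + (σ * x.2) * η.2 : ℝ) : ℂ)) * f η)).symm.trans ?_
    rw [map_scale (inv_pos.2 hσ),
      integral_smul_measure, inv_inv, ENNReal.toReal_ofReal hσ.le, Complex.real_smul]
    rfl
  simp_rw [h1, enorm_mul]
  rw [lintegral_const_mul' _ _ enorm_ne_top,
    ← (measurableEmbedding_scale hσ).lintegral_map (fun x => ‖F2 f x‖ₑ), map_scale hσ,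
    lintegral_smul_measure, smul_eq_mul, ← mul_assoc]
  have : ‖(σ : ℂ)‖ₑ = ENNReal.ofReal σ := by
    rw [← ofReal_norm, Complex.norm_real, Real.norm_of_nonneg hσ.le]
  rw [this, ← ENNReal.ofReal_mul hσ.le, mul_inv_cancel₀ hσ.ne', ENNReal.ofReal_one, one_mul]

variable {φ : ℝ → ℝ}

theorem IsLPBump_supp (hφ : IsLPBump φ) {s : ℝ} (h : φ s ≠ 0) : 999 / 1000 ≤ s ∧ s ≤ 2001 / 1000 := by
  have := hφ.2.2.1 h
  constructor <;> [have := this.1; have := this.2] <;> linarith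

/-- The multiplier `φ(|ξ|) |ξ|^{-1/2} ψ_m(ξ)`. -/
def Wm (φ : ℝ → ℝ) (m : ℤ) (ξ : ℝ × ℝ) : ℝ := φ (en ξ) * en ξ ^ (-(1 : ℝ) / 2) * psiA φ m ξ

/-- The family of multipliers in rescaled coordinates. -/
def Vm (φ : ℝ → ℝ) (z : ℝ × (ℝ × ℝ)) : ℝ :=
  φ (en (z.2.1, z.1 * z.2.2)) * en (z.2.1, z.1 * z.2.2) ^ (-(1 : ℝ) / 2) *
    (Real.smoothTransition (2 - 10 * z.2.1) *
      φ (z.2.2 ^ 2 / (en (z.2.1, z.1 * z.2.2) * (en (z.2.1, z.1 * z.2.2) - z.2.1))))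

theorem contDiffAt_en {E : Type*} [NormedAddCommGroup E] [NormedSpace ℝ E] {f g : E → ℝ} {x : E}
    (hf : ContDiffAt ℝ ∞ f x) (hg : ContDiffAt ℝ ∞ g x) (h : 0 < en (f x, g x)) :
    ContDiffAt ℝ ∞ (fun y => en (f y, g y)) x := by
  refine ContDiffAt.sqrt ((hf.pow 2).add (hg.pow 2)) ?_
  exact (Real.sqrt_pos.1 h).ne'

theorem contDiff_Vm (hφ : IsLPBump φ) : ContDiff ℝ ∞ (Vm φ) := by
  rw [contDiff_iff_contDiffAt]
  intro z
  have hc : Continuous fun z : ℝ × (ℝ × ℝ) => en (z.2.1, z.1 * z.2.2) := by fun_prop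
  by_cases h1 : en (z.2.1, z.1 * z.2.2) < 9 / 10
  · refine (contDiffAt_const (c := (0 : ℝ))).congr_of_eventuallyEq ?_
    filter_upwards [hc.continuousAt.eventually_lt_const h1] with w hw
    have : φ (en (w.2.1, w.1 * w.2.2)) = 0 := by
      by_contra h; have := (IsLPBump_supp hφ h).1; linarith
    simp [Vm, this]
  by_cases h2 : 2 / 10 < z.2.1
  · refine (contDiffAt_const (c := (0 : ℝ))).congr_of_eventuallyEq ?_
    have hc2 : Continuous fun z : ℝ × (ℝ × ℝ) => z.2.1 := by fun_prop
    filter_upwards [hc2.continuousAt.eventually_const_lt h2] with w hw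
    have : Real.smoothTransition (2 - 10 * w.2.1) = 0 :=
      Real.smoothTransition.zero_of_nonpos (by linarith)
    simp [Vm, this]
  have he : ContDiffAt ℝ ∞ (fun z : ℝ × (ℝ × ℝ) => en (z.2.1, z.1 * z.2.2)) z :=
    contDiffAt_en (by fun_prop) (by fun_prop) (by linarith)
  have h3 : en (z.2.1, z.1 * z.2.2) * (en (z.2.1, z.1 * z.2.2) - z.2.1) ≠ 0 :=
    (mul_pos (by linarith) (by linarith)).ne'
  have hφc : ContDiff ℝ ∞ φ := hφ.1
  refine ((hφc.contDiffAt.comp z he).mul (he.rpow_const_of_ne (by linarith))).mul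
    (ContDiffAt.mul ?_ (hφc.contDiffAt.comp z (ContDiffAt.div (by fun_prop) (he.mul (he.sub (by fun_prop))) h3)))
  exact Real.smoothTransition.contDiff.contDiffAt.comp z (by fun_prop)

theorem abs_fst_le_en (ξ : ℝ × ℝ) : |ξ.1| ≤ en ξ :=
  Real.abs_le_sqrt (by nlinarith [sq_nonneg ξ.2])

theorem abs_snd_le_en (ξ : ℝ × ℝ) : |ξ.2| ≤ en ξ :=
  Real.abs_le_sqrt (by nlinarith [sq_nonneg ξ.1])

theorem en_sq (ξ : ℝ × ℝ) : en ξ ^ 2 = ξ.1 ^ 2 + ξ.2 ^ 2 := Real.sq_sqrt (by positivity)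

theorem Vm_supp (hφ : IsLPBump φ) {σ : ℝ} {v : ℝ × ℝ} (h : Vm φ (σ, v) ≠ 0) : ‖v‖ ≤ 10 := by
  simp only [Vm, ne_eq, mul_eq_zero, not_or] at h
  obtain ⟨⟨h1, -⟩, h2, h3⟩ := h
  have h1 := IsLPBump_supp hφ h1
  have h3 := (IsLPBump_supp hφ h3).2
  have h4 : v.1 < 2 / 10 := by
    by_contra h5
    exact h2 (Real.smoothTransition.zero_of_nonpos (by linarith))
  have h6 := abs_le.1 (abs_fst_le_en (v.1, σ * v.2))
  simp only at h6
  set e := en (v.1, σ * v.2)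
  rw [div_le_iff₀ (mul_pos (by linarith) (by linarith))] at h3
  have h7 : |v.2| ≤ 10 := abs_le_of_sq_le_sq (by nlinarith) (by norm_num)
  rw [Prod.norm_def, max_le_iff]
  exact ⟨abs_le.2 ⟨by linarith, by linarith⟩, h7⟩

theorem IsLPBump_le_one (hφ : IsLPBump φ) {s : ℝ} : φ s ≤ 1 := by
  by_cases h : φ s = 0
  · rw [h]; norm_num
  have hs : 0 < s := by linarith [(IsLPBump_supp hφ h).1]
  have := (hφ.2.2.2 s hs)
  simpa using le_hasSum this 0 fun j _ => hφ.2.1 _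

theorem Wm_ne_zero (hφ : IsLPBump φ) {m : ℤ} {ξ : ℝ × ℝ} (h : Wm φ m ξ ≠ 0) :
    (999 / 1000 ≤ en ξ ∧ en ξ ≤ 2001 / 1000) ∧ 999 / 1000 ≤ (2 : ℝ) ^ m * ((en ξ + ξ.1) / en ξ) ∧
      (2 : ℝ) ^ m * ((en ξ + ξ.1) / en ξ) ≤ 2001 / 1000 := by
  simp only [Wm, psiA, ne_eq, mul_eq_zero, not_or] at h
  have h1 := IsLPBump_supp hφ h.1.1
  have h2 := IsLPBump_supp hφ h.2
  have h3 := abs_le.1 (abs_fst_le_en ξ)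
  have h4 : 0 < en ξ := by linarith
  have h5 : |ξ.1 / enorm2 ξ + 1| = (en ξ + ξ.1) / en ξ := by
    change |ξ.1 / en ξ + 1| = _
    rw [abs_of_nonneg]
    · field_simp; ring
    · have : ξ.1 / en ξ + 1 = (en ξ + ξ.1) / en ξ := by field_simp; ring
      rw [this]
      exact div_nonneg (by linarith) h4.le
  rw [h5] at h2
  exact ⟨h1, h2⟩

theorem Wm_eq_Vm (hφ : IsLPBump φ) {m : ℤ} (hm : 1 ≤ m) (ξ : ℝ × ℝ) :
    Wm φ m ξ = Vm φ ((2 : ℝ) ^ (-(m : ℝ) / 2), (ξ.1, ((2 : ℝ) ^ (-(m : ℝ) / 2))⁻¹ * ξ.2)) := by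
  set σ : ℝ := (2 : ℝ) ^ (-(m : ℝ) / 2) with hσ
  have hσ0 : 0 < σ := by positivity
  have hσ2 : σ ^ 2 = ((2 : ℝ) ^ m)⁻¹ := by
    rw [hσ, ← rpow_natCast, ← rpow_mul two_pos.le, ← rpow_intCast, ← rpow_neg two_pos.le]
    congr 1; push_cast; ring
  have hm2 : (2 : ℝ) ≤ (2 : ℝ) ^ m := by
    calc (2 : ℝ) = 2 ^ (1 : ℤ) := by norm_num
      _ ≤ _ := zpow_le_zpow_right₀ one_le_two hm
  have e1 : en (ξ.1, σ * (σ⁻¹ * ξ.2)) = en ξ := by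
    rw [mul_inv_cancel_left₀ hσ0.ne']
  have key : 0 < en ξ → 0 < en ξ - ξ.1 →
      φ ((σ⁻¹ * ξ.2) ^ 2 / (en ξ * (en ξ - ξ.1))) = psiA φ m ξ := by
    intro h1 h2
    have h3 := abs_le.1 (abs_fst_le_en ξ)
    unfold psiA
    congr 1
    change _ = (2 : ℝ) ^ m * |ξ.1 / en ξ + 1|
    have h5 : ξ.1 / en ξ + 1 = (en ξ + ξ.1) / en ξ := by field_simp; ring
    rw [h5, abs_of_nonneg (div_nonneg (by linarith) h1.le), mul_pow, inv_pow, hσ2, inv_inv, mul_div_assoc]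
    congr 1
    rw [div_eq_div_iff (by positivity) h1.ne']
    have := en_sq ξ
    linear_combination (-en ξ) * this
  unfold Wm Vm
  simp only [e1]
  by_cases h0 : φ (en ξ) = 0
  · simp [h0]
  have h1 := IsLPBump_supp hφ h0
  congr 1
  by_cases h2 : ξ.1 ≤ 1 / 10
  · rw [Real.smoothTransition.one_of_one_le (by linarith), one_mul, key (by linarith) (by linarith)]
  have h3 : psiA φ m ξ = 0 := by
    by_contra h
    have h4 := (Wm_ne_zero hφ (m := m) (ξ := ξ) (by
      unfold Wm
      exact mul_ne_zero (mul_ne_zero h0 (rpow_pos_of_pos (by linarith) _).ne') h)).2.2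
    have h5 : (2 : ℝ) * ((en ξ + ξ.1) / en ξ) ≤ 2001 / 1000 :=
      le_trans (mul_le_mul_of_nonneg_right hm2 (div_nonneg (by linarith) (by linarith))) h4
    rw [← mul_div_assoc, div_le_iff₀ (by linarith)] at h5
    linarith
  by_cases h4 : ξ.1 < 2 / 10
  · rw [key (by linarith) (by linarith), h3, mul_zero]
  · rw [Real.smoothTransition.zero_of_nonpos (by linarith), zero_mul, h3]

theorem contDiff_Wm_zero (hφ : IsLPBump φ) : ContDiff ℝ ∞ (Wm φ 0) := by
  rw [contDiff_iff_contDiffAt]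
  intro ξ
  have hφc : ContDiff ℝ ∞ φ := hφ.1
  have hc : Continuous en := continuous_en
  by_cases h1 : en ξ < 9 / 10
  · refine (contDiffAt_const (c := (0 : ℝ))).congr_of_eventuallyEq ?_
    filter_upwards [hc.continuousAt.eventually_lt_const h1] with w hw
    by_contra h
    linarith [(Wm_ne_zero hφ h).1.1]
  have he : ContDiffAt ℝ ∞ (fun z : ℝ × ℝ => en z) ξ :=
    contDiffAt_en (f := Prod.fst) (g := Prod.snd) (by fun_prop) (by fun_prop) (by change 0 < en ξ; linarith)
  have h2 : Wm φ 0 =ᶠ[nhds ξ] fun ξ => φ (en ξ) * en ξ ^ (-(1 : ℝ) / 2) * φ (ξ.1 / en ξ + 1) := by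
    have h3 : (8 : ℝ) / 10 < en ξ := by linarith
    filter_upwards [hc.continuousAt.eventually_const_lt h3] with w hw
    unfold Wm psiA
    rw [zpow_zero, one_mul]
    congr 2
    change |w.1 / en w + 1| = _
    rw [abs_of_nonneg]
    have h3 := abs_le.1 (abs_fst_le_en w)
    have : -1 ≤ w.1 / en w := by rw [le_div_iff₀ (by linarith)]; linarith
    linarith
  refine ContDiffAt.congr_of_eventuallyEq ?_ h2
  refine ((hφc.contDiffAt.comp ξ he).mul (he.rpow_const_of_ne (by linarith))).mul
    (hφc.contDiffAt.comp ξ ?_)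
  exact ((by fun_prop : ContDiffAt ℝ ∞ (fun z : ℝ × ℝ => z.1) ξ).div he (by linarith)).add (by fun_prop)

theorem continuous_Wm (hφ : IsLPBump φ) {m : ℤ} (hm : 0 ≤ m) : Continuous (Wm φ m) := by
  rcases hm.eq_or_lt with rfl | h
  · exact (contDiff_Wm_zero hφ).continuous
  · have := (contDiff_Vm hφ).continuous
    have h2 : Wm φ m = fun ξ => Vm φ ((2 : ℝ) ^ (-(m : ℝ) / 2), (ξ.1, ((2 : ℝ) ^ (-(m : ℝ) / 2))⁻¹ * ξ.2)) :=
      funext fun ξ => Wm_eq_Vm hφ h ξ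
    rw [h2]
    fun_prop

theorem norm_Wm_supp (hφ : IsLPBump φ) {m : ℤ} {ξ : ℝ × ℝ} (h : Wm φ m ξ ≠ 0) : ‖ξ‖ ≤ 10 := by
  have := (Wm_ne_zero hφ h).1.2
  rw [Prod.norm_def, max_le_iff]
  exact ⟨(abs_fst_le_en ξ).trans (by linarith), (abs_snd_le_en ξ).trans (by linarith)⟩

theorem CC_Wm (hφ : IsLPBump φ) {m : ℤ} (hm : 0 ≤ m) : CC fun ξ => (Wm φ m ξ : ℂ) := by
  refine ⟨Complex.continuous_ofReal.comp (continuous_Wm hφ hm), ?_⟩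
  refine HasCompactSupport.of_support_subset_isCompact (isCompact_closedBall (0 : ℝ × ℝ) 10) fun ξ hξ => ?_
  simpa using norm_Wm_supp hφ (m := m) (by simpa using hξ)

theorem abs_Wm_le (hφ : IsLPBump φ) {m : ℤ} (ξ : ℝ × ℝ) : |Wm φ m ξ| ≤ 2 := by
  by_cases h : Wm φ m ξ = 0
  · simp [h]
  have h1 := (Wm_ne_zero hφ h).1.1
  unfold Wm psiA
  have h2 : en ξ ^ (-(1 : ℝ) / 2) ≤ 2 := by
    calc en ξ ^ (-(1 : ℝ) / 2) ≤ (1 / 4 : ℝ) ^ (-(1 : ℝ) / 2) :=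
          rpow_le_rpow_of_nonpos (by norm_num) (by linarith) (by norm_num)
      _ = 2 := by
          rw [show (1 / 4 : ℝ) = (2 : ℝ) ^ (-2 : ℝ) by rw [rpow_neg two_pos.le]; norm_num, ← rpow_mul two_pos.le]
          norm_num
  have h3 : 0 ≤ en ξ ^ (-(1 : ℝ) / 2) := by have : 0 ≤ en ξ := Real.sqrt_nonneg _; positivity
  rw [abs_mul, abs_mul, abs_of_nonneg (hφ.2.1 _), abs_of_nonneg h3, abs_of_nonneg (hφ.2.1 _)]
  calc _ ≤ (1 : ℝ) * 2 * 1 := by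
        gcongr
        · exact hφ.2.1 _
        · exact IsLPBump_le_one hφ
        · exact IsLPBump_le_one hφ
    _ = 2 := by norm_num

theorem exists_lintegral_F2_Wm_le (hφ : IsLPBump φ) : ∃ C : ℝ, 0 ≤ C ∧ ∀ m : ℤ, 0 ≤ m →
    ∫⁻ x, ‖F2 (fun ξ => (Wm φ m ξ : ℂ)) x‖ₑ ≤ ENNReal.ofReal C := by
  obtain ⟨C1, h1⟩ := exists_lintegral_F2_le (Φ := fun z => (Vm φ z : ℂ))
    (Complex.ofRealCLM.contDiff.comp (contDiff_Vm hφ)) 10 (fun σ v h => Vm_supp hφ (by simpa using h))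
  obtain ⟨C2, h2⟩ := exists_lintegral_F2_le (Φ := fun z => (Wm φ 0 z.2 : ℂ))
    (Complex.ofRealCLM.contDiff.comp ((contDiff_Wm_zero hφ).comp contDiff_snd)) 10
    (fun σ v h => norm_Wm_supp hφ (m := 0) (by simpa using h))
  refine ⟨max (max C1 C2) 0, le_max_right _ _, fun m hm => ?_⟩
  rcases hm.eq_or_lt with rfl | h
  · exact (h2 0 (by simp)).trans (ENNReal.ofReal_le_ofReal (le_max_of_le_left (le_max_right _ _)))
  · have hσ : 0 < (2 : ℝ) ^ (-(m : ℝ) / 2) := by positivity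
    have h3 : (fun ξ => (Wm φ m ξ : ℂ)) = fun ξ : ℝ × ℝ =>
        (fun v => (Vm φ ((2 : ℝ) ^ (-(m : ℝ) / 2), v) : ℂ)) (ξ.1, ((2 : ℝ) ^ (-(m : ℝ) / 2))⁻¹ * ξ.2) :=
      funext fun ξ => by rw [Wm_eq_Vm hφ h ξ]
    rw [h3]
    refine (lintegral_F2_scale hσ fun v => (Vm φ ((2 : ℝ) ^ (-(m : ℝ) / 2), v) : ℂ)).trans_le ?_
    refine (h1 _ ?_).trans (ENNReal.ofReal_le_ofReal (le_max_of_le_left (le_max_left _ _)))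
    rw [abs_of_pos hσ]
    refine rpow_le_one_of_one_le_of_nonpos one_le_two ?_
    have : (0 : ℝ) < m := by exact_mod_cast h
    linarith

/-- Fourier inversion on the plane. -/
theorem F2_F2_neg {f : ℝ × ℝ → ℂ} (hc : Continuous f) (h1 : Integrable f) (h2 : Integrable (F2 f))
    (ξ : ℝ × ℝ) : F2 (F2 f) (-ξ) = ((2 * π) ^ 2 : ℝ) * f ξ := by
  have he := WithLp.volume_preserving_symm_measurableEquiv_toLp_prod ℝ ℝ
  set f' : WithLp 2 (ℝ × ℝ) → ℂ := fun v => f (WithLp.ofLp v) with hf'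
  have hc' : Continuous f' := hc.comp (WithLp.prod_continuous_ofLp 2 ℝ ℝ)
  have h1' : Integrable f' := he.integrable_comp_of_integrable h1
  have hpi : (-(2 * π)⁻¹ : ℝ) ≠ 0 := by simp [Real.pi_ne_zero]
  have hF : ∀ w : WithLp 2 (ℝ × ℝ), F2 f (WithLp.ofLp w) = 𝓕 f' ((-(2 * π)⁻¹ : ℝ) • w) :=
    F2_eq_fourier f
  have h2' : Integrable (𝓕 f') := by
    have h3 : Integrable fun w : WithLp 2 (ℝ × ℝ) => F2 f (WithLp.ofLp w) :=
      he.integrable_comp_of_integrable h2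
    simp_rw [hF] at h3
    exact (integrable_comp_smul_iff volume (𝓕 f') hpi).1 h3
  have h4 := congrFun (hc'.fourierInv_fourier_eq h1' h2') (WithLp.toLp 2 ξ)
  have h5 : f' (WithLp.toLp 2 ξ) = f ξ := rfl
  rw [h5] at h4
  rw [← h4, Real.fourierInv_eq']
  have h6 : -ξ = WithLp.ofLp (WithLp.toLp 2 (-ξ)) := rfl
  rw [h6, F2_eq_fourier, Real.fourier_eq']
  have hd : Module.finrank ℝ (WithLp 2 (ℝ × ℝ)) = 2 := by
    rw [(WithLp.linearEquiv 2 ℝ (ℝ × ℝ)).finrank_eq]; simp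
  simp_rw [hF]
  have h7 := Measure.integral_comp_smul (volume : Measure (WithLp 2 (ℝ × ℝ)))
    (fun v => Complex.exp (((2 * π * inner ℝ v (WithLp.toLp 2 ξ) : ℝ) : ℂ) * Complex.I) • 𝓕 f' v) (-(2 * π)⁻¹)
  rw [hd] at h7
  have h8 : |((-(2 * π)⁻¹ : ℝ) ^ 2)⁻¹| = (2 * π) ^ 2 := by
    rw [abs_inv, abs_pow, abs_neg, abs_inv, abs_of_pos (by positivity : 0 < 2 * π), inv_pow, inv_inv]
  rw [h8, Complex.real_smul] at h7
  rw [← h7]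
  refine integral_congr_ae (ae_of_all _ fun v => ?_)
  simp only
  congr 4
  rw [inner_smul_right, inner_smul_left, WithLp.toLp_neg, inner_neg_right]
  simp
  field_simp
  ring

/-- The convolution kernel of the multiplier. -/
def Km (φ : ℝ → ℝ) (m : ℤ) (x : ℝ × ℝ) : ℂ := (((2 * π) ^ 2)⁻¹ : ℝ) * F2 (fun ξ => (Wm φ m ξ : ℂ)) x

/-- Application of the multiplier as a convolution. -/
def sm (φ : ℝ → ℝ) (m : ℤ) (h : ℝ × ℝ → ℂ) (x : ℝ × ℝ) : ℂ := ∫ z, h z * Km φ m (x - z)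

theorem continuous_Km (hφ : IsLPBump φ) {m : ℤ} (hm : 0 ≤ m) : Continuous (Km φ m) :=
  continuous_const.mul (continuous_F2 (CC_Wm hφ hm).integrable)

theorem exists_lintegral_Km_le (hφ : IsLPBump φ) : ∃ C : ℝ, 0 ≤ C ∧ ∀ m : ℤ, 0 ≤ m →
    ∫⁻ x, ‖Km φ m x‖ₑ ≤ ENNReal.ofReal C := by
  obtain ⟨C, hC0, hC⟩ := exists_lintegral_F2_Wm_le hφ
  refine ⟨((2 * π) ^ 2)⁻¹ * C, by positivity, fun m hm => ?_⟩
  unfold Km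
  simp_rw [enorm_mul]
  rw [lintegral_const_mul' _ _ enorm_ne_top, ENNReal.ofReal_mul (by positivity)]
  refine mul_le_mul' ?_ (hC m hm)
  rw [← ofReal_norm, Complex.norm_real, Real.norm_of_nonneg (by positivity)]

theorem integrable_Km (hφ : IsLPBump φ) {m : ℤ} (hm : 0 ≤ m) : Integrable (Km φ m) := by
  obtain ⟨C, -, hC⟩ := exists_lintegral_Km_le hφ
  exact ⟨(continuous_Km hφ hm).aestronglyMeasurable, (hC m hm).trans_lt ENNReal.ofReal_lt_top⟩

theorem F2_Km_neg (hφ : IsLPBump φ) {m : ℤ} (hm : 0 ≤ m) (ξ : ℝ × ℝ) : F2 (Km φ m) (-ξ) = Wm φ m ξ := by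
  have h1 := CC_Wm hφ hm
  have hpi : (((2 * π) ^ 2)⁻¹ : ℝ) ≠ 0 := by positivity
  have h2 : Integrable (F2 fun ξ => (Wm φ m ξ : ℂ)) := by
    have := (integrable_Km hφ hm).const_mul (((2 * π) ^ 2 : ℝ) : ℂ)
    refine this.congr (ae_of_all _ fun x => ?_)
    simp only [Km]
    rw [← mul_assoc, ← Complex.ofReal_mul, mul_inv_cancel₀ (by positivity), Complex.ofReal_one, one_mul]
  have h3 := F2_F2_neg h1.cont h1.integrable h2 ξ
  have h4 : F2 (Km φ m) (-ξ) = (((2 * π) ^ 2)⁻¹ : ℝ) * F2 (F2 fun ξ => (Wm φ m ξ : ℂ)) (-ξ) := by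
    unfold Km
    rw [F2, F2, ← integral_const_mul]
    refine integral_congr_ae (ae_of_all _ fun x => ?_)
    simp only
    ring
  rw [h4, h3, ← mul_assoc, ← Complex.ofReal_mul, inv_mul_cancel₀ (by positivity), Complex.ofReal_one, one_mul]

theorem sm_eq (m : ℤ) (h : ℝ × ℝ → ℂ) :
    sm φ m h = convolution h (Km φ m) (ContinuousLinearMap.mul ℝ ℂ) volume := rfl

theorem integrable_sm (hφ : IsLPBump φ) {m : ℤ} (hm : 0 ≤ m) {h : ℝ × ℝ → ℂ} (hh : Integrable h) :
    Integrable (sm φ m h) := by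
  rw [sm_eq]
  exact hh.integrable_convolution _ (integrable_Km hφ hm)

theorem F2_sm_neg (hφ : IsLPBump φ) {m : ℤ} (hm : 0 ≤ m) {h : ℝ × ℝ → ℂ} (hh : Integrable h)
    (ξ : ℝ × ℝ) : F2 (sm φ m h) (-ξ) = Wm φ m ξ * F2 h (-ξ) := by
  rw [← F2_Km_neg hφ hm]
  set w := -ξ
  have h_int := hh.convolution_integrand (ContinuousLinearMap.mul ℝ ℂ) (integrable_Km hφ hm)
  have hE : ∀ x z : ℝ × ℝ, Complex.exp (Complex.I * ((w.1 * x.1 + w.2 * x.2 : ℝ) : ℂ)) =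
      Complex.exp (Complex.I * ((w.1 * (x - z).1 + w.2 * (x - z).2 : ℝ) : ℂ)) *
        Complex.exp (Complex.I * ((w.1 * z.1 + w.2 * z.2 : ℝ) : ℂ)) := by
    intro x z
    rw [← Complex.exp_add]
    congr 1
    simp only [Prod.fst_sub, Prod.snd_sub]
    push_cast
    ring
  have hint2 : Integrable (fun p : (ℝ × ℝ) × (ℝ × ℝ) =>
      Complex.exp (Complex.I * ((w.1 * p.1.1 + w.2 * p.1.2 : ℝ) : ℂ)) * (h p.2 * Km φ m (p.1 - p.2)))
      (volume.prod volume) := by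
    refine h_int.bdd_mul (c := 1) (Continuous.aestronglyMeasurable (by fun_prop)) (ae_of_all _ fun p => ?_)
    rw [mul_comm, Complex.norm_exp_ofReal_mul_I]
  calc F2 (sm φ m h) w = ∫ x, ∫ z, Complex.exp (Complex.I * ((w.1 * x.1 + w.2 * x.2 : ℝ) : ℂ)) *
        (h z * Km φ m (x - z)) := by
        unfold F2 sm
        simp_rw [integral_const_mul]
    _ = ∫ z, ∫ x, Complex.exp (Complex.I * ((w.1 * x.1 + w.2 * x.2 : ℝ) : ℂ)) *
        (h z * Km φ m (x - z)) := integral_integral_swap hint2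
    _ = ∫ z, F2 (Km φ m) w * (Complex.exp (Complex.I * ((w.1 * z.1 + w.2 * z.2 : ℝ) : ℂ)) * h z) := by
        refine integral_congr_ae (ae_of_all _ fun z => ?_)
        simp only
        rw [F2, ← integral_sub_right_eq_self (fun x : ℝ × ℝ =>
          Complex.exp (Complex.I * ((w.1 * x.1 + w.2 * x.2 : ℝ) : ℂ)) * Km φ m x) z, ← integral_mul_const]
        refine integral_congr_ae (ae_of_all _ fun x => ?_)
        simp only
        rw [hE x z]
        ring
    _ = _ := by rw [integral_const_mul]; rfl

theorem continuous_sm (hφ : IsLPBump φ) {m : ℤ} (hm : 0 ≤ m) {h : ℝ × ℝ → ℂ} (hh : Integrable h) :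
    Continuous (sm φ m h) := by
  have hK := continuous_Km hφ hm
  have hb : ∀ x, ‖Km φ m x‖ ≤ (((2 * π) ^ 2)⁻¹ : ℝ) * ∫ ξ, ‖(Wm φ m ξ : ℂ)‖ := by
    intro x
    unfold Km
    rw [norm_mul, Complex.norm_real, Real.norm_of_nonneg (by positivity)]
    refine mul_le_mul_of_nonneg_left ?_ (by positivity)
    refine (norm_integral_le_integral_norm _).trans (le_of_eq (integral_congr_ae (ae_of_all _ fun ξ => ?_)))
    simp only
    rw [norm_mul, mul_comm Complex.I, Complex.norm_exp_ofReal_mul_I, one_mul]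
  unfold sm
  refine continuous_of_dominated (bound := fun z => ‖h z‖ * ((((2 * π) ^ 2)⁻¹ : ℝ) * ∫ ξ, ‖(Wm φ m ξ : ℂ)‖)) (fun x => ?_) (fun x => ?_)
    (hh.norm.mul_const _) (ae_of_all _ fun z => by fun_prop)
  · exact hh.aestronglyMeasurable.mul (Continuous.aestronglyMeasurable (by fun_prop))
  · refine ae_of_all _ fun z => ?_
    rw [norm_mul]
    exact mul_le_mul_of_nonneg_left (hb _) (norm_nonneg _)

theorem lintegral_pow_four_le {α : Type*} [MeasurableSpace α] {μ : Measure α} {k f : α → ℝ≥0∞}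
    (hk : Measurable k) (hf : Measurable f) :
    (∫⁻ z, k z * f z ∂μ) ^ 4 ≤ (∫⁻ z, k z ∂μ) ^ 3 * ∫⁻ z, k z * f z ^ 4 ∂μ := by
  set ν := μ.withDensity k
  have h1 : ∀ F : α → ℝ≥0∞, Measurable F → ∫⁻ z, k z * F z ∂μ = ∫⁻ z, F z ∂ν := fun F hF => by
    rw [lintegral_withDensity_eq_lintegral_mul _ hk hF]; rfl
  have h2 : ∀ F : α → ℝ≥0∞, Measurable F → (∫⁻ z, F z ∂ν) ^ 2 ≤ ν univ * ∫⁻ z, F z ^ 2 ∂ν := fun F hF => by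
    have := lintegral_mul_sq_le (μ := ν) (f := fun _ => 1) aemeasurable_const hF.aemeasurable
    simpa using this
  have h3 : ∫⁻ z, k z ∂μ = ν univ := by simp [ν]
  rw [h1 _ hf, h1 _ (hf.pow_const 4), h3]
  calc (∫⁻ z, f z ∂ν) ^ 4 = ((∫⁻ z, f z ∂ν) ^ 2) ^ 2 := by rw [← pow_mul]
    _ ≤ (ν univ * ∫⁻ z, f z ^ 2 ∂ν) ^ 2 := pow_le_pow_left₀ zero_le (h2 f hf) 2
    _ = ν univ ^ 2 * (∫⁻ z, f z ^ 2 ∂ν) ^ 2 := mul_pow ..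
    _ ≤ ν univ ^ 2 * (ν univ * ∫⁻ z, (f z ^ 2) ^ 2 ∂ν) := mul_le_mul_right (h2 _ (hf.pow_const 2)) _
    _ = _ := by simp_rw [← pow_mul]; ring

theorem lintegral_conv {k f : ℝ × ℝ → ℝ≥0∞} (hk : Measurable k) (hf : Measurable f) :
    ∫⁻ x, ∫⁻ z, k (x - z) * f z = (∫⁻ x, k x) * ∫⁻ z, f z := by
  rw [lintegral_lintegral_swap (by fun_prop), ← lintegral_const_mul _ hf]
  refine lintegral_congr fun z => ?_
  rw [lintegral_mul_const _ (by fun_prop), lintegral_sub_right_eq_self]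

theorem enorm_sm_le {m : ℤ} (h : ℝ × ℝ → ℂ) (x : ℝ × ℝ) :
    ‖sm φ m h x‖ₑ ≤ ∫⁻ z, ‖Km φ m (x - z)‖ₑ * ‖h z‖ₑ := by
  refine (enorm_integral_le_lintegral_enorm _).trans (lintegral_mono fun z => ?_)
  rw [enorm_mul, mul_comm]

theorem exists_sm_le (hφ : IsLPBump φ) : ∃ C : ℝ, 0 ≤ C ∧ ∀ m : ℤ, 0 ≤ m → ∀ h : ℝ × ℝ → ℂ,
    Measurable h → (∫⁻ x, ‖sm φ m h x‖ₑ ≤ ENNReal.ofReal C * ∫⁻ x, ‖h x‖ₑ) ∧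
      ∫⁻ x, ‖sm φ m h x‖ₑ ^ 4 ≤ ENNReal.ofReal C * ∫⁻ x, ‖h x‖ₑ ^ 4 := by
  obtain ⟨C, hC0, hC⟩ := exists_lintegral_Km_le hφ
  refine ⟨max C (C ^ 4), le_max_of_le_left hC0, fun m hm h hh => ⟨?_, ?_⟩⟩
  · have hk : Measurable fun x => ‖Km φ m x‖ₑ := (continuous_Km hφ hm).measurable.enorm
    calc ∫⁻ x, ‖sm φ m h x‖ₑ ≤ ∫⁻ x, ∫⁻ z, ‖Km φ m (x - z)‖ₑ * ‖h z‖ₑ := lintegral_mono fun x => enorm_sm_le h x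
      _ = (∫⁻ x, ‖Km φ m x‖ₑ) * ∫⁻ x, ‖h x‖ₑ := lintegral_conv hk hh.enorm
      _ ≤ _ := mul_le_mul_left ((hC m hm).trans (ENNReal.ofReal_le_ofReal (le_max_left _ _))) _
  · have hk : Measurable fun x => ‖Km φ m x‖ₑ := (continuous_Km hφ hm).measurable.enorm
    calc ∫⁻ x, ‖sm φ m h x‖ₑ ^ 4 ≤ ∫⁻ x, (∫⁻ x, ‖Km φ m x‖ₑ) ^ 3 * ∫⁻ z, ‖Km φ m (x - z)‖ₑ * ‖h z‖ₑ ^ 4 := by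
          refine lintegral_mono fun x => ?_
          refine (pow_le_pow_left₀ zero_le (enorm_sm_le h x) 4).trans ?_
          refine (lintegral_pow_four_le (k := fun z => ‖Km φ m (x - z)‖ₑ)
            (hk.comp (measurable_const.sub measurable_id)) hh.enorm).trans (le_of_eq ?_)
          rw [lintegral_sub_left_eq_self (fun y => ‖Km φ m y‖ₑ) x]
      _ = (∫⁻ x, ‖Km φ m x‖ₑ) ^ 4 * ∫⁻ x, ‖h x‖ₑ ^ 4 := by
          have hfin : (∫⁻ x, ‖Km φ m x‖ₑ) ^ 3 ≠ ⊤ :=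
            ENNReal.pow_ne_top ((hC m hm).trans_lt ENNReal.ofReal_lt_top).ne
          rw [lintegral_const_mul' _ _ hfin, lintegral_conv hk (hh.enorm.pow_const 4)]
          ring
      _ ≤ _ := by
          refine mul_le_mul_left ?_ _
          refine (pow_le_pow_left₀ zero_le (hC m hm) 4).trans ?_
          rw [← ENNReal.ofReal_pow hC0]
          exact ENNReal.ofReal_le_ofReal (le_max_right _ _)

/-- The frequency-localized half-wave propagator. -/
def Pr (φ : ℝ → ℝ) (m : ℤ) (h : ℝ × ℝ → ℂ) (x : E3) : ℂ :=
  ∫ ξ : ℝ × ℝ, ch x (ξ, en ξ) * (Wm φ m ξ * F2 h (-ξ))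

theorem Pr_eq_Ext (hφ : IsLPBump φ) {m : ℤ} (hm : 0 ≤ m) {h : ℝ × ℝ → ℂ} (hh : Integrable h) (x : E3) :
    Pr φ m h x = Ext (sm φ m h) x := by
  unfold Pr Ext
  simp_rw [F2_sm_neg hφ hm hh]

theorem CC_Pr (hφ : IsLPBump φ) {m : ℤ} (hm : 0 ≤ m) {h : ℝ × ℝ → ℂ} (hh : Integrable h) :
    CC fun ξ => Wm φ m ξ * F2 h (-ξ) :=
  ⟨(CC_Wm hφ hm).cont.mul ((continuous_F2 hh).comp continuous_neg), (CC_Wm hφ hm).supp.mul_right⟩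

theorem continuous_Pr (hφ : IsLPBump φ) {m : ℤ} (hm : 0 ≤ m) {h : ℝ × ℝ → ℂ} (hh : Integrable h) :
    Continuous (Pr φ m h) := by
  have hc := CC_Pr hφ hm hh
  have hcc := hc.cont
  unfold Pr
  refine continuous_of_dominated (bound := fun ξ => ‖(Wm φ m ξ : ℂ) * F2 h (-ξ)‖) (fun x => ?_) (fun x => ?_)
    hc.integrable.norm (ae_of_all _ fun z => ?_)
  · refine (Continuous.mul ?_ hcc).aestronglyMeasurable
    unfold ch; fun_prop
  · refine ae_of_all _ fun z => ?_
    rw [norm_mul, norm_ch, one_mul]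
  · refine Continuous.mul ?_ continuous_const
    unfold ch; fun_prop

theorem Pr_add (hφ : IsLPBump φ) {m : ℤ} (hm : 0 ≤ m) {h k : ℝ × ℝ → ℂ} (hh : Integrable h)
    (hk : Integrable k) (x : E3) : Pr φ m (h + k) x = Pr φ m h x + Pr φ m k x := by
  have hi : ∀ {h : ℝ × ℝ → ℂ}, Integrable h →
      Integrable fun ξ : ℝ × ℝ => ch x (ξ, en ξ) * (Wm φ m ξ * F2 h (-ξ)) := fun {h} hh => by
    refine (CC_Pr hφ hm hh).integrable.bdd_mul (c := 1) ?_ (ae_of_all _ fun z => (norm_ch _ _).le)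
    refine Continuous.aestronglyMeasurable ?_
    unfold ch; fun_prop
  unfold Pr
  rw [← integral_add (hi hh) (hi hk)]
  refine integral_congr_ae (ae_of_all _ fun ξ => ?_)
  simp only
  rw [F2_add hh hk]
  ring

/-- The fixed-time energy bound. -/
theorem lintegral_Pr_slice (hφ : IsLPBump φ) {m : ℤ} (hm : 0 ≤ m) {h : ℝ × ℝ → ℂ} (hh : Integrable h)
    (hh2 : MemLp h 2) (s : ℝ) :
    ∫⁻ y : ℝ × ℝ, ‖Pr φ m h (y, s)‖ₑ ^ 2 ≤ ENNReal.ofReal (4 * (2 * π) ^ 4) * ∫⁻ y, ‖h y‖ₑ ^ 2 := by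
  set f : ℝ × ℝ → ℂ := fun ξ => Complex.exp (Complex.I * ((s * en ξ : ℝ) : ℂ)) * (Wm φ m ξ * F2 h (-ξ)) with hf
  have hfc : CC f := (CC_Pr hφ hm hh).mul_left (by fun_prop)
  have h1 : ∀ y, Pr φ m h (y, s) = F2 f y := fun y => by
    unfold Pr F2
    refine integral_congr_ae (ae_of_all _ fun ξ => ?_)
    simp only [hf, ch]
    rw [← mul_assoc (Complex.exp _) (Complex.exp _), ← Complex.exp_add]
    congr 2
    push_cast; ring
  simp_rw [h1]
  rw [plancherel_F2 hfc.integrable (hfc.memLp 2)]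
  have h2 : ∀ ξ, ‖f ξ‖ₑ ^ 2 ≤ ENNReal.ofReal 4 * ‖F2 h (-ξ)‖ₑ ^ 2 := fun ξ => by
    have h3 : ‖f ξ‖ ≤ 2 * ‖F2 h (-ξ)‖ := by
      simp only [hf]
      rw [norm_mul, norm_mul, mul_comm Complex.I, Complex.norm_exp_ofReal_mul_I, one_mul, Complex.norm_real]
      exact mul_le_mul_of_nonneg_right (abs_Wm_le hφ ξ) (norm_nonneg _)
    rw [← ofReal_norm, ← ofReal_norm, ← ENNReal.ofReal_pow (norm_nonneg _), ← ENNReal.ofReal_pow (norm_nonneg _),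
      ← ENNReal.ofReal_mul (by norm_num)]
    refine ENNReal.ofReal_le_ofReal ?_
    calc ‖f ξ‖ ^ 2 ≤ (2 * ‖F2 h (-ξ)‖) ^ 2 := pow_le_pow_left₀ (norm_nonneg _) h3 2
      _ = _ := by ring
  refine (mul_le_mul_right (lintegral_mono h2) _).trans (le_of_eq ?_)
  rw [lintegral_const_mul' _ _ ENNReal.ofReal_ne_top, lintegral_neg_eq_self (fun ξ : ℝ × ℝ => ‖F2 h ξ‖ₑ ^ 2),
    plancherel_F2 hh hh2, ← mul_assoc, ← mul_assoc, ← ENNReal.ofReal_mul (by positivity),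
    ← ENNReal.ofReal_mul (by positivity)]
  congr 2; ring

theorem lintegral_time_slab {F : E3 → ℝ≥0∞} (hF : Measurable F) {L : ℝ} {B : ℝ≥0∞}
    (h : ∀ s, ∫⁻ y : ℝ × ℝ, F (y, s) ≤ B) :
    ∫⁻ x in {x : E3 | |x.2| ≤ L}, F x ≤ ENNReal.ofReal (2 * L) * B := by
  have h1 : {x : E3 | |x.2| ≤ L} = univ ×ˢ Icc (-L) L := by ext x; simp [abs_le]
  rw [h1, Measure.volume_eq_prod, ← Measure.prod_restrict, Measure.restrict_univ,
    lintegral_prod_symm _ hF.aemeasurable]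
  refine (lintegral_mono h).trans (le_of_eq ?_)
  rw [lintegral_const, Measure.restrict_apply_univ, Real.volume_Icc, mul_comm]
  congr 2; ring

theorem lintegral_Pr_two (hφ : IsLPBump φ) {m : ℤ} (hm : 0 ≤ m) {h : ℝ × ℝ → ℂ} (hh : Integrable h)
    (n : ℕ) : ∫⁻ x in {x : E3 | |x.2| ≤ 4 ^ n}, ‖Pr φ m h x‖ₑ ^ 2 ≤
      ENNReal.ofReal (8 * (2 * π) ^ 4 * 4 ^ n) * ∫⁻ y, ‖h y‖ₑ ^ 2 := by
  by_cases hfin : ∫⁻ y, ‖h y‖ₑ ^ 2 = ⊤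
  · rw [hfin, ENNReal.mul_top (ENNReal.ofReal_pos.2 (by positivity)).ne']
    exact le_top
  have hh2 : MemLp h 2 := by
    refine ⟨hh.aestronglyMeasurable, ?_⟩
    rw [eLpNorm_lt_top_iff_lintegral_rpow_enorm_lt_top (by norm_num) (by norm_num)]
    simpa using lt_top_iff_ne_top.2 hfin
  refine (lintegral_time_slab ((continuous_Pr hφ hm hh).measurable.enorm.pow_const 2)
    (lintegral_Pr_slice hφ hm hh hh2)).trans (le_of_eq ?_)
  rw [← mul_assoc, ← ENNReal.ofReal_mul (by positivity)]
  congr 2; ring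

theorem Sec_of_Wm (hφ : IsLPBump φ) {m : ℤ} (hm : 1 ≤ m) {ξ : ℝ × ℝ} (h : Wm φ m ξ ≠ 0) : ξ ∈ Sec := by
  obtain ⟨⟨h1, h2⟩, -, h4⟩ := Wm_ne_zero hφ h
  have he : 0 < en ξ := by linarith
  have h5 : (2 : ℝ) ≤ (2 : ℝ) ^ m := by
    simpa using zpow_le_zpow_right₀ (by norm_num : (1 : ℝ) ≤ 2) hm
  have h6 := abs_le.1 (abs_fst_le_en ξ)
  have h7 := abs_snd_le_en ξ
  have h8 : 0 ≤ (en ξ + ξ.1) / en ξ := div_nonneg (by linarith) he.le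
  have h9 : (en ξ + ξ.1) / en ξ ≤ 2001 / 2000 := by nlinarith
  rw [div_le_iff₀ he] at h9
  exact ⟨by linarith, by linarith, by linarith⟩

/-- Reflection in the first coordinate. -/
def rfl1 (ξ : ℝ × ℝ) : ℝ × ℝ := (-ξ.1, ξ.2)

theorem Sec_of_Wm_zero (hφ : IsLPBump φ) {ξ : ℝ × ℝ} (h : Wm φ 0 (rfl1 ξ) ≠ 0) : ξ ∈ Sec := by
  obtain ⟨⟨h1, h2⟩, h3, h4⟩ := Wm_ne_zero hφ h
  have hen : en (rfl1 ξ) = en ξ := by simp [en, rfl1]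
  rw [hen] at h1 h2 h3 h4
  have he : 0 < en ξ := by linarith
  have h7 := abs_snd_le_en ξ
  simp only [zpow_zero, one_mul] at h3 h4
  change 999 / 1000 ≤ (en ξ + -ξ.1) / en ξ at h3
  change (en ξ + -ξ.1) / en ξ ≤ 2001 / 1000 at h4
  rw [div_le_iff₀ he] at h4
  rw [le_div_iff₀ he] at h3
  exact ⟨by linarith, by linarith, by linarith⟩

theorem measurePreserving_rfl1 : MeasurePreserving rfl1 (volume : Measure (ℝ × ℝ)) volume :=
  (Measure.measurePreserving_neg (volume : Measure ℝ)).prod (MeasurePreserving.id volume)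

theorem measurableEmbedding_rfl1 : MeasurableEmbedding rfl1 :=
  (MeasurableEquiv.neg ℝ).measurableEmbedding.prodMap MeasurableEmbedding.id

theorem F2_comp_rfl1 (u : ℝ × ℝ → ℂ) (w : ℝ × ℝ) : F2 (u ∘ rfl1) w = F2 u (rfl1 w) := by
  unfold F2
  rw [← measurePreserving_rfl1.integral_comp measurableEmbedding_rfl1]
  simp [rfl1]

theorem Ext_comp_rfl1 (u : ℝ × ℝ → ℂ) (x : E3) : Ext (u ∘ rfl1) x = Ext u (rfl1 x.1, x.2) := by
  unfold Ext
  rw [← measurePreserving_rfl1.integral_comp measurableEmbedding_rfl1]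
  refine integral_congr_ae (ae_of_all _ fun ξ => ?_)
  simp only [F2_comp_rfl1]
  simp [rfl1, ch, en]
  rfl

theorem exists_lintegral_Pr_four (hφ : IsLPBump φ) {ε : ℝ} (hε : 0 < ε) : ∃ C : ℝ, 0 ≤ C ∧
    ∀ m : ℤ, 0 ≤ m → ∀ (n : ℕ) (h : ℝ × ℝ → ℂ), Measurable h → Integrable h →
    ∫⁻ x in {x : E3 | |x.2| ≤ 4 ^ n}, ‖Pr φ m h x‖ₑ ^ 4 ≤
      ENNReal.ofReal (C * 4 ^ n * (2 : ℝ) ^ (ε * n)) * ∫⁻ y, ‖h y‖ₑ ^ 4 := by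
  obtain ⟨C₁, hC₁, H₁⟩ := ext_four hε
  obtain ⟨C₂, hC₂, H₂⟩ := exists_sm_le hφ
  refine ⟨C₁ * C₂, by positivity, fun m hm n h hmeas hh => ?_⟩
  have hu : Integrable (sm φ m h) := integrable_sm hφ hm hh
  have hum : Measurable (sm φ m h) := (continuous_sm hφ hm hh).measurable
  have key : ∫⁻ x in {x : E3 | |x.2| ≤ 4 ^ n}, ‖Pr φ m h x‖ₑ ^ 4 ≤
      ENNReal.ofReal (C₁ * 4 ^ n * (2 : ℝ) ^ (ε * n)) * ∫⁻ y, ‖sm φ m h y‖ₑ ^ 4 := by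
    simp_rw [Pr_eq_Ext hφ hm hh]
    rcases hm.eq_or_lt with rfl | hm1
    · have h1 := H₁ n (sm φ 0 h ∘ rfl1) (hum.comp measurePreserving_rfl1.measurable)
        (measurePreserving_rfl1.integrable_comp_of_integrable hu) (fun ξ hξ => ?_)
      · simp only [Function.comp_apply] at h1
        rw [measurePreserving_rfl1.lintegral_comp_emb measurableEmbedding_rfl1
          (fun y => ‖sm φ 0 h y‖ₑ ^ 4)] at h1
        refine le_trans (le_of_eq ?_) h1
        have h2 : MeasurePreserving (Prod.map rfl1 id) (volume : Measure E3) volume :=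
          measurePreserving_rfl1.prod (MeasurePreserving.id volume)
        have h3 : MeasurableEmbedding (Prod.map rfl1 (id : ℝ → ℝ)) :=
          measurableEmbedding_rfl1.prodMap MeasurableEmbedding.id
        have h4 := h2.setLIntegral_comp_preimage_emb h3 (fun x : E3 => ‖Ext (sm φ 0 h) x‖ₑ ^ 4)
          {x : E3 | |x.2| ≤ 4 ^ n}
        rw [← h4]
        simp_rw [Ext_comp_rfl1]
        rfl
      · rw [F2_comp_rfl1, show rfl1 (-ξ) = -rfl1 ξ by simp [rfl1], F2_sm_neg hφ le_rfl hh] at hξ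
        exact Sec_of_Wm_zero hφ (by exact_mod_cast left_ne_zero_of_mul hξ)
    · refine H₁ n _ hum hu fun ξ hξ => ?_
      rw [F2_sm_neg hφ hm hh] at hξ
      exact Sec_of_Wm hφ hm1 (by exact_mod_cast left_ne_zero_of_mul hξ)
  refine key.trans ((mul_le_mul_right (H₂ m hm h hmeas).2 _).trans (le_of_eq ?_))
  rw [← mul_assoc, ← ENNReal.ofReal_mul (by positivity)]
  congr 2; ring

theorem sq_le_abs_cos_sub_cos {a b : ℝ} (ha : 0 ≤ a) (haπ : a ≤ π) (hb : 0 ≤ b) (hbπ : b ≤ π) :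
    2 / π ^ 2 * (a - b) ^ 2 ≤ |Real.cos a - Real.cos b| := by
  wlog hab : a ≤ b generalizing a b
  · rw [abs_sub_comm, ← neg_sub b a, neg_sq]
    exact this hb hbπ ha haπ (le_of_not_ge hab)
  have h1 := Real.mul_le_sin (x := (b - a) / 2) (by linarith) (by linarith)
  have h2 : Real.sin ((b - a) / 2) ≤ Real.sin ((a + b) / 2) := by
    have h3 : 0 ≤ Real.sin (a / 2) := Real.sin_nonneg_of_nonneg_of_le_pi (by linarith) (by linarith)
    have h4 : 0 ≤ Real.cos (b / 2) := Real.cos_nonneg_of_neg_pi_div_two_le_of_le (by linarith) (by linarith)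
    rw [show (b - a) / 2 = b / 2 - a / 2 by ring, show (a + b) / 2 = b / 2 + a / 2 by ring,
      Real.sin_sub, Real.sin_add]
    nlinarith [mul_nonneg h4 h3]
  have h5 : 0 ≤ 2 / π * ((b - a) / 2) := by
    have := Real.pi_pos
    have : 0 ≤ b - a := by linarith
    positivity
  have h6 : Real.cos a - Real.cos b = 2 * (Real.sin ((a + b) / 2) * Real.sin ((b - a) / 2)) := by
    rw [Real.cos_sub_cos, show (a - b) / 2 = -((b - a) / 2) by ring, Real.sin_neg]; ring
  refine le_trans ?_ (le_abs_self _)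
  rw [h6]
  have h7 : (2 / π * ((b - a) / 2)) * (2 / π * ((b - a) / 2)) ≤
      Real.sin ((a + b) / 2) * Real.sin ((b - a) / 2) :=
    mul_le_mul (h1.trans h2) h1 h5 ((h5.trans h1).trans h2)
  refine le_trans (le_of_eq ?_) (mul_le_mul_of_nonneg_left h7 zero_le_two)
  field_simp
  ring

theorem integral_inv_one_add_mul_sq {κ : ℝ} (hκ : 0 < κ) (c : ℝ) :
    Integrable (fun x : ℝ => (1 + (κ * (x - c)) ^ 2)⁻¹) ∧
      ∫ x : ℝ, (1 + (κ * (x - c)) ^ 2)⁻¹ = π / κ := by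
  have h1 : Integrable (fun x : ℝ => (1 + (κ * x) ^ 2)⁻¹) :=
    integrable_inv_one_add_sq.comp_mul_left' hκ.ne'
  refine ⟨h1.comp_sub_right c, ?_⟩
  rw [integral_sub_right_eq_self (fun x : ℝ => (1 + (κ * x) ^ 2)⁻¹) c,
    Measure.integral_comp_mul_left (fun x : ℝ => (1 + x ^ 2)⁻¹) κ, integral_univ_inv_one_add_sq,
    abs_of_pos (inv_pos.2 hκ), smul_eq_mul]
  ring

/-- The angular integral of the dispersive kernel. -/
theorem integral_angle_le {τ R : ℝ} (hτ : 0 < τ) (hR : 0 ≤ R) :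
    ∫ θ in (0 : ℝ)..π, (1 + (τ - R * Real.cos θ) ^ 2)⁻¹ ≤ 2 * π ^ 2 / √τ := by
  have hπ := Real.pi_pos
  have hs : 0 < √τ := Real.sqrt_pos.2 hτ
  have hcont : Continuous fun θ : ℝ => (1 + (τ - R * Real.cos θ) ^ 2)⁻¹ :=
    Continuous.inv₀ (by fun_prop) fun θ => by positivity
  rcases le_total R (τ / 2) with hRτ | hRτ
  · have h1 : ∀ θ ∈ Icc 0 π, (1 + (τ - R * Real.cos θ) ^ 2)⁻¹ ≤ (√τ)⁻¹ := fun θ _ => by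
      refine inv_anti₀ hs ?_
      have h2 : τ / 2 ≤ τ - R * Real.cos θ := by nlinarith [Real.cos_le_one θ]
      have h3 : (τ / 2) ^ 2 ≤ (τ - R * Real.cos θ) ^ 2 := pow_le_pow_left₀ (by positivity) h2 2
      have h4 : √τ ^ 2 = τ := Real.sq_sqrt hτ.le
      nlinarith [sq_nonneg (τ / 2 - 1), sq_nonneg (√τ - 1 / 2), sq_nonneg (√τ - 1), sq_nonneg (τ / 2 - 1 / 2)]
    calc _ ≤ ∫ θ in (0 : ℝ)..π, (√τ)⁻¹ :=
          intervalIntegral.integral_mono_on hπ.le (hcont.intervalIntegrable _ _) (by simp) h1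
      _ = π / √τ := by simp [div_eq_mul_inv]
      _ ≤ _ := by
          refine div_le_div_of_nonneg_right ?_ hs.le
          nlinarith [Real.pi_gt_three]
  · have hR0 : 0 < R := by linarith
    set θ₀ := Real.arccos (min (τ / R) 1) with hθ₀
    have hc0 : Real.cos θ₀ = min (τ / R) 1 := by
      refine Real.cos_arccos ?_ (min_le_right _ _)
      exact le_min (by have := div_pos hτ hR0; linarith) (by norm_num)
    set κ := √τ / π with hκ
    have hκ0 : 0 < κ := by positivity
    obtain ⟨hi, hI⟩ := integral_inv_one_add_mul_sq hκ0 θ₀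
    have h1 : ∀ θ ∈ Icc 0 π, (1 + (τ - R * Real.cos θ) ^ 2)⁻¹ ≤ 2 * (1 + (κ * (θ - θ₀)) ^ 2)⁻¹ := by
      intro θ hθ
      have h2 := sq_le_abs_cos_sub_cos (Real.arccos_nonneg (min (τ / R) 1)) (Real.arccos_le_pi _) hθ.1 hθ.2
      rw [← hθ₀, hc0] at h2
      have h3 : R * |min (τ / R) 1 - Real.cos θ| ≤ |τ - R * Real.cos θ| := by
        rcases le_total (τ / R) 1 with h | h
        · rw [min_eq_left h, ← abs_of_pos hR0, ← abs_mul, abs_of_pos hR0]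
          refine le_of_eq ?_
          congr 1
          field_simp
        · rw [min_eq_right h, abs_of_nonneg (by linarith [Real.cos_le_one θ])]
          rw [le_div_iff₀ hR0] at h
          refine le_trans ?_ (le_abs_self _)
          linarith
      have h4 : (κ * (θ - θ₀)) ^ 2 ≤ |τ - R * Real.cos θ| := by
        refine le_trans ?_ h3
        refine le_trans ?_ (mul_le_mul_of_nonneg_left h2 hR0.le)
        have h5 : κ ^ 2 ≤ R * (2 / π ^ 2) := by
          rw [hκ, div_pow, Real.sq_sqrt hτ.le, ← mul_div_assoc]
          exact div_le_div_of_nonneg_right (by linarith) (by positivity)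
        calc (κ * (θ - θ₀)) ^ 2 = κ ^ 2 * (θ₀ - θ) ^ 2 := by ring
          _ ≤ R * (2 / π ^ 2) * (θ₀ - θ) ^ 2 := mul_le_mul_of_nonneg_right h5 (sq_nonneg _)
          _ = _ := by ring
      have h6 : ((κ * (θ - θ₀)) ^ 2) ^ 2 ≤ (τ - R * Real.cos θ) ^ 2 := by
        rw [← sq_abs (τ - _)]
        exact pow_le_pow_left₀ (sq_nonneg _) h4 2
      rw [← div_eq_mul_inv, inv_eq_one_div, div_le_div_iff₀ (by positivity) (by positivity)]
      nlinarith [sq_nonneg ((κ * (θ - θ₀)) ^ 2 - 1 / 2)]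
    have hi' : Integrable fun θ : ℝ => 2 * (1 + (κ * (θ - θ₀)) ^ 2)⁻¹ := hi.const_mul 2
    calc _ ≤ ∫ θ in (0 : ℝ)..π, 2 * (1 + (κ * (θ - θ₀)) ^ 2)⁻¹ :=
          intervalIntegral.integral_mono_on hπ.le (hcont.intervalIntegrable _ _) hi'.intervalIntegrable h1
      _ ≤ ∫ θ : ℝ, 2 * (1 + (κ * (θ - θ₀)) ^ 2)⁻¹ := by
          rw [intervalIntegral.integral_of_le hπ.le]
          exact setIntegral_le_integral hi' (ae_of_all _ fun θ => by positivity)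
      _ = 2 * (π / κ) := by rw [integral_const_mul, hI]
      _ = 2 * π ^ 2 / √τ := by rw [hκ]; field_simp
      _ ≤ _ := le_rfl

theorem exists_polar (y : ℝ × ℝ) : ∃ R α : ℝ, 0 ≤ R ∧
    ∀ θ, y.1 * Real.cos θ + y.2 * Real.sin θ = R * Real.cos (θ - α) := by
  refine ⟨‖(⟨y.1, y.2⟩ : ℂ)‖, Complex.arg ⟨y.1, y.2⟩, norm_nonneg _, fun θ => ?_⟩
  have h1 := Complex.norm_mul_cos_arg ⟨y.1, y.2⟩
  have h2 := Complex.norm_mul_sin_arg ⟨y.1, y.2⟩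
  simp only at h1 h2
  rw [Real.cos_sub]
  linear_combination (-Real.cos θ) * h1 - Real.sin θ * h2

theorem integral_angle_full_le {τ : ℝ} (hτ : 0 < τ) (y : ℝ × ℝ) :
    ∫ θ in (-π)..π, (1 + (τ + (y.1 * Real.cos θ + y.2 * Real.sin θ)) ^ 2)⁻¹ ≤ 4 * π ^ 2 / √τ := by
  obtain ⟨R, α, hR, hα⟩ := exists_polar y
  simp_rw [hα]
  set G : ℝ → ℝ := fun θ => (1 + (τ + R * Real.cos θ) ^ 2)⁻¹ with hG
  have hper : Function.Periodic G (2 * π) := fun θ => by simp [hG]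
  have hcont : Continuous G := Continuous.inv₀ (by fun_prop) fun θ => by positivity
  have h1 : ∫ θ in (-π)..π, (1 + (τ + R * Real.cos (θ - α)) ^ 2)⁻¹ = ∫ θ in (0 : ℝ)..(2 * π), G θ := by
    change ∫ θ in (-π)..π, G (θ - α) = _
    rw [intervalIntegral.integral_comp_sub_right (fun θ => G θ) α]
    have := hper.intervalIntegral_add_eq (-π - α) 0
    rw [zero_add] at this
    rw [← this]
    congr 1; ring
  have h2 : ∫ θ in (0 : ℝ)..π, G θ ≤ 2 * π ^ 2 / √τ := by
    refine le_trans (le_of_eq ?_) (integral_angle_le hτ hR)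
    have := intervalIntegral.integral_comp_sub_left (a := 0) (b := π) G π
    rw [sub_self, sub_zero] at this
    rw [← this]
    refine intervalIntegral.integral_congr fun θ _ => ?_
    simp only [hG, Real.cos_pi_sub]
    ring_nf
  have h3 : ∫ θ in π..(2 * π), G θ = ∫ θ in (0 : ℝ)..π, G θ := by
    have := intervalIntegral.integral_comp_sub_left (a := 0) (b := π) G (2 * π)
    rw [sub_zero, show 2 * π - π = π by ring] at this
    rw [← this]
    refine intervalIntegral.integral_congr fun θ _ => ?_
    simp only [hG, Real.cos_two_pi_sub]
  rw [h1, ← intervalIntegral.integral_add_adjacent_intervals (hcont.intervalIntegrable 0 π)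
    (hcont.intervalIntegrable π (2 * π)), h3]
  calc _ ≤ 2 * π ^ 2 / √τ + 2 * π ^ 2 / √τ := add_le_add h2 h2
    _ = _ := by ring

/-- The radial cutoff used in the dispersive estimate. -/
def bmp : ContDiffBump (3 / 2 : ℝ) := ⟨3 / 5, 1, by norm_num, by norm_num⟩

theorem bmp_eq_one {ρ : ℝ} (h1 : 9 / 10 ≤ ρ) (h2 : ρ ≤ 21 / 10) : bmp ρ = 1 := by
  refine bmp.one_of_mem_closedBall ?_
  rw [Metric.mem_closedBall, Real.dist_eq, abs_le]
  change -(3 / 5) ≤ _ ∧ _ ≤ (3 / 5 : ℝ)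
  constructor <;> linarith

theorem bmp_ne_zero {ρ : ℝ} (h : bmp ρ ≠ 0) : 1 / 2 < ρ ∧ ρ < 5 / 2 := by
  have h1 : ρ ∈ Function.support bmp := h
  rw [bmp.support_eq, Metric.mem_ball, Real.dist_eq, abs_lt] at h1
  change -1 < _ ∧ _ < (1 : ℝ) at h1
  constructor <;> linarith [h1.1, h1.2]

theorem CC_bmp_en : CC fun ξ : ℝ × ℝ => (bmp (en ξ) : ℂ) := by
  refine ⟨Complex.continuous_ofReal.comp (bmp.continuous.comp (by fun_prop)), ?_⟩
  refine HasCompactSupport.intro (isCompact_closedBall (0 : ℝ × ℝ) 3) fun ξ hξ => ?_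
  rw [mem_closedBall_zero_iff, not_le] at hξ
  by_contra h
  have h1 := bmp_ne_zero (ρ := en ξ) (by exact_mod_cast h)
  have h2 : ‖ξ‖ ≤ en ξ := by
    rw [Prod.norm_def]
    exact max_le (abs_fst_le_en ξ) (abs_snd_le_en ξ)
  linarith

/-- The radial integral in the dispersive kernel. -/
def radInt (s : ℝ) : ℂ := ∫ ρ : ℝ, Complex.exp (Complex.I * ((ρ * s : ℝ) : ℂ)) * ((ρ * bmp ρ : ℝ) : ℂ)

theorem exists_radInt_le : ∃ C : ℝ, 0 ≤ C ∧ ∀ s, ‖radInt s‖ ≤ C * (1 + s ^ 2)⁻¹ := by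
  set B : ℝ → ℂ := fun ρ => ((ρ * bmp ρ : ℝ) : ℂ) with hB
  have hBs : HasCompactSupport B := by
    have : HasCompactSupport fun ρ : ℝ => ((ρ : ℂ)) * ((bmp ρ : ℝ) : ℂ) :=
      (bmp.hasCompactSupport.comp_left (g := fun x : ℝ => (x : ℂ)) (by simp)).mul_left
    simpa [hB] using this
  have hBd : ContDiff ℝ ∞ B := Complex.ofRealCLM.contDiff.comp (contDiff_id.mul bmp.contDiff)
  set S : 𝓢(ℝ, ℂ) := hBs.toSchwartzMap hBd
  set T : 𝓢(ℝ, ℂ) := 𝓕 S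
  have hT : ∀ s, radInt s = T (-(s / (2 * π))) := fun s => by
    have h0 : T (-(s / (2 * π))) = 𝓕 B (-(s / (2 * π))) := by
      rw [SchwartzMap.fourier_coe]; rfl
    rw [h0, Real.fourier_eq', radInt]
    refine integral_congr_ae (ae_of_all _ fun ρ => ?_)
    simp only [hB, smul_eq_mul, RCLike.inner_apply, conj_trivial]
    congr 2
    rw [mul_comm]
    congr 2
    field_simp
  obtain ⟨C0, hC0⟩ := T.decay 0 0
  obtain ⟨C2, hC2⟩ := T.decay 2 0
  obtain ⟨hC0p, hC0⟩ := hC0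
  obtain ⟨hC2p, hC2⟩ := hC2
  refine ⟨C0 + (2 * π) ^ 2 * C2, by positivity, fun s => ?_⟩
  have h0 := hC0 (-(s / (2 * π)))
  have h2 := hC2 (-(s / (2 * π)))
  rw [norm_iteratedFDeriv_zero] at h0 h2
  rw [pow_zero, one_mul, ← hT] at h0
  rw [← hT, norm_neg, Real.norm_eq_abs, sq_abs, div_pow, div_mul_eq_mul_div, div_le_iff₀ (by positivity)] at h2
  rw [← div_eq_mul_inv, le_div_iff₀ (by positivity)]
  linarith

/-- The dispersive kernel. -/
def KB (x : E3) : ℂ := ∫ ξ : ℝ × ℝ, ch x (ξ, en ξ) * (bmp (en ξ) : ℂ)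

theorem KB_eq (x : E3) : KB x =
    ∫ θ in Ioo (-π) π, radInt (x.2 + (x.1.1 * Real.cos θ + x.1.2 * Real.sin θ)) := by
  set G : ℝ × ℝ → ℂ := fun p => Complex.exp (Complex.I *
    ((p.1 * (x.2 + (x.1.1 * Real.cos p.2 + x.1.2 * Real.sin p.2)) : ℝ) : ℂ)) * ((p.1 * bmp p.1 : ℝ) : ℂ) with hG
  have hB : Integrable fun ρ : ℝ => ((ρ * bmp ρ : ℝ) : ℂ) := by
    refine Integrable.ofReal ?_
    have h1 : Continuous fun ρ : ℝ => ρ * bmp ρ := continuous_id.mul bmp.continuous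
    exact h1.integrable_of_hasCompactSupport bmp.hasCompactSupport.mul_left
  have hGi : Integrable G (volume.prod (volume.restrict (Ioo (-π) π))) := by
    have h1 : Integrable (fun _ : ℝ => (1 : ℂ)) (volume.restrict (Ioo (-π) π)) := integrable_const _
    have h2 := hB.mul_prod h1
    simp only [mul_one] at h2
    refine h2.bdd_mul (c := 1) (Continuous.aestronglyMeasurable (by fun_prop)) (ae_of_all _ fun p => ?_)
    rw [mul_comm, Complex.norm_exp_ofReal_mul_I]
  have h1 : KB x = ∫ p in Ioi (0 : ℝ) ×ˢ Ioo (-π) π, G p := by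
    unfold KB
    rw [← integral_comp_polarCoord_symm, polarCoord_target]
    refine setIntegral_congr_fun (measurableSet_Ioi.prod measurableSet_Ioo) fun p hp => ?_
    have hp0 : 0 < p.1 := hp.1
    have hen : en (p.1 * Real.cos p.2, p.1 * Real.sin p.2) = p.1 := by
      rw [en]
      have : (p.1 * Real.cos p.2) ^ 2 + (p.1 * Real.sin p.2) ^ 2 = p.1 ^ 2 := by
        linear_combination p.1 ^ 2 * Real.sin_sq_add_cos_sq p.2
      simp only
      rw [this, Real.sqrt_sq hp0.le]
    simp only [hG, ch, polarCoord_symm_apply, hen]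
    rw [Complex.real_smul]
    push_cast
    ring_nf
  have h2 : ∫ p in Ioi (0 : ℝ) ×ˢ Ioo (-π) π, G p = ∫ p in univ ×ˢ Ioo (-π) π, G p := by
    symm
    refine setIntegral_eq_of_subset_of_forall_sdiff_eq_zero (MeasurableSet.univ.prod measurableSet_Ioo)
      (prod_mono (subset_univ _) le_rfl) fun p hp => ?_
    have h3 : bmp p.1 = 0 := by
      by_contra h
      exact hp.2 ⟨by have := (bmp_ne_zero h).1; simp only [mem_Ioi]; linarith, hp.1.2⟩
    simp [hG, h3]
  rw [h1, h2, Measure.volume_eq_prod, ← Measure.prod_restrict, Measure.restrict_univ,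
    integral_prod_symm _ hGi]
  rfl

theorem exists_KB_le : ∃ C : ℝ, 0 ≤ C ∧ ∀ x : E3, 0 < x.2 → ‖KB x‖ ≤ C / √x.2 := by
  obtain ⟨C, hC0, hC⟩ := exists_radInt_le
  refine ⟨C * (4 * π ^ 2), by positivity, fun x hx => ?_⟩
  have hcont : Continuous fun θ : ℝ => (1 + (x.2 + (x.1.1 * Real.cos θ + x.1.2 * Real.sin θ)) ^ 2)⁻¹ :=
    Continuous.inv₀ (by fun_prop) fun θ => by positivity
  have hi : IntegrableOn (fun θ : ℝ => C * (1 + (x.2 + (x.1.1 * Real.cos θ + x.1.2 * Real.sin θ)) ^ 2)⁻¹)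
      (Ioo (-π) π) :=
    ((continuous_const.mul hcont).continuousOn.integrableOn_Icc).mono_set Ioo_subset_Icc_self
  rw [KB_eq]
  refine (norm_integral_le_of_norm_le hi (ae_of_all _ fun θ => hC _)).trans ?_
  rw [integral_const_mul, ← integral_Ioc_eq_integral_Ioo, ← intervalIntegral.integral_of_le
    (by linarith [Real.pi_pos]), mul_div_assoc]
  exact mul_le_mul_of_nonneg_left (integral_angle_full_le hx x.1) hC0

theorem Pr_eq_KB (hφ : IsLPBump φ) {m : ℤ} (hm : 0 ≤ m) {h : ℝ × ℝ → ℂ} (hh : Integrable h) (x : E3) :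
    Pr φ m h x = ∫ z, sm φ m h z * KB (x.1 - z, x.2) := by
  have hu := integrable_sm hφ hm hh
  have h1 : ∀ ξ, Wm φ m ξ * F2 h (-ξ) = (bmp (en ξ) : ℂ) * F2 (sm φ m h) (-ξ) := fun ξ => by
    rw [F2_sm_neg hφ hm hh]
    by_cases hW : Wm φ m ξ = 0
    · simp [hW]
    · obtain ⟨⟨h1, h2⟩, -⟩ := Wm_ne_zero hφ hW
      rw [bmp_eq_one (by linarith) (by linarith)]
      simp
  have h_int : Integrable (fun p : (ℝ × ℝ) × (ℝ × ℝ) => ch x (p.1, en p.1) *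
      Complex.exp (Complex.I * (((-p.1).1 * p.2.1 + (-p.1).2 * p.2.2 : ℝ) : ℂ)) *
        ((bmp (en p.1) : ℂ) * sm φ m h p.2)) (volume.prod volume) := by
    refine (CC_bmp_en.integrable.mul_prod hu).bdd_mul (c := 1)
      (Continuous.aestronglyMeasurable ?_) (ae_of_all _ fun p => ?_)
    · unfold ch; fun_prop
    · rw [norm_mul, norm_ch, one_mul, mul_comm, Complex.norm_exp_ofReal_mul_I]
  calc Pr φ m h x = ∫ ξ, ∫ z, ch x (ξ, en ξ) *
      Complex.exp (Complex.I * (((-ξ).1 * z.1 + (-ξ).2 * z.2 : ℝ) : ℂ)) *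
        ((bmp (en ξ) : ℂ) * sm φ m h z) := by
        unfold Pr
        refine integral_congr_ae (ae_of_all _ fun ξ => ?_)
        simp only
        rw [h1, F2, ← integral_const_mul, ← integral_const_mul]
        refine integral_congr_ae (ae_of_all _ fun z => ?_)
        simp only
        ring
    _ = ∫ z, ∫ ξ, ch x (ξ, en ξ) *
      Complex.exp (Complex.I * (((-ξ).1 * z.1 + (-ξ).2 * z.2 : ℝ) : ℂ)) *
        ((bmp (en ξ) : ℂ) * sm φ m h z) := integral_integral_swap h_int
    _ = _ := by
        refine integral_congr_ae (ae_of_all _ fun z => ?_)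
        simp only
        rw [KB, ← integral_const_mul]
        refine integral_congr_ae (ae_of_all _ fun ξ => ?_)
        simp only [ch]
        rw [← Complex.exp_add, show ∀ a b c : ℂ, a * (b * c) = c * (a * b) from fun a b c => by ring]
        congr 3
        simp only [Prod.fst_neg, Prod.snd_neg, Prod.fst_sub, Prod.snd_sub]
        push_cast
        ring

theorem exists_Pr_sup_le (hφ : IsLPBump φ) : ∃ C : ℝ, 0 ≤ C ∧ ∀ m : ℤ, 0 ≤ m →
    ∀ h : ℝ × ℝ → ℂ, Measurable h → Integrable h → ∀ x : E3, 0 < x.2 →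
    ‖Pr φ m h x‖ₑ ≤ ENNReal.ofReal (C / √x.2) * ∫⁻ y, ‖h y‖ₑ := by
  obtain ⟨C₁, hC₁, H₁⟩ := exists_KB_le
  obtain ⟨C₂, hC₂, H₂⟩ := exists_sm_le hφ
  refine ⟨C₁ * C₂, by positivity, fun m hm h hmeas hh x hx => ?_⟩
  rw [Pr_eq_KB hφ hm hh]
  refine (enorm_integral_le_lintegral_enorm _).trans ?_
  calc ∫⁻ z, ‖sm φ m h z * KB (x.1 - z, x.2)‖ₑ
      ≤ ∫⁻ z, ENNReal.ofReal (C₁ / √x.2) * ‖sm φ m h z‖ₑ := by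
        refine lintegral_mono fun z => ?_
        rw [enorm_mul, mul_comm, ← ofReal_norm (KB _)]
        exact mul_le_mul_left (ENNReal.ofReal_le_ofReal (H₁ (x.1 - z, x.2) hx)) _
    _ = ENNReal.ofReal (C₁ / √x.2) * ∫⁻ z, ‖sm φ m h z‖ₑ :=
        lintegral_const_mul' _ _ ENNReal.ofReal_ne_top
    _ ≤ ENNReal.ofReal (C₁ / √x.2) * (ENNReal.ofReal C₂ * ∫⁻ z, ‖h z‖ₑ) :=
        mul_le_mul_right (H₂ m hm h hmeas).1 _
    _ = _ := by
        rw [← mul_assoc, ← ENNReal.ofReal_mul (by positivity)]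
        congr 2; ring

theorem lintegral_Ioi_rpow_indicator_Ici {a : ℝ} (ha : a < 0) {T : ℝ} (hT : 0 < T) :
    ∫⁻ t in Ioi (0 : ℝ), (Ici T).indicator (fun t => ENNReal.ofReal (t ^ (a - 1))) t =
      ENNReal.ofReal (T ^ a / (-a)) := by
  rw [lintegral_indicator measurableSet_Ici, Measure.restrict_restrict measurableSet_Ici,
    inter_eq_left.2 (Ici_subset_Ioi.2 hT), ← restrict_Ioi_eq_restrict_Ici,
    ← ofReal_integral_eq_lintegral_ofReal (integrableOn_Ioi_rpow_of_lt (by linarith) hT),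
    integral_Ioi_rpow_of_lt (by linarith) hT, sub_add_cancel]
  · rw [div_neg, neg_div]
  · exact (ae_restrict_iff' measurableSet_Ioi).2 (ae_of_all _ fun t ht => rpow_nonneg (hT.trans ht).le _)

theorem lintegral_layer_swap {Y : Type*} [MeasurableSpace Y] {ν : Measure Y} [SFinite ν]
    {S : Set (Y × ℝ)} (hS : MeasurableSet S) {w : ℝ → ℝ≥0∞} (hw : Measurable w) {h : Y → ℝ≥0∞}
    (hh : Measurable h) :
    ∫⁻ t in Ioi (0 : ℝ), (∫⁻ y, {y | (y, t) ∈ S}.indicator h y ∂ν) * w t =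
      ∫⁻ y, h y * (∫⁻ t in Ioi (0 : ℝ), {t | (y, t) ∈ S}.indicator w t) ∂ν := by
  have hm : Measurable fun z : Y × ℝ => S.indicator (fun z => h z.1 * w z.2) z :=
    Measurable.indicator (by fun_prop) hS
  calc _ = ∫⁻ t in Ioi (0 : ℝ), ∫⁻ y, S.indicator (fun z => h z.1 * w z.2) (y, t) ∂ν := by
        refine lintegral_congr fun t => ?_
        have hm' : Measurable fun y => {y | (y, t) ∈ S}.indicator h y := hh.indicator (measurable_prodMk_right hS)
        rw [← lintegral_mul_const _ hm']
        refine lintegral_congr fun y => ?_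
        by_cases hy : (y, t) ∈ S <;> simp [indicator, hy]
    _ = ∫⁻ y, (∫⁻ t in Ioi (0 : ℝ), S.indicator (fun z => h z.1 * w z.2) (y, t)) ∂ν :=
        lintegral_lintegral_swap (f := fun t y => S.indicator (fun z => h z.1 * w z.2) (y, t))
          (hm.comp measurable_swap).aemeasurable
    _ = _ := by
        refine lintegral_congr fun y => ?_
        have hm' : Measurable fun t => {t | (y, t) ∈ S}.indicator w t := hw.indicator (measurable_prodMk_left hS)
        rw [← lintegral_const_mul _ hm']
        refine lintegral_congr fun t => ?_
        by_cases hy : (y, t) ∈ S <;> simp [indicator, hy]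

theorem lintegral_rpow_of_weak {X Y : Type*} [MeasurableSpace X] [MeasurableSpace Y]
    {μ : Measure X} {ν : Measure Y} [SFinite ν] {p : ℝ} (hp2 : 2 < p) (hp4 : p < 4)
    {F : X → ℝ} (hFm : Measurable F) (hF : ∀ x, 0 ≤ F x) {f : Y → ℝ} (hfm : Measurable f)
    (hf : ∀ y, 0 ≤ f y) {A : ℝ≥0∞} (hA : A ≠ ⊤)
    (H : ∀ t : ℝ, 0 < t → μ {x | t < F x / 2} ≤
      A * (ENNReal.ofReal (t ^ (-2 : ℝ)) * (∫⁻ y, {y | t < f y}.indicator (fun y => ENNReal.ofReal (f y ^ 2)) y ∂ν) +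
        ENNReal.ofReal (t ^ (-4 : ℝ)) * ∫⁻ y, {y | f y ≤ t}.indicator (fun y => ENNReal.ofReal (f y ^ 4)) y ∂ν)) :
    ∫⁻ x, ENNReal.ofReal (F x ^ p) ∂μ ≤
      ENNReal.ofReal (2 ^ p * p * ((p - 2)⁻¹ + (4 - p)⁻¹)) * A * ∫⁻ y, ENNReal.ofReal (f y ^ p) ∂ν := by
  have hp0 : 0 < p := by linarith
  have hp2' : 0 < p - 2 := by linarith
  have hp4' : 0 < 4 - p := by linarith
  have e1 : ∫⁻ x, ENNReal.ofReal (F x ^ p) ∂μ = ENNReal.ofReal (2 ^ p) * ∫⁻ x, ENNReal.ofReal ((F x / 2) ^ p) ∂μ := by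
    rw [← lintegral_const_mul' _ _ ENNReal.ofReal_ne_top]
    refine lintegral_congr fun x => ?_
    rw [← ENNReal.ofReal_mul (by positivity), div_rpow (hF x) zero_le_two]
    congr 1; field_simp
  have hS1 : MeasurableSet {z : Y × ℝ | z.2 < f z.1} :=
    measurableSet_lt measurable_snd (hfm.comp measurable_fst)
  have hS2 : MeasurableSet {z : Y × ℝ | f z.1 ≤ z.2} :=
    measurableSet_le (hfm.comp measurable_fst) measurable_snd
  have e2 := lintegral_rpow_eq_lintegral_meas_lt_mul μ (f := fun x => F x / 2)
    (ae_of_all _ fun x => by have := hF x; positivity) (by fun_prop) hp0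
  have I1 := lintegral_layer_swap (ν := ν) hS1 (w := fun t => ENNReal.ofReal (t ^ (p - 2 - 1)))
    (by fun_prop) (h := fun y => ENNReal.ofReal (f y ^ 2)) (by fun_prop)
  have I2 := lintegral_layer_swap (ν := ν) hS2 (w := fun t => ENNReal.ofReal (t ^ (p - 4 - 1)))
    (by fun_prop) (h := fun y => ENNReal.ofReal (f y ^ 4)) (by fun_prop)
  have J1 : ∀ y, ENNReal.ofReal (f y ^ 2) * ∫⁻ t in Ioi (0 : ℝ), {t | (y, t) ∈ {z : Y × ℝ | z.2 < f z.1}}.indicator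
      (fun t => ENNReal.ofReal (t ^ (p - 2 - 1))) t = ENNReal.ofReal (p - 2)⁻¹ * ENNReal.ofReal (f y ^ p) := fun y => by
    have := lintegral_Ioi_rpow_indicator hp2' (hf y)
    rw [show {t | (y, t) ∈ {z : Y × ℝ | z.2 < f z.1}} = Iio (f y) from rfl, this,
      ← ENNReal.ofReal_mul (by positivity), ← ENNReal.ofReal_mul (by positivity)]
    congr 1
    rw [← mul_div_assoc, ← rpow_natCast, ← rpow_add' (hf y) (by norm_num; linarith)]
    norm_num [div_eq_inv_mul]
  have J2 : ∀ y, ENNReal.ofReal (f y ^ 4) * ∫⁻ t in Ioi (0 : ℝ), {t | (y, t) ∈ {z : Y × ℝ | f z.1 ≤ z.2}}.indicator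
      (fun t => ENNReal.ofReal (t ^ (p - 4 - 1))) t = ENNReal.ofReal (4 - p)⁻¹ * ENNReal.ofReal (f y ^ p) := fun y => by
    rcases (hf y).eq_or_lt with h0 | h0
    · rw [← h0, zero_rpow hp0.ne']; simp
    have := lintegral_Ioi_rpow_indicator_Ici (a := p - 4) (by linarith) h0
    rw [show {t | (y, t) ∈ {z : Y × ℝ | f z.1 ≤ z.2}} = Ici (f y) from rfl, this,
      ← ENNReal.ofReal_mul (by positivity), ← ENNReal.ofReal_mul (by positivity)]
    congr 1
    rw [← mul_div_assoc, ← rpow_natCast, ← rpow_add h0]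
    norm_num [div_eq_inv_mul]
  simp_rw [J1] at I1
  simp_rw [J2] at I2
  rw [lintegral_const_mul' _ _ ENNReal.ofReal_ne_top] at I1 I2
  have hm1 : Measurable fun t : ℝ => (∫⁻ y, {y | (y, t) ∈ {z : Y × ℝ | z.2 < f z.1}}.indicator
      (fun y => ENNReal.ofReal (f y ^ 2)) y ∂ν) * ENNReal.ofReal (t ^ (p - 2 - 1)) := by
    refine Measurable.mul ?_ (by fun_prop)
    have : Measurable fun z : ℝ × Y => {z : Y × ℝ | z.2 < f z.1}.indicator (fun z => ENNReal.ofReal (f z.1 ^ 2)) z.swap :=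
      (Measurable.indicator (by fun_prop) hS1).comp measurable_swap
    exact this.lintegral_prod_right'
  calc ∫⁻ x, ENNReal.ofReal (F x ^ p) ∂μ
      = ENNReal.ofReal (2 ^ p) * (ENNReal.ofReal p * ∫⁻ t in Ioi 0, μ {x | t < F x / 2} * ENNReal.ofReal (t ^ (p - 1))) := by
        rw [e1, e2]
    _ ≤ ENNReal.ofReal (2 ^ p) * (ENNReal.ofReal p * ∫⁻ t in Ioi (0 : ℝ), A *
        ((∫⁻ y, {y | (y, t) ∈ {z : Y × ℝ | z.2 < f z.1}}.indicator (fun y => ENNReal.ofReal (f y ^ 2)) y ∂ν) *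
            ENNReal.ofReal (t ^ (p - 2 - 1)) +
          (∫⁻ y, {y | (y, t) ∈ {z : Y × ℝ | f z.1 ≤ z.2}}.indicator (fun y => ENNReal.ofReal (f y ^ 4)) y ∂ν) *
            ENNReal.ofReal (t ^ (p - 4 - 1)))) := by
        refine mul_le_mul_right (mul_le_mul_right (setLIntegral_mono' measurableSet_Ioi fun t ht => ?_) _) _
        have ht0 : 0 < t := ht
        refine (mul_le_mul_left (H t ht0) _).trans (le_of_eq ?_)
        have s1 : ENNReal.ofReal (t ^ (p - 2 - 1)) = ENNReal.ofReal (t ^ (-2 : ℝ)) * ENNReal.ofReal (t ^ (p - 1)) := by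
          rw [← ENNReal.ofReal_mul (by positivity), ← rpow_add ht0]; congr 2; ring
        have s2 : ENNReal.ofReal (t ^ (p - 4 - 1)) = ENNReal.ofReal (t ^ (-4 : ℝ)) * ENNReal.ofReal (t ^ (p - 1)) := by
          rw [← ENNReal.ofReal_mul (by positivity), ← rpow_add ht0]; congr 2; ring
        rw [s1, s2]
        simp only [mem_ofPred_eq]
        ring
    _ = ENNReal.ofReal (2 ^ p) * (ENNReal.ofReal p * (A * (ENNReal.ofReal (p - 2)⁻¹ * (∫⁻ y, ENNReal.ofReal (f y ^ p) ∂ν) +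
          ENNReal.ofReal (4 - p)⁻¹ * ∫⁻ y, ENNReal.ofReal (f y ^ p) ∂ν))) := by
        rw [lintegral_const_mul' _ _ hA, lintegral_add_left hm1, I1, I2]
    _ = _ := by
        rw [ENNReal.ofReal_mul (by positivity), ENNReal.ofReal_mul (by positivity),
          ENNReal.ofReal_add (by positivity) (by positivity)]
        ring

/-- A linear operator with the endpoint bounds used in the interpolation. -/
structure EndBd (μ : Measure E3) (T : (ℝ × ℝ → ℂ) → E3 → ℂ) (A D : ℝ) : Prop where
  A0 : 0 < A
  D0 : 0 < D
  meas : ∀ h, Measurable h → Integrable h → Measurable (T h)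
  add : ∀ h k, Integrable h → Integrable k → ∀ x, T (h + k) x = T h x + T k x
  two : ∀ h, Measurable h → Integrable h → ∫⁻ x, ‖T h x‖ₑ ^ 2 ∂μ ≤ ENNReal.ofReal A * ∫⁻ y, ‖h y‖ₑ ^ 2
  four : ∀ h, Measurable h → Integrable h → ∫⁻ x, ‖T h x‖ₑ ^ 4 ∂μ ≤ ENNReal.ofReal A * ∫⁻ y, ‖h y‖ₑ ^ 4
  sup : ∀ h, Measurable h → Integrable h → ∀ x, ‖T h x‖ₑ ≤ ENNReal.ofReal D * ∫⁻ y, ‖h y‖ₑ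

theorem enorm_rpow_eq (z : ℂ) {p : ℝ} (hp : 0 ≤ p) : ‖z‖ₑ ^ p = ENNReal.ofReal (‖z‖ ^ p) := by
  rw [← ofReal_norm, ENNReal.ofReal_rpow_of_nonneg (norm_nonneg _) hp]

theorem enorm_pow_eq (z : ℂ) (n : ℕ) : ‖z‖ₑ ^ n = ENNReal.ofReal (‖z‖ ^ n) := by
  rw [← ofReal_norm, ENNReal.ofReal_pow (norm_nonneg _)]

theorem meas_le_of_lintegral_pow {μ : Measure E3} {F : E3 → ℂ} (hF : Measurable F) {n : ℕ} {B : ℝ≥0∞}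
    (h : ∫⁻ x, ‖F x‖ₑ ^ n ∂μ ≤ B) {t : ℝ} (ht : 0 < t) :
    μ {x | t ≤ ‖F x‖} ≤ ENNReal.ofReal (t ^ (-n : ℝ)) * B := by
  have h1 := mul_meas_ge_le_lintegral (μ := μ) (hF.enorm.pow_const n) (ENNReal.ofReal (t ^ n))
  have h2 : μ {x | t ≤ ‖F x‖} ≤ μ {x | ENNReal.ofReal (t ^ n) ≤ ‖F x‖ₑ ^ n} := by
    refine measure_mono fun x hx => ?_
    rw [mem_ofPred_eq] at hx ⊢
    rw [enorm_pow_eq]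
    exact ENNReal.ofReal_le_ofReal (pow_le_pow_left₀ ht.le hx n)
  have h3 : ENNReal.ofReal (t ^ (-n : ℝ)) * ENNReal.ofReal (t ^ n) = 1 := by
    rw [← ENNReal.ofReal_mul (by positivity), ← rpow_natCast, ← rpow_add ht]; simp
  calc _ = ENNReal.ofReal (t ^ (-n : ℝ)) * (ENNReal.ofReal (t ^ n) * μ {x | t ≤ ‖F x‖}) := by
        rw [← mul_assoc, h3, one_mul]
    _ ≤ _ := mul_le_mul_right (((mul_le_mul_right h2 _).trans h1).trans h) _

theorem EndBd.exists_diag {p : ℝ} (hp2 : 2 ≤ p) (hp4 : p ≤ 4) : ∃ C : ℝ, 0 < C ∧ ∀ {μ T A D}, EndBd μ T A D →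
    ∀ h, Measurable h → Integrable h →
      ∫⁻ x, ‖T h x‖ₑ ^ p ∂μ ≤ ENNReal.ofReal (C * A) * ∫⁻ y, ‖h y‖ₑ ^ p := by
  rcases hp2.eq_or_lt with rfl | hp2
  · exact ⟨1, one_pos, fun {μ T A D} H h hm hi => by simpa using H.two h hm hi⟩
  rcases hp4.eq_or_lt with rfl | hp4
  · refine ⟨1, one_pos, fun {μ T A D} H h hm hi => ?_⟩
    have := H.four h hm hi
    have e : ∀ z : ℂ, ‖z‖ₑ ^ (4 : ℝ) = ‖z‖ₑ ^ (4 : ℕ) := fun z => by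
      rw [← ENNReal.rpow_natCast]; norm_num
    simpa only [e, one_mul] using this
  have hp2' : 0 < p - 2 := by linarith
  have hp4' : 0 < 4 - p := by linarith
  refine ⟨2 ^ p * p * ((p - 2)⁻¹ + (4 - p)⁻¹), by positivity, fun {μ T A D} H h hm hi => ?_⟩
  simp_rw [enorm_rpow_eq _ (by linarith : 0 ≤ p)]
  rw [ENNReal.ofReal_mul (by positivity)]
  refine lintegral_rpow_of_weak hp2 hp4 (H.meas h hm hi).norm (fun x => norm_nonneg _) hm.norm
    (fun y => norm_nonneg _) ENNReal.ofReal_ne_top fun t ht => ?_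
  have hs : MeasurableSet {y | t < ‖h y‖} := measurableSet_lt measurable_const hm.norm
  set h1 := {y | t < ‖h y‖}.indicator h with hh1
  set h2 := {y | t < ‖h y‖}ᶜ.indicator h with hh2
  have hadd : h1 + h2 = h := indicator_self_add_compl _ _
  have m1 : Measurable h1 := hm.indicator hs
  have m2 : Measurable h2 := hm.indicator hs.compl
  have i1 : Integrable h1 := hi.indicator hs
  have i2 : Integrable h2 := hi.indicator hs.compl
  have b1 := meas_le_of_lintegral_pow (H.meas h1 m1 i1) (H.two h1 m1 i1) ht
  have b2 := meas_le_of_lintegral_pow (H.meas h2 m2 i2) (H.four h2 m2 i2) ht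
  have hsub : {x | t < ‖T h x‖ / 2} ⊆ {x | t ≤ ‖T h1 x‖} ∪ {x | t ≤ ‖T h2 x‖} := fun x hx => by
    rw [mem_ofPred_eq, ← hadd, H.add h1 h2 i1 i2] at hx
    have := norm_add_le (T h1 x) (T h2 x)
    by_contra hc
    simp only [mem_union, mem_ofPred_eq, not_or, not_le] at hc
    linarith [hc.1, hc.2]
  refine (measure_mono hsub).trans ((measure_union_le _ _).trans ((add_le_add b1 b2).trans (le_of_eq ?_)))
  have e1 : ∀ y, ‖h1 y‖ₑ ^ 2 = {y | t < ‖h y‖}.indicator (fun y => ENNReal.ofReal (‖h y‖ ^ 2)) y := fun y => by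
    rw [enorm_pow_eq]
    by_cases hy : y ∈ {y | t < ‖h y‖} <;> simp [hh1, hy]
  have e2 : ∀ y, ‖h2 y‖ₑ ^ 4 = {y | ‖h y‖ ≤ t}.indicator (fun y => ENNReal.ofReal (‖h y‖ ^ 4)) y := fun y => by
    have hc : {y | ‖h y‖ ≤ t} = {y | t < ‖h y‖}ᶜ := by ext y; simp
    rw [enorm_pow_eq, hc]
    by_cases hy : y ∈ {y | t < ‖h y‖} <;> simp [hh2, hy]
  simp_rw [e1, e2]
  push_cast
  ring

/-- Off-diagonal interpolation. -/
theorem EndBd.exists_offdiag {p q : ℝ} (hp : 1 < p) (hpq : p ≤ q) (h2 : 1 ≤ q * (1 - 1 / p))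
    (h4 : q * (1 - 1 / p) ≤ 3) : ∃ C : ℝ, 0 < C ∧ ∀ {μ T A D}, [SFinite μ] → EndBd μ T A D →
    ∀ h, Measurable h → Integrable h →
      ∫⁻ x, ‖T h x‖ₑ ^ q ∂μ ≤ ENNReal.ofReal (C * A * D ^ (q / p - 1)) * (∫⁻ y, ‖h y‖ₑ ^ p) ^ (q / p) := by
  have hp0 : 0 < p := by linarith
  rcases hpq.eq_or_lt with rfl | hpq
  · have e : p * (1 - 1 / p) = p - 1 := by field_simp
    rw [e] at h2 h4
    obtain ⟨C, hC, hC'⟩ := EndBd.exists_diag (p := p) (by linarith) (by linarith)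
    refine ⟨C, hC, fun {μ T A D} _ H h hm hi => ?_⟩
    simpa [div_self hp0.ne'] using hC' H h hm hi
  set r := q * (1 - 1 / p) + 1 with hr
  obtain ⟨C, hC, hC'⟩ := EndBd.exists_diag (p := r) (by linarith) (by linarith)
  have hqr : q - r = q / p - 1 := by rw [hr]; ring
  have hqp1 : 1 < q / p := (one_lt_div hp0).2 hpq
  have hrq : r < q := by linarith
  have hr0 : 0 < r := by linarith
  refine ⟨2 ^ q * C, by positivity, fun {μ T A D} _ H h hm hi => ?_⟩
  have hA := H.A0
  have hD := H.D0
  rcases eq_or_ne (∫⁻ y, ‖h y‖ₑ ^ p) ⊤ with htop | htop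
  · rw [htop, ENNReal.top_rpow_of_pos (by linarith), ENNReal.mul_top]
    · exact le_top
    · exact (ENNReal.ofReal_pos.2 (by positivity)).ne'
  rcases eq_or_ne (∫⁻ y, ‖h y‖ₑ ^ p) 0 with hzero | hzero
  · have hz : ∫⁻ y, ‖h y‖ₑ = 0 := by
      rw [lintegral_eq_zero_iff (by fun_prop)] at hzero ⊢
      filter_upwards [hzero] with y hy
      simpa [hp0, hp0.not_gt] using hy
    have hT : ∀ x, ‖T h x‖ₑ = 0 := fun x => by
      have := H.sup h hm hi x
      rw [hz, mul_zero] at this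
      exact le_antisymm this zero_le
    simp [hT, hr0.trans hrq]
  obtain ⟨M, hM⟩ : ∃ M : ℝ, M = (∫⁻ y, ‖h y‖ₑ ^ p).toReal := ⟨_, rfl⟩
  have hM0 : 0 < M := hM ▸ ENNReal.toReal_pos hzero htop
  have hMe : ∫⁻ y, ‖h y‖ₑ ^ p = ENNReal.ofReal M := by rw [hM, ENNReal.ofReal_toReal htop]
  set τ : ℝ × ℝ → ℝ := fun y => D * M * ‖h y‖ ^ (-(p - 1)) with hτ
  have hτm : Measurable τ := by fun_prop
  have key := lintegral_rpow_le_of_layer (μ := μ) (ν := volume) hr0 hrq (H.meas h hm hi).enorm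
    (fun x => enorm_ne_top) (h := fun y => ‖h y‖ₑ ^ r) (by fun_prop) hτm (fun y => by positivity)
    (A := ENNReal.ofReal (C * A)) ENNReal.ofReal_ne_top (fun t ht => ?_)
  · refine key.trans ?_
    have e : ∀ y, ‖h y‖ₑ ^ r * ENNReal.ofReal (τ y ^ (q - r)) ≤
        ENNReal.ofReal ((D * M) ^ (q / p - 1)) * ‖h y‖ₑ ^ p := fun y => by
      rw [enorm_rpow_eq _ hr0.le, enorm_rpow_eq _ hp0.le, ← ENNReal.ofReal_mul (by positivity),
        ← ENNReal.ofReal_mul (by positivity)]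
      refine ENNReal.ofReal_le_ofReal ?_
      rcases (norm_nonneg (h y)).eq_or_lt with h0 | h0
      · rw [← h0, zero_rpow hr0.ne', zero_mul]; positivity
      · simp only [hτ]
        rw [mul_rpow (by positivity) (by positivity), ← rpow_mul h0.le, hqr, mul_left_comm, ← rpow_add h0]
        refine le_of_eq ?_
        congr 2
        rw [hr]
        field_simp
        ring
    refine (mul_le_mul_right (lintegral_mono e) _).trans (le_of_eq ?_)
    rw [lintegral_const_mul' _ _ ENNReal.ofReal_ne_top, hMe, ENNReal.ofReal_rpow_of_nonneg hM0.le (by linarith),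
      ← ENNReal.ofReal_mul (by positivity), ← ENNReal.ofReal_mul (by positivity), ← ENNReal.ofReal_mul (by positivity),
      ← ENNReal.ofReal_mul (by positivity)]
    congr 1
    rw [mul_rpow hD.le hM0.le]
    have : M ^ (q / p) = M ^ (q / p - 1) * M := by
      rw [← rpow_add_one hM0.ne', sub_add_cancel]
    rw [this]; ring
  · have hs : MeasurableSet {y | t < τ y} := measurableSet_lt measurable_const hτm
    set h1 := {y | t < τ y}.indicator h with hh1
    set h2 := {y | t < τ y}ᶜ.indicator h with hh2
    have hadd : h1 + h2 = h := indicator_self_add_compl _ _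
    have m1 : Measurable h1 := hm.indicator hs
    have m2 : Measurable h2 := hm.indicator hs.compl
    have i1 : Integrable h1 := hi.indicator hs
    have i2 : Integrable h2 := hi.indicator hs.compl
    have hsmall : ENNReal.ofReal D * ∫⁻ y, ‖h2 y‖ₑ ≤ ENNReal.ofReal t := by
      have e : ∀ y, ENNReal.ofReal (D * M) * ‖h2 y‖ₑ ≤ ENNReal.ofReal t * ‖h y‖ₑ ^ p := fun y => by
        by_cases hy : t < τ y
        · have : h2 y = 0 := indicator_of_notMem (by simpa using hy) _
          rw [this]; simp
        have : h2 y = h y := indicator_of_mem (by simpa using hy) _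
        rw [this, enorm_rpow_eq _ hp0.le, ← ofReal_norm, ← ENNReal.ofReal_mul (by positivity),
          ← ENNReal.ofReal_mul ht.le]
        refine ENNReal.ofReal_le_ofReal ?_
        rcases (norm_nonneg (h y)).eq_or_lt with h0 | h0
        · rw [← h0, mul_zero]; positivity
        have h5 := mul_le_mul_of_nonneg_right (not_lt.1 hy) (rpow_nonneg h0.le p)
        refine le_trans (le_of_eq ?_) h5
        simp only [hτ]
        rw [mul_assoc (D * M) (‖h y‖ ^ (-(p - 1))), ← rpow_add h0]
        norm_num
      have h6 := lintegral_mono (μ := volume) e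
      rw [lintegral_const_mul' _ _ ENNReal.ofReal_ne_top, lintegral_const_mul' _ _ ENNReal.ofReal_ne_top, hMe,
        ENNReal.ofReal_mul hD.le, mul_right_comm] at h6
      exact (ENNReal.mul_le_mul_iff_left (ENNReal.ofReal_pos.2 hM0).ne' ENNReal.ofReal_ne_top).1 h6
    calc _ ≤ ∫⁻ x, ‖T h1 x‖ₑ ^ r ∂μ := by
          refine lintegral_mono fun x => ENNReal.rpow_le_rpow ?_ hr0.le
          rw [tsub_le_iff_right]
          rw [← hadd, H.add h1 h2 i1 i2]
          refine (enorm_add_le _ _).trans ?_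
          exact add_le_add_right ((H.sup h2 m2 i2 x).trans hsmall) _
      _ ≤ ENNReal.ofReal (C * A) * ∫⁻ y, ‖h1 y‖ₑ ^ r := hC' H h1 m1 i1
      _ = _ := by
          congr 1
          refine lintegral_congr fun y => ?_
          by_cases hy : y ∈ {y | t < τ y}
          · simp only [hh1, indicator_of_mem hy]
          · simp only [hh1, indicator_of_notMem hy]
            simp [hr0]

theorem exists_EndBd (hφ : IsLPBump φ) {ε : ℝ} (hε : 0 < ε) : ∃ C : ℝ, 0 < C ∧ ∀ m : ℤ, 0 ≤ m → ∀ n : ℕ, ∀ a : ℝ,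
    0 < a → EndBd (volume.restrict {x : E3 | |x.2| ≤ 4 ^ n})
      (fun h x => if a ≤ x.2 then Pr φ m h x else 0) (C * (4 ^ n * (2 : ℝ) ^ (ε * n))) (C / √a) := by
  obtain ⟨C1, hC1, h1⟩ := exists_Pr_sup_le hφ
  obtain ⟨C2, hC2, h2⟩ := exists_lintegral_Pr_four hφ hε
  have hb : ∀ a : ℝ, ∀ z : ℂ, ∀ x : E3, ‖if a ≤ x.2 then z else 0‖ₑ ≤ ‖z‖ₑ := fun a z x => by
    split_ifs <;> simp
  have hπ : 0 < 8 * (2 * π) ^ 4 := by positivity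
  set K := C1 + C2 + 8 * (2 * π) ^ 4 with hK
  have hK1 : C1 ≤ K := by linarith
  have hK2 : C2 ≤ K := by linarith
  have hK3 : 8 * (2 * π) ^ 4 ≤ K := by linarith
  have hK0 : 0 < K := by linarith
  refine ⟨K, hK0, fun m hm n a ha => ⟨by positivity, by positivity, fun h _ hi => ?_, fun h k hh hk x => ?_,
    fun h hmh hi => ?_, fun h hmh hi => ?_, fun h hmh hi x => ?_⟩⟩
  · exact Measurable.ite (measurableSet_le measurable_const measurable_snd) (continuous_Pr hφ hm hi).measurable
      measurable_const
  · split_ifs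
    · exact Pr_add hφ hm hh hk x
    · simp
  · refine (lintegral_mono fun x => pow_le_pow_left₀ zero_le (hb a _ x) 2).trans
      ((lintegral_Pr_two hφ hm hi n).trans (mul_le_mul_left (ENNReal.ofReal_le_ofReal ?_) _))
    have : 1 ≤ (2 : ℝ) ^ (ε * n) := one_le_rpow one_le_two (by positivity)
    have h4 : (4 : ℝ) ^ n ≤ 4 ^ n * 2 ^ (ε * n) := le_mul_of_one_le_right (by positivity) this
    exact mul_le_mul hK3 h4 (by positivity) hK0.le
  · refine (lintegral_mono fun x => pow_le_pow_left₀ zero_le (hb a _ x) 4).trans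
      ((h2 m hm n h hmh hi).trans (mul_le_mul_left (ENNReal.ofReal_le_ofReal ?_) _))
    rw [mul_assoc]
    exact mul_le_mul_of_nonneg_right hK2 (by positivity)
  · split_ifs with hx
    · refine (h1 m hm h hmh hi x (ha.trans_le hx)).trans (mul_le_mul_left (ENNReal.ofReal_le_ofReal ?_) _)
      exact div_le_div₀ hK0.le hK1 (sqrt_pos.2 ha) (sqrt_le_sqrt hx)
    · simp

theorem exists_lintegral_Pr_rpow_le (hφ : IsLPBump φ) {ε : ℝ} (hε : 0 < ε) {p q : ℝ} (hp : 1 < p) (hpq : p ≤ q)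
    (h2 : 1 ≤ q * (1 - 1 / p)) (h4 : q * (1 - 1 / p) ≤ 3) : ∃ C : ℝ, 0 < C ∧ ∀ m : ℤ, 0 ≤ m → ∀ n : ℕ, ∀ a : ℝ,
    0 < a → ∀ h : ℝ × ℝ → ℂ, Measurable h → Integrable h →
      ∫⁻ x in {x : E3 | a ≤ x.2 ∧ x.2 ≤ 4 ^ n}, ‖Pr φ m h x‖ₑ ^ q ≤
        ENNReal.ofReal (C * (4 ^ n * (2 : ℝ) ^ (ε * n)) * (1 / √a) ^ (q / p - 1)) *
          (∫⁻ y, ‖h y‖ₑ ^ p) ^ (q / p) := by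
  obtain ⟨C1, hC1, h1⟩ := exists_EndBd hφ hε
  obtain ⟨C2, hC2, h2⟩ := EndBd.exists_offdiag hp hpq h2 h4
  have hp0 : 0 < p := by linarith
  have hq0 : 0 < q := by linarith
  refine ⟨C2 * C1 * C1 ^ (q / p - 1), by positivity, fun m hm n a ha h hmh hi => ?_⟩
  have key := h2 (h1 m hm n a ha) h hmh hi
  have hs : MeasurableSet {x : E3 | a ≤ x.2 ∧ x.2 ≤ 4 ^ n} := by measurability
  refine le_trans ?_ (key.trans (le_of_eq ?_))
  · refine le_trans (le_of_eq (setLIntegral_congr_fun hs fun x hx => ?_)) (lintegral_mono_set fun x hx => ?_)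
    · rw [if_pos hx.1]
    · rw [mem_ofPred_eq, abs_of_pos (ha.trans_le hx.1)]
      exact hx.2
  · congr 2
    rw [div_eq_mul_one_div C1, mul_rpow hC1.le (by positivity)]
    ring

theorem ft2_eq (g : ℝ × ℝ → ℂ) (ξ : ℝ × ℝ) : ft2 g ξ = F2 g (-ξ) := by
  unfold ft2 F2
  refine integral_congr_ae (ae_of_all _ fun y => ?_)
  simp only [Prod.fst_neg, Prod.snd_neg]
  congr 2
  push_cast
  ring

theorem integral_scale {N : ℝ} (hN : 0 < N) (f : ℝ × ℝ → ℂ) :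
    ∫ x : ℝ × ℝ, f (N⁻¹ • x) = ((N ^ 2 : ℝ) : ℂ) * ∫ x, f x := by
  rw [Measure.integral_comp_inv_smul_of_nonneg volume f hN.le, Complex.real_smul]
  simp

theorem ft2_smul {N : ℝ} (hN : 0 < N) (g : ℝ × ℝ → ℂ) (η : ℝ × ℝ) :
    ((N ^ 2 : ℝ) : ℂ) * ft2 g (N • η) = F2 (fun x => g (N⁻¹ • x)) (-η) := by
  unfold ft2 F2
  rw [← integral_scale hN]
  refine integral_congr_ae (ae_of_all _ fun x => ?_)
  simp only [Prod.smul_fst, Prod.smul_snd, Prod.fst_neg, Prod.snd_neg, smul_eq_mul]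
  have h1 : N⁻¹ * x.1 * (N * η.1) = x.1 * η.1 := by field_simp
  have h2 : N⁻¹ * x.2 * (N * η.2) = x.2 * η.2 := by field_simp
  rw [h1, h2]
  congr 2
  push_cast
  ring

theorem en_smul {N : ℝ} (hN : 0 < N) (ξ : ℝ × ℝ) : en (N • ξ) = N * en ξ := by
  unfold en
  rw [← sqrt_sq hN.le, ← sqrt_mul (sq_nonneg N), sqrt_sq hN.le]
  congr 1
  simp only [Prod.smul_fst, Prod.smul_snd, smul_eq_mul]
  ring

theorem psiA_smul {N : ℝ} (hN : 0 < N) (m : ℤ) (ξ : ℝ × ℝ) : psiA φ m (N • ξ) = psiA φ m ξ := by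
  unfold psiA
  change φ ((2 : ℝ) ^ m * |(N • ξ).1 / en (N • ξ) + 1|) = φ ((2 : ℝ) ^ m * |ξ.1 / en ξ + 1|)
  rw [en_smul hN, Prod.smul_fst, smul_eq_mul, mul_div_mul_left _ _ hN.ne']

theorem multiplier_smul (hφ : IsLPBump φ) (j m : ℤ) (η : ℝ × ℝ) :
    φ ((2 : ℝ) ^ (-j) * enorm2 ((2 : ℝ) ^ j • η)) * psiA φ m ((2 : ℝ) ^ j • η) = Wm φ m η * √(en η) := by
  have hN : (0 : ℝ) < 2 ^ j := by positivity
  have h1 : enorm2 ((2 : ℝ) ^ j • η) = 2 ^ j * en η := en_smul hN η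
  rw [psiA_smul hN, h1, ← mul_assoc, ← zpow_add₀ two_ne_zero, neg_add_cancel, zpow_zero, one_mul, Wm]
  by_cases h : φ (en η) = 0
  · simp [h]
  have h2 : 0 < en η := by linarith [(IsLPBump_supp hφ h).1]
  have h3 : en η ^ (-(1 : ℝ) / 2) * √(en η) = 1 := by
    rw [sqrt_eq_rpow, ← rpow_add h2]; norm_num
  linear_combination (-(φ (en η) * psiA φ m η)) * h3

/-- The frequency profile of `projJM φ j m g`. -/
def mulHat (φ : ℝ → ℝ) (j m : ℤ) (g : ℝ × ℝ → ℂ) (ξ : ℝ × ℝ) : ℂ :=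
  ((φ ((2 : ℝ) ^ (-j) * enorm2 ξ) * psiA φ m ξ : ℝ) : ℂ) * ft2 g ξ

theorem CC_mulHat (hφ : IsLPBump φ) (j : ℤ) {m : ℤ} (hm : 0 ≤ m) {g : ℝ × ℝ → ℂ} (hg : Integrable g) :
    CC (mulHat φ j m g) := by
  have hN : (0 : ℝ) < 2 ^ j := by positivity
  have h1 := CC_Wm hφ hm
  have h2 : mulHat φ j m g = fun ξ => ((Wm φ m (((2 : ℝ) ^ j)⁻¹ • ξ) : ℝ) : ℂ) *
      ((√(en (((2 : ℝ) ^ j)⁻¹ • ξ)) : ℂ) * F2 g (-ξ)) := by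
    funext ξ
    unfold mulHat
    have := multiplier_smul hφ j m (((2 : ℝ) ^ j)⁻¹ • ξ)
    rw [smul_inv_smul₀ hN.ne'] at this
    rw [this, ft2_eq]
    push_cast
    ring
  rw [h2]
  have h3 := continuous_F2 hg
  have h4 := continuous_Wm hφ hm
  refine ⟨by fun_prop, HasCompactSupport.mul_right ?_⟩
  exact h1.supp.comp_homeomorph (Homeomorph.smulOfNeZero ((2 : ℝ) ^ j)⁻¹ (inv_ne_zero hN.ne'))

theorem projJM_eq (j m : ℤ) (g : ℝ × ℝ → ℂ) (x : ℝ × ℝ) :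
    projJM φ j m g x = ((((2 * π) ^ 2)⁻¹ : ℝ) : ℂ) * F2 (mulHat φ j m g) x := by
  unfold projJM F2 mulHat
  congr 2
  simp_rw [mul_assoc]

theorem ft2_projJM (hφ : IsLPBump φ) (j : ℤ) {m : ℤ} (hm : 0 ≤ m) {g : ℝ × ℝ → ℂ} (hg : Integrable g) :
    (∀ ξ, ft2 (projJM φ j m g) ξ = mulHat φ j m g ξ) ∨ ∀ ξ, ft2 (projJM φ j m g) ξ = 0 := by
  have hc := CC_mulHat hφ j hm hg
  have h0 : ∀ ξ, ft2 (projJM φ j m g) ξ = ((((2 * π) ^ 2)⁻¹ : ℝ) : ℂ) * F2 (F2 (mulHat φ j m g)) (-ξ) := fun ξ => by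
    rw [ft2_eq, F2, F2, ← integral_const_mul]
    refine integral_congr_ae (ae_of_all _ fun x => ?_)
    simp only [projJM_eq]
    ring
  by_cases hi : Integrable (F2 (mulHat φ j m g))
  · refine Or.inl fun ξ => ?_
    rw [h0, F2_F2_neg hc.cont hc.integrable hi, ← mul_assoc, ← Complex.ofReal_mul,
      inv_mul_cancel₀ (by positivity), Complex.ofReal_one, one_mul]
  · refine Or.inr fun ξ => ?_
    rw [h0, F2, integral_undef, mul_zero]
    intro h
    refine hi ((integrable_norm_iff (continuous_F2 hc.integrable).aestronglyMeasurable).1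
      (h.norm.congr (ae_of_all _ fun x => ?_)))
    simp only [norm_mul]
    rw [mul_comm Complex.I, Complex.norm_exp_ofReal_mul_I, one_mul]

theorem enorm_Uop_le (hφ : IsLPBump φ) (j : ℤ) {m : ℤ} (hm : 0 ≤ m) {g : ℝ × ℝ → ℂ} (hg : Integrable g)
    {r : ℝ} (hr : 0 < r) (t y : ℝ) : ‖Uop (projJM φ j m g) t r y‖ₑ ≤
      ENNReal.ofReal ((r * 2 ^ j) ^ (-(1 : ℝ) / 2)) *
        ‖Pr φ m (fun x => g (((2 : ℝ) ^ j)⁻¹ • x)) ((2 ^ j * ((r ^ 2 + t ^ 2) / 2), 2 ^ j * y), 2 ^ j * (t * r))‖ₑ := by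
  rcases ft2_projJM hφ j hm hg with h | h
  swap
  · simp [Uop, h]
  obtain ⟨N, hN⟩ : ∃ N : ℝ, N = 2 ^ j := ⟨_, rfl⟩
  have hN0 : 0 < N := hN ▸ by positivity
  refine le_of_eq ?_
  have he : ENNReal.ofReal ((r * 2 ^ j) ^ (-(1 : ℝ) / 2)) = ‖(((r * 2 ^ j) ^ (-(1 : ℝ) / 2) : ℝ) : ℂ)‖ₑ := by
    rw [← ofReal_norm, Complex.norm_real, norm_of_nonneg (by positivity)]
  rw [he, ← enorm_mul]
  congr 1
  unfold Uop
  simp_rw [h]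
  rw [← hN]
  calc _ = ∫ ξ : ℝ × ℝ, (fun η => ch ((N * ((r ^ 2 + t ^ 2) / 2), N * y), N * (t * r)) (η, en η) *
        ((((r * N) ^ (-(1 : ℝ) / 2) : ℝ) : ℂ) * (Wm φ m η * ft2 g (N • η)))) (N⁻¹ • ξ) := by
        refine integral_congr_ae (ae_of_all _ fun ξ => ?_)
        obtain ⟨η, rfl⟩ : ∃ η, ξ = N • η := ⟨N⁻¹ • ξ, (smul_inv_smul₀ hN0.ne' ξ).symm⟩
        simp only [inv_smul_smul₀ hN0.ne', mulHat]
        have h1 := multiplier_smul hφ j m η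
        have h2 : enorm2 (N • η) = N * en η := en_smul hN0 η
        rw [← hN] at h1
        rw [h1, h2, abs_of_pos hr]
        have h3 : (r * (N * en η)) ^ (-(1 : ℝ) / 2) * (Wm φ m η * √(en η)) =
            (r * N) ^ (-(1 : ℝ) / 2) * Wm φ m η := by
          by_cases hW : Wm φ m η = 0
          · simp [hW]
          have h4 : 0 < en η := by linarith [(Wm_ne_zero hφ hW).1.1]
          rw [← mul_assoc r, mul_rpow (by positivity) h4.le]
          have h3 : en η ^ (-(1 : ℝ) / 2) * √(en η) = 1 := by
            rw [sqrt_eq_rpow, ← rpow_add h4]; norm_num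
          linear_combination ((r * N) ^ (-(1 : ℝ) / 2) * Wm φ m η) * h3
        have h3' := congrArg (fun x : ℝ => (x : ℂ)) h3
        simp only [Complex.ofReal_mul] at h3'
        have h5 : Complex.exp (Complex.I * (((r ^ 2 + t ^ 2) / 2 * (N • η).1 + y * (N • η).2 +
            t * r * (N * en η) : ℝ) : ℂ)) = ch ((N * ((r ^ 2 + t ^ 2) / 2), N * y), N * (t * r)) (η, en η) := by
          unfold ch
          simp only [Prod.smul_fst, Prod.smul_snd, smul_eq_mul]
          congr 3
          ring
        rw [h5]
        push_cast
        linear_combination (ch ((N * ((r ^ 2 + t ^ 2) / 2), N * y), N * (t * r)) (η, en η) * ft2 g (N • η)) * h3'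
    _ = _ := by
        refine (integral_scale hN0 fun η => ch ((N * ((r ^ 2 + t ^ 2) / 2), N * y), N * (t * r)) (η, en η) *
          ((((r * N) ^ (-(1 : ℝ) / 2) : ℝ) : ℂ) * (Wm φ m η * ft2 g (N • η)))).trans ?_
        rw [Pr, ← integral_const_mul, ← integral_const_mul]
        refine integral_congr_ae (ae_of_all _ fun η => ?_)
        simp only
        rw [← ft2_smul hN0]
        ring

/-- The change of variables taking `(r, t)` to the spatial and temporal variables of a half-wave. -/
def cov (w : ℝ × ℝ) : ℝ × ℝ := ((w.1 ^ 2 + w.2 ^ 2) / 2, w.2 * w.1)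

/-- The derivative of `cov`. -/
def covDeriv (w : ℝ × ℝ) : ℝ × ℝ →L[ℝ] ℝ × ℝ :=
  (Matrix.toLin (.finTwoProd ℝ) (.finTwoProd ℝ) !![w.1, w.2; w.2, w.1]).toContinuousLinearMap

theorem hasFDerivAt_cov (w : ℝ × ℝ) : HasFDerivAt cov (covDeriv w) w := by
  unfold covDeriv
  rw [Matrix.toLin_finTwoProd_toContinuousLinearMap]
  have h1 : HasFDerivAt (fun w : ℝ × ℝ => w.1) (ContinuousLinearMap.fst ℝ ℝ ℝ) w := hasFDerivAt_fst
  have h2 : HasFDerivAt (fun w : ℝ × ℝ => w.2) (ContinuousLinearMap.snd ℝ ℝ ℝ) w := hasFDerivAt_snd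
  have h3 := (((h1.mul h1).add (h2.mul h2)).const_mul (1 / 2)).prodMk (h2.mul h1)
  have e : cov = fun w : ℝ × ℝ => (1 / 2 * (w.1 * w.1 + w.2 * w.2), w.2 * w.1) := by
    funext w; simp only [cov]; congr 1; ring
  rw [e]
  refine h3.congr_fderiv ?_
  ext <;> simp <;> ring

theorem det_covDeriv (w : ℝ × ℝ) : (covDeriv w).det = (w.1 + w.2) * (w.1 - w.2) := by
  rw [covDeriv]
  simp only [LinearMap.det_toContinuousLinearMap, LinearMap.det_toLin, Matrix.det_fin_two_of]
  ring

theorem lintegral_comp_cov_le_aux {S : Set (ℝ × ℝ)} (hS : MeasurableSet S) {d : ℝ} (hd : 0 < d)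
    (h1 : ∀ w ∈ S, 1 ≤ w.1 + w.2 ∧ d ≤ |w.1 - w.2|) (hi : InjOn cov S) (G : ℝ × ℝ → ℝ≥0∞) :
    ∫⁻ w in S, G (cov w) ≤ ENNReal.ofReal d⁻¹ * ∫⁻ v, G v := by
  have key := lintegral_image_eq_lintegral_abs_det_fderiv_mul volume hS
    (fun w _ => (hasFDerivAt_cov w).hasFDerivWithinAt) hi G
  have h2 : ∫⁻ w in S, ENNReal.ofReal d * G (cov w) ≤ ∫⁻ v, G v := by
    refine le_trans ?_ (key.symm.le.trans (setLIntegral_le_lintegral _ _))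
    refine setLIntegral_mono' hS fun w hw => mul_le_mul_left (ENNReal.ofReal_le_ofReal ?_) _
    obtain ⟨h3, h4⟩ := h1 w hw
    rw [det_covDeriv, abs_mul, abs_of_nonneg (by linarith)]
    nlinarith
  rw [lintegral_const_mul' _ _ ENNReal.ofReal_ne_top] at h2
  calc _ = ENNReal.ofReal d⁻¹ * (ENNReal.ofReal d * ∫⁻ w in S, G (cov w)) := by
        rw [← mul_assoc, ← ENNReal.ofReal_mul (by positivity), inv_mul_cancel₀ hd.ne', ENNReal.ofReal_one, one_mul]
    _ ≤ _ := mul_le_mul_right h2 _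

theorem lintegral_comp_cov_le {S : Set (ℝ × ℝ)} (hS : MeasurableSet S) {d : ℝ} (hd : 0 < d)
    (h1 : ∀ w ∈ S, 1 ≤ w.1 + w.2 ∧ d ≤ |w.1 - w.2|) (G : ℝ × ℝ → ℝ≥0∞) :
    ∫⁻ w in S, G (cov w) ≤ ENNReal.ofReal (2 * d⁻¹) * ∫⁻ v, G v := by
  have hadd : ∀ {w w' : ℝ × ℝ}, w ∈ S → w' ∈ S → cov w = cov w' →
      w.1 + w.2 = w'.1 + w'.2 ∧ (w.1 - w.2) ^ 2 = (w'.1 - w'.2) ^ 2 := fun {w w'} hw hw' h => by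
    simp only [cov, Prod.mk.injEq] at h
    have ha := (h1 w hw).1
    have hb := (h1 w' hw').1
    exact ⟨(sq_eq_sq₀ (by linarith) (by linarith)).1 (by linear_combination 2 * h.1 + 2 * h.2),
      by linear_combination 2 * h.1 - 2 * h.2⟩
  set T := {w : ℝ × ℝ | w.2 < w.1} with hT
  have hTm : MeasurableSet T := measurableSet_lt measurable_snd measurable_fst
  have a1 := lintegral_comp_cov_le_aux (hS.inter hTm) hd (fun w hw => h1 w hw.1) (fun w hw w' hw' h => by
    obtain ⟨e1, e2⟩ := hadd hw.1 hw'.1 h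
    have hw2 : w.2 < w.1 := hw.2
    have hw2' : w'.2 < w'.1 := hw'.2
    have := (sq_eq_sq₀ (by linarith) (by linarith)).1 e2
    ext <;> linarith) G
  have a2 := lintegral_comp_cov_le_aux (hS.diff hTm) hd (fun w hw => h1 w hw.1) (fun w hw w' hw' h => by
    obtain ⟨e1, e2⟩ := hadd hw.1 hw'.1 h
    have hw2 : w.1 ≤ w.2 := not_lt.1 hw.2
    have hw2' : w'.1 ≤ w'.2 := not_lt.1 hw'.2
    have := (sq_eq_sq₀ (a := w.2 - w.1) (b := w'.2 - w'.1) (by linarith) (by linarith)).1 (by linear_combination e2)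
    ext <;> linarith) G
  rw [← lintegral_inter_add_sdiff _ S hTm, two_mul, ENNReal.ofReal_add (by positivity) (by positivity), add_mul]
  exact add_le_add a1 a2

theorem lintegral_E3_swap {H : E3 → ℝ≥0∞} (hH : Measurable H) :
    ∫⁻ z, H z = ∫⁻ y : ℝ, ∫⁻ w : ℝ × ℝ, H ((w.1, y), w.2) := by
  calc _ = ∫⁻ x : ℝ × ℝ, ∫⁻ t : ℝ, H (x, t) := lintegral_prod _ hH.aemeasurable
    _ = ∫⁻ r : ℝ, ∫⁻ y : ℝ, ∫⁻ t : ℝ, H ((r, y), t) := lintegral_prod _ hH.lintegral_prod_right'.aemeasurable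
    _ = ∫⁻ y : ℝ, ∫⁻ r : ℝ, ∫⁻ t : ℝ, H ((r, y), t) :=
        lintegral_lintegral_swap (by
          exact (hH.lintegral_prod_right' (ν := volume) : Measurable fun x : ℝ × ℝ => _).aemeasurable)
    _ = _ := by
        refine lintegral_congr fun y => ?_
        have h1 : Measurable fun w : ℝ × ℝ => H ((w.1, y), w.2) := hH.comp (by fun_prop)
        exact (lintegral_prod _ h1.aemeasurable).symm

theorem lintegral_E3_comp_cov_le {S : Set (ℝ × ℝ)} (hS : MeasurableSet S) {d : ℝ} (hd : 0 < d)
    (h1 : ∀ w ∈ S, 1 ≤ w.1 + w.2 ∧ d ≤ |w.1 - w.2|) {G : E3 → ℝ≥0∞} (hG : Measurable G) :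
    ∫⁻ z in {z : E3 | (z.1.1, z.2) ∈ S}, G (((z.1.1 ^ 2 + z.2 ^ 2) / 2, z.1.2), z.2 * z.1.1) ≤
      ENNReal.ofReal (2 * d⁻¹) * ∫⁻ x, G x := by
  have hS' : MeasurableSet {z : E3 | (z.1.1, z.2) ∈ S} :=
    (by fun_prop : Measurable fun z : E3 => (z.1.1, z.2)) hS
  have hG' : Measurable fun z : E3 => G (((z.1.1 ^ 2 + z.2 ^ 2) / 2, z.1.2), z.2 * z.1.1) :=
    hG.comp (by fun_prop)
  rw [← lintegral_indicator hS', lintegral_E3_swap (hG'.indicator hS'), lintegral_E3_swap hG,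
    ← lintegral_const_mul' _ _ ENNReal.ofReal_ne_top]
  refine lintegral_mono fun y => ?_
  refine le_trans (le_of_eq ?_) (lintegral_comp_cov_le hS hd h1 fun v => G ((v.1, y), v.2))
  rw [← lintegral_indicator hS]
  rfl

theorem lintegral_E3_smul {N : ℝ} (hN : 0 < N) {G : E3 → ℝ≥0∞} (hG : Measurable G) :
    ∫⁻ x, G (N • x) = ENNReal.ofReal (N ^ 3)⁻¹ * ∫⁻ x, G x := by
  have h := Measure.map_addHaar_smul (volume : Measure E3) hN.ne'
  have h2 := lintegral_map (μ := (volume : Measure E3)) hG (measurable_const_smul N)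
  rw [← h2, h, lintegral_smul_measure, abs_of_nonneg (by positivity)]
  simp

/-- The region of `(r, t)` carrying the localized operator. -/
def Sup (l : ℤ) : Set (ℝ × ℝ) :=
  {w | 2 / 5 ≤ w.1 ∧ w.1 ≤ 5 ∧ 1 ≤ w.2 ∧ w.2 ≤ 2 ∧ 1 / 2 * ((2 : ℝ) ^ l)⁻¹ ≤ |w.1 - w.2|}

theorem measurableSet_Sup (l : ℤ) : MeasurableSet (Sup l) := by
  have h1 : Measurable fun w : ℝ × ℝ => |w.1 - w.2| := by fun_prop
  exact (measurableSet_le measurable_const measurable_fst).inter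
    ((measurableSet_le measurable_fst measurable_const).inter
      ((measurableSet_le measurable_const measurable_snd).inter
        ((measurableSet_le measurable_snd measurable_const).inter (measurableSet_le measurable_const h1))))

theorem mem_Sup (hφ : IsLPBump φ) {k l : ℤ} (hk : k = -1 ∨ k = 0 ∨ k = 1) {r t : ℝ} (ht : t ∈ Icc (1 : ℝ) 2)
    (h : phikl φ k l r t ≠ 0) : (r, t) ∈ Sup l := by
  simp only [phikl, ne_eq, mul_eq_zero, not_or] at h
  have h1 := IsLPBump_supp hφ h.1
  have h2 := (IsLPBump_supp hφ h.2).1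
  have h3 : 1 / 2 * ((2 : ℝ) ^ l)⁻¹ ≤ |r - t| := by
    rw [← div_eq_mul_inv, div_le_iff₀ (by positivity)]
    linarith
  rcases hk with rfl | rfl | rfl <;> norm_num at h1 <;>
    exact ⟨by simp only; linarith, by simp only; linarith, ht.1, ht.2, h3⟩

theorem enorm_localized_le (hφ : IsLPBump φ) {j k l m : ℤ} (hk : k = -1 ∨ k = 0 ∨ k = 1) (hm : 0 ≤ m)
    {g : ℝ × ℝ → ℂ} (hg : Integrable g) {r t : ℝ} (y : ℝ) (ht : t ∈ Icc (1 : ℝ) 2) :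
    ‖((phikl φ k l r t : ℝ) : ℂ) * Uop (projJM φ j m g) t r y‖ₑ ≤ ENNReal.ofReal (2 * ((2 : ℝ) ^ j) ^ (-(1 : ℝ) / 2)) *
      (Sup l).indicator (fun _ => ‖Pr φ m (fun x => g (((2 : ℝ) ^ j)⁻¹ • x))
        ((2 : ℝ) ^ j • (((r ^ 2 + t ^ 2) / 2, y), t * r))‖ₑ) (r, t) := by
  by_cases h0 : phikl φ k l r t = 0
  · simp [h0]
  have h1 := mem_Sup hφ hk ht h0
  have hr : 2 / 5 ≤ r := h1.1
  rw [indicator_of_mem h1, enorm_mul]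
  have h2 : ‖((phikl φ k l r t : ℝ) : ℂ)‖ₑ ≤ 1 := by
    rw [← ofReal_norm, Complex.norm_real, ENNReal.ofReal_le_one, phikl, norm_mul]
    have hb : ∀ s, ‖φ s‖ ≤ 1 := fun s => by
      rw [norm_of_nonneg (hφ.2.1 s)]; exact IsLPBump_le_one hφ
    exact mul_le_one₀ (hb _) (norm_nonneg _) (hb _)
  refine (mul_le_of_le_one_left zero_le h2).trans ((enorm_Uop_le hφ j hm hg (by linarith) t y).trans ?_)
  refine mul_le_mul_left (ENNReal.ofReal_le_ofReal ?_) _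
  rw [mul_rpow (by linarith) (by positivity)]
  refine mul_le_mul_of_nonneg_right ?_ (by positivity)
  calc r ^ (-(1 : ℝ) / 2) ≤ (1 / 4) ^ (-(1 : ℝ) / 2) :=
        rpow_le_rpow_of_nonpos (by norm_num) (by linarith) (by norm_num)
    _ = 2 := by
        have : (1 / 4 : ℝ) = 2 ^ (-2 : ℝ) := by norm_num [rpow_neg]
        rw [this, ← rpow_mul two_pos.le]
        norm_num

theorem exists_time_exponent {j : ℤ} (hj : -1 ≤ j) : ∃ n : ℕ, 10 * (2 : ℝ) ^ j ≤ 4 ^ n ∧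
    (4 : ℝ) ^ n ≤ 32 * 2 ^ j ∧ (n : ℝ) ≤ (j + 5) / 2 := by
  have h0 : 0 ≤ (j + 5) / 2 := by omega
  obtain ⟨n, hn⟩ := Int.eq_ofNat_of_zero_le h0
  have h4 : (4 : ℝ) ^ n = 2 ^ (2 * n : ℤ) := by
    rw [zpow_mul, zpow_natCast]; norm_num
  refine ⟨n, ?_, ?_, ?_⟩
  · calc 10 * (2 : ℝ) ^ j ≤ 2 ^ (4 : ℤ) * 2 ^ j := by
          refine mul_le_mul_of_nonneg_right (by norm_num) (by positivity)
      _ = 2 ^ (4 + j) := (zpow_add₀ two_ne_zero _ _).symm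
      _ ≤ _ := by rw [h4]; exact zpow_le_zpow_right₀ one_le_two (by omega)
  · calc (4 : ℝ) ^ n = 2 ^ (2 * n : ℤ) := h4
      _ ≤ 2 ^ (5 + j) := zpow_le_zpow_right₀ one_le_two (by omega)
      _ = 2 ^ (5 : ℤ) * 2 ^ j := zpow_add₀ two_ne_zero _ _
      _ = _ := by norm_num
  · have : 2 * (n : ℤ) ≤ j + 5 := by omega
    have := (Int.cast_le (R := ℝ)).2 this
    push_cast at this
    linarith

theorem lintegral_plane_scale {N : ℝ} (hN : 0 < N) {G : ℝ × ℝ → ℝ≥0∞} (hG : Measurable G) :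
    ∫⁻ x, G (N⁻¹ • x) = ENNReal.ofReal (N ^ 2) * ∫⁻ x, G x := by
  have h := Measure.map_addHaar_smul (volume : Measure (ℝ × ℝ)) (inv_ne_zero hN.ne')
  have h2 := lintegral_map (μ := (volume : Measure (ℝ × ℝ))) hG (measurable_const_smul N⁻¹)
  rw [← h2, h, lintegral_smul_measure, abs_of_nonneg (by positivity)]
  simp

theorem exists_lintegral_localized_le (hφ : IsLPBump φ) {ε : ℝ} (hε : 0 < ε) {p q : ℝ} (hp : 1 < p) (hpq : p ≤ q)
    (h2 : 1 ≤ q * (1 - 1 / p)) (h4 : q * (1 - 1 / p) ≤ 3) {k : ℤ} (hk : k = -1 ∨ k = 0 ∨ k = 1) :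
    ∃ C : ℝ, 0 < C ∧ ∀ j l m : ℤ, -1 ≤ j → 0 ≤ m → ∀ g : ℝ × ℝ → ℂ, Measurable g → Integrable g →
      ∫⁻ z : E3 in univ ×ˢ Icc (1 : ℝ) 2,
          ‖((phikl φ k l z.1.1 z.2 : ℝ) : ℂ) * Uop (projJM φ j m g) z.2 z.1.1 z.1.2‖ₑ ^ q ≤
        ENNReal.ofReal (C * (2 : ℝ) ^ (l - j * q / 2 + 3 * j / 2 * (q / p - 1) + ε * q * j)) *
          (∫⁻ y, ‖g y‖ₑ ^ p) ^ (q / p) := by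
  have hp0 : 0 < p := by linarith
  have hq0 : 0 < q := by linarith
  have hqp : 0 ≤ q / p - 1 := by rw [sub_nonneg, le_div_iff₀ hp0]; linarith
  set ε' := 2 * q * ε with hε'
  have hε0 : 0 < ε' := by positivity
  obtain ⟨C, hC, key⟩ := exists_lintegral_Pr_rpow_le hφ hε0 hp hpq h2 h4
  refine ⟨4 * 2 ^ q * (C * (32 * 2 ^ (5 * q * ε)) * 2 ^ (q / p - 1)), by positivity,
    fun j l m hj hm g hmg hg => ?_⟩
  obtain ⟨n, hn1, hn2, hn3⟩ := exists_time_exponent hj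
  obtain ⟨N, hN⟩ : ∃ N : ℝ, N = 2 ^ j := ⟨_, rfl⟩
  have hN0 : 0 < N := hN ▸ by positivity
  set h : ℝ × ℝ → ℂ := fun x => g (N⁻¹ • x) with hh
  have hmh : Measurable h := hmg.comp (measurable_const_smul N⁻¹)
  have hi : Integrable h := hg.comp_smul (inv_ne_zero hN0.ne')
  have hpt := fun (z : E3) (ht : z.2 ∈ Icc (1 : ℝ) 2) =>
    enorm_localized_le hφ (j := j) (l := l) hk hm hg (r := z.1.1) z.1.2 ht
  rw [← hN] at hn1 hn2 hpt
  set V : Set E3 := {x : E3 | 1 / 4 * N ≤ x.2 ∧ x.2 ≤ 4 ^ n} with hV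
  have hVm : MeasurableSet V := (measurableSet_le measurable_const measurable_snd).inter
    (measurableSet_le measurable_snd measurable_const)
  have hPm : Measurable (V.indicator fun x => ‖Pr φ m h x‖ₑ ^ q) :=
    ((continuous_Pr hφ hm hi).measurable.enorm.pow_const q).indicator hVm
  set G : E3 → ℝ≥0∞ := fun x => V.indicator (fun x => ‖Pr φ m h x‖ₑ ^ q) (N • x) with hG
  have hGm : Measurable G := hPm.comp (measurable_const_smul N)
  have hSE : MeasurableSet {z : E3 | (z.1.1, z.2) ∈ Sup l} :=
    (by fun_prop : Measurable fun z : E3 => (z.1.1, z.2)) (measurableSet_Sup l)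
  set K := 2 * N ^ (-(1 : ℝ) / 2) with hK
  have hK0 : 0 < K := by positivity
  have b1 : ∫⁻ z : E3 in univ ×ˢ Icc (1 : ℝ) 2,
        ‖((phikl φ k l z.1.1 z.2 : ℝ) : ℂ) * Uop (projJM φ j m g) z.2 z.1.1 z.1.2‖ₑ ^ q ≤
      ENNReal.ofReal (K ^ q) * ∫⁻ z in {z : E3 | (z.1.1, z.2) ∈ Sup l},
        G (((z.1.1 ^ 2 + z.2 ^ 2) / 2, z.1.2), z.2 * z.1.1) := by
    rw [← lintegral_const_mul' _ _ ENNReal.ofReal_ne_top, ← lintegral_indicator hSE]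
    refine (setLIntegral_mono' (MeasurableSet.univ.prod measurableSet_Icc) fun z hz => ?_).trans
      (setLIntegral_le_lintegral _ _)
    refine (ENNReal.rpow_le_rpow (hpt z hz.2) hq0.le).trans ?_
    by_cases hzS : (z.1.1, z.2) ∈ Sup l
    · rw [indicator_of_mem hzS, indicator_of_mem (by exact hzS), ENNReal.mul_rpow_of_nonneg _ _ hq0.le,
        ENNReal.ofReal_rpow_of_nonneg hK0.le hq0.le]
      refine mul_le_mul_right (le_of_eq ?_) _
      simp only [hG]
      rw [indicator_of_mem]
      obtain ⟨s1, s2, s3, s4, -⟩ := hzS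
      simp only at s1 s2 s3 s4
      have e1 : 1 / 4 ≤ z.2 * z.1.1 := by nlinarith
      have e2 : z.2 * z.1.1 ≤ 10 := by nlinarith
      simp only [hV, mem_ofPred_eq, Prod.smul_snd, smul_eq_mul]
      constructor <;> nlinarith
    · rw [indicator_of_notMem hzS, mul_zero, ENNReal.zero_rpow_of_pos hq0]
      exact zero_le
  have b2 := lintegral_E3_comp_cov_le (measurableSet_Sup l) (d := 1 / 2 * ((2 : ℝ) ^ l)⁻¹) (by positivity)
    (fun w hw => ⟨by linarith [hw.1, hw.2.2.1], hw.2.2.2.2⟩) hGm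
  have b3 : ∫⁻ x, G x = ENNReal.ofReal (N ^ 3)⁻¹ * ∫⁻ x in V, ‖Pr φ m h x‖ₑ ^ q := by
    rw [← lintegral_indicator hVm]
    exact lintegral_E3_smul hN0 hPm
  have b4 := key m hm n (1 / 4 * N) (by positivity) h hmh hi
  have b5 : ∫⁻ y, ‖h y‖ₑ ^ p = ENNReal.ofReal (N ^ 2) * ∫⁻ y, ‖g y‖ₑ ^ p :=
    lintegral_plane_scale hN0 (hmg.enorm.pow_const p)
  rw [b3] at b2
  rw [b5, ENNReal.mul_rpow_of_nonneg _ _ (by positivity), ENNReal.ofReal_rpow_of_nonneg (by positivity) (by positivity)] at b4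
  refine (b1.trans (mul_le_mul_right (b2.trans (mul_le_mul_right (mul_le_mul_right b4 _) _)) _)).trans ?_
  simp_rw [← mul_assoc]
  refine mul_le_mul_left ?_ _
  rw [← ENNReal.ofReal_mul (by positivity), ← ENNReal.ofReal_mul (by positivity), ← ENNReal.ofReal_mul (by positivity),
    ← ENNReal.ofReal_mul (by positivity)]
  refine ENNReal.ofReal_le_ofReal ?_
  have hNr : N = (2 : ℝ) ^ (j : ℝ) := by rw [hN, rpow_intCast]
  have c1 : K ^ q = 2 ^ q * 2 ^ (-(j * q / 2) : ℝ) := by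
    rw [hK, mul_rpow two_pos.le (by positivity), hNr, ← rpow_mul two_pos.le, ← rpow_mul two_pos.le]
    ring_nf
  have c2 : 2 * (1 / 2 * ((2 : ℝ) ^ l)⁻¹)⁻¹ = 4 * 2 ^ (l : ℝ) := by
    rw [rpow_intCast]; field_simp; norm_num
  have c3 : (N ^ 3)⁻¹ = (2 : ℝ) ^ (-(3 * j) : ℝ) := by
    rw [hNr, ← rpow_natCast, ← rpow_mul two_pos.le, ← rpow_neg two_pos.le]
    push_cast; ring_nf
  have c4 : (4 : ℝ) ^ n * 2 ^ (ε' * n) ≤ 32 * 2 ^ (5 * q * ε) * (2 ^ (j : ℝ) * 2 ^ (ε * q * j)) := by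
    calc _ ≤ (32 * (2 : ℝ) ^ (j : ℝ)) * (2 : ℝ) ^ (ε' * ((j + 5) / 2)) := by
          refine mul_le_mul (hn2.trans_eq (by rw [hNr])) ?_ (by positivity) (by positivity)
          exact rpow_le_rpow_of_exponent_le one_le_two (by gcongr)
      _ = _ := by
          have : ε' * ((j + 5) / 2) = 5 * q * ε + ε * q * j := by rw [hε']; ring
          rw [this, rpow_add two_pos]
          ring
  have c5 : (1 / √(1 / 4 * N)) ^ (q / p - 1) = 2 ^ (q / p - 1) * 2 ^ (-(j / 2 * (q / p - 1)) : ℝ) := by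
    rw [sqrt_eq_rpow, one_div, ← rpow_neg (by positivity), mul_rpow (by norm_num) hN0.le,
      mul_rpow (by positivity) (by positivity), hNr, ← rpow_mul two_pos.le, ← rpow_mul two_pos.le]
    have : (1 / 4 : ℝ) ^ (-(1 / 2) : ℝ) = 2 := by
      have : (1 / 4 : ℝ) = 2 ^ (-2 : ℝ) := by norm_num [rpow_neg]
      rw [this, ← rpow_mul two_pos.le]
      norm_num
    rw [this]
    ring_nf
  have c6 : (N ^ 2) ^ (q / p) = (2 : ℝ) ^ (2 * j * (q / p) : ℝ) := by
    rw [hNr, ← rpow_natCast, ← rpow_mul two_pos.le, ← rpow_mul two_pos.le]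
    push_cast; ring_nf
  rw [c1, c2, c3, c5, c6]
  have c7 : (2 : ℝ) ^ (l - j * q / 2 + 3 * j / 2 * (q / p - 1) + ε * q * j) =
      2 ^ (-(j * q / 2) : ℝ) * 2 ^ (l : ℝ) * 2 ^ (-(3 * j) : ℝ) * (2 ^ (j : ℝ) * 2 ^ (ε * q * j)) *
        2 ^ (-(j / 2 * (q / p - 1)) : ℝ) * (2 : ℝ) ^ (2 * j * (q / p) : ℝ) := by
    simp only [← rpow_add two_pos]
    congr 1
    ring
  rw [c7]
  calc _ = (2 ^ q * 2 ^ (-(j * q / 2) : ℝ) * (4 * 2 ^ (l : ℝ)) * 2 ^ (-(3 * j) : ℝ) * C *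
        (2 ^ (q / p - 1) * 2 ^ (-(j / 2 * (q / p - 1)) : ℝ)) * 2 ^ (2 * j * (q / p) : ℝ)) *
          ((4 : ℝ) ^ n * 2 ^ (ε' * n)) := by ring
    _ ≤ _ := mul_le_mul_of_nonneg_left c4 (by positivity)
    _ = _ := by ring

theorem exists_localized_sup_le (hφ : IsLPBump φ) {k : ℤ} (hk : k = -1 ∨ k = 0 ∨ k = 1) :
    ∃ C : ℝ, 0 < C ∧ ∀ j l m : ℤ, 0 ≤ m → ∀ g : ℝ × ℝ → ℂ, Measurable g → Integrable g →
      ∀ z : E3, z.2 ∈ Icc (1 : ℝ) 2 →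
        ‖((phikl φ k l z.1.1 z.2 : ℝ) : ℂ) * Uop (projJM φ j m g) z.2 z.1.1 z.1.2‖ₑ ≤
          ENNReal.ofReal (C * (2 : ℝ) ^ (j : ℝ)) * ∫⁻ y, ‖g y‖ₑ := by
  obtain ⟨C, hC, key⟩ := exists_Pr_sup_le hφ
  refine ⟨4 * C + 1, by linarith, fun j l m hm g hmg hg z hz => ?_⟩
  obtain ⟨N, hN⟩ : ∃ N : ℝ, N = 2 ^ j := ⟨_, rfl⟩
  have hN0 : 0 < N := hN ▸ by positivity
  have hmh : Measurable fun x => g (N⁻¹ • x) := hmg.comp (measurable_const_smul N⁻¹)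
  have hi : Integrable fun x => g (N⁻¹ • x) := hg.comp_smul (inv_ne_zero hN0.ne')
  have hpt := enorm_localized_le hφ (j := j) (l := l) hk hm hg (r := z.1.1) z.1.2 hz
  refine hpt.trans ?_
  by_cases hzS : (z.1.1, z.2) ∈ Sup l
  swap
  · rw [indicator_of_notMem hzS, mul_zero]; exact zero_le
  rw [indicator_of_mem hzS, ← hN]
  obtain ⟨s1, -, s3, -, -⟩ := hzS
  simp only at s1 s3
  have e1 : 1 / 4 ≤ z.2 * z.1.1 := by nlinarith
  have h1 := key m hm _ hmh hi (N • (((z.1.1 ^ 2 + z.2 ^ 2) / 2, z.1.2), z.2 * z.1.1)) (by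
    simp only [Prod.smul_snd, smul_eq_mul]; positivity)
  rw [lintegral_plane_scale hN0 hmg.enorm] at h1
  refine (mul_le_mul_right h1 _).trans ?_
  rw [← mul_assoc, ← mul_assoc, ← ENNReal.ofReal_mul (by positivity), ← ENNReal.ofReal_mul (by positivity)]
  refine mul_le_mul_left (ENNReal.ofReal_le_ofReal ?_) _
  simp only [Prod.smul_snd, smul_eq_mul]
  have h2 : C / √(N * (z.2 * z.1.1)) ≤ C * (2 * N ^ (-(1 : ℝ) / 2)) := by
    rw [div_eq_mul_inv]
    refine mul_le_mul_of_nonneg_left ?_ hC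
    calc (√(N * (z.2 * z.1.1)))⁻¹ ≤ (√(N * (1 / 2) ^ 2))⁻¹ := by
          refine inv_anti₀ (by positivity) (sqrt_le_sqrt ?_)
          nlinarith
      _ = _ := by
          rw [sqrt_mul hN0.le, sqrt_sq (by norm_num), mul_inv, sqrt_eq_rpow, ← rpow_neg hN0.le]
          norm_num [mul_comm]
  have h3 : N ^ (-(1 : ℝ) / 2) * N ^ (-(1 : ℝ) / 2) * N ^ 2 = 2 ^ (j : ℝ) := by
    rw [← rpow_add hN0, ← rpow_natCast N 2, ← rpow_add hN0, rpow_intCast, ← hN]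
    norm_num
  calc _ ≤ 2 * N ^ (-(1 : ℝ) / 2) * (C * (2 * N ^ (-(1 : ℝ) / 2))) * N ^ 2 := by gcongr
    _ = 4 * C * (N ^ (-(1 : ℝ) / 2) * N ^ (-(1 : ℝ) / 2) * N ^ 2) := by ring
    _ ≤ _ := by
        rw [h3]
        exact mul_le_mul_of_nonneg_right (by linarith) (by positivity)

theorem ft2_of_not_integrable {g : ℝ × ℝ → ℂ} (hg : ¬Integrable g) (ξ : ℝ × ℝ) : ft2 g ξ = 0 := by
  refine integral_undef fun h => hg ?_
  have h1 : Integrable fun y : ℝ × ℝ => Complex.exp (Complex.I * ((y.1 * ξ.1 + y.2 * ξ.2 : ℝ) : ℂ)) *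
      (Complex.exp (-Complex.I * ((y.1 * ξ.1 + y.2 * ξ.2 : ℝ) : ℂ)) * g y) := by
    refine h.bdd_mul (c := 1) (Continuous.aestronglyMeasurable (by fun_prop)) (ae_of_all _ fun y => ?_)
    rw [mul_comm Complex.I, Complex.norm_exp_ofReal_mul_I]
  refine h1.congr (ae_of_all _ fun y => ?_)
  simp only
  rw [← mul_assoc, ← Complex.exp_add, ← add_mul, add_neg_cancel, zero_mul, Complex.exp_zero, one_mul]

theorem ft2_congr {g h : ℝ × ℝ → ℂ} (hgh : g =ᵐ[volume] h) (ξ : ℝ × ℝ) : ft2 g ξ = ft2 h ξ :=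
  integral_congr_ae (hgh.mono fun y hy => by simp only [hy])

theorem projJM_congr (j m : ℤ) {g h : ℝ × ℝ → ℂ} (hgh : ∀ ξ, ft2 g ξ = ft2 h ξ) : projJM φ j m g = projJM φ j m h := by
  funext x
  unfold projJM
  simp_rw [hgh]

theorem Uop_projJM_of_not_integrable (j m : ℤ) {g : ℝ × ℝ → ℂ} (hg : ¬Integrable g) (t r y : ℝ) :
    Uop (projJM φ j m g) t r y = 0 := by
  have h1 : projJM φ j m g = fun _ => 0 := by
    funext x
    simp [projJM, ft2_of_not_integrable hg]
  simp [Uop, h1, ft2]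

/-- The estimate for finite exponents, in terms of seminorms. -/
theorem exists_eLpNorm_localized_le (hφ : IsLPBump φ) {ε : ℝ} (hε : 0 < ε) {p q : ℝ≥0∞} (hpq : p ≤ q)
    (hpq1 : 1 / p + 1 / q ≤ 1) (hpq2 : 1 ≤ 1 / p + 3 / q) {k : ℤ} (hk : k = -1 ∨ k = 0 ∨ k = 1) :
    ∃ C : ℝ, 0 < C ∧ ∀ j l m : ℤ, -1 ≤ j → 0 ≤ m → ∀ g : ℝ × ℝ → ℂ, Measurable g → Integrable g →
      eLpNorm (fun z : E3 => ((phikl φ k l z.1.1 z.2 : ℝ) : ℂ) * Uop (projJM φ j m g) z.2 z.1.1 z.1.2) q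
          (volume.restrict (univ ×ˢ Icc (1 : ℝ) 2)) ≤
        ENNReal.ofReal (C * (2 : ℝ) ^ (-(j : ℝ) / 2 + l * (1 / q).toReal +
          3 * (j : ℝ) / 2 * ((1 / p).toReal - (1 / q).toReal) + ε * j)) * eLpNorm g p volume := by
  have hms : MeasurableSet (univ ×ˢ Icc (1 : ℝ) 2 : Set E3) := MeasurableSet.univ.prod measurableSet_Icc
  rcases eq_or_ne q ⊤ with rfl | hq
  · have hp : p = 1 := by
      rw [ENNReal.div_top, add_zero, one_div, ENNReal.inv_le_one] at hpq1
      rw [ENNReal.div_top, add_zero, one_div, ENNReal.one_le_inv] at hpq2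
      exact le_antisymm hpq2 hpq1
    subst hp
    obtain ⟨C, hC, key⟩ := exists_localized_sup_le hφ hk
    refine ⟨C * 2 ^ ε, by positivity, fun j l m hj hm g hmg hg => ?_⟩
    rw [eLpNorm_exponent_top, eLpNorm_one_eq_lintegral_enorm]
    refine eLpNormEssSup_le_of_ae_enorm_bound ((ae_restrict_mem hms).mono fun z hz => ?_)
    refine (key j l m hm g hmg hg z hz.2).trans (mul_le_mul_left (ENNReal.ofReal_le_ofReal ?_) _)
    rw [mul_assoc, ← rpow_add two_pos]
    refine mul_le_mul_of_nonneg_left (rpow_le_rpow_of_exponent_le one_le_two ?_) hC.le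
    have hj' : (-1 : ℝ) ≤ j := by exact_mod_cast hj
    simp
    nlinarith
  have hp : p ≠ ⊤ := fun h => hq (top_le_iff.1 (h ▸ hpq))
  have hp0 : p ≠ 0 := by
    rintro rfl
    simp at hpq1
  have hq0 : q ≠ 0 := fun h => hp0 (le_antisymm (h ▸ hpq) zero_le)
  obtain ⟨P, hP0, rfl⟩ : ∃ P : ℝ, 0 < P ∧ p = ENNReal.ofReal P :=
    ⟨p.toReal, ENNReal.toReal_pos hp0 hp, (ENNReal.ofReal_toReal hp).symm⟩
  obtain ⟨Q, hQ0, rfl⟩ : ∃ Q : ℝ, 0 < Q ∧ q = ENNReal.ofReal Q :=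
    ⟨q.toReal, ENNReal.toReal_pos hq0 hq, (ENNReal.ofReal_toReal hq).symm⟩
  have hPQ : P ≤ Q := (ENNReal.ofReal_le_ofReal_iff hQ0.le).1 hpq
  have eP : 1 / ENNReal.ofReal P = ENNReal.ofReal (1 / P) := by
    rw [ENNReal.ofReal_div_of_pos hP0, ENNReal.ofReal_one]
  have eQ : 1 / ENNReal.ofReal Q = ENNReal.ofReal (1 / Q) := by
    rw [ENNReal.ofReal_div_of_pos hQ0, ENNReal.ofReal_one]
  have eQ3 : 3 / ENNReal.ofReal Q = ENNReal.ofReal (3 / Q) := by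
    rw [ENNReal.ofReal_div_of_pos hQ0, ENNReal.ofReal_ofNat]
  rw [eP, eQ, ← ENNReal.ofReal_add (by positivity) (by positivity), ENNReal.ofReal_le_one] at hpq1
  rw [eP, eQ3, ← ENNReal.ofReal_add (by positivity) (by positivity), ENNReal.one_le_ofReal] at hpq2
  have hQi : 0 < 1 / Q := by positivity
  have hP1 : 1 < P := by
    by_contra h
    have : 1 ≤ 1 / P := (one_le_div hP0).2 (not_lt.1 h)
    linarith
  have h2 : 1 ≤ Q * (1 - 1 / P) := by
    have : Q * (1 / Q) ≤ Q * (1 - 1 / P) := mul_le_mul_of_nonneg_left (by linarith) hQ0.le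
    rwa [mul_one_div_cancel hQ0.ne'] at this
  have h4 : Q * (1 - 1 / P) ≤ 3 := by
    have : Q * (1 - 1 / P) ≤ Q * (3 / Q) := mul_le_mul_of_nonneg_left (by linarith) hQ0.le
    rwa [mul_div_cancel₀ _ hQ0.ne'] at this
  obtain ⟨C, hC, key⟩ := exists_lintegral_localized_le hφ hε hP1 hPQ h2 h4 hk
  refine ⟨C ^ (1 / Q), by positivity, fun j l m hj hm g hmg hg => ?_⟩
  rw [eLpNorm_eq_lintegral_rpow_enorm_toReal hq0 hq, eLpNorm_eq_lintegral_rpow_enorm_toReal hp0 hp, eP, eQ,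
    ENNReal.toReal_ofReal hQ0.le, ENNReal.toReal_ofReal hP0.le, ENNReal.toReal_ofReal hQi.le,
    ENNReal.toReal_ofReal (by positivity : 0 ≤ 1 / P)]
  refine (ENNReal.rpow_le_rpow (key j l m hj hm g hmg hg) hQi.le).trans (le_of_eq ?_)
  rw [ENNReal.mul_rpow_of_nonneg _ _ hQi.le, ← ENNReal.rpow_mul, ENNReal.ofReal_rpow_of_nonneg (by positivity) hQi.le,
    mul_rpow hC.le (by positivity), ← rpow_mul two_pos.le]
  have e1 : Q / P * (1 / Q) = 1 / P := by field_simp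
  have e2 : (l - j * Q / 2 + 3 * j / 2 * (Q / P - 1) + ε * Q * j) * (1 / Q) =
      -(j : ℝ) / 2 + l * (1 / Q) + 3 * (j : ℝ) / 2 * (1 / P - 1 / Q) + ε * j := by
    field_simp
    ring
  rw [e1, e2]

end LocalSmoothing

/-- Proposition 3.7: for `j ≥ −1`, `k ∈ {−1,0,1}`, `m ≥ 0`, `0 ≤ l ≤ m/2` and
`p ≤ q`, `1/p+1/q ≤ 1`, `1/p+3/q ≥ 1`, every `ε > 0`:
`‖φ_{k,l} 𝒰_t 𝒫_{j,m} g‖_{L^q(ℝ²×[1,2])} ≲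
2^{−j/2} 2^{l/q} 2^{(m/2−l)(1/p+3/q−1)+(3j/2)(1/p−1/q)+εj} ‖g‖_{L^p}`,
with constant independent of `j, l, m, g`. -/
theorem singular_local_smoothing_Uop
    (φ : ℝ → ℝ) (hφ : IsLPBump φ) (p q : ℝ≥0∞)
    (hpq : p ≤ q) (hpq1 : 1/p + 1/q ≤ 1) (hpq2 : 1 ≤ 1/p + 3/q)
    (k : ℤ) (hk : k = -1 ∨ k = 0 ∨ k = 1) (ε : ℝ) (hε : 0 < ε) :
    ∃ C : ℝ, 0 < C ∧ ∀ j l m : ℤ, -1 ≤ j → 0 ≤ l → 2 * l ≤ m → ∀ g : ℝ × ℝ → ℂ,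
      eLpNorm (fun z : (ℝ × ℝ) × ℝ =>
          ((phikl φ k l z.1.1 z.2 : ℝ) : ℂ) * Uop (projJM φ j m g) z.2 z.1.1 z.1.2) q
          (volume.restrict (Set.univ ×ˢ Set.Icc (1:ℝ) 2)) ≤
        ENNReal.ofReal (C * (2:ℝ) ^
            (-(j:ℝ)/2 + (l:ℝ) * (1/q).toReal +
              ((m:ℝ)/2 - (l:ℝ)) * ((1/p).toReal + 3 * (1/q).toReal - 1) +
              3 * (j:ℝ)/2 * ((1/p).toReal - (1/q).toReal) + ε * (j:ℝ))) *
          eLpNorm g p volume := by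
  obtain ⟨C, hC, key⟩ := LocalSmoothing.exists_eLpNorm_localized_le hφ hε hpq hpq1 hpq2 hk
  refine ⟨C, hC, fun j l m hj hl hlm g => ?_⟩
  by_cases hg : Integrable g
  swap
  · simp [LocalSmoothing.Uop_projJM_of_not_integrable j m hg]
  have hae := hg.1.ae_eq_mk
  rw [LocalSmoothing.projJM_congr j m (LocalSmoothing.ft2_congr hae), eLpNorm_congr_ae hae]
  refine (key j l m hj (by omega) _ hg.1.stronglyMeasurable_mk.measurable (hg.congr hae)).trans
    (mul_le_mul_left (ENNReal.ofReal_le_ofReal ?_) _)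
  refine mul_le_mul_of_nonneg_left (rpow_le_rpow_of_exponent_le one_le_two ?_) hC.le
  have h1 : (0 : ℝ) ≤ m / 2 - l := by
    have : (2 : ℝ) * l ≤ m := by exact_mod_cast hlm
    linarith
  have hp1 : 1 / p ≠ ⊤ := fun h => by simp [h] at hpq1
  have hq1 : 1 / q ≠ ⊤ := fun h => by simp [h] at hpq1
  have h2 : 1 ≤ (1 / p).toReal + 3 * (1 / q).toReal := by
    have h3 : 3 / q = 3 * (1 / q) := by rw [mul_one_div]
    rw [h3] at hpq2
    have h4 := ENNReal.toReal_mono (by finiteness) hpq2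
    rwa [ENNReal.toReal_one, ENNReal.toReal_add hp1 (by finiteness), ENNReal.toReal_mul, ENNReal.toReal_ofNat] at h4
  have := mul_nonneg h1 (sub_nonneg.2 h2)
  linarith

end
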